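/- Let A = kQ/I be a toupie algebra over a field k with t ≥ 2 branches and m = dim_k e_0 A e_∞. Then A is laura and not weakly shod if and only if m = 1 and exactly one of the branches of Q lies in the ideal I. -/

import Mathlib

/-!
Formalization preamble for "Toupie algebras".

We realize the bound quiver algebra `A = kQ/I` of a toupie quiver `Q` concretely:
the path algebra `kQ` is realized, via its (faithful) left regular representation,
as the subalgebra of `Module.End k (paths → k)` generated by the operators of left
multiplication by the trivial paths `e_v` and by the arrows of `Q`.  Paths are
composed from left to right (`p * q` = "first `p`, then `q`"), as in
Assem–Simson–Skowroński, so that paths from the source `0` to the sink `∞` span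
`e₀ (kQ) e∞`, and (right) `A`-modules are identified with representations of `(Q, I)`.
Right `A`-modules are formalized as (left) modules over `Aᵐᵒᵖ`.
-/

set_option synthInstance.maxHeartbeats 400000
set_option maxHeartbeats 800000

noncomputable section
open scoped Classical
open MulOpposite

universe u

namespace Toupie

/-- Vertices of a toupie quiver with `t` branches, branch `i` having length `ℓ i ≥ 1`:
the unique source `src`, the unique sink `snk`, and for each branch `i` its interior
vertices `mid i a` (the `(a+1)`-st vertex on branch `i`, for `a : Fin (ℓ i - 1)`). -/
inductive Vtx (t : ℕ) (ℓ : Fin t → ℕ) : Type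
  | src : Vtx t ℓ
  | snk : Vtx t ℓ
  | mid (i : Fin t) (a : Fin (ℓ i - 1)) : Vtx t ℓ

/-- The `a`-th vertex on branch `i`, for `0 ≤ a ≤ ℓ i`
(`a = 0` is the source, `a = ℓ i` is the sink). -/
def vtx (t : ℕ) (ℓ : Fin t → ℕ) (i : Fin t) (a : ℕ) : Vtx t ℓ :=
  if a = 0 then .src else if h : a - 1 < ℓ i - 1 then .mid i ⟨a - 1, h⟩ else .snk

/-- The paths of a toupie quiver: trivial paths at the vertices, and for each branch
`i` and `a < b ≤ ℓ i` the path `sub i a b` along branch `i` from its `a`-th vertex to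
its `b`-th vertex.  (`sub i 0 (ℓ i)` is the `i`-th branch `w i`.) -/
inductive PIdx (t : ℕ) (ℓ : Fin t → ℕ) : Type
  | vert (v : Vtx t ℓ) : PIdx t ℓ
  | sub (i : Fin t) (a b : ℕ) (hab : a < b) (hb : b ≤ ℓ i) : PIdx t ℓ

variable (k : Type u) [Field k] (t : ℕ) (ℓ : Fin t → ℕ)

/-- The vector space with basis the set of paths of the toupie quiver. -/
abbrev PSp : Type u := PIdx t ℓ → k

variable {t ℓ}

/-- The starting vertex of a path. -/
def startIdx : PIdx t ℓ → Vtx t ℓ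
  | .vert v => v
  | .sub i a _ _ _ => vtx t ℓ i a

/-- Left multiplication by the trivial path (primitive idempotent) `e_v`. -/
def Ev (v : Vtx t ℓ) : Module.End k (PSp k t ℓ) where
  toFun f := fun p => if startIdx p = v then f p else 0
  map_add' f g := by funext p; by_cases h : startIdx p = v <;> simp [h]
  map_smul' c f := by funext p; by_cases h : startIdx p = v <;> simp [h]

/-- Strip the `j`-th arrow of branch `i` (the arrow `vtx i j ⟶ vtx i (j+1)`) from the
front of a path, if possible. -/
def strip (i : Fin t) (j : ℕ) : PIdx t ℓ → Option (PIdx t ℓ)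
  | .vert _ => none
  | .sub i' a b _ hb =>
      if h : i' = i ∧ a = j then
        if hb2 : j + 1 < b then some (.sub i (j + 1) b hb2 (h.1 ▸ hb))
        else some (.vert (vtx t ℓ i b))
      else none

/-- Left multiplication by the `j`-th arrow of branch `i`
(the arrow from `vtx i j` to `vtx i (j+1)`, for `j < ℓ i`; the zero operator for junk `j`). -/
def Ar (i : Fin t) (j : ℕ) : Module.End k (PSp k t ℓ) where
  toFun f := fun p => (strip i j p).elim 0 f
  map_add' f g := by funext p; rcases h : strip i j p with _ | q <;> simp [h]
  map_smul' c f := by funext p; rcases h : strip i j p with _ | q <;> simp [h]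

variable (t ℓ)

/-- The generators of the path algebra: the trivial paths and the arrows. -/
def gens : Set (Module.End k (PSp k t ℓ)) :=
  Set.range (Ev k) ∪ {x | ∃ i j, x = Ar k i j}

/-- The path algebra `kQ` of the toupie quiver, realized as the subalgebra of
`Module.End k (PSp k t ℓ)` generated by left multiplication by trivial paths and arrows. -/
def PathAlg : Subalgebra k (Module.End k (PSp k t ℓ)) :=
  Algebra.adjoin k (gens k t ℓ)

variable {k t ℓ}

/-- The trivial path `e_v` as an element of the path algebra. -/
def eV (v : Vtx t ℓ) : PathAlg k t ℓ :=
  ⟨Ev k v, Algebra.subset_adjoin (Or.inl ⟨v, rfl⟩)⟩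

/-- The `j`-th arrow of branch `i` as an element of the path algebra. -/
def arE (i : Fin t) (j : ℕ) : PathAlg k t ℓ :=
  ⟨Ar k i j, Algebra.subset_adjoin (Or.inr ⟨i, j, rfl⟩)⟩

/-- The path along branch `i` from its `a`-th vertex to its `b`-th vertex, as an element
of the path algebra: the product (composed from left to right) of the arrows
`a → a+1 → ⋯ → b`.  (For `b ≤ a` this is the empty product `1`.) -/
def subE (i : Fin t) (a b : ℕ) : PathAlg k t ℓ :=
  (((List.range (b - a)).map fun s => arE i (a + s)).prod)

/-- The `i`-th branch `w i` (the path from the source to the sink along branch `i`)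
as an element of the path algebra. -/
def wE (i : Fin t) : PathAlg k t ℓ := subE i 0 (ℓ i)

variable {k : Type u} [Field k]

/-- A toupie algebra `A = kQ/I`: a toupie quiver `Q` (a non-linear quiver with a unique
source, a unique sink, and all other vertices having exactly one incoming and one
outgoing arrow, i.e. `t ≥ 2` branches of lengths `ℓ i ≥ 1`), together with an admissible
ideal `I` of the path algebra `kQ`.  Since `Q` is finite and acyclic, the arrow ideal is
nilpotent, so admissibility amounts to `I ⊆ R_Q²`, i.e. every element of `I` is a linear
combination of paths of length `≥ 2`. -/
structure ToupieAlg (k : Type u) [Field k] : Type u where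
  t : ℕ
  ht : 2 ≤ t
  ℓ : Fin t → ℕ
  hℓ : ∀ i, 1 ≤ ℓ i
  I : TwoSidedIdeal (PathAlg k t ℓ)
  adm : ∀ x ∈ I, x ∈ Submodule.span k
    {y : PathAlg k t ℓ | ∃ i a b, a + 2 ≤ b ∧ b ≤ ℓ i ∧ y = subE i a b}

variable (T : ToupieAlg k)

/-- The underlying algebra `A = kQ/I` of a toupie algebra. -/
def Alg : Type u := T.I.ringCon.Quotient

instance : Ring (Alg T) := inferInstanceAs (Ring T.I.ringCon.Quotient)

/-- The quotient map `kQ → A = kQ/I`. -/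
def mkA : PathAlg k T.t T.ℓ →+* Alg T := T.I.ringCon.mk'

lemma mkA_surjective : Function.Surjective (mkA T) := Quotient.mk''_surjective

instance : Algebra k (Alg T) :=
  RingHom.toAlgebra' ((mkA T).comp (algebraMap k (PathAlg k T.t T.ℓ)))
    (by
      intro c x
      obtain ⟨y, rfl⟩ := mkA_surjective T x
      simp only [RingHom.coe_comp, Function.comp_apply, ← map_mul]
      rw [Algebra.commutes])

/-- The idempotent `e₀` (at the source) in `A`. -/
def e0 : Alg T := mkA T (eV Vtx.src)

/-- The idempotent `e∞` (at the sink) in `A`. -/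
def einf : Alg T := mkA T (eV Vtx.snk)

/-- The `k`-linear map `A → A`, `x ↦ e₀ * x * e∞`, whose range is `e₀ A e∞`. -/
def lrMap : Alg T →ₗ[k] Alg T where
  toFun x := e0 T * x * einf T
  map_add' x y := by simp [mul_add, add_mul]
  map_smul' c x := by
    simp only [RingHom.id_apply]
    rw [mul_smul_comm, smul_mul_assoc]

/-- `m = dim_k e₀ A e∞`, the dimension of the span of the (residues of the) paths from
the source to the sink. -/
def mDim : ℕ := Module.finrank k ↥(LinearMap.range (lrMap T))

/-- The branch `w i` lies in the ideal `I`. -/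
def branchInI (i : Fin T.t) : Prop := wE i ∈ T.I

/-- A minimal relation: `∑_{i ∈ J} λ i • w i ∈ I` with `|J| ≥ 2`, all `λ i ≠ 0`, and no
nonempty proper subsum in `I`. -/
def MinRel (J : Finset (Fin T.t)) (lam : Fin T.t → k) : Prop :=
  2 ≤ J.card ∧ (∀ i ∈ J, lam i ≠ 0) ∧ (∑ i ∈ J, lam i • wE i) ∈ T.I ∧
    ∀ J' ⊂ J, J'.Nonempty → (∑ i ∈ J', lam i • wE i) ∉ T.I

/-- A toupie algebra is simply connected if any two distinct branches are involved in a
common minimal relation. -/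
def SimplyConnected : Prop :=
  ∀ i j : Fin T.t, i ≠ j → ∃ J lam, MinRel T J lam ∧ i ∈ J ∧ j ∈ J

/-- A (minimal) zero-relation on branch `i`: the subpath of branch `i` from its `a`-th
to its `b`-th vertex lies in `I`, but no proper subpath of it does. -/
def ZeroRel (i : Fin T.t) (a b : ℕ) : Prop :=
  a < b ∧ b ≤ T.ℓ i ∧ subE i a b ∈ T.I ∧
    ∀ a' b', a ≤ a' → b' ≤ b → a' < b' → (a', b') ≠ (a, b) → subE i a' b' ∉ T.I

/-- There is exactly one relation on branch `i`. -/
def ExactlyOneRel (i : Fin T.t) : Prop := ∃! p : ℕ × ℕ, ZeroRel T i p.1 p.2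

/-- Branch `i` carries more than one relation. -/
def MoreThanOneRel (i : Fin T.t) : Prop :=
  ∃ p q : ℕ × ℕ, p ≠ q ∧ ZeroRel T i p.1 p.2 ∧ ZeroRel T i q.1 q.2

/-- At most one branch of `Q` has length at least three. -/
def AtMostOneLongBranch : Prop := ∀ i j : Fin T.t, 3 ≤ T.ℓ i → 3 ≤ T.ℓ j → i = j

/-- The two-sided ideal `I` is generated by the set `S`. -/
def IsGenBy {R : Type u} [Ring R] (I : TwoSidedIdeal R) (S : Set R) : Prop :=
  S ⊆ (I : Set R) ∧ ∀ J : TwoSidedIdeal R, S ⊆ (J : Set R) → (I : Set R) ⊆ (J : Set R)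

/-- A toupie algebra is canonical if (after choosing two distinguished branches `i₁, i₂`)
its ideal is generated by `{w i₁ + λ j • w i₂ - w j}` over the remaining branches `j`,
with the `λ j` pairwise distinct and nonzero. -/
def IsCanonical : Prop :=
  ∃ (i₁ i₂ : Fin T.t) (lam : Fin T.t → k), i₁ ≠ i₂ ∧
    (∀ j, j ≠ i₁ → j ≠ i₂ → lam j ≠ 0) ∧
    (∀ j j', j ≠ i₁ → j ≠ i₂ → j' ≠ i₁ → j' ≠ i₂ → j ≠ j' → lam j ≠ lam j') ∧
    IsGenBy T.I {x | ∃ j, j ≠ i₁ ∧ j ≠ i₂ ∧ x = wE i₁ + lam j • wE i₂ - wE j}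

end Toupie
namespace Toupie

/-! ### Module-theoretic notions over an arbitrary ring

Following the paper, all modules are finite-dimensional *right* modules; a right
`A`-module is formalized as a (left) module over `Aᵐᵒᵖ`.  The definitions below are
stated for modules over an arbitrary ring `R` and are applied with `R := Aᵐᵒᵖ`. -/

variable (R : Type u) [Ring R]

/-- A module is indecomposable if it is nonzero and its only idempotent endomorphisms
are `0` and the identity. -/
def Indec (M : ModuleCat.{u} R) : Prop :=
  Nontrivial M ∧ ∀ f : M →ₗ[R] M, f.comp f = f → f = 0 ∨ f = LinearMap.id

/-- Finiteness ("finite dimensionality") of a module. -/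
def FdMod (M : ModuleCat.{u} R) : Prop := Module.Finite R M

/-- `M` has projective dimension at most one: it is the quotient of a projective module
by a projective submodule. -/
def PdLeOne (M : ModuleCat.{u} R) : Prop :=
  ∃ (P : ModuleCat.{u} R) (f : P →ₗ[R] M), Function.Surjective f ∧
    Module.Projective R P ∧ Module.Projective R ↥(LinearMap.ker f)

/-- `M` has injective dimension at most one: it embeds in an injective module with
injective cokernel. -/
def IdLeOne (M : ModuleCat.{u} R) : Prop :=
  ∃ (E : ModuleCat.{u} R) (f : M →ₗ[R] E), Function.Injective f ∧
    Module.Injective R E ∧ Module.Injective R (E ⧸ LinearMap.range f)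

/-- One step of a path in `ind R`: a nonzero non-isomorphism between (finite-dimensional)
indecomposable modules. -/
def Step (M N : ModuleCat.{u} R) : Prop :=
  Indec R M ∧ FdMod R M ∧ Indec R N ∧ FdMod R N ∧
    ∃ f : M →ₗ[R] N, f ≠ 0 ∧ ¬ Function.Bijective f

/-- A path in `ind R` from `M` to `N` (possibly trivial): a chain
`M = M₀ → M₁ → ⋯ → Mₙ = N` of nonzero non-isomorphisms between indecomposables. -/
def IndPath (M N : ModuleCat.{u} R) : Prop := Relation.ReflTransGen (Step R) M N

/-- The left part `L_R`: the indecomposable (finite-dimensional) modules `M` such that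
every indecomposable `X` with a path `X ⇝ M` in `ind R` has projective dimension `≤ 1`. -/
def InLeftPart (M : ModuleCat.{u} R) : Prop :=
  Indec R M ∧ FdMod R M ∧
    ∀ X : ModuleCat.{u} R, Indec R X → FdMod R X → IndPath R X M → PdLeOne R X

/-- The right part `R_R`: the indecomposable (finite-dimensional) modules `M` such that
every indecomposable `X` with a path `M ⇝ X` in `ind R` has injective dimension `≤ 1`. -/
def InRightPart (M : ModuleCat.{u} R) : Prop :=
  Indec R M ∧ FdMod R M ∧
    ∀ X : ModuleCat.{u} R, Indec R X → FdMod R X → IndPath R M X → IdLeOne R X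

/-- Hereditary: global dimension at most one, i.e. every module has projective dimension
at most one. -/
def Hereditary : Prop := ∀ M : ModuleCat.{u} R, PdLeOne R M

/-- Quasitilted: every indecomposable projective module lies in the left part. -/
def Quasitilted : Prop :=
  ∀ P : ModuleCat.{u} R, Indec R P → FdMod R P → Module.Projective R P → InLeftPart R P

/-- A module is directed if it lies on no cycle of nonzero non-isomorphisms between
indecomposables in `ind R`. -/
def Directed (M : ModuleCat.{u} R) : Prop := ¬ Relation.TransGen (Step R) M M

/-- Weakly shod: every indecomposable (finite-dimensional) module not lying in
`L_R ∪ R_R` is directed. -/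
def WeaklyShod : Prop :=
  ∀ M : ModuleCat.{u} R, Indec R M → FdMod R M →
    ¬ InLeftPart R M → ¬ InRightPart R M → Directed R M

/-- Laura: all but finitely many isomorphism classes of indecomposable
(finite-dimensional) modules lie in `L_R ∪ R_R`. -/
def Laura : Prop :=
  ∃ S : Set (ModuleCat.{u} R), S.Finite ∧
    ∀ M : ModuleCat.{u} R, Indec R M → FdMod R M →
      ¬ InLeftPart R M → ¬ InRightPart R M → ∃ N ∈ S, Nonempty (M ≃ₗ[R] N)

/-- There are exactly `n` isomorphism classes of modules satisfying `P`. -/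
def NumClasses (P : ModuleCat.{u} R → Prop) (n : ℕ) : Prop :=
  ∃ f : Fin n → ModuleCat.{u} R, (∀ i, P (f i)) ∧
    (∀ i j, Nonempty ((f i : Type u) ≃ₗ[R] (f j : Type u)) → i = j) ∧
    ∀ M : ModuleCat.{u} R, P M → ∃ i, Nonempty ((M : Type u) ≃ₗ[R] (f i : Type u))

/-- `M` is (isomorphic to) a direct summand of `T`. -/
def IsSummandOf (T : Type u) [AddCommGroup T] [Module R T] (M : ModuleCat.{u} R) : Prop :=
  ∃ N N' : Submodule R T, IsCompl N N' ∧ Nonempty ((M : Type u) ≃ₗ[R] N)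

/-- `Ext¹_R(T, T) = 0`: every self-extension `0 → T → E → T → 0` splits. -/
def SelfExtVanish (T : Type u) [AddCommGroup T] [Module R T] : Prop :=
  ∀ (E : Type u) [AddCommGroup E] [Module R E] (ι : T →ₗ[R] E) (π : E →ₗ[R] T),
    Function.Injective ι → Function.Surjective π → LinearMap.range ι = LinearMap.ker π →
      ∃ s : T →ₗ[R] E, π.comp s = LinearMap.id

/-- A tilting module over a hereditary algebra: a finite module with `Ext¹(T,T) = 0`
having as many pairwise non-isomorphic indecomposable direct summands as there are
simple modules. -/
def IsTiltingMod (T : Type u) [AddCommGroup T] [Module R T] : Prop :=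
  Module.Finite R T ∧ SelfExtVanish R T ∧
    ∃ n : ℕ, NumClasses R (fun M => Indec R M ∧ IsSummandOf R T M) n ∧
      NumClasses R (fun M => IsSimpleModule R M) n

variable (k : Type u) [Field k]

/-- A `k`-algebra `A` is tilted if it is the endomorphism algebra of a tilting (right)
module over a hereditary finite-dimensional `k`-algebra `H`.  (Right `H`-modules are
modules over `Hᵐᵒᵖ`; the isomorphism `A ≅ End_H T` is a `k`-linear ring isomorphism.) -/
def IsTilted (A : Type u) [Ring A] [Algebra k A] : Prop :=
  ∃ (H : Type u) (_ : Ring H) (_ : Algebra k H),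
    FiniteDimensional k H ∧ Hereditary Hᵐᵒᵖ ∧
      ∃ (T : Type u) (_ : AddCommGroup T) (_ : Module Hᵐᵒᵖ T),
        IsTiltingMod Hᵐᵒᵖ T ∧
          ∃ (_ : Module k T) (_ : SMulCommClass Hᵐᵒᵖ k T) (_ : IsScalarTower k Hᵐᵒᵖ T)
            (φ : A ≃+* Module.End Hᵐᵒᵖ T), ∀ (c : k) (x : A), φ (c • x) = c • φ x

end Toupie
namespace Toupie

variable {k : Type u} [Field k] (T : ToupieAlg k)

/-! ### Right `A`-modules as representations of `(Q, I)`

For a right `A`-module `M` (a module over `Aᵐᵒᵖ`) and a vertex `v`, the space of the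
corresponding representation at `v` is `M_v = M • e_v`. -/

/-- The action of the idempotent `e_v ∈ A` on a right `A`-module (= `Aᵐᵒᵖ`-module). -/
def actV (v : Vtx T.t T.ℓ) : (Alg T)ᵐᵒᵖ := op (mkA T (eV v))

/-- The space `M_v = M • e_v` of the representation `M` at the vertex `v` is zero. -/
def VanishAt (M : ModuleCat.{u} (Alg T)ᵐᵒᵖ) (v : Vtx T.t T.ℓ) : Prop :=
  ∀ m : M, actV T v • m = 0

/-- Every simple summand of `top M = M / rad M` is one of the simple modules `S_v`,
`v ∈ vs`: for every maximal submodule `N` the simple quotient `M/N` is supported at some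
vertex of `vs` (for an admissible quotient of a path algebra, the simple module `S_v` is
the unique simple on which `e_v` acts nontrivially). -/
def TopIn (M : ModuleCat.{u} (Alg T)ᵐᵒᵖ) (vs : Set (Vtx T.t T.ℓ)) : Prop :=
  ∀ N : Submodule (Alg T)ᵐᵒᵖ M, IsCoatom N → ∃ v ∈ vs, ∃ m : M, actV T v • m ∉ N

/-- Every simple summand of the socle of `M` is one of the simple modules `S_v`,
`v ∈ vs`: every simple submodule `N ≤ M` is supported at some vertex of `vs`. -/
def SocIn (M : ModuleCat.{u} (Alg T)ᵐᵒᵖ) (vs : Set (Vtx T.t T.ℓ)) : Prop :=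
  ∀ N : Submodule (Alg T)ᵐᵒᵖ M, IsAtom N → ∃ v ∈ vs, ∃ m ∈ N, actV T v • m ≠ 0

/-- The module `D x y` (for two positions `0 ≤ x, y ≤ ℓ i₀` on the unique branch `i₀`
lying in `I`, and an auxiliary branch `i₂ ≠ i₀`): the right `A`-module with generators
`g = e₀` (at the source) and `h = e_y` (at the `y`-th vertex of branch `i₀`), subject to
the relations `g ⬝ (subpath of w i₀ from 0 to x+1) = 0` and
`g ⬝ w i₂ = h ⬝ (subpath of w i₀ from y to ℓ i₀)`.  It is presented as the quotient of
the right regular module `A ⊕ A` by the right submodule generated by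
`(1 - e₀, 0)`, `(0, 1 - e_y)`, `(subE i₀ 0 (min (x+1) (ℓ i₀)), 0)` and
`(w i₂, - subE i₀ y (ℓ i₀))`. -/
abbrev Dmod (i₀ i₂ : Fin T.t) (x y : ℕ) : Type u :=
  (Alg T × Alg T) ⧸ Submodule.span (Alg T)ᵐᵒᵖ
    ({((mkA T (1 - eV Vtx.src) : Alg T), (0 : Alg T)),
      ((0 : Alg T), (mkA T (1 - eV (vtx T.t T.ℓ i₀ y)) : Alg T)),
      ((mkA T (subE i₀ 0 (min (x + 1) (T.ℓ i₀))) : Alg T), (0 : Alg T)),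
      ((mkA T (wE i₂) : Alg T), (- mkA T (subE i₀ y (T.ℓ i₀)) : Alg T))} :
        Set (Alg T × Alg T))

end Toupie

namespace Toupie

variable {t : ℕ} {ℓ : Fin t → ℕ}

instance : Finite (Vtx t ℓ) := by
  let f : Vtx t ℓ → Option (Option (Σ i : Fin t, Fin (ℓ i - 1)))
    | .src => none
    | .snk => some none
    | .mid i a => some (some ⟨i, a⟩)
  refine Finite.of_injective f ?_
  intro v w h
  cases v <;> cases w <;> simp_all [f]

instance : Fintype (Vtx t ℓ) := Fintype.ofFinite _

lemma vtx_zero (i : Fin t) : vtx t ℓ i 0 = .src := by simp [vtx]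

lemma vtx_mid (i : Fin t) (a : ℕ) (h0 : 0 < a) (h : a < ℓ i) :
    vtx t ℓ i a = .mid i ⟨a - 1, by omega⟩ := by
  have h1 : a - 1 < ℓ i - 1 := by omega
  have h2 : a ≠ 0 := by omega
  simp [vtx, h1, h2]

lemma vtx_snk (i : Fin t) (a : ℕ) (h0 : 0 < a) (h : ℓ i ≤ a) : vtx t ℓ i a = .snk := by
  have h1 : ¬ a - 1 < ℓ i - 1 := by omega
  have h2 : a ≠ 0 := by omega
  simp [vtx, h1, h2]

lemma vtx_cases (i : Fin t) (a : ℕ) : a = 0 ∨ (0 < a ∧ a < ℓ i) ∨ (0 < a ∧ ℓ i ≤ a) := by omega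

lemma vtx_eq_src (i : Fin t) (a : ℕ) : vtx t ℓ i a = .src ↔ a = 0 := by
  rcases vtx_cases (ℓ := ℓ) i a with rfl | ⟨h0, h⟩ | ⟨h0, h⟩
  · simp [vtx_zero]
  · simp [vtx_mid i a h0 h]; omega
  · simp [vtx_snk i a h0 h]; omega

lemma vtx_eq_snk (i : Fin t) (a : ℕ) : vtx t ℓ i a = .snk ↔ 0 < a ∧ ℓ i ≤ a := by
  rcases vtx_cases (ℓ := ℓ) i a with rfl | ⟨h0, h⟩ | ⟨h0, h⟩
  · simp [vtx_zero]
  · simp [vtx_mid i a h0 h]; omega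
  · simp [vtx_snk i a h0 h]; omega

lemma vtx_inj {i j : Fin t} {a b : ℕ} (h0 : 0 < a) (h : a < ℓ i)
    (e : vtx t ℓ i a = vtx t ℓ j b) : i = j ∧ a = b := by
  rcases vtx_cases (ℓ := ℓ) j b with rfl | ⟨h0', h'⟩ | ⟨h0', h'⟩
  · rw [vtx_mid i a h0 h, vtx_zero] at e; cases e
  · rw [vtx_mid i a h0 h, vtx_mid j b h0' h'] at e
    injection e with e1 e2
    subst e1
    have := congrArg Fin.val (eq_of_heq e2)
    simp at this
    exact ⟨rfl, by omega⟩
  · rw [vtx_mid i a h0 h, vtx_snk j b h0' h'] at e; cases e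

lemma vtx_inj' {i i' : Fin t} {a j b : ℕ} (hj : j < ℓ i) (hab : a < b)
    (h : vtx t ℓ i j = vtx t ℓ i' b) : i = i' ∧ j = b := by
  refine vtx_inj (Nat.pos_of_ne_zero ?_) hj h
  rintro rfl
  rw [vtx_zero, eq_comm, vtx_eq_src] at h; omega

lemma vtx_inj_same {i : Fin t} {a b : ℕ} (ha : a ≤ ℓ i) (hb : b ≤ ℓ i)
    (e : vtx t ℓ i a = vtx t ℓ i b) : a = b := by
  rcases vtx_cases (ℓ := ℓ) i a with rfl | ⟨h0', h'⟩ | ⟨h0', h'⟩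
  · rw [vtx_zero] at e; exact ((vtx_eq_src i b).1 e.symm).symm
  · exact (vtx_inj h0' h' e).2
  · rw [vtx_snk i a h0' h'] at e
    have := (vtx_eq_snk i b).1 e.symm
    omega

lemma exists_vtx (hℓ : ∀ i, 1 ≤ ℓ i) (i₀ : Fin t) (v : Vtx t ℓ) :
    ∃ i a, a ≤ ℓ i ∧ v = vtx t ℓ i a := by
  cases v with
  | src => exact ⟨i₀, 0, by simp, (vtx_zero i₀).symm⟩
  | snk => exact ⟨i₀, ℓ i₀, le_rfl, (vtx_snk i₀ _ (hℓ i₀) le_rfl).symm⟩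
  | mid i a =>
    refine ⟨i, a + 1, by omega, ?_⟩
    rw [vtx_mid i (a + 1) (by omega) (by omega)]
    simp

/-- The terminal vertex of a path. -/
def endIdx : PIdx t ℓ → Vtx t ℓ
  | .vert v => v
  | .sub i _ b _ _ => vtx t ℓ i b

/-- The path `q'` followed by the path `q`, if they are composable. -/
def pcomp : PIdx t ℓ → PIdx t ℓ → Option (PIdx t ℓ)
  | .vert v, q' => if endIdx q' = v then some q' else none
  | .sub i b c h h', .vert v => if v = vtx t ℓ i b then some (.sub i b c h h') else none
  | .sub i b c h h', .sub j a b' g _ =>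
      if e : i = j ∧ b = b' then
        some (.sub i a c (by obtain ⟨-, rfl⟩ := e; omega) h')
      else none

/-- A family of elements of an algebra satisfying the relations of the path algebra
of a toupie quiver, written as operators acting from the left (later arrows on the left). -/
structure PathSys (k R : Type u) [Field k] [Ring R] [Algebra k R] (t : ℕ) (ℓ : Fin t → ℕ) where
  e : Vtx t ℓ → R
  p : Fin t → ℕ → ℕ → R
  e_mul : ∀ v w, e v * e w = if v = w then e v else 0
  e_sum : ∑ v, e v = 1
  p_self : ∀ i a, a ≤ ℓ i → p i a a = e (vtx t ℓ i a)
  p_comp : ∀ i a b c, a ≤ b → b ≤ c → c ≤ ℓ i → p i b c * p i a b = p i a c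

/-- A path system exhibiting `R` as the opposite of a toupie algebra. -/
structure TD (k R : Type u) [Field k] [Ring R] [Algebra k R] (t : ℕ) (ℓ : Fin t → ℕ)
    extends PathSys k R t ℓ where
  hℓ : ∀ i, 1 ≤ ℓ i
  span_top : Submodule.span k (Set.range e ∪ {x | ∃ i a b, a < b ∧ b ≤ ℓ i ∧ x = p i a b}) = ⊤
  e_ne : ∀ v, e v ≠ 0
  arrow_ne : ∀ i a, a < ℓ i → p i a (a + 1) ≠ 0
  adm : ∀ r : Fin t → k, ∑ i, r i • p i 0 (ℓ i) = 0 → ∀ i, r i ≠ 0 → 2 ≤ ℓ i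

variable {k R : Type u} [Field k] [Ring R] [Algebra k R]

namespace PathSys

variable (S : PathSys k R t ℓ)

/-- The element of the algebra attached to a path. -/
def x : PIdx t ℓ → R
  | .vert v => S.e v
  | .sub i a b _ _ => S.p i a b

lemma e_idem (v) : S.e v * S.e v = S.e v := by simp [S.e_mul]

lemma e_p (i : Fin t) (a b : ℕ) (hab : a ≤ b) (hb : b ≤ ℓ i) :
    S.e (vtx t ℓ i b) * S.p i a b = S.p i a b := by
  rw [← S.p_self i b hb, S.p_comp i a b b hab le_rfl hb]

lemma p_e (i : Fin t) (a b : ℕ) (hab : a ≤ b) (hb : b ≤ ℓ i) :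
    S.p i a b * S.e (vtx t ℓ i a) = S.p i a b := by
  rw [← S.p_self i a (hab.trans hb), S.p_comp i a a b le_rfl hab hb]

lemma e_p_of_ne (i : Fin t) (a b : ℕ) (hab : a ≤ b) (hb : b ≤ ℓ i) (v) (h : v ≠ vtx t ℓ i b) :
    S.e v * S.p i a b = 0 := by
  rw [← S.e_p i a b hab hb, ← mul_assoc, S.e_mul, if_neg h, zero_mul]

lemma p_e_of_ne (i : Fin t) (a b : ℕ) (hab : a ≤ b) (hb : b ≤ ℓ i) (v) (h : vtx t ℓ i a ≠ v) :
    S.p i a b * S.e v = 0 := by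
  rw [← S.p_e i a b hab hb, mul_assoc, S.e_mul, if_neg h, mul_zero]

lemma e_x (q : PIdx t ℓ) (v) : S.e v * S.x q = if v = endIdx q then S.x q else 0 := by
  cases q with
  | vert w => by_cases h : v = w <;> simp [x, endIdx, S.e_mul, h]
  | sub i a b hab hb =>
    by_cases h : v = vtx t ℓ i b
    · simp [x, endIdx, h, S.e_p i a b hab.le hb]
    · simp [x, endIdx, h, S.e_p_of_ne i a b hab.le hb v h]

lemma x_e (q : PIdx t ℓ) (v) : S.x q * S.e v = if startIdx q = v then S.x q else 0 := by
  cases q with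
  | vert w => by_cases h : w = v <;> simp [x, startIdx, S.e_mul, h]
  | sub i a b hab hb =>
    by_cases h : vtx t ℓ i a = v
    · subst h; simp [x, startIdx, S.p_e i a b hab.le hb]
    · simp [x, startIdx, h, S.p_e_of_ne i a b hab.le hb v h]

lemma x_mul (q q' : PIdx t ℓ) : S.x q * S.x q' = (pcomp q q').elim 0 S.x := by
  cases q with
  | vert v =>
    have := S.e_x q' v
    by_cases h : v = endIdx q'
    · simp [pcomp, h] at this ⊢; simpa [x] using this
    · have h' : ¬ endIdx q' = v := fun e => h e.symm
      simp [pcomp, h, h'] at this ⊢; simpa [x] using this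
  | sub i b c h h' =>
    cases q' with
    | vert v =>
      have := S.x_e (.sub i b c h h') v
      by_cases hv : v = vtx t ℓ i b
      · simp [pcomp, startIdx, hv] at this ⊢; simpa [x] using this
      · have hv' : ¬ vtx t ℓ i b = v := fun e => hv e.symm
        simp [pcomp, hv, startIdx, hv'] at this ⊢; simpa [x] using this
    | sub j a b' g g' =>
      by_cases e : i = j ∧ b = b'
      · obtain ⟨rfl, rfl⟩ := e
        simp [pcomp, x, S.p_comp i a b c g.le h.le h']
      · simp only [pcomp, e, dite_false, Option.elim_none, x]
        rw [← S.p_e i b c h.le h', mul_assoc, S.e_p_of_ne j a b' g.le g', mul_zero]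
        intro hv
        rcases Nat.eq_zero_or_pos b with rfl | hb
        · rw [vtx_zero] at hv
          have := (vtx_eq_src j b').1 hv.symm
          omega
        · exact e (vtx_inj hb (by omega) hv)

end PathSys

/-- The branch `i` as a path. -/
def br (hℓ : ∀ i, 1 ≤ ℓ i) (i : Fin t) : PIdx t ℓ := .sub i 0 (ℓ i) (hℓ i) le_rfl

lemma br_injective (hℓ : ∀ i, 1 ≤ ℓ i) : Function.Injective (br hℓ) := by
  intro i j h; simp only [br] at h; injection h

lemma path_ext (hℓ : ∀ i, 1 ≤ ℓ i) (q q' : PIdx t ℓ) (hq : ∀ i, q ≠ br hℓ i)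
    (hs : startIdx q' = startIdx q) (he : endIdx q' = endIdx q) : q' = q := by
  have key : ∀ q₁ q₂ : PIdx t ℓ, startIdx q₁ = startIdx q₂ → endIdx q₁ = endIdx q₂ →
      ∀ i a b hab hb, q₁ = .sub i a b hab hb → q₁ ≠ br hℓ i → q₁ = q₂ := by
    rintro _ q₂ hs he i a b hab hb rfl hn
    simp only [startIdx, endIdx] at hs he
    cases q₂ with
    | vert v =>
      simp only at hs he
      have := vtx_inj_same (by omega) hb (hs.trans he.symm)
      omega
    | sub j c d hcd hd =>
      simp only at hs he
      rcases Nat.eq_zero_or_pos a with rfl | ha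
      · have hbl : b < ℓ i := by
          rcases hb.lt_or_eq with h | rfl
          · exact h
          · exact absurd rfl hn
        obtain ⟨rfl, rfl⟩ := vtx_inj hab hbl he
        have := vtx_inj_same (by omega) (by omega) hs
        subst this; rfl
      · obtain ⟨rfl, rfl⟩ := vtx_inj ha (by omega) hs
        have := vtx_inj_same (by omega) (by omega) he
        subst this; rfl
  cases q with
  | vert v =>
    cases q' with
    | vert w => simpa [startIdx] using hs
    | sub i a b hab hb =>
      simp only [startIdx, endIdx] at hs he
      have := vtx_inj_same (by omega) hb (hs.trans he.symm)
      omega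
  | sub i a b hab hb => exact (key _ q' hs.symm he.symm i a b hab hb rfl (hq i)).symm

namespace TD

variable (D : TD k R t ℓ)

/-- The `i`-th branch in a toupie algebra. -/
def w (i : Fin t) : R := D.p i 0 (ℓ i)

/-- The space of linear relations between the branches. -/
def Rel : Submodule k (Fin t → k) := LinearMap.ker (Fintype.linearCombination k D.w)

lemma mem_Rel {r : Fin t → k} : r ∈ D.Rel ↔ ∑ i, r i • D.w i = 0 := by
  simp [Rel, Fintype.linearCombination_apply]

/-- The dimension of the span of the branches. -/
def m : ℕ := Module.finrank k (Submodule.span k (Set.range D.w))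

lemma range_x : Set.range D.x =
    Set.range D.e ∪ {x | ∃ i a b, a < b ∧ b ≤ ℓ i ∧ x = D.p i a b} := by
  ext y; constructor
  · rintro ⟨q, rfl⟩
    cases q with
    | vert v => exact Or.inl ⟨v, rfl⟩
    | sub i a b hab hb => exact Or.inr ⟨i, a, b, hab, hb, rfl⟩
  · rintro (⟨v, rfl⟩ | ⟨i, a, b, hab, hb, rfl⟩)
    · exact ⟨.vert v, rfl⟩
    · exact ⟨.sub i a b hab hb, rfl⟩

lemma span_x : Submodule.span k (Set.range D.x) = ⊤ := by rw [range_x]; exact D.span_top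

lemma surj_x : Function.Surjective (Finsupp.linearCombination k D.x) := by
  rw [← LinearMap.range_eq_top, Finsupp.range_linearCombination, D.span_x]

lemma sum_branch {A : Type u} [AddCommGroup A] [Module k A] (f : PIdx t ℓ → A)
    (c : PIdx t ℓ →₀ k) :
    ∑ q ∈ c.support, (if ∃ i, q = br D.hℓ i then c q • f q else 0) =
      ∑ i, c (br D.hℓ i) • f (br D.hℓ i) := by
  rw [← Finset.sum_filter]
  rw [← Finset.sum_image (s := Finset.univ) (g := br D.hℓ) (f := fun q => c q • f q)
    (fun i _ j _ h => br_injective D.hℓ h)]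
  apply Finset.sum_subset
  · intro q hq
    simp only [Finset.mem_filter] at hq
    obtain ⟨i, rfl⟩ := hq.2
    simp
  · intro q hq hn
    simp only [Finset.mem_image, Finset.mem_univ, true_and] at hq
    obtain ⟨i, rfl⟩ := hq
    have : c (br D.hℓ i) = 0 := by
      by_contra h; exact hn (by simp [h])
    simp [this]

lemma peirce (c : PIdx t ℓ →₀ k) (h : Finsupp.linearCombination k D.x c = 0) (v w) :
    ∑ q ∈ c.support, (if startIdx q = v ∧ endIdx q = w then c q • D.x q else 0) = 0 := by
  have := congrArg (fun z => D.e w * z * D.e v) h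
  simp only [Finsupp.linearCombination_apply, Finsupp.sum, Finset.mul_sum, Finset.sum_mul,
    mul_zero, zero_mul] at this
  refine Eq.trans (Finset.sum_congr rfl fun q _ => ?_) this
  rw [mul_smul_comm, smul_mul_assoc, D.e_x]
  by_cases h1 : w = endIdx q
  · rw [if_pos h1, D.x_e]
    by_cases h2 : startIdx q = v
    · simp [h1, h2]
    · simp [h2]
  · rw [if_neg h1, if_neg]
    · simp
    · rintro ⟨-, rfl⟩; exact h1 rfl

lemma coeff_nonbranch (c : PIdx t ℓ →₀ k) (h : Finsupp.linearCombination k D.x c = 0)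
    (q : PIdx t ℓ) (hq : ∀ i, q ≠ br D.hℓ i) : c q • D.x q = 0 := by
  have := D.peirce c h (startIdx q) (endIdx q)
  rw [← this]
  symm
  by_cases hc : q ∈ c.support
  · rw [Finset.sum_eq_single_of_mem q hc]
    · simp
    · intro q' _ hne
      rw [if_neg]
      rintro ⟨h1, h2⟩
      exact hne (path_ext D.hℓ q q' hq h1 h2)
  · rw [Finsupp.notMem_support_iff] at hc
    rw [hc, zero_smul]
    refine Finset.sum_eq_zero fun q' hq' => ?_
    rw [if_neg]
    rintro ⟨h1, h2⟩
    have := path_ext D.hℓ q q' hq h1 h2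
    subst this
    simp [hc] at hq'

lemma coeff_branch (c : PIdx t ℓ →₀ k) (h : Finsupp.linearCombination k D.x c = 0) :
    (fun i => c (br D.hℓ i)) ∈ D.Rel := by
  rw [mem_Rel]
  have := D.peirce c h .src .snk
  refine (D.sum_branch D.x c).symm.trans ?_
  rw [← this]
  refine Finset.sum_congr rfl fun q _ => ?_
  congr 1
  apply propext
  constructor
  · rintro ⟨i, rfl⟩
    exact ⟨vtx_zero i, vtx_snk i _ (D.hℓ i) le_rfl⟩
  · rintro ⟨h1, h2⟩
    cases q with
    | vert v => simp [startIdx, endIdx] at h1 h2; rw [h1] at h2; cases h2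
    | sub i a b hab hb =>
      simp only [startIdx, endIdx] at h1 h2
      have h3 := (vtx_eq_src i a).1 h1
      have h4 := (vtx_eq_snk i b).1 h2
      have h5 : b = ℓ i := by omega
      subst h3 h5
      exact ⟨i, rfl⟩

/-- The universal property of a toupie algebra. -/
theorem up {B : Type u} [Ring B] [Algebra k B] (S : PathSys k B t ℓ)
    (hz : ∀ i a b, a < b → b ≤ ℓ i → (a, b) ≠ (0, ℓ i) → D.p i a b = 0 → S.p i a b = 0)
    (hr : ∀ r ∈ D.Rel, ∑ i, r i • S.p i 0 (ℓ i) = 0) :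
    ∃ Ψ : R →ₐ[k] B, (∀ v, Ψ (D.e v) = S.e v) ∧
      ∀ i a b, a ≤ b → b ≤ ℓ i → Ψ (D.p i a b) = S.p i a b := by
  let φ := Finsupp.linearCombination k D.x
  let ψ := Finsupp.linearCombination k S.x
  have hker : ∀ c, φ c = 0 → ψ c = 0 := by
    intro c hc
    have e1 : ψ c = ∑ q ∈ c.support, (if ∃ i, q = br D.hℓ i then c q • S.x q else 0) := by
      simp only [ψ, Finsupp.linearCombination_apply, Finsupp.sum]
      refine Finset.sum_congr rfl fun q _ => ?_
      split_ifs with h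
      · rfl
      · push Not at h
        have := D.coeff_nonbranch c hc q h
        rcases smul_eq_zero.1 this with h0 | h0
        · simp [h0]
        · cases q with
          | vert v => exact absurd h0 (D.e_ne v)
          | sub i a b hab hb =>
            have : S.p i a b = 0 := by
              refine hz i a b hab hb ?_ h0
              intro hab'
              simp only [Prod.mk.injEq] at hab'
              obtain ⟨rfl, rfl⟩ := hab'
              exact h i rfl
            simp [PathSys.x, this]
    rw [e1, D.sum_branch S.x c]
    exact hr _ (D.coeff_branch c hc)
  obtain ⟨s, hs⟩ := φ.exists_rightInverse_of_surjective (LinearMap.range_eq_top.2 D.surj_x)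
  have hs' : ∀ y, φ (s y) = y := fun y => LinearMap.congr_fun hs y
  let Ψ : R →ₗ[k] B := ψ ∘ₗ s
  have hΨ : ∀ c, Ψ (φ c) = ψ c := by
    intro c
    have := hker (s (φ c) - c) (by rw [map_sub, hs', sub_self])
    rw [map_sub, sub_eq_zero] at this
    exact this
  have hx : ∀ q, Ψ (D.x q) = S.x q := by
    intro q
    have := hΨ (Finsupp.single q 1)
    simpa [φ, ψ] using this
  have hmulx : ∀ q q', Ψ (D.x q * D.x q') = S.x q * S.x q' := by
    intro q q'
    rw [D.x_mul, S.x_mul]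
    cases pcomp q q' with
    | none => simp
    | some r => simp [hx]
  have hmul : ∀ a b, Ψ (a * b) = Ψ a * Ψ b := by
    intro a b
    have ha : a ∈ Submodule.span k (Set.range D.x) := by rw [D.span_x]; trivial
    have hb : b ∈ Submodule.span k (Set.range D.x) := by rw [D.span_x]; trivial
    induction ha using Submodule.span_induction with
    | zero => simp
    | add y z _ _ hy hz => rw [add_mul, map_add, hy, hz, map_add, add_mul]
    | smul c y _ hy => rw [smul_mul_assoc, map_smul, hy, map_smul, smul_mul_assoc]
    | mem y hy =>
      obtain ⟨q, rfl⟩ := hy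
      induction hb using Submodule.span_induction with
      | zero => simp
      | add y z _ _ hy hz => rw [mul_add, map_add, hy, hz, map_add, mul_add]
      | smul c y _ hy => rw [mul_smul_comm, map_smul, hy, map_smul, mul_smul_comm]
      | mem y hy =>
        obtain ⟨q', rfl⟩ := hy
        rw [hmulx, hx, hx]
  have he : ∀ v, Ψ (D.e v) = S.e v := fun v => hx (.vert v)
  have hone : Ψ 1 = 1 := by
    rw [← D.e_sum, map_sum, ← S.e_sum]
    exact Finset.sum_congr rfl fun v _ => he v
  refine ⟨AlgHom.ofLinearMap Ψ hone hmul, he, ?_⟩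
  intro i a b hab hb
  rcases hab.lt_or_eq with h | rfl
  · exact hx (.sub i a b h hb)
  · change Ψ _ = _
    rw [D.p_self i a hb, S.p_self i a hb, he]

end TD

section PathAlgebra

variable {k : Type u} [Field k] {t : ℕ} {ℓ : Fin t → ℕ}

local notation "𝖯" => PathAlg k t ℓ

lemma eV_mul_eV (v w : Vtx t ℓ) : (eV v * eV w : 𝖯) = if v = w then eV v else 0 := by
  apply Subtype.ext
  ext f p
  by_cases h : v = w
  · subst h
    simp only [eV, Ev, if_true]
    change (if startIdx p = v then (if startIdx p = v then f p else 0) else 0) =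
      if startIdx p = v then f p else 0
    split_ifs <;> rfl
  · simp only [eV, Ev, h, if_false]
    change (if startIdx p = v then (if startIdx p = w then f p else 0) else 0) = 0
    split_ifs with h1 h2
    · exact absurd (h1.symm.trans h2) h
    · rfl
    · rfl

lemma sum_eV : (∑ v, eV v : 𝖯) = 1 := by
  apply Subtype.ext
  ext f p
  rw [AddSubmonoidClass.coe_finsetSum]
  simp [eV, Ev]

lemma strip_start {i : Fin t} {j : ℕ} {p q : PIdx t ℓ} (h : strip i j p = some q) :
    startIdx p = vtx t ℓ i j ∧ startIdx q = vtx t ℓ i (j + 1) ∧ j < ℓ i := by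
  cases p with
  | vert v => simp [strip] at h
  | sub i' a b hab hb =>
    by_cases h1 : i' = i ∧ a = j
    · obtain ⟨rfl, rfl⟩ := h1
      by_cases h2 : a + 1 < b
      · simp [strip, h2] at h
        subst h
        exact ⟨rfl, rfl, by omega⟩
      · have : b = a + 1 := by omega
        subst this
        simp [strip] at h
        subst h
        exact ⟨rfl, rfl, by omega⟩
    · simp [strip, h1] at h

lemma eV_mul_arE (i : Fin t) (j : ℕ) : (eV (vtx t ℓ i j) * arE i j : 𝖯) = arE i j := by
  apply Subtype.ext
  ext f p
  change (if startIdx p = vtx t ℓ i j then (strip i j p).elim 0 f else 0) = (strip i j p).elim 0 f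
  rcases h : strip i j p with _ | q
  · simp
  · simp [(strip_start h).1]

lemma arE_mul_eV (i : Fin t) (j : ℕ) : (arE i j * eV (vtx t ℓ i (j + 1)) : 𝖯) = arE i j := by
  apply Subtype.ext
  ext f p
  change (strip i j p).elim 0 (fun p => if startIdx p = vtx t ℓ i (j + 1) then f p else 0)
    = (strip i j p).elim 0 f
  rcases h : strip i j p with _ | q
  · simp
  · simp [(strip_start h).2.1]

lemma arE_eq_zero (i : Fin t) (j : ℕ) (hj : ℓ i ≤ j) : (arE i j : 𝖯) = 0 := by
  apply Subtype.ext
  ext f p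
  change (strip i j p).elim 0 f = 0
  rcases h : strip i j p with _ | q
  · simp
  · have := (strip_start h).2.2
    omega

lemma subE_self (i : Fin t) (a : ℕ) : (subE i a a : 𝖯) = 1 := by simp [subE]

lemma subE_succ (i : Fin t) (a b : ℕ) (h : a ≤ b) :
    (subE i a (b + 1) : 𝖯) = subE i a b * arE i b := by
  have h1 : b + 1 - a = (b - a) + 1 := by omega
  have h2 : a + (b - a) = b := by omega
  simp [subE, h1, List.range_succ, h2]

lemma subE_cons (i : Fin t) (a b : ℕ) (h : a < b) :
    (subE i a b : 𝖯) = arE i a * subE i (a + 1) b := by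
  induction b, h using Nat.le_induction with
  | base => rw [subE_succ i a a le_rfl, subE_self, subE_self]; simp
  | succ b hb ih => rw [subE_succ i a b (by omega), ih, subE_succ i (a + 1) b (by omega), mul_assoc]

lemma eV_mul_subE (i : Fin t) (a b : ℕ) (h : a < b) :
    (eV (vtx t ℓ i a) * subE i a b : 𝖯) = subE i a b := by
  rw [subE_cons i a b h, ← mul_assoc, eV_mul_arE]

lemma subE_mul_eV (i : Fin t) (a b : ℕ) (h : a < b) :
    (subE i a b * eV (vtx t ℓ i b) : 𝖯) = subE i a b := by
  obtain ⟨b, rfl⟩ : ∃ c, b = c + 1 := ⟨b - 1, by omega⟩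
  rw [subE_succ i a b (by omega), mul_assoc, arE_mul_eV]

lemma subE_mul_subE (i : Fin t) (a b c : ℕ) (h : a ≤ b) (h' : b ≤ c) :
    (subE i a b * subE i b c : 𝖯) = subE i a c := by
  induction c, h' using Nat.le_induction with
  | base => rw [subE_self, mul_one]
  | succ c hc ih => rw [subE_succ i b c hc, ← mul_assoc, ih, subE_succ i a c (by omega)]

/-- The spanning set of the path algebra consisting of all paths. -/
def pathSet (k : Type u) [Field k] (t : ℕ) (ℓ : Fin t → ℕ) : Set (PathAlg k t ℓ) :=
  Set.range eV ∪ {x | ∃ i a b, a < b ∧ b ≤ ℓ i ∧ x = subE i a b}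

lemma eV_mul_mem (v : Vtx t ℓ) (y : 𝖯) (hy : y ∈ pathSet k t ℓ) :
    eV v * y ∈ Submodule.span k (pathSet k t ℓ) := by
  rcases hy with ⟨w, rfl⟩ | ⟨i, a, b, hab, hb, rfl⟩
  · rw [eV_mul_eV]
    split_ifs
    · exact Submodule.subset_span (Or.inl ⟨v, rfl⟩)
    · exact zero_mem _
  · rw [← eV_mul_subE i a b hab, ← mul_assoc, eV_mul_eV]
    split_ifs with h
    · rw [h, eV_mul_subE i a b hab]
      exact Submodule.subset_span (Or.inr ⟨i, a, b, hab, hb, rfl⟩)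
    · rw [zero_mul]; exact zero_mem _

lemma arE_mul_mem (i : Fin t) (j : ℕ) (y : 𝖯) (hy : y ∈ pathSet k t ℓ) :
    arE i j * y ∈ Submodule.span k (pathSet k t ℓ) := by
  rcases lt_or_ge j (ℓ i) with hj | hj
  swap
  · rw [arE_eq_zero i j hj, zero_mul]; exact zero_mem _
  rcases hy with ⟨w, rfl⟩ | ⟨i', a, b, hab, hb, rfl⟩
  · rw [← arE_mul_eV, mul_assoc, eV_mul_eV]
    split_ifs
    · rw [arE_mul_eV]
      refine Submodule.subset_span (Or.inr ⟨i, j, j + 1, by omega, by omega, ?_⟩)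
      rw [subE_succ i j j le_rfl, subE_self, one_mul]
    · rw [mul_zero]; exact zero_mem _
  · rw [← eV_mul_subE i' a b hab, ← mul_assoc, ← arE_mul_eV, mul_assoc (arE i j), eV_mul_eV]
    split_ifs with h
    · have : i' = i ∧ a = j + 1 := by
        rcases Nat.eq_zero_or_pos a with rfl | ha
        · rw [vtx_zero] at h
          have := (vtx_eq_src i _).1 h
          omega
        · exact vtx_inj ha (by omega) h.symm
      obtain ⟨rfl, rfl⟩ := this
      rw [arE_mul_eV, ← subE_cons i' j b (by omega)]
      exact Submodule.subset_span (Or.inr ⟨i', j, b, by omega, hb, rfl⟩)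
    · rw [mul_zero, zero_mul]; exact zero_mem _

lemma span_pathSet : Submodule.span k (pathSet k t ℓ) = ⊤ := by
  have key : ∀ x (hx : x ∈ Algebra.adjoin k (gens k t ℓ)),
      ∀ y ∈ Submodule.span k (pathSet k t ℓ),
        ((⟨x, hx⟩ : 𝖯) * y) ∈ Submodule.span k (pathSet k t ℓ) := by
    intro x hx
    induction hx using Algebra.adjoin_induction with
    | mem x hx =>
      intro y hy
      induction hy using Submodule.span_induction with
      | zero => rw [mul_zero]; exact zero_mem _
      | add y z _ _ hy hz => rw [mul_add]; exact add_mem hy hz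
      | smul c y _ hy => rw [mul_smul_comm]; exact Submodule.smul_mem _ _ hy
      | mem y hy =>
        rcases hx with ⟨v, rfl⟩ | ⟨i, j, rfl⟩
        · exact eV_mul_mem v y hy
        · exact arE_mul_mem i j y hy
    | algebraMap c =>
      intro y hy
      exact Submodule.smul_mem _ c hy
    | add x z hx hz h1 h2 =>
      intro y hy
      have : (⟨x + z, add_mem hx hz⟩ : 𝖯) * y = (⟨x, hx⟩ : 𝖯) * y + (⟨z, hz⟩ : 𝖯) * y := by
        rw [← add_mul]; rfl
      exact this ▸ add_mem (h1 y hy) (h2 y hy)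
    | mul x z hx hz h1 h2 =>
      intro y hy
      have : (⟨x * z, mul_mem hx hz⟩ : 𝖯) * y = (⟨x, hx⟩ : 𝖯) * ((⟨z, hz⟩ : 𝖯) * y) := by
        rw [← mul_assoc]; rfl
      exact this ▸ h1 _ (h2 y hy)
  rw [eq_top_iff]
  rintro ⟨x, hx⟩ -
  have h1 : (1 : 𝖯) ∈ Submodule.span k (pathSet k t ℓ) := by
    rw [← sum_eV]
    exact Submodule.sum_mem _ fun v _ => Submodule.subset_span (Or.inl ⟨v, rfl⟩)
  simpa using key x hx 1 h1

/-- The coefficient of a path in an element of the path algebra. -/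
def coeff (q : PIdx t ℓ) : 𝖯 →ₗ[k] k where
  toFun x := x.1 (fun p => match p with | .vert _ => 1 | .sub _ _ _ _ _ => 0) q
  map_add' _ _ := rfl
  map_smul' _ _ := rfl

lemma coeff_eV (v : Vtx t ℓ) : coeff (.vert v) (eV v : 𝖯) = 1 := by
  simp [coeff, eV, Ev, startIdx]

lemma coeff_subE (i : Fin t) (a b : ℕ) (h : a < b) (hb : b ≤ ℓ i) (q : PIdx t ℓ) :
    coeff q (subE i a b : 𝖯) = if q = .sub i a b h hb then 1 else 0 := by
  obtain ⟨n, hn⟩ : ∃ n, b = a + 1 + n := ⟨b - (a + 1), by omega⟩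
  induction n generalizing a q with
  | zero =>
    rw [add_zero] at hn
    subst hn
    have : (subE i a (a + 1) : 𝖯) = arE i a := by
      rw [subE_succ i a a le_rfl, subE_self, one_mul]
    rw [this]
    change (strip i a q).elim 0 _ = _
    cases q with
    | vert v => simp [strip]
    | sub i' a' b hab hb' =>
      by_cases h1 : i' = i ∧ a' = a
      · obtain ⟨rfl, rfl⟩ := h1
        by_cases h2 : a' + 1 < b
        · have : b ≠ a' + 1 := by omega
          simp [strip, h2, this]
        · have : b = a' + 1 := by omega
          subst this
          simp [strip]
      · have h1' : ¬ (i' = i ∧ a' = a ∧ b = a + 1) := fun e => h1 ⟨e.1, e.2.1⟩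
        simp [strip, h1, h1']
  | succ n ih =>
    rw [subE_cons i a _ h]
    change (strip i a q).elim 0 (fun q' => coeff q' (subE i (a + 1) b : 𝖯)) = _
    have h' := fun q => ih (a + 1) (by omega) q (by omega)
    simp only [h']
    cases q with
    | vert v => simp [strip]
    | sub i' a' b' hab hb' =>
      by_cases h1 : i' = i ∧ a' = a
      · obtain ⟨rfl, rfl⟩ := h1
        by_cases h2 : a' + 1 < b'
        · simp [strip, h2]
        · have h3 : b' = a' + 1 := by omega
          have h4 : b' ≠ b := by omega
          simp [strip, h2, h4]
      · have h1' : ¬ (i' = i ∧ a' = a ∧ b' = b) := fun e => h1 ⟨e.1, e.2.1⟩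
        simp [strip, h1, h1']

end PathAlgebra

section Concrete

variable {k : Type u} [Field k] (T : ToupieAlg k)

lemma mkA_smul (c : k) (x : PathAlg k T.t T.ℓ) : mkA T (c • x) = c • mkA T x := by
  rw [Algebra.smul_def, Algebra.smul_def, map_mul]; rfl

lemma mkA_eq_zero (x : PathAlg k T.t T.ℓ) : mkA T x = 0 ↔ x ∈ T.I := by
  rw [TwoSidedIdeal.mem_iff, ← map_zero (mkA T)]
  exact RingCon.eq _

/-- The quotient map as a linear map to the opposite algebra. -/
def mkOp : PathAlg k T.t T.ℓ →ₗ[k] (Alg T)ᵐᵒᵖ where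
  toFun x := op (mkA T x)
  map_add' x y := by simp
  map_smul' c x := by simp [mkA_smul]

lemma mkOp_mul (x y) : mkOp T (x * y) = mkOp T y * mkOp T x := by simp [mkOp]

lemma mkOp_surjective : Function.Surjective (mkOp T) := fun y => by
  obtain ⟨x, hx⟩ := mkA_surjective T (unop y)
  exact ⟨x, by simp [mkOp, hx]⟩

lemma mkOp_eq_zero (x) : mkOp T x = 0 ↔ x ∈ T.I := by
  simp [mkOp, ← mkA_eq_zero]

lemma coeff_vert_of_mem (x) (hx : x ∈ T.I) (v) : coeff (.vert v) x = 0 := by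
  have : Submodule.span k {y : PathAlg k T.t T.ℓ | ∃ i a b, a + 2 ≤ b ∧ b ≤ T.ℓ i ∧
      y = subE i a b} ≤ LinearMap.ker (coeff (.vert v)) := by
    rw [Submodule.span_le]
    rintro _ ⟨i, a, b, hab, hb, rfl⟩
    simp [coeff_subE i a b (by omega) hb]
  exact this (T.adm x hx)

lemma coeff_arrow_of_mem (x) (hx : x ∈ T.I) (i a h h') :
    coeff (.sub i a (a + 1) h h') x = 0 := by
  have : Submodule.span k {y : PathAlg k T.t T.ℓ | ∃ i a b, a + 2 ≤ b ∧ b ≤ T.ℓ i ∧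
      y = subE i a b} ≤ LinearMap.ker (coeff (.sub i a (a + 1) h h')) := by
    rw [Submodule.span_le]
    rintro _ ⟨j, a', b, hab, hb, rfl⟩
    simp only [SetLike.mem_coe, LinearMap.mem_ker, coeff_subE j a' b (by omega) hb,
      PIdx.sub.injEq]
    rw [if_neg]
    omega
  exact this (T.adm x hx)

/-- The path system of a toupie algebra. -/
def toTD : TD k (Alg T)ᵐᵒᵖ T.t T.ℓ where
  e v := mkOp T (eV v)
  p i a b := mkOp T (eV (vtx T.t T.ℓ i a) * subE i a b)
  e_mul v w := by
    rw [← mkOp_mul, eV_mul_eV]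
    by_cases h : v = w
    · simp [h]
    · simp [h, Ne.symm h]
  e_sum := by
    rw [← map_sum, sum_eV]; simp [mkOp]
  p_self i a _ := by rw [subE_self, mul_one]
  p_comp i a b c hab hbc _ := by
    rw [← mkOp_mul]
    congr 1
    rcases hab.eq_or_lt with rfl | hab
    · rw [subE_self, mul_one, ← mul_assoc, eV_mul_eV, if_pos rfl]
    · rw [mul_assoc, ← mul_assoc (subE i a b), subE_mul_eV i a b hab, subE_mul_subE i a b c hab.le hbc]
  hℓ := T.hℓ
  span_top := by
    have h1 : Set.range (fun v => mkOp T (eV v)) ∪ {x | ∃ i a b, a < b ∧ b ≤ T.ℓ i ∧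
        x = mkOp T (eV (vtx T.t T.ℓ i a) * subE i a b)} = mkOp T '' pathSet k T.t T.ℓ := by
      rw [pathSet, Set.image_union, ← Set.range_comp]
      congr 1
      ext x; constructor
      · rintro ⟨i, a, b, hab, hb, rfl⟩
        exact ⟨_, ⟨i, a, b, hab, hb, rfl⟩, by rw [eV_mul_subE i a b hab]⟩
      · rintro ⟨_, ⟨i, a, b, hab, hb, rfl⟩, rfl⟩
        exact ⟨i, a, b, hab, hb, by rw [eV_mul_subE i a b hab]⟩
    rw [h1, ← Submodule.map_span, span_pathSet, Submodule.map_top, LinearMap.range_eq_top]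
    exact mkOp_surjective T
  e_ne v h := by
    rw [mkOp_eq_zero] at h
    have := coeff_vert_of_mem T _ h v
    simp [coeff_eV] at this
  arrow_ne i a ha h := by
    rw [mkOp_eq_zero, eV_mul_subE i a _ (by omega)] at h
    have := coeff_arrow_of_mem T _ h i a (by omega) ha
    simp [coeff_subE i a (a + 1) (by omega) ha] at this
  adm r hr i hi := by
    simp only [eV_mul_subE _ 0 _ (T.hℓ _), ← map_smul, ← map_sum, mkOp_eq_zero] at hr
    by_contra h
    have h1 : T.ℓ i = 0 + 1 := by have := T.hℓ i; omega
    have := coeff_arrow_of_mem T _ hr i 0 (by omega) (by omega)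
    simp only [map_sum, map_smul, coeff_subE _ 0 _ (T.hℓ _) le_rfl, PIdx.sub.injEq] at this
    rw [Finset.sum_eq_single i] at this
    · simp [h1] at this; exact hi this
    · intro j _ hj; simp [Ne.symm hj]
    · simp

lemma toTD_w (i) : (toTD T).w i = mkOp T (wE i) := by
  change mkOp T _ = _
  rw [eV_mul_subE i 0 _ (T.hℓ i)]; rfl

lemma branchInI_iff (i) : branchInI T i ↔ (toTD T).w i = 0 := by
  rw [toTD_w, mkOp_eq_zero]; rfl

lemma mDim_eq : mDim T = (toTD T).m := by
  have h : (LinearMap.range (lrMap T)).map (MulOpposite.opLinearEquiv k).toLinearMap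
      = Submodule.span k (Set.range (toTD T).w) := by
    apply le_antisymm
    · rintro _ ⟨_, ⟨y, rfl⟩, rfl⟩
      obtain ⟨x, rfl⟩ := mkA_surjective T y
      have hx : x ∈ Submodule.span k (pathSet k T.t T.ℓ) := by rw [span_pathSet]; trivial
      change mkOp T (eV .src * x * eV .snk) ∈ _
      induction hx using Submodule.span_induction with
      | zero => simp
      | add x y _ _ hx hy => rw [mul_add, add_mul, map_add]; exact add_mem hx hy
      | smul c x _ hx =>
        rw [mul_smul_comm, smul_mul_assoc, map_smul]; exact Submodule.smul_mem _ _ hx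
      | mem x hx =>
        rcases hx with ⟨v, rfl⟩ | ⟨i, a, b, hab, hb, rfl⟩
        · rw [eV_mul_eV]
          split_ifs with h
          · rw [eV_mul_eV]; simp
          · simp
        · rw [← eV_mul_subE i a b hab, ← mul_assoc, eV_mul_eV]
          split_ifs with h
          · rw [← subE_mul_eV i a b hab, mul_assoc, mul_assoc, eV_mul_eV]
            split_ifs with h'
            · rw [subE_mul_eV i a b hab]
              have h3 := (vtx_eq_src i a).1 h.symm
              have h4 := (vtx_eq_snk i b).1 h'
              have h5 : b = T.ℓ i := by omega
              subst h3 h5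
              rw [← vtx_zero i, eV_mul_subE _ _ _ hab]
              refine Submodule.subset_span ⟨i, ?_⟩
              rw [toTD_w]; rfl
            · simp
          · simp
    · rw [Submodule.span_le]
      rintro _ ⟨i, rfl⟩
      refine ⟨_, ⟨mkA T (wE i), rfl⟩, ?_⟩
      rw [toTD_w]
      change mkOp T (eV .src * wE i * eV .snk) = _
      rw [← vtx_zero i, ← vtx_snk i _ (T.hℓ i) le_rfl, wE, eV_mul_subE _ _ _ (T.hℓ i),
        subE_mul_eV _ _ _ (T.hℓ i)]
  rw [mDim, TD.m, ← h]
  exact (LinearEquiv.finrank_map_eq _ _).symm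

end Concrete

/-- A function on the vertices of a toupie quiver given by its values at the source, at the sink,
and at the interior vertices, the latter indexed by branch and position. -/
def fam {α : Sort*} {t : ℕ} {ℓ : Fin t → ℕ} (s z : α) (f : Fin t → ℕ → α) : Vtx t ℓ → α
  | .src => s
  | .snk => z
  | .mid i a => f i (a + 1)

section fam
variable {α : Sort*} {t : ℕ} {ℓ : Fin t → ℕ} (s z : α) (f : Fin t → ℕ → α)

@[simp] lemma fam_src : fam (ℓ := ℓ) s z f .src = s := rfl
@[simp] lemma fam_snk : fam (ℓ := ℓ) s z f .snk = z := rfl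

lemma fam_vtx (i : Fin t) (a : ℕ) :
    fam s z f (vtx t ℓ i a) = if a = 0 then s else if a < ℓ i then f i a else z := by
  rcases vtx_cases (ℓ := ℓ) i a with rfl | ⟨h0, h⟩ | ⟨h0, h⟩
  · simp [vtx_zero, fam]
  · have : a - 1 + 1 = a := by omega
    have h1 : a ≠ 0 := by omega
    simp [vtx_mid i a h0 h, fam, h, h1, this]
  · have h1 : a ≠ 0 := by omega
    have h2 : ¬ a < ℓ i := by omega
    simp [vtx_snk i a h0 h, h1, h2]

end fam

lemma vtx_forall {t : ℕ} {ℓ : Fin t → ℕ} {P : Vtx t ℓ → Prop} (h0 : P .src) (hz : P .snk)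
    (h : ∀ i a, 0 < a → a < ℓ i → P (vtx t ℓ i a)) : ∀ v, P v := by
  intro v
  cases v with
  | src => exact h0
  | snk => exact hz
  | mid i a =>
    have := h i (a + 1) (by omega) (by omega)
    rwa [vtx_mid i (a + 1) (by omega) (by omega)] at this

namespace TD

variable (D : TD k R t ℓ)


lemma vtx_ℓ (D : TD k R t ℓ) (i : Fin t) : vtx t ℓ i (ℓ i) = .snk := vtx_snk i _ (D.hℓ i) le_rfl

section Ring

variable {M N : Type u} [AddCommGroup M] [Module R M] [AddCommGroup N] [Module R N]

lemma e_e (v w) (m : M) : D.e v • D.e w • m = if v = w then D.e v • m else 0 := by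
  rw [← mul_smul, D.e_mul]; split_ifs <;> simp

lemma e_e_self (v) (m : M) : D.e v • D.e v • m = D.e v • m := by simp [D.e_e]

lemma sum_e (m : M) : ∑ v, D.e v • m = m := by
  rw [← Finset.sum_smul, D.e_sum, one_smul]

lemma ext_e {m m' : M} (h : ∀ v, D.e v • m = D.e v • m') : m = m' := by
  rw [← D.sum_e m, ← D.sum_e m']; exact Finset.sum_congr rfl fun v _ => h v

lemma e_p_smul {i : Fin t} {a b : ℕ} (hab : a ≤ b) (hb : b ≤ ℓ i) (m : M) :
    D.e (vtx t ℓ i b) • D.p i a b • m = D.p i a b • m := by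
  rw [← mul_smul, D.e_p i a b hab hb]

lemma p_e_smul {i : Fin t} {a b : ℕ} (hab : a ≤ b) (hb : b ≤ ℓ i) (m : M) :
    D.p i a b • D.e (vtx t ℓ i a) • m = D.p i a b • m := by
  rw [← mul_smul, D.p_e i a b hab hb]

lemma p_smul_of_ne {i : Fin t} {a b : ℕ} (hab : a ≤ b) (hb : b ≤ ℓ i) {v} (h : vtx t ℓ i a ≠ v)
    {m : M} (hm : D.e v • m = m) : D.p i a b • m = 0 := by
  rw [← hm, ← mul_smul, D.p_e_of_ne i a b hab hb v h, zero_smul]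

lemma p_p_smul {i : Fin t} {a b c : ℕ} (hab : a ≤ b) (hbc : b ≤ c) (hc : c ≤ ℓ i) (m : M) :
    D.p i b c • D.p i a b • m = D.p i a c • m := by
  rw [← mul_smul, D.p_comp i a b c hab hbc hc]

lemma p_self_smul {i : Fin t} {a : ℕ} (ha : a ≤ ℓ i) (m : M) :
    D.p i a a • m = D.e (vtx t ℓ i a) • m := by rw [D.p_self i a ha]

lemma p_succ_smul {i : Fin t} {a b : ℕ} (hab : a ≤ b) (hb : b + 1 ≤ ℓ i) (m : M) :
    D.p i a (b + 1) • m = D.p i b (b + 1) • D.p i a b • m :=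
  (D.p_p_smul hab (by omega) hb m).symm

lemma map_at (f : M →ₗ[R] N) {v} {m : M} (hm : D.e v • m = m) : D.e v • f m = f m := by
  rw [← map_smul, hm]

end Ring

section Basic

variable {M N : Type u} [AddCommGroup M] [Module R M] [Module k M] [IsScalarTower k R M]
  [AddCommGroup N] [Module R N] [Module k N] [IsScalarTower k R N]

/-- Multiplication by a ring element as a `k`-linear map. -/
def act (M : Type u) [AddCommGroup M] [Module R M] [Module k M] [IsScalarTower k R M] (r : R) :
    M →ₗ[k] M := Algebra.lsmul k k M r

@[simp] lemma act_apply (r : R) (m : M) : act (k := k) M r m = r • m := rfl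

/-- The space of the representation `M` at the vertex `v`. -/
def at' (M : Type u) [AddCommGroup M] [Module R M] [Module k M] [IsScalarTower k R M]
    (v : Vtx t ℓ) : Submodule k M where
  carrier := {m | D.e v • m = m}
  add_mem' := fun {a b} (ha : _ = _) (hb : _ = _) => show _ = _ by rw [smul_add, ha, hb]
  zero_mem' := show _ = _ by simp
  smul_mem' := fun c m (hm : _ = _) => show _ = _ by rw [smul_comm, hm]

lemma mem_at {v} {m : M} : m ∈ D.at' M v ↔ D.e v • m = m := Iff.rfl

lemma e_mem (v) (m : M) : D.e v • m ∈ D.at' M v := D.e_e_self v m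

lemma p_mem {i : Fin t} {a b : ℕ} (hab : a ≤ b) (hb : b ≤ ℓ i) (m : M) :
    D.p i a b • m ∈ D.at' M (vtx t ℓ i b) := D.e_p_smul hab hb m

lemma mem_span (r : R) : r ∈ Submodule.span k
    (Set.range D.e ∪ {x | ∃ i a b, a < b ∧ b ≤ ℓ i ∧ x = D.p i a b}) := D.span_top ▸ trivial

lemma at_ne {v w} (h : v ≠ w) {m : M} (hm : m ∈ D.at' M w) : D.e v • m = 0 := by
  rw [← D.mem_at.1 hm, D.e_e, if_neg h]

lemma lin_of (f : M →ₗ[k] N) (he : ∀ v m, f (D.e v • m) = D.e v • f m)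
    (hp : ∀ i a, a < ℓ i → ∀ m, f (D.p i a (a + 1) • m) = D.p i a (a + 1) • f m) (r : R) (m : M) :
    f (r • m) = r • f m := by
  induction D.mem_span r using Submodule.span_induction with
  | zero => simp
  | add x y _ _ hx hy => rw [add_smul, map_add, hx, hy, add_smul]
  | smul c x _ hx => rw [smul_assoc, map_smul, hx, smul_assoc]
  | mem x hx =>
    rcases hx with ⟨v, rfl⟩ | ⟨i, a, b, hab, hb, rfl⟩
    · exact he v m
    · induction b, hab using Nat.le_induction with
      | base => exact hp i a hb m
      | succ b hab ih =>
        rw [D.p_succ_smul (by omega) hb, hp i b hb, ih (by omega), ← D.p_succ_smul (by omega) hb]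

/-- The module homomorphism given by compatible linear maps at the vertices. -/
def mkHom (g : Vtx t ℓ → (M →ₗ[k] N))
    (hg : ∀ i a, a < ℓ i → ∀ m ∈ D.at' M (vtx t ℓ i a), D.p i a (a + 1) • g (vtx t ℓ i a) m =
      D.e (vtx t ℓ i (a + 1)) • g (vtx t ℓ i (a + 1)) (D.p i a (a + 1) • m)) : M →ₗ[R] N :=
  let f : M →ₗ[k] N := ∑ v, act N (D.e v) ∘ₗ g v ∘ₗ act M (D.e v)
  have hf : ∀ m, f m = ∑ v, D.e v • g v (D.e v • m) := fun m => by
    simp [f, LinearMap.sum_apply]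
  have hv : ∀ v m, D.e v • f m = D.e v • g v (D.e v • m) := fun v m => by
    rw [hf, Finset.smul_sum, Finset.sum_eq_single v]
    · rw [D.e_e_self]
    · intro w _ hw; rw [D.e_e, if_neg hw.symm]
    · simp
  { toFun := f
    map_add' := map_add f
    map_smul' := by
      refine D.lin_of f (fun v m => ?_) (fun i a ha m => ?_)
      · apply D.ext_e
        intro w
        rw [hv, D.e_e, D.e_e]
        split_ifs with h
        · subst h; rw [hv]
        · simp
      · apply D.ext_e
        intro w
        by_cases h : w = vtx t ℓ i (a + 1)
        · subst h
          rw [hv, D.e_p_smul (by omega) ha, D.e_p_smul (by omega) ha,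
            ← D.p_e_smul (by omega) ha (f m), hv, D.p_e_smul (by omega) ha]
          rw [← D.p_e_smul (by omega) ha m, hg i a ha _ (D.e_mem _ _)]
        · rw [hv, D.at_ne h (D.p_mem (by omega) ha m), D.at_ne h (D.p_mem (by omega) ha _), map_zero,
            smul_zero] }

lemma mkHom_at (g : Vtx t ℓ → (M →ₗ[k] N)) (hg) (v) (m : M) (hm : m ∈ D.at' M v) :
    D.mkHom g hg m = D.e v • g v m := by
  change (∑ v, act N (D.e v) ∘ₗ g v ∘ₗ act M (D.e v)) m = _
  rw [LinearMap.sum_apply, Finset.sum_eq_single v]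
  · simp [D.mem_at.1 hm]
  · intro w _ hw
    simp [D.at_ne hw hm]
  · simp

lemma hom_ext_at {f g : M →ₗ[R] N} (h : ∀ v, ∀ m ∈ D.at' M v, f m = g m) : f = g := by
  ext m
  rw [← D.sum_e m, map_sum, map_sum]
  exact Finset.sum_congr rfl fun v _ => h v _ (D.e_mem v m)

/-- Module homomorphisms are linear over the ground field. -/
lemma hom_smul (f : M →ₗ[R] N) (c : k) (m : M) : f (c • m) = c • f m := by
  rw [← algebraMap_smul R c m, map_smul, algebraMap_smul]

/-- Restriction of scalars of a homomorphism to the ground field. -/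
def toK (f : M →ₗ[R] N) : M →ₗ[k] N where
  toFun := f
  map_add' := map_add f
  map_smul' := hom_smul f

/-- The submodule given by subspaces at the vertices stable under the arrows. -/
def sub (P : Vtx t ℓ → Submodule k M)
    (hP : ∀ i a, a < ℓ i → ∀ m ∈ P (vtx t ℓ i a), D.p i a (a + 1) • m ∈ P (vtx t ℓ i (a + 1))) :
    Submodule R M where
  carrier := {m | ∀ v, D.e v • m ∈ P v}
  add_mem' := fun {a b} ha hb v => by rw [smul_add]; exact add_mem (ha v) (hb v)
  zero_mem' := fun v => by rw [smul_zero]; exact zero_mem _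
  smul_mem' := by
    intro r m hm v
    induction D.mem_span r using Submodule.span_induction with
    | zero => simp
    | add x y _ _ hx hy => rw [add_smul, smul_add]; exact add_mem hx hy
    | smul c x _ hx => rw [smul_assoc, smul_comm]; exact Submodule.smul_mem _ _ hx
    | mem x hx =>
      rcases hx with ⟨w, rfl⟩ | ⟨i, a, b, hab, hb, rfl⟩
      · rw [D.e_e]
        split_ifs
        · exact hm v
        · exact zero_mem _
      · by_cases h : v = vtx t ℓ i b
        · subst h
          rw [D.e_p_smul hab.le hb]
          have key : ∀ c, a ≤ c → c ≤ ℓ i → D.p i a c • m ∈ P (vtx t ℓ i c) := by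
            intro c hac
            induction c, hac using Nat.le_induction with
            | base => intro h; rw [D.p_self_smul h]; exact hm _
            | succ c hac ih =>
              intro h
              rw [D.p_succ_smul hac h]
              exact hP i c h _ (ih (by omega))
          exact key b hab.le hb
        · rw [← D.e_p_smul hab.le hb, D.e_e, if_neg h]; exact zero_mem _

end Basic

section Indec

/-- An indecomposable module cannot be decomposed vertexwise. -/
lemma indec_split {M : ModuleCat.{u} R} (hM : Indec R M) [Module k M] [IsScalarTower k R M]
    (P Q : Vtx t ℓ → Submodule k M)
    (hP : ∀ i a, a < ℓ i → ∀ m ∈ P (vtx t ℓ i a), D.p i a (a + 1) • m ∈ P (vtx t ℓ i (a + 1)))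
    (hQ : ∀ i a, a < ℓ i → ∀ m ∈ Q (vtx t ℓ i a), D.p i a (a + 1) • m ∈ Q (vtx t ℓ i (a + 1)))
    (hd : ∀ v, Disjoint (P v) (Q v)) (hs : ∀ v, P v ⊔ Q v = D.at' M v) :
    (∀ v, P v = ⊥) ∨ ∀ v, Q v = ⊥ := by
  have hc : IsCompl (D.sub P hP) (D.sub Q hQ) := by
    constructor
    · rw [Submodule.disjoint_def]
      intro x hx hx'
      apply D.ext_e
      intro v
      rw [smul_zero]
      exact Submodule.disjoint_def.1 (hd v) _ (hx v) (hx' v)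
    · rw [codisjoint_iff, eq_top_iff]
      intro m _
      rw [← D.sum_e m]
      refine Submodule.sum_mem _ fun v _ => ?_
      have := D.e_mem v m
      rw [← hs v] at this
      obtain ⟨x, hx, y, hy, hxy⟩ := Submodule.mem_sup.1 this
      have aux : ∀ (P : Vtx t ℓ → Submodule k M) x, P v ≤ D.at' M v → x ∈ P v →
          ∀ w, D.e w • x ∈ P w := by
        intro P x hPv hx w
        by_cases h : w = v
        · subst h; rwa [D.mem_at.1 (hPv hx)]
        · rw [D.at_ne h (hPv hx)]; exact zero_mem _
      rw [← hxy]
      exact Submodule.add_mem_sup (aux P x (hs v ▸ le_sup_left) hx)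
        (aux Q y (hs v ▸ le_sup_right) hy)
  have key : ∀ (P : Vtx t ℓ → Submodule k M) (hP), (∀ v, P v ≤ D.at' M v) →
      D.sub P hP = ⊥ → ∀ v, P v = ⊥ := by
    intro P hP hle h v
    rw [eq_bot_iff]
    intro x hx
    have : x ∈ D.sub P hP := by
      intro w
      by_cases h : w = v
      · subst h; rwa [D.mem_at.1 (hle _ hx)]
      · rw [D.at_ne h (hle _ hx)]; exact zero_mem _
    rw [h] at this
    exact this
  rcases hM.2 (Submodule.projection _ _ hc) (by ext x; simp) with h | h
  · left
    refine key P hP (fun v => hs v ▸ le_sup_left) ?_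
    rw [← Submodule.range_projection hc, h, LinearMap.range_zero]
  · right
    refine key Q hQ (fun v => hs v ▸ le_sup_right) ?_
    rw [← Submodule.ker_projection hc, h, LinearMap.ker_id]

end Indec

end TD

section LinearAlgebra

variable {k : Type*} [Field k] {V W : Type*} [AddCommGroup V] [Module k V] [AddCommGroup W]
  [Module k W]

/-- A linear map injective on a subspace has a linear left inverse on its image. -/
lemma exists_left_inverse (A : Submodule k V) (f : V →ₗ[k] W) (hf : ∀ x ∈ A, f x = 0 → x = 0) :
    ∃ g : W →ₗ[k] V, (∀ y, g y ∈ A) ∧ ∀ x ∈ A, g (f x) = x := by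
  obtain ⟨g, hg⟩ := (f ∘ₗ A.subtype).exists_leftInverse_of_injective (by
    rw [LinearMap.ker_eq_bot']
    rintro ⟨x, hx⟩ h
    exact Subtype.ext (hf x hx h))
  refine ⟨A.subtype ∘ₗ g, fun y => (g y).2, fun x hx => ?_⟩
  have := LinearMap.congr_fun hg ⟨x, hx⟩
  exact congrArg Subtype.val this

lemma exists_left_inverse_pi {ι : Type*} [Fintype ι] (A : ι → Submodule k V) (f : ι → V →ₗ[k] W)
    (hf : ∀ x : ι → V, (∀ i, x i ∈ A i) → ∑ i, f i (x i) = 0 → ∀ i, x i = 0) :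
    ∃ g : ι → W →ₗ[k] V, (∀ i y, g i y ∈ A i) ∧
      ∀ i, ∀ x ∈ A i, ∀ j, g j (f i x) = if i = j then x else 0 := by
  obtain ⟨g, hg, hg'⟩ := exists_left_inverse (Submodule.pi Set.univ A)
    (∑ i, f i ∘ₗ LinearMap.proj i) (fun x hx h => by
      ext i
      refine hf x (fun i => hx i trivial) ?_ i
      simpa [LinearMap.sum_apply] using h)
  refine ⟨fun i => LinearMap.proj i ∘ₗ g, fun i y => hg y i trivial, fun i x hx j => ?_⟩
  have := hg' (Pi.single i x) (fun j _ => by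
    by_cases h : j = i
    · subst h; simpa using hx
    · simp [h])
  have h2 : (∑ i, f i ∘ₗ LinearMap.proj i : (ι → V) →ₗ[k] W) (Pi.single i x) = f i x := by
    rw [LinearMap.sum_apply, Finset.sum_eq_single i]
    · simp
    · intro b _ hb; simp [hb]
    · simp
  rw [h2] at this
  change g (f i x) j = _
  rw [this, Pi.single_apply]
  simp only [eq_comm]

end LinearAlgebra

lemma exists_seq {α : Type*} (P : ℕ → α → Prop) (Q : ℕ → α → α → Prop) (x₀ : α) (h₀ : P 0 x₀)
    (h : ∀ n x, P n x → ∃ y, P (n + 1) y ∧ Q n x y) :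
    ∃ f : ℕ → α, f 0 = x₀ ∧ (∀ n, P n (f n)) ∧ ∀ n, Q n (f n) (f (n + 1)) := by
  choose! g hg hg' using h
  let f : ℕ → α := fun n => Nat.rec x₀ g n
  have hf : ∀ n, P n (f n) := fun n => by
    induction n with
    | zero => exact h₀
    | succ n ih => exact hg n _ ih
  exact ⟨f, rfl, hf, fun n => hg' n _ (hf n)⟩

section Paths

variable {R : Type u} [Ring R]

lemma indPath_pred {P : ModuleCat.{u} R → Prop} (h : ∀ X Y, Step R X Y → P Y → P X)
    {X M : ModuleCat.{u} R} (hp : IndPath R X M) (hM : P M) : P X := by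
  induction hp using Relation.ReflTransGen.head_induction_on with
  | refl => exact hM
  | head hs _ ih => exact h _ _ hs ih

lemma indPath_succ {P : ModuleCat.{u} R → Prop} (h : ∀ X Y, Step R X Y → P X → P Y)
    {X M : ModuleCat.{u} R} (hp : IndPath R M X) (hM : P M) : P X := by
  induction hp with
  | refl => exact hM
  | tail _ hs ih => exact h _ _ hs ih

/-- A class closed under predecessors and of projective dimension at most one lies in the left
part. -/
lemma inLeftPart_of {P : ModuleCat.{u} R → Prop} (h : ∀ X Y, Step R X Y → P Y → P X)
    (hpd : ∀ X, Indec R X → FdMod R X → P X → PdLeOne R X) {M : ModuleCat.{u} R} (hi : Indec R M)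
    (hf : FdMod R M) (hM : P M) : InLeftPart R M :=
  ⟨hi, hf, fun X hX hX' hp => hpd X hX hX' (indPath_pred h hp hM)⟩

lemma inRightPart_of {P : ModuleCat.{u} R → Prop} (h : ∀ X Y, Step R X Y → P X → P Y)
    (hid : ∀ X, Indec R X → FdMod R X → P X → IdLeOne R X) {M : ModuleCat.{u} R} (hi : Indec R M)
    (hf : FdMod R M) (hM : P M) : InRightPart R M :=
  ⟨hi, hf, fun X hX hX' hp => hid X hX hX' (indPath_succ h hp hM)⟩

/-- A split torsion pair whose torsion class has injective dimension at most one and whose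
torsion-free class has projective dimension at most one. -/
lemma weaklyShod_of_split (A B : ModuleCat.{u} R → Prop)
    (hcov : ∀ M, Indec R M → FdMod R M → A M ∨ B M)
    (hom : ∀ M N, Indec R M → FdMod R M → Indec R N → FdMod R N → A M → B N →
      ∀ f : M →ₗ[R] N, f = 0)
    (hpd : ∀ M, Indec R M → FdMod R M → B M → PdLeOne R M)
    (hid : ∀ M, Indec R M → FdMod R M → A M → IdLeOne R M) : WeaklyShod R := by
  intro M hi hf hL hR
  exfalso
  rcases hcov M hi hf with h | h
  · refine hR (inRightPart_of (P := fun X => ¬ B X ∨ A X) ?_ ?_ hi hf (Or.inr h))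
    · rintro X Y ⟨hX, hX', hY, hY', f, hf0, -⟩ h
      by_contra hn
      push Not at hn
      have hA : A X := h.elim (hcov X hX hX').resolve_right id
      exact hf0 (hom X Y hX hX' hY hY' hA hn.1 f)
    · exact fun X hX hX' h => hid X hX hX' (h.elim (hcov X hX hX').resolve_right id)
  · refine hL (inLeftPart_of (P := B) ?_ hpd hi hf h)
    rintro X Y ⟨hX, hX', hY, hY', f, hf0, -⟩ h
    by_contra hn
    exact hf0 (hom X Y hX hX' hY hY' ((hcov X hX hX').resolve_right hn) h f)

end Paths

namespace TD

variable (D : TD k R t ℓ)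

/-- A criterion for projectivity of a representation vanishing at the source. -/
theorem projective_of (N : Type u) [AddCommGroup N] [Module R N] [Module k N] [IsScalarTower k R N]
    (h0 : ∀ n ∈ D.at' N .src, n = 0)
    (hinj : ∀ i a, a < ℓ i → ∀ n ∈ D.at' N (vtx t ℓ i a), D.p i a (a + 1) • n = 0 → n = 0)
    (hind : ∀ n : Fin t → N, (∀ i, n i ∈ D.at' N (vtx t ℓ i (ℓ i - 1))) →
      ∑ i, D.p i (ℓ i - 1) (ℓ i) • n i = 0 → ∀ i, n i = 0) : Module.Projective R N := by
  let X := N →₀ R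
  let g : X →ₗ[R] N := Finsupp.linearCombination R id
  have hg : Function.Surjective g := Finsupp.linearCombination_id_surjective R N
  obtain ⟨τ, hτ⟩ := (toK (k := k) g).exists_rightInverse_of_surjective
    (LinearMap.range_eq_top.2 hg)
  have hτ' : ∀ n, g (τ n) = n := fun n => LinearMap.congr_fun hτ n
  have hseq : ∀ i, ∃ σ : ℕ → (N →ₗ[k] X), σ 0 = 0 ∧
      (∀ a, a < ℓ i → ∀ n ∈ D.at' N (vtx t ℓ i a), g (σ a n) = n) ∧
      ∀ a, a + 1 < ℓ i → ∀ n ∈ D.at' N (vtx t ℓ i a),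
        σ (a + 1) (D.p i a (a + 1) • n) = D.p i a (a + 1) • σ a n := by
    intro i
    refine exists_seq (fun a (σ : N →ₗ[k] X) => a < ℓ i → ∀ n ∈ D.at' N (vtx t ℓ i a), g (σ n) = n)
      (fun a (σ σ' : N →ₗ[k] X) => a + 1 < ℓ i → ∀ n ∈ D.at' N (vtx t ℓ i a),
        σ' (D.p i a (a + 1) • n) = D.p i a (a + 1) • σ n) 0 ?_ ?_
    · intro _ n hn
      rw [vtx_zero] at hn
      simp [h0 n hn]
    · intro a σ hσ
      by_cases ha : a + 1 < ℓ i
      · obtain ⟨lam, hl, hl'⟩ := exists_left_inverse (D.at' N (vtx t ℓ i a))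
          (act (k := k) N (D.p i a (a + 1))) (fun x hx h => hinj i a (by omega) x hx h)
        have hσ := hσ (by omega)
        refine ⟨τ + act X (D.p i a (a + 1)) ∘ₗ σ ∘ₗ lam - τ ∘ₗ act N (D.p i a (a + 1)) ∘ₗ lam,
          fun _ n _ => ?_, fun _ n hn => ?_⟩
        · simp [hτ', hσ _ (hl n)]
        · have := hl' n hn
          simp only [act_apply] at this
          simp [this]
      · exact ⟨0, fun h => absurd h ha, fun h => absurd h ha⟩
  choose σ hσ0 hσg hσα using hseq
  obtain ⟨lam, hl, hl'⟩ := exists_left_inverse_pi (fun i => D.at' N (vtx t ℓ i (ℓ i - 1)))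
    (fun i => act (k := k) N (D.p i (ℓ i - 1) (ℓ i))) (fun x hx h => hind x hx (by simpa using h))
  let σz : N →ₗ[k] X := τ + ∑ i, (act X (D.p i (ℓ i - 1) (ℓ i)) ∘ₗ σ i (ℓ i - 1) ∘ₗ lam i
    - τ ∘ₗ act N (D.p i (ℓ i - 1) (ℓ i)) ∘ₗ lam i)
  have hσz : ∀ n, g (σz n) = n := by
    intro n
    have : ∀ i, g (σ i (ℓ i - 1) (lam i n)) = lam i n := fun i =>
      hσg i _ (by have := D.hℓ i; omega) _ (hl i n)
    simp [σz, LinearMap.sum_apply, hτ', this]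
  have hσzα : ∀ i, ∀ n ∈ D.at' N (vtx t ℓ i (ℓ i - 1)),
      σz (D.p i (ℓ i - 1) (ℓ i) • n) = D.p i (ℓ i - 1) (ℓ i) • σ i (ℓ i - 1) n := by
    intro i n hn
    have := hl' i n hn
    simp only [act_apply] at this
    simp only [σz, LinearMap.add_apply, LinearMap.sum_apply, LinearMap.sub_apply,
      LinearMap.comp_apply, act_apply, this]
    rw [Finset.sum_eq_single i]
    · simp
    · intro j _ hj; simp [hj.symm]
    · simp
  let F := fam (ℓ := ℓ) (0 : N →ₗ[k] X) σz σ
  have hFg : ∀ v, ∀ n ∈ D.at' N v, g (F v n) = n := by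
    refine vtx_forall ?_ ?_ ?_
    · intro n hn; simp [h0 n hn]
    · intro n _; exact hσz n
    · intro i a ha hb n hn
      simp only [F, fam_vtx, ha.ne', hb, if_true, if_false]
      exact hσg i a hb n hn
  have hF : ∀ i a, a < ℓ i → ∀ n ∈ D.at' N (vtx t ℓ i a), D.p i a (a + 1) • F (vtx t ℓ i a) n =
      D.e (vtx t ℓ i (a + 1)) • F (vtx t ℓ i (a + 1)) (D.p i a (a + 1) • n) := by
    intro i a ha n hn
    rcases Nat.eq_zero_or_pos a with rfl | ha0
    · rw [vtx_zero] at hn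
      simp [h0 n hn]
    · rcases (show a + 1 ≤ ℓ i from ha).lt_or_eq with h | h
      · simp only [F, fam_vtx, ha0.ne', ha, h, if_true, if_false, Nat.succ_ne_zero]
        rw [hσα i a h n hn, D.e_p_smul (by omega) ha]
      · have h1 : ¬ a + 1 < ℓ i := by omega
        simp only [F, fam_vtx, ha0.ne', ha, h1, if_true, if_false, Nat.succ_ne_zero]
        have h2 : a = ℓ i - 1 := by omega
        subst h2
        have := hσzα i n hn
        rw [← h] at this
        simp only [Nat.add_sub_cancel] at this
        rw [this, D.e_p_smul (by omega) ha]
  refine Module.Projective.of_split (D.mkHom F hF) g (D.hom_ext_at fun v n hn => ?_)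
  rw [LinearMap.comp_apply, D.mkHom_at F hF v n hn, map_smul, hFg v n hn]
  exact hn

/-- Every module has a projective cover-like presentation with linear section. -/
theorem exists_cover (M : Type u) [AddCommGroup M] [Module R M] [Module k M] [IsScalarTower k R M] :
    ∃ (P : Type u) (_ : AddCommGroup P) (_ : Module R P) (_ : Module k P) (_ : IsScalarTower k R P)
      (f : P →ₗ[R] M) (s : M →ₗ[k] P), Module.Projective R P ∧ (∀ m, f (s m) = m) ∧
      (∀ v m, s (D.e v • m) = D.e v • s m) ∧ Submodule.span R (Set.range s) = ⊤ ∧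
      ∀ (ζ : M →ₗ[k] k) v, ∃ h : P →ₗ[R] R, ∀ m, h (s m) = ζ (D.e v • m) • D.e v := by
  have hspan : ⊤ ≤ Submodule.span k (⋃ v, (D.at' M v : Set M)) := by
    intro m _
    rw [← D.sum_e m]
    exact Submodule.sum_mem _ fun v _ => Submodule.subset_span
      (Set.mem_iUnion.2 ⟨v, D.e_mem v m⟩)
  let b := Module.Basis.ofSpan hspan
  have hb : ∀ β, ∃ v, b β ∈ D.at' M v := fun β => by
    exact Set.mem_iUnion.1 (Module.Basis.ofSpan_subset hspan ⟨β, rfl⟩)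
  choose vt hvt using hb
  let ι := ((linearIndepOn_empty k (id : M → M)).extend
    (Set.empty_subset (⋃ v, (D.at' M v : Set M))))
  let π : (ι →₀ R) →ₗ[R] (ι →₀ R) :=
    Finsupp.linearCombination R (fun β => Finsupp.single β (D.e (vt β)))
  have hπ : ∀ β, π (Finsupp.single β (D.e (vt β))) = Finsupp.single β (D.e (vt β)) := fun β => by
    simp [π, D.e_idem]
  have hππ : ∀ x ∈ LinearMap.range π, π x = x := by
    rintro _ ⟨x, rfl⟩
    induction x using Finsupp.induction_linear with
    | zero => simp
    | add x y hx hy => simp only [map_add, hx, hy]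
    | single β r =>
      have : π (Finsupp.single β r) = r • Finsupp.single β (D.e (vt β)) := by simp [π]
      rw [this, map_smul, hπ]
  let P := LinearMap.range π
  have hmem : ∀ β, Finsupp.single β (D.e (vt β)) ∈ P := fun β => ⟨_, hπ β⟩
  let s : M →ₗ[k] P := b.constr k (fun β => ⟨_, hmem β⟩)
  have hs : ∀ β, s (b β) = ⟨_, hmem β⟩ := fun β => b.constr_basis k _ β
  have heb : ∀ v β, D.e v • b β = if v = vt β then b β else 0 := fun v β => by
    split_ifs with h
    · subst h; exact hvt β
    · exact D.at_ne h (hvt β)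
  have hext : ∀ {Y : Type u} [AddCommGroup Y] [Module k Y] (f g : M →ₗ[k] Y),
      (∀ β, f (b β) = g (b β)) → ∀ m, f m = g m := fun f g h m => by
    rw [b.ext h]
  refine ⟨P, inferInstance, inferInstance, inferInstance, inferInstance,
    Finsupp.linearCombination R b ∘ₗ P.subtype, s, ?_, ?_, ?_, ?_, ?_⟩
  · refine Module.Projective.of_split P.subtype π.rangeRestrict ?_
    ext ⟨x, hx⟩ : 1
    exact Subtype.ext (hππ x hx)
  · let g : P →ₗ[k] M := (Finsupp.linearCombination R b).restrictScalars k ∘ₗ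
      P.subtype.restrictScalars k
    refine hext (g ∘ₗ s) LinearMap.id fun β => ?_
    simp only [LinearMap.comp_apply, g, LinearMap.restrictScalars_apply]
    simp [hs, heb]
  · intro v
    refine hext (s ∘ₗ act M (D.e v)) (act P (D.e v) ∘ₗ s) fun β => ?_
    simp only [LinearMap.comp_apply, act_apply, heb, hs]
    apply Subtype.ext
    split_ifs with h
    · simp [hs, ← h, D.e_idem]
    · simp [D.e_mul, h]
  · rw [eq_top_iff]
    rintro ⟨_, x, rfl⟩ -
    induction x using Finsupp.induction_linear with
    | zero =>
      convert Submodule.zero_mem (Submodule.span R (Set.range s))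
      exact Subtype.ext (map_zero π)
    | add x y hx hy =>
      have := add_mem hx hy
      convert this using 1
      apply Subtype.ext; simp
    | single β r =>
      have : (⟨π (Finsupp.single β r), ⟨_, rfl⟩⟩ : P) = r • s (b β) := by
        apply Subtype.ext
        rw [hs]; simp [π]
      rw [this]
      exact Submodule.smul_mem _ _ (Submodule.subset_span ⟨_, rfl⟩)
  · intro ζ v
    refine ⟨Finsupp.linearCombination R (fun β => ζ (D.e v • b β) • D.e v) ∘ₗ P.subtype, ?_⟩
    let g : P →ₗ[k] R :=
      (Finsupp.linearCombination R (fun β => ζ (D.e v • b β) • D.e v)).restrictScalars k ∘ₗ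
        P.subtype.restrictScalars k
    refine hext (g ∘ₗ s) (LinearMap.toSpanSingleton k R (D.e v) ∘ₗ ζ ∘ₗ act M (D.e v)) fun β => ?_
    simp only [LinearMap.comp_apply, hs, g, LinearMap.restrictScalars_apply, act_apply]
    simp only [Submodule.subtype_apply, Finsupp.linearCombination_single, smul_eq_mul, heb]
    split_ifs with h
    · simp [h, D.e_idem]
    · simp

/-- The coefficient vectors orthogonal to all relations between the branches. -/
def Lam : Submodule k (Fin t → k) where
  carrier := {θ | ∀ r ∈ D.Rel, ∑ i, r i * θ i = 0}
  add_mem' := fun {a b} ha hb r hr => by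
    simp only [Pi.add_apply, mul_add, Finset.sum_add_distrib, ha r hr, hb r hr, add_zero]
  zero_mem' := fun r _ => by simp
  smul_mem' := fun c a ha r hr => by
    simp only [Pi.smul_apply, smul_eq_mul, mul_left_comm _ c, ← Finset.mul_sum, ha r hr, mul_zero]

lemma mem_Lam {θ : Fin t → k} : θ ∈ D.Lam ↔ ∀ r ∈ D.Rel, ∑ i, r i * θ i = 0 := Iff.rfl

lemma mem_Lam_of {b : R} {c : Fin t → k} (hb0 : b ≠ 0) (hb : ∀ i, D.w i = c i • b) : c ∈ D.Lam :=
  fun r hr => by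
    rw [D.mem_Rel] at hr
    simp only [hb, smul_smul, ← Finset.sum_smul] at hr
    exact (smul_eq_zero.1 hr).resolve_right hb0

lemma mem_Rel_of_Lam {r : Fin t → k} (h : ∀ θ ∈ D.Lam, ∑ i, r i * θ i = 0) : r ∈ D.Rel := by
  by_contra hn
  obtain ⟨f, hf, hf'⟩ := Submodule.exists_le_ker_of_notMem hn
  let θ : Fin t → k := fun i => f (Pi.single i 1)
  have hθ : ∀ r, f r = ∑ i, r i * θ i := fun r => by
    conv_lhs => rw [pi_eq_sum_univ' r]
    simp [θ]
  refine hf ((hθ r).trans (h θ fun r' hr' => ?_))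
  rw [← hθ]
  exact hf' hr'

lemma sum_smul_eq_zero {V : Type*} [AddCommGroup V] [Module k V] (v : Fin t → V)
    (h : ∀ ζ : V →ₗ[k] k, (fun i => ζ (v i)) ∈ D.Rel) {θ : Fin t → k} (hθ : θ ∈ D.Lam) :
    ∑ i, θ i • v i = 0 := by
  by_contra hn
  obtain ⟨ζ, hζ⟩ := Module.Projective.exists_dual_ne_zero k hn
  refine hζ ?_
  simpa [mul_comm] using hθ _ (h ζ)

section Cover

variable {M P : Type u} [AddCommGroup M] [Module R M] [Module k M] [IsScalarTower k R M]
  [AddCommGroup P] [Module R P] [Module k P] [IsScalarTower k R P] {s : M →ₗ[k] P}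

lemma cover_form (hs : ∀ v m, s (D.e v • m) = D.e v • s m)
    (hspan : Submodule.span R (Set.range s) = ⊤) (i : Fin t) {j : ℕ} (hj : j < ℓ i) (x : P) :
    ∃ μ : ℕ → M, (∀ a, μ a ∈ D.at' M (vtx t ℓ i a)) ∧
      D.e (vtx t ℓ i j) • x = ∑ a ∈ Finset.range (j + 1), D.p i a j • s (μ a) := by
  let L : ℕ → (ℕ → M) →ₗ[k] P := fun j => ∑ a ∈ Finset.range (j + 1),
    act P (D.p i a j) ∘ₗ s ∘ₗ act M (D.e (vtx t ℓ i a)) ∘ₗ LinearMap.proj a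
  have hL : ∀ j μ, L j μ = ∑ a ∈ Finset.range (j + 1),
      D.p i a j • s (D.e (vtx t ℓ i a) • μ a) := fun j μ => by simp [L, LinearMap.sum_apply]
  suffices h : ∀ x : P, ∀ j, j < ℓ i → D.e (vtx t ℓ i j) • x ∈ LinearMap.range (L j) by
    obtain ⟨μ, hμ⟩ := h x j hj
    exact ⟨fun a => D.e (vtx t ℓ i a) • μ a, fun a => D.e_mem _ _, by rw [← hμ, hL]⟩
  intro x
  have hx : x ∈ Submodule.span R (Set.range s) := hspan ▸ trivial
  induction hx using Submodule.span_induction with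
  | zero => intro j _; rw [smul_zero]; exact zero_mem _
  | add x y _ _ hx hy => intro j hj; rw [smul_add]; exact add_mem (hx j hj) (hy j hj)
  | mem x hx =>
    obtain ⟨m, rfl⟩ := hx
    intro j hj
    refine ⟨Pi.single j m, ?_⟩
    rw [hL, Finset.sum_eq_single j]
    · rw [D.p_self_smul hj.le, Pi.single_eq_same, hs, D.e_e_self]
    · intro a _ ha; simp [Pi.single_eq_of_ne ha]
    · simp
  | smul r x _ hx =>
    induction D.mem_span r using Submodule.span_induction with
    | zero => intro j _; rw [zero_smul, smul_zero]; exact zero_mem _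
    | add r r' _ _ h h' => intro j hj; rw [add_smul, smul_add]; exact add_mem (h j hj) (h' j hj)
    | smul c r _ h =>
      intro j hj
      rw [smul_assoc, smul_algebra_smul_comm]
      exact Submodule.smul_mem _ c (h j hj)
    | mem r hr =>
      intro j hj
      rcases hr with ⟨v, rfl⟩ | ⟨i', a, b, hab, hb, rfl⟩
      · rw [D.e_e]
        split_ifs
        · exact hx j hj
        · exact zero_mem _
      · by_cases h : vtx t ℓ i j = vtx t ℓ i' b
        · obtain ⟨rfl, rfl⟩ := vtx_inj' hj hab h
          rw [D.e_p_smul hab.le hb, ← D.p_e_smul hab.le hb]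
          obtain ⟨μ, hμ⟩ := hx a (hab.trans hj)
          rw [← hμ]
          refine ⟨fun c => if c ≤ a then μ c else 0, ?_⟩
          rw [hL, hL, Finset.smul_sum, ← Finset.sum_subset
            (Finset.range_subset_range.2 (Nat.succ_le_succ hab.le))]
          · refine Finset.sum_congr rfl fun c hc => ?_
            have hc : c ≤ a := by simpa [Nat.lt_succ_iff] using hc
            rw [if_pos hc, D.p_p_smul hc hab.le hb]
          · intro c _ hc
            have hc : ¬ c ≤ a := by simpa [Nat.lt_succ_iff] using hc
            simp [hc]
        · rw [← D.e_p_smul hab.le hb, D.e_e, if_neg h]; exact zero_mem _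

lemma cover_indep (hh : ∀ (ζ : M →ₗ[k] k) v, ∃ h : P →ₗ[R] R, ∀ m, h (s m) = ζ (D.e v • m) • D.e v)
    {ι : Type*} (S : Finset ι) (r : ι → R) (m : ι → M) (h : ∑ c ∈ S, r c • s (m c) = 0)
    (ζ : M →ₗ[k] k) (v) : ∑ c ∈ S, ζ (D.e v • m c) • (r c * D.e v) = 0 := by
  obtain ⟨g, hg⟩ := hh ζ v
  have := congrArg g h
  simpa [hg] using this

end Cover

/-- A criterion for projective dimension at most one. -/
theorem pd_le_one (ht : 0 < t) (M : ModuleCat.{u} R) [Module k M] [IsScalarTower k R M]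
    (hA : ∀ i a b, a < b → b ≤ ℓ i → D.p i a b = 0 → ∀ m ∈ D.at' M (vtx t ℓ i a), m = 0)
    (hB : ∀ v : Fin t → M, (∀ i, v i ∈ D.at' M .src) → (∀ θ ∈ D.Lam, ∑ i, θ i • v i = 0) →
      (∀ i, D.p i 0 (ℓ i - 1) • v i = 0) → ∀ i, v i = 0) : PdLeOne R M := by
  obtain ⟨P, _, _, _, _, f, s, hP, hfs, hse, hspan, hh⟩ := D.exists_cover M
  refine ⟨ModuleCat.of R P, f, fun m => ⟨s m, hfs m⟩, hP, ?_⟩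
  have hA' : ∀ i a b, a ≤ b → b ≤ ℓ i → ∀ m ∈ D.at' M (vtx t ℓ i a),
      (∀ ζ : M →ₗ[k] k, ζ m • D.p i a b = 0) → m = 0 := by
    intro i a b hab hb m hm hz
    by_contra hn
    obtain ⟨ζ, hζ⟩ := Module.Projective.exists_dual_ne_zero k hn
    have h0 := (smul_eq_zero.1 (hz ζ)).resolve_left hζ
    rcases hab.lt_or_eq with h | rfl
    · exact hn (hA i a b h hb h0 m hm)
    · rw [D.p_self i a hb] at h0
      exact D.e_ne _ h0
  have hform := fun i j (hj : j < ℓ i) (x : P) => D.cover_form hse hspan i hj x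
  have hN : ∀ (n : LinearMap.ker f) v, n ∈ D.at' (LinearMap.ker f) v ↔ (n : P) ∈ D.at' P v :=
    fun n v => by rw [mem_at, mem_at, ← Subtype.coe_inj]; rfl
  refine D.projective_of (LinearMap.ker f) ?_ ?_ ?_
  · intro n hn
    let i : Fin t := ⟨0, ht⟩
    obtain ⟨μ, hμ, h⟩ := hform i 0 (D.hℓ i) n
    rw [← vtx_zero i, hN, mem_at] at hn
    rw [h] at hn
    have h2 := hμ 0
    simp only [zero_add, Finset.range_one, Finset.sum_singleton, D.p_self_smul (Nat.zero_le _),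
      ← hse, D.mem_at.1 h2] at hn
    have : f n = 0 := n.2
    rw [← hn, hfs] at this
    ext
    rw [← hn, this]; simp
  · intro i a ha n hn h
    obtain ⟨μ, hμ, hx⟩ := hform i a ha n
    rw [hN, mem_at] at hn
    rw [hn] at hx
    have h' : D.p i a (a + 1) • (n : P) = 0 := congrArg Subtype.val h
    rw [hx, Finset.smul_sum, Finset.sum_congr rfl fun c hc => D.p_p_smul
      (by simp at hc; omega) (by omega) ha _] at h'
    ext
    rw [hx]
    refine Finset.sum_eq_zero fun c hc => ?_
    have hc' : c ≤ a := by simp at hc; omega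
    rw [hA' i c (a + 1) (by omega) ha _ (hμ c), map_zero, smul_zero]
    intro ζ
    have := D.cover_indep hh _ _ _ h' ζ (vtx t ℓ i c)
    rw [Finset.sum_eq_single c] at this
    · rwa [D.mem_at.1 (hμ c), D.p_e i c (a + 1) (by omega) ha] at this
    · intro d hd hdc
      simp at hd
      rw [D.at_ne _ (hμ d), map_zero, zero_smul]
      intro h
      exact hdc (vtx_inj_same (by omega) (by omega) h).symm
    · exact fun h => absurd hc h
  · intro n hn h
    choose μ hμ hx using fun i => hform i (ℓ i - 1) (by have := D.hℓ i; omega) (n i)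
    replace hx : ∀ i, (n i : P) = _ := fun i => (D.mem_at.1 ((hN _ _).1 (hn i))).symm.trans (hx i)
    have hr : ∀ i, Finset.range (ℓ i - 1 + 1) = Finset.range (ℓ i) := fun i => by
      have := D.hℓ i
      rw [Nat.sub_add_cancel this]
    have h' : ∑ q ∈ Finset.univ.sigma fun i => Finset.range (ℓ i),
        D.p q.1 q.2 (ℓ q.1) • s (μ q.1 q.2) = 0 := by
      rw [Finset.sum_sigma]
      have := congrArg Subtype.val h
      simp only [AddSubmonoidClass.coe_finsetSum, Submodule.coe_smul, hx, ZeroMemClass.coe_zero,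
        Finset.smul_sum] at this
      rw [← this]
      refine Finset.sum_congr rfl fun i _ => ?_
      rw [hr]
      refine Finset.sum_congr rfl fun c hc => ?_
      rw [Finset.mem_range] at hc
      rw [D.p_p_smul (by omega) (by omega) le_rfl]
    have hz : ∀ i c, 0 < c → c < ℓ i → μ i c = 0 := by
      intro i c hc0 hc
      refine hA' i c (ℓ i) hc.le le_rfl _ (hμ i c) fun ζ => ?_
      have := D.cover_indep hh _ _ _ h' ζ (vtx t ℓ i c)
      rw [Finset.sum_eq_single (⟨i, c⟩ : Σ _ : Fin t, ℕ)] at this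
      · simpa only [D.mem_at.1 (hμ i c), D.p_e i c (ℓ i) hc.le le_rfl] using this
      · rintro ⟨j, d⟩ hd hdc
        rw [D.at_ne _ (hμ j d), map_zero, zero_smul]
        intro h
        obtain ⟨rfl, rfl⟩ := vtx_inj hc0 hc h
        exact hdc rfl
      · simp [hc]
    have h0 : ∀ i, μ i 0 ∈ D.at' M .src := fun i => by simpa [vtx_zero] using hμ i 0
    have hx' : ∀ i, (n i : P) = D.p i 0 (ℓ i - 1) • s (μ i 0) := fun i => by
      rw [hx, Finset.sum_eq_single 0]
      · intro c hc hc0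
        rw [Finset.mem_range] at hc
        have := D.hℓ i
        rw [hz i c (by omega) (by omega), map_zero, smul_zero]
      · simp
    have hB' := hB (fun i => μ i 0) h0 (fun θ hθ => D.sum_smul_eq_zero _ (fun ζ => ?_) hθ) ?_
    · intro i
      ext
      rw [hx', hB', map_zero, smul_zero]; rfl
    · have := D.cover_indep hh _ _ _ h' ζ .src
      rw [Finset.sum_sigma] at this
      rw [mem_Rel, ← this]
      refine Finset.sum_congr rfl fun i _ => ?_
      rw [Finset.sum_eq_single 0]
      · rw [D.mem_at.1 (h0 i), ← vtx_zero i, D.p_e _ _ _ (Nat.zero_le _) le_rfl, w]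
      · intro c hc hc0
        rw [Finset.mem_range] at hc
        rw [hz i c (by omega) hc]; simp
      · have := D.hℓ i
        simp; omega
    · intro i
      have : f (n i) = 0 := (n i).2
      rwa [hx', map_smul, hfs] at this

end TD

section Dual

/-- The `k`-structure of a module over a `k`-algebra. -/
abbrev kMod (k R M : Type u) [Field k] [Ring R] [Algebra k R]
    [AddCommGroup M] [Module R M] : Module k M := Module.compHom M (algebraMap k R)

instance (k R M : Type u) [Field k] [Ring R] [Algebra k R] [AddCommGroup M] [Module R M] :
    letI := kMod k R M; IsScalarTower k R M :=
  letI := kMod k R M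
  IsScalarTower.of_algebraMap_smul fun _ _ => rfl

/-- The `k`-dual of a left module. -/
def DualL (k : Type u) (M : Type u) [Field k] [AddCommGroup M] [Module k M] : Type u := M →ₗ[k] k

/-- The `k`-dual of a right module. -/
def DualR (k : Type u) (M : Type u) [Field k] [AddCommGroup M] [Module k M] : Type u := M →ₗ[k] k

section
variable (M : Type u) [AddCommGroup M] [Module k M]

instance : AddCommGroup (DualL k M) := inferInstanceAs (AddCommGroup (M →ₗ[k] k))
instance : Module k (DualL k M) := inferInstanceAs (Module k (M →ₗ[k] k))
instance : AddCommGroup (DualR k M) := inferInstanceAs (AddCommGroup (M →ₗ[k] k))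
instance : Module k (DualR k M) := inferInstanceAs (Module k (M →ₗ[k] k))

instance : FunLike (DualL k M) M k := inferInstanceAs (FunLike (M →ₗ[k] k) M k)
instance : LinearMapClass (DualL k M) k M k := inferInstanceAs (LinearMapClass (M →ₗ[k] k) k M k)
instance : FunLike (DualR k M) M k := inferInstanceAs (FunLike (M →ₗ[k] k) M k)
instance : LinearMapClass (DualR k M) k M k := inferInstanceAs (LinearMapClass (M →ₗ[k] k) k M k)

instance [Module R M] [IsScalarTower k R M] : Module Rᵐᵒᵖ (DualL k M) where
  smul r ξ := (LinearMap.comp ξ (TD.act M (r.unop)) : M →ₗ[k] k)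
  one_smul ξ := LinearMap.ext fun m => congrArg ξ (one_smul R m)
  mul_smul r r' ξ := LinearMap.ext fun m => congrArg ξ (mul_smul _ _ m)
  smul_zero r := LinearMap.zero_comp _
  smul_add r ξ η := LinearMap.add_comp _ _ _
  add_smul r r' ξ := LinearMap.ext fun m => (congrArg ξ (add_smul _ _ m)).trans (map_add ξ _ _)
  zero_smul ξ := LinearMap.ext fun m => (congrArg ξ (zero_smul R m)).trans (map_zero ξ)

instance [Module Rᵐᵒᵖ M] [IsScalarTower k Rᵐᵒᵖ M] : Module R (DualR k M) where
  smul r ξ := (LinearMap.comp ξ (TD.act M (op r)) : M →ₗ[k] k)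
  one_smul ξ := LinearMap.ext fun m => congrArg ξ (one_smul Rᵐᵒᵖ m)
  mul_smul r r' ξ := LinearMap.ext fun m => congrArg ξ (mul_smul _ _ m)
  smul_zero r := LinearMap.zero_comp _
  smul_add r ξ η := LinearMap.add_comp _ _ _
  add_smul r r' ξ := LinearMap.ext fun m => (congrArg ξ (add_smul _ _ m)).trans (map_add ξ _ _)
  zero_smul ξ := LinearMap.ext fun m => (congrArg ξ (zero_smul Rᵐᵒᵖ m)).trans (map_zero ξ)

variable {M}

lemma DualL.smul_apply [Module R M] [IsScalarTower k R M] (r : Rᵐᵒᵖ) (ξ : DualL k M) (m : M) :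
    (r • ξ) m = ξ (r.unop • m) := rfl

lemma DualR.smul_apply [Module Rᵐᵒᵖ M] [IsScalarTower k Rᵐᵒᵖ M] (r : R) (ξ : DualR k M) (m : M) :
    (r • ξ) m = ξ (op r • m) := rfl

@[ext] lemma DualL.ext {ξ η : DualL k M} (h : ∀ m, ξ m = η m) : ξ = η := LinearMap.ext h
@[ext] lemma DualR.ext {ξ η : DualR k M} (h : ∀ m, ξ m = η m) : ξ = η := LinearMap.ext h

lemma DualL.ksmul_apply (c : k) (ξ : DualL k M) (m : M) : (c • ξ) m = c * ξ m := rfl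

instance [Module R M] [IsScalarTower k R M] : IsScalarTower k Rᵐᵒᵖ (DualL k M) where
  smul_assoc c r ξ := by
    ext m
    rw [DualL.smul_apply, DualL.ksmul_apply, DualL.smul_apply, unop_smul, smul_assoc, map_smul,
      smul_eq_mul]

end

/-- The dual of a projective module is injective. -/
lemma injective_dual (P : Type u) [AddCommGroup P] [Module Rᵐᵒᵖ P] [Module k P]
    [IsScalarTower k Rᵐᵒᵖ P] [Module.Projective Rᵐᵒᵖ P] : Module.Injective R (DualR k P) := by
  constructor
  intro X Y _ _ _ _ f hf g
  let _ := kMod k R X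
  let _ := kMod k R Y
  let F : DualL k Y →ₗ[Rᵐᵒᵖ] DualL k X :=
    { toFun := fun ξ => (LinearMap.comp (ξ : Y →ₗ[k] k) (TD.toK f) : X →ₗ[k] k)
      map_add' := fun _ _ => rfl
      map_smul' := fun r ξ => by
        apply DualL.ext; intro m
        exact congrArg ξ (f.map_smul r.unop m).symm }
  have hF : Function.Surjective F := fun ξ => by
    obtain ⟨g, hg⟩ := (TD.toK (k := k) f).exists_leftInverse_of_injective
      (LinearMap.ker_eq_bot.2 hf)
    refine ⟨(LinearMap.comp (ξ : X →ₗ[k] k) g : Y →ₗ[k] k), ?_⟩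
    apply DualL.ext; intro m
    exact congrArg ξ (LinearMap.congr_fun hg m)
  let G : P →ₗ[Rᵐᵒᵖ] DualL k X :=
    { toFun := fun p => ({ toFun := fun x => g x p
                           map_add' := fun x y => by rw [map_add]; rfl
                           map_smul' := fun c x => by
                             change g (algebraMap k R c • x) p = _
                             rw [map_smul, DualR.smul_apply]
                             have : op (algebraMap k R c) • p = c • p := by
                               rw [← algebraMap_smul Rᵐᵒᵖ c p]; rfl
                             rw [this, map_smul]; rfl } : X →ₗ[k] k)
      map_add' := fun p q => by
        apply DualL.ext; intro x
        exact map_add (g x) p q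
      map_smul' := fun r p => by
        apply DualL.ext; intro x
        change g x (r • p) = g (r.unop • x) p
        rw [g.map_smul]; rfl }
  obtain ⟨H, hH⟩ := Module.projective_lifting_property F G hF
  refine ⟨{ toFun := fun y => ({ toFun := fun p => H p y
                                 map_add' := fun p q => by rw [map_add]; rfl
                                 map_smul' := fun c p => by
                                   rw [TD.hom_smul]; rfl } : P →ₗ[k] k)
            map_add' := fun y z => by
              apply DualR.ext; intro p
              exact map_add (H p) y z
            map_smul' := fun r y => by
              apply DualR.ext; intro p
              change H p (r • y) = H (op r • p) y
              rw [H.map_smul]; rfl }, fun x => ?_⟩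
  apply DualR.ext; intro p
  exact congrFun (congrArg DFunLike.coe (LinearMap.congr_fun hH p)) x

lemma injective_of_equiv {X Y : Type u} [AddCommGroup X] [Module R X] [AddCommGroup Y] [Module R Y]
    (h : Module.Injective R X) (e : X ≃ₗ[R] Y) : Module.Injective R Y := by
  constructor
  intro A B _ _ _ _ f hf g
  obtain ⟨H, hH⟩ := h.out f hf (e.symm.toLinearMap ∘ₗ g)
  exact ⟨e.toLinearMap ∘ₗ H, fun x => by simp [hH]⟩

/-- Duality between projective and injective dimension at most one. -/
lemma idLeOne_of_dual (M : ModuleCat.{u} R) [Module k M] [IsScalarTower k R M]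
    [Module.Finite k M] (h : PdLeOne Rᵐᵒᵖ (ModuleCat.of _ (DualL k M))) : IdLeOne R M := by
  obtain ⟨P, f, hf, hP, hK⟩ := h
  let _ := kMod k Rᵐᵒᵖ P
  let K := LinearMap.ker f
  have hfk : ∀ (c : k) p, (f (c • p) : DualL k M) = c • (f p : DualL k M) := fun c p =>
    TD.hom_smul (N := DualL k M) f c p
  let fk : P →ₗ[k] (M →ₗ[k] k) := { toFun := f, map_add' := map_add f, map_smul' := hfk }
  let E := DualR k P
  let F : M →ₗ[R] E :=
    { toFun := fun m => ({ toFun := fun p => (f p : DualL k M) m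
                           map_add' := fun p q => by rw [map_add]; rfl
                           map_smul' := fun c p => by
                             rw [hfk]; rfl } : P →ₗ[k] k)
      map_add' := fun y z => by
        apply DualR.ext; intro p
        exact map_add (f p : DualL k M) y z
      map_smul' := fun r y => by
        apply DualR.ext; intro p
        change (f p : DualL k M) (r • y) = (f (op r • p) : DualL k M) y
        rw [f.map_smul]; rfl }
  let Q : E →ₗ[R] DualR k K :=
    { toFun := fun ξ => (LinearMap.comp (ξ : P →ₗ[k] k) (K.subtype.restrictScalars k) : K →ₗ[k] k)
      map_add' := fun _ _ => rfl
      map_smul' := fun _ _ => rfl }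
  have hQ : Function.Surjective Q := fun ξ => by
    obtain ⟨g, hg⟩ := (K.subtype.restrictScalars k).exists_leftInverse_of_injective
      (LinearMap.ker_eq_bot.2 K.injective_subtype)
    refine ⟨(LinearMap.comp (ξ : K →ₗ[k] k) g : P →ₗ[k] k), ?_⟩
    apply DualR.ext; intro m
    exact congrArg ξ (LinearMap.congr_fun hg m)
  have hker : LinearMap.range F = LinearMap.ker Q := by
    ext ξ
    constructor
    · rintro ⟨m, rfl⟩
      rw [LinearMap.mem_ker]
      apply DualR.ext; rintro ⟨x, hx⟩
      change (f x : DualL k M) m = 0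
      rw [LinearMap.mem_ker.1 hx]; rfl
    · intro h
      have h' : ∀ x, f x = 0 → ξ x = 0 := fun x hx =>
        congrFun (congrArg DFunLike.coe (LinearMap.mem_ker.1 h)) (⟨x, hx⟩ : K)
      obtain ⟨σ, hσ⟩ := fk.exists_rightInverse_of_surjective (LinearMap.range_eq_top.2 hf)
      obtain ⟨m, hm⟩ := (Module.evalEquiv k M).surjective ((ξ : P →ₗ[k] k) ∘ₗ σ)
      refine ⟨m, ?_⟩
      apply DualR.ext; intro p
      have h1 : ξ (σ (fk p)) = ξ p := by
        rw [← sub_eq_zero, ← map_sub]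
        apply h'
        have : fk (σ (fk p)) = fk p := LinearMap.congr_fun hσ _
        change fk (σ (fk p) - p) = 0
        rw [map_sub, this, sub_self]
      rw [← h1]
      have := LinearMap.congr_fun hm (fk p)
      exact this
  refine ⟨ModuleCat.of R E, F, ?_, injective_dual P, ?_⟩
  · rw [← LinearMap.ker_eq_bot, LinearMap.ker_eq_bot']
    intro m hm
    by_contra hn
    obtain ⟨ζ, hζ⟩ := Module.Projective.exists_dual_ne_zero k hn
    obtain ⟨p, hp⟩ := hf (ζ : DualL k M)
    refine hζ ?_
    have h1 : (f p : DualL k M) m = 0 := congrFun (congrArg DFunLike.coe hm) p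
    rw [hp] at h1
    exact h1
  · refine injective_of_equiv (X := DualR k K) (injective_dual (k := k) K) ?_
    exact ((Submodule.quotEquivOfEq _ _ hker).trans (Q.quotKerEquivOfSurjective hQ)).symm

end Dual

/-- The reflection of the vertices. -/
def rev {t : ℕ} {ℓ : Fin t → ℕ} : Vtx t ℓ → Vtx t ℓ
  | .src => .snk
  | .snk => .src
  | .mid i a => .mid i a.rev

lemma rev_rev {t : ℕ} {ℓ : Fin t → ℕ} (v : Vtx t ℓ) : rev (rev v) = v := by
  cases v <;> simp [rev]

lemma rev_injective {t : ℕ} {ℓ : Fin t → ℕ} : Function.Injective (rev (t := t) (ℓ := ℓ)) :=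
  Function.Involutive.injective rev_rev

lemma rev_vtx {t : ℕ} {ℓ : Fin t → ℕ} (hℓ : ∀ i, 1 ≤ ℓ i) (i : Fin t) {a : ℕ} (ha : a ≤ ℓ i) :
    rev (vtx t ℓ i a) = vtx t ℓ i (ℓ i - a) := by
  have := hℓ i
  rcases vtx_cases (ℓ := ℓ) i a with rfl | ⟨h0, h⟩ | ⟨h0, h⟩
  · rw [vtx_zero, vtx_snk i _ (by omega) (by omega)]; rfl
  · rw [vtx_mid i a h0 h, vtx_mid i _ (by omega) (by omega)]
    simp only [rev, Vtx.mid.injEq, heq_eq_eq, true_and]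
    ext; simp; omega
  · rw [vtx_snk i a h0 h, show ℓ i - a = 0 by omega, vtx_zero]; rfl

namespace TD

variable (D : TD k R t ℓ)

/-- The opposite of a toupie algebra is a toupie algebra. -/
def opp : TD k Rᵐᵒᵖ t ℓ where
  e v := op (D.e (rev v))
  p i a b := op (D.p i (ℓ i - b) (ℓ i - a))
  e_mul v w := by
    rw [← op_mul, D.e_mul]
    by_cases h : v = w
    · simp [h]
    · rw [if_neg h, if_neg fun h' => h (rev_injective h').symm, op_zero]
  e_sum := by
    rw [← Finset.op_sum, Function.Bijective.sum_comp (Function.Involutive.bijective rev_rev) D.e, D.e_sum,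
      op_one]
  p_self i a ha := by
    rw [D.p_self i _ (Nat.sub_le _ _), rev_vtx D.hℓ i ha]
  p_comp i a b c hab hbc hc := by
    rw [← op_mul, D.p_comp i _ _ _ (by omega) (by omega) (by omega)]
  hℓ := D.hℓ
  span_top := by
    rw [eq_top_iff]
    intro x _
    have hx := D.mem_span x.unop
    rw [← op_unop x]
    generalize x.unop = y at hx
    induction hx using Submodule.span_induction with
    | zero => exact zero_mem _
    | add y z _ _ hy hz => rw [op_add]; exact add_mem hy hz
    | smul c y _ hy => rw [op_smul]; exact Submodule.smul_mem _ _ hy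
    | mem y hy =>
      refine Submodule.subset_span ?_
      rcases hy with ⟨v, rfl⟩ | ⟨i, a, b, hab, hb, rfl⟩
      · exact Or.inl ⟨rev v, by simp [rev_rev]⟩
      · refine Or.inr ⟨i, ℓ i - b, ℓ i - a, by omega, by omega, ?_⟩
        congr 2 <;> omega
  e_ne v := by simpa using D.e_ne (rev v)
  arrow_ne i a ha := by
    have := D.arrow_ne i (ℓ i - (a + 1)) (by omega)
    rw [show ℓ i - (a + 1) + 1 = ℓ i - a by omega] at this
    simpa using this
  adm r hr i hi := by
    refine D.adm r ?_ i hi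
    simp only [Nat.sub_self, Nat.sub_zero, ← op_smul, ← Finset.op_sum] at hr
    exact (op_eq_zero_iff _).1 hr

lemma opp_e (v) : D.opp.e v = op (D.e (rev v)) := rfl

lemma opp_p (i a b) : D.opp.p i a b = op (D.p i (ℓ i - b) (ℓ i - a)) := rfl

lemma opp_w (i) : D.opp.w i = op (D.w i) := by
  rw [w, w, opp_p, Nat.sub_self, Nat.sub_zero]

lemma opp_Rel : D.opp.Rel = D.Rel := by
  ext r
  simp only [mem_Rel, opp_w, ← op_smul, ← Finset.op_sum, op_eq_zero_iff]

lemma opp_Lam : D.opp.Lam = D.Lam := by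
  ext r
  simp only [mem_Lam, opp_Rel]

/-- A criterion for injective dimension at most one. -/
theorem id_le_one (ht : 0 < t) (M : ModuleCat.{u} R) [Module k M] [IsScalarTower k R M]
    [Module.Finite k M]
    (hA : ∀ i a b, a < b → b ≤ ℓ i → D.p i a b = 0 → ∀ m ∈ D.at' M (vtx t ℓ i b), m = 0)
    (hB : ∀ ξ : Fin t → M →ₗ[k] k, (∀ i m, ξ i (D.e .snk • m) = ξ i m) →
      (∀ θ ∈ D.Lam, ∑ i, θ i • ξ i = 0) → (∀ i m, ξ i (D.p i 1 (ℓ i) • m) = 0) →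
      ∀ i, ξ i = 0) : IdLeOne R M := by
  refine idLeOne_of_dual (k := k) M (pd_le_one D.opp ht _ ?_ ?_)
  · intro i a b hab hb h0 (ξ : DualL k M) hξ
    rw [opp_p, op_eq_zero_iff] at h0
    apply DualL.ext
    intro m
    have h1 : D.opp.e (vtx t ℓ i a) • ξ = ξ := hξ
    rw [← h1, opp_e, DualL.smul_apply, unop_op, rev_vtx D.hℓ i (by omega),
      hA i _ _ (by omega) (by omega) h0 _ (D.e_mem _ m), map_zero]
    rfl
  · intro ξ hξ hθ hp i
    refine hB ξ (fun i m => ?_) (fun θ h => hθ θ (D.opp_Lam ▸ h)) (fun i m => ?_) i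
    · have h1 : D.opp.e .src • (ξ i : DualL k M) = ξ i := hξ i
      exact congrFun (congrArg DFunLike.coe h1) m
    · have h1 : D.opp.p i 0 (ℓ i - 1) • (ξ i : DualL k M) = 0 := hp i
      have h2 := congrFun (congrArg DFunLike.coe h1) m
      rw [opp_p, show ℓ i - (ℓ i - 1) = 1 by have := D.hℓ i; omega] at h2
      exact h2

end TD

/-- Solvability of linear equations passes from a ring to its projective modules. -/
lemma projective_solve {R : Type u} [Ring R] {ι κ J : Type*} [Fintype ι] [Fintype κ]
    (A : J → ι → R) (B : ι → κ → R)
    (hR : ∀ n : ι → R, (∀ j, ∑ i, A j i * n i = 0) → ∃ y : κ → R, ∀ i, n i = ∑ c, B i c * y c)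
    {P : Type u} [AddCommGroup P] [Module R P] [Module.Projective R P] (n : ι → P)
    (h : ∀ j, ∑ i, A j i • n i = 0) : ∃ y : κ → P, ∀ i, n i = ∑ c, B i c • y c := by
  obtain ⟨σ, hσ⟩ := (Module.projective_def' (R := R) (P := P)).1 ‹_›
  have hσ' : ∀ x, Finsupp.linearCombination R id (σ x) = x := fun x => LinearMap.congr_fun hσ x
  have h1 : ∀ x : P, ∃ y : κ → R, (∀ i, σ (n i) x = ∑ c, B i c * y c) ∧
      ((∀ i, σ (n i) x = 0) → y = 0) := fun x => by
    by_cases h0 : ∀ i, σ (n i) x = 0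
    · exact ⟨0, fun i => by simp [h0], fun _ => rfl⟩
    · obtain ⟨y, hy⟩ := hR (fun i => σ (n i) x) (fun j => by
        have := congrArg (fun z => σ z x) (h j)
        simpa using this)
      exact ⟨y, hy, fun h => absurd h h0⟩
  choose y hy hy0 using h1
  let Y : κ → (P →₀ R) := fun c => Finsupp.onFinset (Finset.univ.biUnion fun i => (σ (n i)).support)
    (fun x => y x c) (fun x hx => by
      by_contra hn
      simp only [Finset.mem_biUnion, Finset.mem_univ, true_and, Finsupp.mem_support_iff,
        not_exists, not_not] at hn
      exact hx (congrFun (hy0 x hn) c))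
  refine ⟨fun c => Finsupp.linearCombination R id (Y c), fun i => ?_⟩
  have : σ (n i) = ∑ c, B i c • Y c := by
    ext x
    simp [Finsupp.finsetSum_apply, Y, hy]
  conv_lhs => rw [← hσ' (n i), this]
  simp

/-- Compatible systems of equations in one unknown are solvable in injective modules. -/
lemma injective_solve {R : Type u} [Ring R] {κ : Type*} [Fintype κ] (r : κ → R) {Q : Type u}
    [AddCommGroup Q] [Module R Q] (hQ : Module.Injective R Q) (x : κ → Q)
    (h : ∀ s : κ → R, ∑ j, s j * r j = 0 → ∑ j, s j • x j = 0) : ∃ y : Q, ∀ j, r j • y = x j := by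
  let F : (κ → R) →ₗ[R] R := Fintype.linearCombination R r
  let G : (κ → R) →ₗ[R] Q := Fintype.linearCombination R x
  have hFG : LinearMap.ker F ≤ LinearMap.ker G := fun s hs => by
    have := h s (by simpa [F, Fintype.linearCombination_apply] using hs)
    simpa [G, Fintype.linearCombination_apply] using this
  let g : LinearMap.range F →ₗ[R] Q :=
    ((LinearMap.ker F).liftQ G hFG) ∘ₗ F.quotKerEquivRange.symm.toLinearMap
  have hg : ∀ s, g ⟨F s, s, rfl⟩ = G s := fun s => by
    simp only [g, LinearMap.comp_apply, LinearEquiv.coe_coe]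
    have : F.quotKerEquivRange.symm ⟨F s, s, rfl⟩ = (LinearMap.ker F).mkQ s :=
      F.quotKerEquivRange_symm_apply_image s _
    rw [this]; simp
  obtain ⟨H, hH⟩ := hQ.out (LinearMap.range F).subtype Subtype.val_injective g
  refine ⟨H 1, fun j => ?_⟩
  have h1 := hH ⟨F (Pi.single j 1), _, rfl⟩
  rw [hg] at h1
  have h2 : F (Pi.single j 1) = r j := by simp [F]
  have h3 : G (Pi.single j 1) = x j := by simp [G]
  rw [← h3, ← h1, ← map_smul]
  simp [h2]

namespace TD

variable (D : TD k R t ℓ)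

lemma ring_form (i : Fin t) {j : ℕ} (hj : j < ℓ i) (x : R) (hx : D.e (vtx t ℓ i j) * x = x) :
    ∃ c : ℕ → k, x = ∑ a ∈ Finset.range (j + 1), c a • D.p i a j := by
  let L : (ℕ → k) →ₗ[k] R := ∑ a ∈ Finset.range (j + 1),
    LinearMap.toSpanSingleton k R (D.p i a j) ∘ₗ LinearMap.proj a
  have hL : ∀ c, L c = ∑ a ∈ Finset.range (j + 1), c a • D.p i a j := fun c => by
    simp [L, LinearMap.sum_apply]
  suffices h : D.e (vtx t ℓ i j) * x ∈ LinearMap.range L by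
    obtain ⟨c, hc⟩ := h
    exact ⟨c, by rw [← hL, hc, hx]⟩
  clear hx
  have hp : ∀ a ≤ j, D.p i a j ∈ LinearMap.range L := fun a ha => ⟨Pi.single a 1, by
    rw [hL, Finset.sum_eq_single a]
    · simp
    · intro b _ hb; simp [hb]
    · simp; omega⟩
  induction D.mem_span x using Submodule.span_induction with
  | zero => rw [mul_zero]; exact zero_mem _
  | add x y _ _ hx hy => rw [mul_add]; exact add_mem hx hy
  | smul c y _ hy => rw [mul_smul_comm]; exact Submodule.smul_mem _ _ hy
  | mem y hy =>
    rcases hy with ⟨v, rfl⟩ | ⟨i', a, b, hab, hb, rfl⟩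
    · rw [D.e_mul]
      split_ifs
      · rw [← D.p_self i j hj.le]; exact hp j le_rfl
      · exact zero_mem _
    · by_cases h : vtx t ℓ i j = vtx t ℓ i' b
      · obtain ⟨rfl, rfl⟩ := vtx_inj' hj hab h
        rw [D.e_p _ _ _ hab.le hb]
        exact hp a hab.le
      · rw [D.e_p_of_ne _ _ _ hab.le hb _ h]; exact zero_mem _

lemma sum_p_eq_zero (i : Fin t) {j b : ℕ} (hjb : j ≤ b) (hb : b ≤ ℓ i) {c : ℕ → k}
    (h : ∑ a ∈ Finset.range (j + 1), c a • D.p i a b = 0) {a : ℕ} (ha : a ≤ j)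
    (hp : D.p i a b ≠ 0) : c a = 0 := by
  have := congrArg (· * D.e (vtx t ℓ i a)) h
  simp only [Finset.sum_mul, zero_mul, smul_mul_assoc] at this
  rw [Finset.sum_eq_single a, D.p_e i a b (by omega) hb] at this
  · exact (smul_eq_zero.1 this).resolve_right hp
  · intro d hd hda
    simp at hd
    rw [D.p_e_of_ne i d b (by omega) hb _ fun h => hda (vtx_inj_same (by omega) (by omega) h),
      smul_zero]
  · simp; omega

lemma projective_arrow (i : Fin t) {a b : ℕ} (hab : a ≤ b) (ha : a < ℓ i) (hb : b ≤ ℓ i)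
    (hp : D.p i a b ≠ 0) {P : Type u} [AddCommGroup P] [Module R P] [Module.Projective R P] (x : P)
    (hx : D.e (vtx t ℓ i a) • x = x) (h : D.p i a b • x = 0) :
    ∃ y : P, x = (if a = 0 then 0 else D.p i (a - 1) a) • y := by
  obtain ⟨y, hy⟩ := projective_solve (ι := Unit) (κ := Unit) (J := Bool)
    (fun j _ => if j then D.p i a b else D.e (vtx t ℓ i a) - 1)
    (fun _ _ => if a = 0 then 0 else D.p i (a - 1) a) (fun n hn => by
      have h1 := hn true
      have h2 := hn false
      simp only [if_true, Finset.univ_unique, Finset.sum_singleton, sub_mul, one_mul,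
        sub_eq_zero, Bool.false_eq_true, if_false] at h1 h2
      obtain ⟨c, hc⟩ := D.ring_form i ha _ h2
      rw [hc, Finset.mul_sum, Finset.sum_congr rfl fun d hd => by
        rw [mul_smul_comm, D.p_comp i d a b (by simp at hd; omega) hab hb]] at h1
      have h3 := D.sum_p_eq_zero i hab hb h1 le_rfl hp
      rw [Finset.sum_range_succ, h3, zero_smul, add_zero] at hc
      refine ⟨fun _ => ∑ d ∈ Finset.range a, c d • D.p i d (a - 1), fun _ => ?_⟩
      rw [Subsingleton.elim default _] at hc
      rw [hc]
      simp only [Finset.univ_unique, Finset.sum_singleton]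
      split_ifs with h0
      · subst h0; simp
      · rw [Finset.mul_sum]
        refine Finset.sum_congr rfl fun d hd => ?_
        simp at hd
        rw [mul_smul_comm, D.p_comp i d (a - 1) a (by omega) (by omega) (by omega)])
    (fun _ => x) (fun j => by cases j <;> simp [h, sub_smul, hx])
  exact ⟨y (), by simpa using hy ()⟩

lemma projective_sink (hw : ∀ i, D.w i ≠ 0) {P : Type u} [AddCommGroup P] [Module R P]
    [Module.Projective R P] (n : Fin t → P) (hn : ∀ i, D.e (vtx t ℓ i (ℓ i - 1)) • n i = n i)
    (h : ∑ i, D.p i (ℓ i - 1) (ℓ i) • n i = 0) :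
    ∃ y : Fin t → P, ∀ i, n i = D.p i 0 (ℓ i - 1) • y i := by
  obtain ⟨y, hy⟩ := projective_solve (ι := Fin t) (κ := Fin t) (J := Option (Fin t))
    (fun j i => j.elim (D.p i (ℓ i - 1) (ℓ i))
      (fun j => if j = i then D.e (vtx t ℓ i (ℓ i - 1)) - 1 else 0))
    (fun i j => if j = i then D.p i 0 (ℓ i - 1) else 0) (fun n hn => by
      have h1 := hn none
      have h2 := fun i => hn (some i)
      simp only [Option.elim, ite_mul, zero_mul, Finset.sum_ite_eq, Finset.mem_univ,
        if_true, sub_mul, one_mul, sub_eq_zero] at h1 h2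
      choose c hc using fun i => D.ring_form i (by have := D.hℓ i; omega) _ (h2 i)
      have hc' : ∀ i d, 0 < d → d < ℓ i → c i d = 0 := by
        intro i d hd hdi
        have h3 := congrArg (· * D.e (vtx t ℓ i d)) h1
        simp only [Finset.sum_mul, zero_mul] at h3
        rw [Finset.sum_eq_single i, hc, Finset.mul_sum, Finset.sum_mul, Finset.sum_eq_single d,
          mul_smul_comm, D.p_comp i d _ _ (by omega) (by omega) le_rfl, smul_mul_assoc,
          D.p_e i d _ (by omega) le_rfl] at h3
        · refine (smul_eq_zero.1 h3).resolve_right fun h0 => hw i ?_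
          rw [w, ← D.p_comp i 0 d _ (by omega) (by omega) le_rfl, h0, zero_mul]
        · intro a ha had
          simp at ha
          rw [mul_smul_comm, smul_mul_assoc, D.p_comp i a _ _ (by omega) (by omega) le_rfl,
            D.p_e_of_ne i a _ (by omega) le_rfl _ fun h => had (vtx_inj_same (by omega) (by omega) h),
            smul_zero]
        · simp; omega
        · intro j _ hj
          rw [hc, Finset.mul_sum, Finset.sum_mul]
          refine Finset.sum_eq_zero fun a ha => ?_
          have := D.hℓ j
          simp at ha
          rw [mul_smul_comm, smul_mul_assoc, D.p_comp j a _ _ (by omega) (by omega) le_rfl,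
            D.p_e_of_ne j a _ (by omega) le_rfl _ fun h => hj (vtx_inj hd hdi h.symm).1.symm,
            smul_zero]
        · simp
      refine ⟨fun i => algebraMap k R (c i 0), fun i => ?_⟩
      simp only [ite_mul, zero_mul, Finset.sum_ite_eq', Finset.mem_univ, if_true]
      rw [hc, Finset.sum_eq_single 0]
      · rw [← Algebra.commutes, Algebra.smul_def]
      · intro d hd hd0
        simp at hd
        have := D.hℓ i
        rw [hc' i d (by omega) (by omega), zero_smul]
      · simp) n
    (fun j => by
      cases j with
      | none => simpa using h
      | some j => simp [ite_smul, sub_smul, hn])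
  exact ⟨y, fun i => by simpa [ite_smul] using hy i⟩

lemma sum_apply_eq_zero {V X : Type*} [AddCommGroup V] [Module k V] [AddCommGroup X] [Module k X]
    (g : Fin t → V →ₗ[k] X) (hg : ∀ r ∈ D.Rel, ∑ i, r i • g i = 0) (v : Fin t → V)
    (hv : ∀ θ ∈ D.Lam, ∑ i, θ i • v i = 0) : ∑ i, g i (v i) = 0 := by
  let b := Module.Basis.ofVectorSpace k V
  have h1 : ∀ β, (fun i => b.repr (v i) β) ∈ D.Rel := fun β => D.mem_Rel_of_Lam fun θ hθ => by
    have := congrArg (fun x => b.repr x β) (hv θ hθ)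
    simpa [mul_comm, Finsupp.finsetSum_apply] using this
  let S := Finset.univ.biUnion fun i => (b.repr (v i)).support
  have h2 : ∀ i, v i = ∑ β ∈ S, b.repr (v i) β • b β := fun i => by
    conv_lhs => rw [← b.linearCombination_repr (v i), Finsupp.linearCombination_apply]
    refine Finsupp.sum_of_support_subset _ (Finset.subset_biUnion_of_mem
      (fun i => (b.repr (v i)).support) (Finset.mem_univ i)) _ fun _ _ => zero_smul k _
  rw [Finset.sum_congr rfl fun i _ => by rw [h2 i, map_sum], Finset.sum_comm]
  refine Finset.sum_eq_zero fun β _ => ?_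
  have := LinearMap.congr_fun (hg _ (h1 β)) (b β)
  simpa [LinearMap.sum_apply] using this

lemma ring_form_right (i : Fin t) {j : ℕ} (h0 : 0 < j) (hj : j ≤ ℓ i) (x : R)
    (hx : x * D.e (vtx t ℓ i j) = x) :
    ∃ c : ℕ → k, x = ∑ b ∈ Finset.Icc j (ℓ i), c b • D.p i j b := by
  obtain ⟨c, hc⟩ := D.opp.ring_form i (j := ℓ i - j) (by omega) (op x) (by
    rw [opp_e, rev_vtx D.hℓ i (by omega), ← op_mul, Nat.sub_sub_self hj, hx])
  refine ⟨fun b => c (ℓ i - b), ?_⟩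
  have := congrArg unop hc
  rw [unop_op, Finset.unop_sum] at this
  rw [this]
  refine Finset.sum_nbij' (fun a => ℓ i - a) (fun b => ℓ i - b) ?_ ?_ ?_ ?_ ?_
  · intro a ha; simp at ha ⊢; omega
  · intro a ha; simp at ha ⊢; omega
  · intro a ha; simp at ha ⊢; omega
  · intro a ha; simp at ha ⊢; omega
  · intro a ha
    simp at ha
    have : ℓ i - (ℓ i - a) = a := by omega
    rw [unop_smul, opp_p, unop_op, Nat.sub_sub_self hj]
    simp only [this]

lemma sum_p_eq_zero_right (i : Fin t) {j a : ℕ} (haj : a ≤ j) {c : ℕ → k}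
    (h : ∑ b ∈ Finset.Icc j (ℓ i), c b • D.p i a b = 0) {b : ℕ} (hjb : j ≤ b) (hb : b ≤ ℓ i)
    (hp : D.p i a b ≠ 0) : c b = 0 := by
  have := congrArg (D.e (vtx t ℓ i b) * ·) h
  simp only [Finset.mul_sum, mul_zero, mul_smul_comm] at this
  rw [Finset.sum_eq_single b, D.e_p i a b (by omega) hb] at this
  · exact (smul_eq_zero.1 this).resolve_right hp
  · intro d hd hda
    simp at hd
    rw [D.e_p_of_ne i a d (by omega) (by omega) _ fun h => hda
      (vtx_inj_same (by omega) (by omega) h.symm), smul_zero]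
  · simp; omega

lemma p_ne_zero_of_w {i : Fin t} (hw : D.w i ≠ 0) {a b : ℕ} (hab : a ≤ b) (hb : b ≤ ℓ i) :
    D.p i a b ≠ 0 := fun h => hw (by
  rw [w, ← D.p_comp i 0 a (ℓ i) (by omega) (by omega) le_rfl, ← D.p_comp i a b _ hab hb le_rfl, h,
    mul_zero, zero_mul])

/-- An obstruction to projective dimension at most one coming from the source. -/
theorem pd_obstruction (hw : ∀ i, D.w i ≠ 0) {M : ModuleCat.{u} R} [Module k M]
    [IsScalarTower k R M] (h : PdLeOne R M) (v : Fin t → M) (hv : ∀ i, v i ∈ D.at' M .src)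
    (hΛ : ∀ θ ∈ D.Lam, ∑ i, θ i • v i = 0) (hp : ∀ i, D.p i 0 (ℓ i - 1) • v i = 0) (i : Fin t) :
    v i = 0 := by
  obtain ⟨P, f, hf, hP, hN⟩ := h
  let _ := kMod k R P
  obtain ⟨σ, hσ⟩ := (toK (k := k) f).exists_rightInverse_of_surjective (LinearMap.range_eq_top.2 hf)
  have hσ' : ∀ x, f (σ x) = x := fun x => LinearMap.congr_fun hσ x
  let s : M →ₗ[k] P := act P (D.e .src) ∘ₗ σ
  have hs : ∀ i, f (s (v i)) = v i := fun i => by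
    simp only [s, LinearMap.comp_apply, act_apply, map_smul, hσ']
    exact hv i
  have hl : ∀ i, ℓ i - 1 + 1 = ℓ i := fun i => Nat.sub_add_cancel (D.hℓ i)
  let n : Fin t → LinearMap.ker f := fun i => ⟨D.p i 0 (ℓ i - 1) • s (v i), by
    rw [LinearMap.mem_ker, map_smul, hs, hp]⟩
  obtain ⟨y, hy⟩ := D.projective_sink hw n (fun i => Subtype.ext
    (D.e_p_smul (by omega) (by omega) _)) (by
      apply Subtype.ext
      rw [Submodule.coe_zero, Submodule.coe_sum]
      refine Eq.trans (Finset.sum_congr rfl fun i _ => ?_) (D.sum_apply_eq_zero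
        (fun i => act P (D.w i) ∘ₗ s) (fun r hr => ?_) v hΛ)
      · exact D.p_p_smul (by omega) (by omega) le_rfl _
      · ext x
        simp only [LinearMap.sum_apply, LinearMap.smul_apply, LinearMap.comp_apply, act_apply]
        simp only [← smul_assoc, ← Finset.sum_smul, D.mem_Rel.1 hr, zero_smul, LinearMap.zero_apply])
  have hy' : D.p i 0 (ℓ i - 1) • s (v i) = D.p i 0 (ℓ i - 1) • (y i : P) :=
    congrArg Subtype.val (hy i)
  obtain ⟨z, hz⟩ := D.projective_arrow i (Nat.zero_le (ℓ i - 1)) (D.hℓ i) (by omega)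
    (D.p_ne_zero_of_w (hw i) (by omega) (by omega)) (s (v i) - D.e .src • (y i : P)) (by
      rw [vtx_zero, smul_sub, D.e_e_self]
      simp only [s, LinearMap.comp_apply, act_apply]
      rw [D.e_e_self]) (by
      rw [smul_sub, sub_eq_zero, ← vtx_zero i, D.p_e_smul (by omega) (by omega), hy'])
  rw [if_pos rfl, zero_smul, sub_eq_zero] at hz
  rw [← hs i, hz, map_smul, LinearMap.mem_ker.1 (y i).2, smul_zero]

/-- An obstruction to projective dimension at most one coming from a vanishing branch. -/
theorem pd_obstruction_zero (i : Fin t) {a : ℕ} (ha : a < ℓ i) (h0 : D.p i a (ℓ i) = 0)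
    (h1 : D.p i (a + 1) (ℓ i) ≠ 0) {M : ModuleCat.{u} R} (h : PdLeOne R M) (s : M)
    (hs : D.e (vtx t ℓ i a) • s = s) (hs' : D.p i a (a + 1) • s = 0) :
    ∃ m : M, s = (if a = 0 then 0 else D.p i (a - 1) a) • m := by
  obtain ⟨P, f, hf, hP, hN⟩ := h
  have ha' : a + 1 < ℓ i := by
    by_contra h
    exact D.arrow_ne i a ha ((by omega : a + 1 = ℓ i) ▸ h0)
  obtain ⟨x, hx⟩ := hf s
  let n : LinearMap.ker f := ⟨D.p i a (a + 1) • x, by rw [LinearMap.mem_ker, map_smul, hx, hs']⟩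
  obtain ⟨y, hy⟩ := D.projective_arrow i ha'.le ha' le_rfl h1 n
    (Subtype.ext (D.e_p_smul (by omega) (by omega) _)) (Subtype.ext (by
      change D.p i (a + 1) (ℓ i) • D.p i a (a + 1) • x = 0
      rw [D.p_p_smul (by omega) (by omega) le_rfl, h0, zero_smul]))
  rw [if_neg (by omega), Nat.add_sub_cancel] at hy
  have hy' : D.p i a (a + 1) • x = D.p i a (a + 1) • (y : P) := congrArg Subtype.val hy
  obtain ⟨z, hz⟩ := D.projective_arrow i (Nat.le_succ a) ha ha (D.arrow_ne i a ha)
    (D.e (vtx t ℓ i a) • (x - (y : P))) (D.e_e_self _ _) (by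
      rw [D.p_e_smul (by omega) (by omega), smul_sub, hy', sub_self])
  refine ⟨f z, ?_⟩
  rw [← map_smul, ← hz, map_smul, map_sub, hx, LinearMap.mem_ker.1 y.2, sub_zero, hs]

lemma smul_at_eq_zero (i : Fin t) {j : ℕ} (h0 : 0 < j) (hj : j ≤ ℓ i) {a : ℕ} (ha : a ≤ j)
    (hp : D.p i a j ≠ 0) (c : R) (hc : c * D.p i a j = 0) {Q : Type u} [AddCommGroup Q] [Module R Q]
    (x : Q) (hx : D.e (vtx t ℓ i j) • x = x) (hx' : j < ℓ i → D.p i j (j + 1) • x = 0) :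
    c • x = 0 := by
  obtain ⟨d, hd⟩ := D.ring_form_right i h0 hj (c * D.e (vtx t ℓ i j))
    (by rw [mul_assoc, D.e_idem])
  have h1 : ∑ b ∈ Finset.Icc j (ℓ i), d b • D.p i a b = 0 := by
    rw [← D.e_p i a j ha hj, ← mul_assoc, hd, Finset.sum_mul] at hc
    refine Eq.trans (Finset.sum_congr rfl fun b hb => ?_) hc
    simp at hb
    rw [smul_mul_assoc, D.p_comp i a j b ha hb.1 hb.2]
  have h2 := D.sum_p_eq_zero_right i ha h1 le_rfl hj hp
  rw [← hx, ← mul_smul, hd, Finset.sum_smul]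
  refine Finset.sum_eq_zero fun b hb => ?_
  simp at hb
  rcases hb.1.eq_or_lt with rfl | hlt
  · rw [h2, zero_smul, zero_smul]
  · rw [← D.p_comp i j (j + 1) b (by omega) (by omega) hb.2, ← smul_mul_assoc, mul_smul,
      hx' (by omega), smul_zero]

/-- An obstruction to injective dimension at most one coming from a vanishing branch. -/
theorem id_obstruction_zero (i : Fin t) {b : ℕ} (hb0 : 0 < b) (hb : b ≤ ℓ i) (h0 : D.p i 0 b = 0)
    (h1 : D.p i 0 (b - 1) ≠ 0) {M : ModuleCat.{u} R} (h : IdLeOne R M) (s : M)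
    (hs : D.e (vtx t ℓ i b) • s = s) (hs' : b < ℓ i → D.p i b (b + 1) • s = 0) :
    ∃ m : M, s = D.p i (b - 1) b • m := by
  obtain ⟨E, f, hf, hE, hQ⟩ := h
  obtain ⟨c, rfl⟩ : ∃ c, b = c + 1 := ⟨b - 1, by omega⟩
  rw [Nat.add_sub_cancel] at h1 ⊢
  have hc : 0 < c := Nat.pos_of_ne_zero fun h => by subst h; exact D.arrow_ne i 0 hb h0
  obtain ⟨y, hy⟩ := injective_solve (κ := Unit) (fun _ => D.p i c (c + 1)) hE (fun _ => f s)
    (fun r hr => by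
      simp only [Finset.univ_unique, Finset.sum_singleton] at hr ⊢
      refine D.smul_at_eq_zero i hb0 hb (Nat.le_succ c) (D.arrow_ne i c hb) _ hr _
        (D.map_at f hs) fun h => ?_
      rw [← map_smul, hs' h, map_zero])
  have hy := hy ()
  obtain ⟨z, hz⟩ := injective_solve (κ := Unit) (fun _ => D.p i 0 c) hQ
    (fun _ => (LinearMap.range f).mkQ (D.e (vtx t ℓ i c) • y)) (fun r hr => by
      simp only [Finset.univ_unique, Finset.sum_singleton] at hr ⊢
      refine D.smul_at_eq_zero i hc (by omega) (Nat.zero_le c) h1 _ hr _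
        (D.map_at _ (D.e_e_self _ _)) fun h => ?_
      rw [← map_smul, D.p_e_smul (by omega) hb, hy, Submodule.mkQ_apply,
        Submodule.Quotient.mk_eq_zero]
      exact ⟨s, rfl⟩)
  have hz := hz ()
  obtain ⟨Z, rfl⟩ := (LinearMap.range f).mkQ_surjective z
  rw [← map_smul, ← sub_eq_zero, ← map_sub, Submodule.mkQ_apply,
    Submodule.Quotient.mk_eq_zero] at hz
  obtain ⟨m, hm⟩ := hz
  refine ⟨-m, hf ?_⟩
  rw [map_smul, map_neg, hm, neg_sub, smul_sub, D.p_e_smul (by omega) hb, hy,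
    D.p_p_smul (by omega) (by omega) hb, h0, zero_smul, sub_zero]

/-- An obstruction to injective dimension at most one coming from the sink. -/
theorem id_obstruction (hw : ∀ i, D.w i ≠ 0) {M : ModuleCat.{u} R} [Module k M]
    [IsScalarTower k R M] (h : IdLeOne R M) (ξ : Fin t → M →ₗ[k] k)
    (hΛ : ∀ θ ∈ D.Lam, ∑ i, θ i • ξ i = 0) (hp : ∀ i m, ξ i (D.p i 1 (ℓ i) • m) = 0) (i : Fin t)
    (m : M) (hm : m ∈ D.at' M .snk) : ξ i m = 0 := by
  obtain ⟨E, f, hf, hE, hQ⟩ := h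
  let _ := kMod k R E
  obtain ⟨ρ, hρ⟩ := (toK (k := k) f).exists_leftInverse_of_injective (LinearMap.ker_eq_bot.2 hf)
  have hρ' : ∀ x, ρ (f x) = x := fun x => LinearMap.congr_fun hρ x
  have hm : D.e (vtx t ℓ i (ℓ i)) • m = m := by rw [D.vtx_ℓ]; exact hm
  obtain ⟨y, hy⟩ := injective_solve (κ := Unit) (fun _ => D.p i 1 (ℓ i)) hE (fun _ => f m)
    (fun r hr => by
      simp only [Finset.univ_unique, Finset.sum_singleton] at hr ⊢
      exact D.smul_at_eq_zero i (D.hℓ i) le_rfl (D.hℓ i) (D.p_ne_zero_of_w (hw i) (D.hℓ i) le_rfl)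
        _ hr _ (D.map_at f hm) fun h => absurd h (lt_irrefl _))
  have hy := hy ()
  let y' : E := D.e (vtx t ℓ i 1) • y
  have hy' : D.p i 1 (ℓ i) • y' = f m := by rw [D.p_e_smul (D.hℓ i) le_rfl, hy]
  obtain ⟨z, hz⟩ := injective_solve (fun j => D.p j 0 1) hQ
    (fun j => if j = i then (LinearMap.range f).mkQ y' else 0) (fun r hr => by
      simp only [smul_ite, smul_zero, Finset.sum_ite_eq', Finset.mem_univ, if_true]
      choose c hc using fun j => D.ring_form_right j Nat.one_pos (D.hℓ j)
        (r j * D.e (vtx t ℓ j 1)) (by rw [mul_assoc, D.e_idem])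
      have hr' : ∑ j, ∑ b ∈ Finset.Icc 1 (ℓ j), c j b • D.p j 0 b = 0 := by
        refine Eq.trans (Finset.sum_congr rfl fun j _ => ?_) hr
        rw [← D.e_p j 0 1 (by omega) (D.hℓ j), ← mul_assoc, hc, Finset.sum_mul]
        refine Finset.sum_congr rfl fun b hb => ?_
        simp at hb
        rw [smul_mul_assoc, D.p_comp j 0 1 b (by omega) hb.1 hb.2]
      have hcz : ∀ b, 1 ≤ b → b < ℓ i → c i b = 0 := fun b hb1 hb => by
        have := congrArg (D.e (vtx t ℓ i b) * ·) hr'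
        simp only [mul_zero, Finset.mul_sum, mul_smul_comm] at this
        rw [Finset.sum_eq_single i, Finset.sum_eq_single b, D.e_p i 0 b (by omega) hb.le] at this
        · exact (smul_eq_zero.1 this).resolve_right (D.p_ne_zero_of_w (hw i) (by omega) hb.le)
        · intro d hd hdb
          simp at hd
          rw [D.e_p_of_ne i 0 d (by omega) (by omega) _ fun h =>
            hdb (vtx_inj_same (by omega) (by omega) h.symm), smul_zero]
        · simp; omega
        · intro j _ hj
          refine Finset.sum_eq_zero fun d hd => ?_
          simp at hd
          rw [D.e_p_of_ne j 0 d (by omega) (by omega) _ fun h =>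
            hj (vtx_inj hb1 hb h).1.symm, smul_zero]
        · simp
      have : D.e (vtx t ℓ i 1) • y' = y' := D.e_e_self _ _
      rw [← this, map_smul, ← mul_smul, hc, Finset.sum_smul]
      refine Finset.sum_eq_zero fun b hb => ?_
      simp at hb
      rcases hb.2.eq_or_lt with rfl | hlt
      · rw [smul_assoc, ← map_smul, hy', Submodule.mkQ_apply,
          (Submodule.Quotient.mk_eq_zero _).2 (LinearMap.mem_range_self f m), smul_zero]
      · rw [hcz b hb.1 hlt, zero_smul, zero_smul])
  obtain ⟨Z, rfl⟩ := (LinearMap.range f).mkQ_surjective z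
  have hZ : ∀ j, ∃ n, D.p j 0 1 • Z = (if j = i then y' else 0) + f n := fun j => by
    have h1 := hz j
    have h2 : (LinearMap.range f).mkQ (D.p j 0 1 • Z - if j = i then y' else 0) = 0 := by
      rw [map_sub, map_smul, h1]
      split_ifs <;> simp
    rw [Submodule.mkQ_apply, Submodule.Quotient.mk_eq_zero] at h2
    obtain ⟨n, hn⟩ := h2
    exact ⟨n, by rw [hn]; abel⟩
  have hwZ : ∀ j, ξ j (ρ (D.w j • Z)) = if j = i then ξ i m else 0 := fun j => by
    obtain ⟨n, hn⟩ := hZ j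
    rw [w, ← D.p_p_smul (Nat.zero_le 1) (D.hℓ j) le_rfl, hn, smul_add, map_add, ← map_smul, hρ',
      map_add, hp, add_zero]
    split_ifs with h
    · subst h; rw [hy', hρ']
    · simp
  have := D.sum_apply_eq_zero (V := M →ₗ[k] k) (X := k)
    (fun j => LinearMap.applyₗ (ρ (D.w j • Z))) (fun r hr => by
      ext η
      simp only [LinearMap.zero_apply, ← map_smul, ← map_sum, ← smul_assoc, ← Finset.sum_smul,
        D.mem_Rel.1 hr, zero_smul, map_zero]) ξ hΛ
  simpa [hwZ] using this

end TD

lemma exists_compl_above {k V : Type*} [Field k] [AddCommGroup V] [Module k V]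
    {A K T : Submodule k V} (hA : A ≤ T) (hK : K ≤ T) (hd : Disjoint A K) :
    ∃ C, A ≤ C ∧ C ≤ T ∧ Disjoint K C ∧ K ⊔ C = T := by
  obtain ⟨C, hAC, hC⟩ := hd.exists_isCompl
  refine ⟨C ⊓ T, le_inf hAC hA, inf_le_right, hC.symm.disjoint.mono_right inf_le_left, ?_⟩
  rw [← sup_inf_assoc_of_le _ hK, hC.symm.sup_eq_top, top_inf_eq]

namespace TD

variable (D : TD k R t ℓ)

/-- A module homomorphism can be defined branchwise. -/
lemma exists_hom {M N : Type u} [AddCommGroup M] [Module R M] [Module k M] [IsScalarTower k R M]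
    [AddCommGroup N] [Module R N] [Module k N] [IsScalarTower k R N] (s z : M →ₗ[k] N)
    (G : Fin t → ℕ → M →ₗ[k] N) (hs : ∀ m ∈ D.at' M .src, s m ∈ D.at' N .src)
    (hz : ∀ m ∈ D.at' M .snk, z m ∈ D.at' N .snk)
    (h0 : ∀ i, ∀ m ∈ D.at' M .src, G i 0 m = s m)
    (hl : ∀ i, ∀ m ∈ D.at' M .snk, G i (ℓ i) m = z m)
    (hG : ∀ i a, 0 < a → a < ℓ i → ∀ m ∈ D.at' M (vtx t ℓ i a), G i a m ∈ D.at' N (vtx t ℓ i a))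
    (hp : ∀ i a, a < ℓ i → ∀ m ∈ D.at' M (vtx t ℓ i a),
      D.p i a (a + 1) • G i a m = G i (a + 1) (D.p i a (a + 1) • m)) :
    ∃ f : M →ₗ[R] N, (∀ m ∈ D.at' M .src, f m = s m) ∧ (∀ m ∈ D.at' M .snk, f m = z m) ∧
      ∀ i a, a ≤ ℓ i → ∀ m ∈ D.at' M (vtx t ℓ i a), f m = G i a m := by
  let g : Vtx t ℓ → M →ₗ[k] N := fam s z G
  have hg : ∀ i a, a ≤ ℓ i → ∀ m ∈ D.at' M (vtx t ℓ i a),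
      g (vtx t ℓ i a) m = G i a m ∧ G i a m ∈ D.at' N (vtx t ℓ i a) := by
    intro i a ha m hm
    have h1 := fam_vtx (ℓ := ℓ) s z G i a
    by_cases ha0 : a = 0
    · subst ha0
      rw [vtx_zero] at hm ⊢
      exact ⟨(h0 i m hm).symm, h0 i m hm ▸ hs m hm⟩
    · by_cases hal : a < ℓ i
      · rw [if_neg ha0, if_pos hal] at h1
        exact ⟨by rw [← h1], hG i a (by omega) hal m hm⟩
      · obtain rfl : a = ℓ i := by omega
        rw [D.vtx_ℓ] at hm ⊢
        exact ⟨(hl i m hm).symm, hl i m hm ▸ hz m hm⟩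
  let f := D.mkHom g (fun i a ha m hm => by
    obtain ⟨h1, -⟩ := hg i a ha.le m hm
    obtain ⟨h2, h3⟩ := hg i (a + 1) ha _ (D.p_mem (Nat.le_succ a) ha m)
    rw [h1, h2, D.mem_at.1 h3, hp i a ha m hm])
  refine ⟨f, fun m hm => ?_, fun m hm => ?_, fun i a ha m hm => ?_⟩
  · rw [D.mkHom_at g _ _ m hm]; exact hs m hm
  · rw [D.mkHom_at g _ _ m hm]; exact hz m hm
  · rw [D.mkHom_at g _ _ m hm, (hg i a ha m hm).1]; exact (hg i a ha m hm).2

section Split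

variable {M : ModuleCat.{u} R} [Module k M] [IsScalarTower k R M]

/-- Subspaces with injective induced arrows on the quotient split off. -/
lemma indec_of_reflect (hM : Indec R M) (K : Vtx t ℓ → Submodule k M)
    (hle : ∀ v, K v ≤ D.at' M v)
    (hK : ∀ i a, a < ℓ i → ∀ m ∈ K (vtx t ℓ i a), D.p i a (a + 1) • m ∈ K (vtx t ℓ i (a + 1)))
    (href : ∀ i a, a < ℓ i → ∀ m ∈ D.at' M (vtx t ℓ i a),
      D.p i a (a + 1) • m ∈ K (vtx t ℓ i (a + 1)) → m ∈ K (vtx t ℓ i a))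
    (hsnk : K .snk = ⊥) : (∀ v, K v = ⊥) ∨ ∀ v, K v = D.at' M v := by
  obtain ⟨C₀, -, h1, h2, h3⟩ := exists_compl_above (bot_le : ⊥ ≤ D.at' M .src) (hle .src)
    disjoint_bot_left
  have key : ∀ i, ∃ f : ℕ → Submodule k M, f 0 = C₀ ∧ (∀ n, n ≤ ℓ i →
      f n ≤ D.at' M (vtx t ℓ i n) ∧ Disjoint (K (vtx t ℓ i n)) (f n) ∧
        K (vtx t ℓ i n) ⊔ f n = D.at' M (vtx t ℓ i n)) ∧
      ∀ n, n < ℓ i → (f n).map (act M (D.p i n (n + 1))) ≤ f (n + 1) := fun i => by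
    refine exists_seq (fun n x => n ≤ ℓ i → x ≤ D.at' M (vtx t ℓ i n) ∧
      Disjoint (K (vtx t ℓ i n)) x ∧ K (vtx t ℓ i n) ⊔ x = D.at' M (vtx t ℓ i n))
      (fun n x y => n < ℓ i → x.map (act M (D.p i n (n + 1))) ≤ y) C₀
      (fun _ => by rw [vtx_zero]; exact ⟨h1, h2, h3⟩) fun n x hx => ?_
    by_cases hn : n < ℓ i
    · obtain ⟨hx1, hx2, -⟩ := hx hn.le
      obtain ⟨C, hC1, hC2, hC3, hC4⟩ := exists_compl_above
        (A := x.map (act M (D.p i n (n + 1)))) (K := K (vtx t ℓ i (n + 1)))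
        (T := D.at' M (vtx t ℓ i (n + 1)))
        (by rintro _ ⟨m, -, rfl⟩; exact D.p_mem (by omega) hn m) (hle _) (by
          rw [Submodule.disjoint_def]
          rintro _ ⟨m, hm, rfl⟩ hm'
          rw [Submodule.disjoint_def.1 hx2 m (href i n hn m (hx1 hm) hm') hm, map_zero])
      exact ⟨C, fun _ => ⟨hC2, hC3, hC4⟩, fun _ => hC1⟩
    · exact ⟨⊥, fun h => absurd h (by omega), fun h => absurd h hn⟩
  choose f hf0 hf hf' using key
  let Q : Vtx t ℓ → Submodule k M := fam C₀ (D.at' M .snk) f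
  have hQ : ∀ i a, a < ℓ i → Q (vtx t ℓ i a) = f i a := fun i a ha => by
    refine (fam_vtx _ _ f i a).trans ?_
    split_ifs with h
    · rw [h, hf0]
    · rfl
  have hall : ∀ v, Disjoint (K v) (Q v) ∧ K v ⊔ Q v = D.at' M v := by
    refine vtx_forall ⟨h2, h3⟩ ?_ fun i a h0 ha => ?_
    · rw [hsnk]; exact ⟨disjoint_bot_left, bot_sup_eq _⟩
    · rw [hQ i a ha]; exact (hf i a ha.le).2
  rcases D.indec_split hM K Q hK (fun i a ha m hm => by
      rw [hQ i a ha] at hm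
      by_cases ha' : a + 1 < ℓ i
      · rw [hQ i _ ha']; exact hf' i a ha ⟨m, hm, rfl⟩
      · have : vtx t ℓ i (a + 1) = .snk := vtx_snk i _ (by omega) (by omega)
        have h := D.p_mem (M := M) (Nat.le_succ a) ha m
        rw [Nat.succ_eq_add_one, this] at h
        rw [this]; exact h) (fun v => (hall v).1) (fun v => (hall v).2) with h | h
  · exact .inl h
  · exact .inr fun v => by rw [← (hall v).2, h, sup_bot_eq]

/-- Subspaces containing the source on which the arrows are surjective split off. -/
lemma indec_of_surj (hM : Indec R M) (P : Vtx t ℓ → Submodule k M)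
    (hle : ∀ v, P v ≤ D.at' M v)
    (hP : ∀ i a, a < ℓ i → ∀ m ∈ P (vtx t ℓ i a), D.p i a (a + 1) • m ∈ P (vtx t ℓ i (a + 1)))
    (hsurj : ∀ i a, 0 < a → a < ℓ i → ∀ m ∈ P (vtx t ℓ i (a + 1)), ∃ n ∈ P (vtx t ℓ i a),
      D.p i a (a + 1) • n = m)
    (hsrc : P .src = D.at' M .src) : (∀ v, P v = ⊥) ∨ ∀ v, P v = D.at' M v := by
  obtain ⟨C₀, -, h1, h2, h3⟩ := exists_compl_above (bot_le : ⊥ ≤ D.at' M .snk) (hle .snk)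
    disjoint_bot_left
  have key : ∀ i, ∃ f : ℕ → Submodule k M, f 0 = C₀ ∧ (∀ n, n < ℓ i →
      f n ≤ D.at' M (vtx t ℓ i (ℓ i - n)) ∧ Disjoint (P (vtx t ℓ i (ℓ i - n))) (f n) ∧
        P (vtx t ℓ i (ℓ i - n)) ⊔ f n = D.at' M (vtx t ℓ i (ℓ i - n))) ∧
      ∀ n, n + 1 < ℓ i → f (n + 1) ≤ (f n).comap (act M (D.p i (ℓ i - (n + 1)) (ℓ i - n))) :=
      fun i => by
    refine exists_seq (fun n x => n < ℓ i → x ≤ D.at' M (vtx t ℓ i (ℓ i - n)) ∧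
      Disjoint (P (vtx t ℓ i (ℓ i - n))) x ∧
      P (vtx t ℓ i (ℓ i - n)) ⊔ x = D.at' M (vtx t ℓ i (ℓ i - n)))
      (fun n x y => n + 1 < ℓ i → y ≤ x.comap (act M (D.p i (ℓ i - (n + 1)) (ℓ i - n)))) C₀
      (fun _ => by rw [Nat.sub_zero, D.vtx_ℓ]; exact ⟨h1, h2, h3⟩) fun n x hx => ?_
    by_cases hn : n + 1 < ℓ i
    · obtain ⟨-, -, hx3⟩ := hx (by omega)
      obtain ⟨a, ha⟩ : ∃ a, ℓ i - (n + 1) = a := ⟨_, rfl⟩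
      have ha' : ℓ i - n = a + 1 := by omega
      rw [ha'] at hx3
      rw [ha', ha]
      have hal : a < ℓ i := by omega
      have ha0 : 0 < a := by omega
      let T := x.comap (act M (D.p i a (a + 1))) ⊓ D.at' M (vtx t ℓ i a)
      obtain ⟨C, -, hC2, hC3, hC4⟩ := exists_compl_above (bot_le : ⊥ ≤ T)
        (inf_le_right : P (vtx t ℓ i a) ⊓ T ≤ T) disjoint_bot_left
      refine ⟨C, fun _ => ⟨hC2.trans inf_le_right, ?_, le_antisymm
        (sup_le (hle _) (hC2.trans inf_le_right)) fun m hm => ?_⟩,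
        fun _ => hC2.trans inf_le_left⟩
      · rw [Submodule.disjoint_def] at hC3 ⊢
        exact fun m hm hm' => hC3 m ⟨hm, hC2 hm'⟩ hm'
      · have h4 := D.p_mem (M := M) (Nat.le_succ a) hal m
        rw [Nat.succ_eq_add_one, ← hx3] at h4
        obtain ⟨q, hq, r, hr, hqr⟩ := Submodule.mem_sup.1 h4
        obtain ⟨q', hq', rfl⟩ := hsurj i a ha0 hal q hq
        have h5 : m - q' ∈ T := ⟨by
          change D.p i a (a + 1) • (m - q') ∈ x
          rw [smul_sub, ← hqr, add_sub_cancel_left]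
          exact hr, sub_mem hm (hle _ hq')⟩
        rw [← hC4] at h5
        rw [← sub_add_cancel m q', add_comm]
        have : P (vtx t ℓ i a) ⊓ T ⊔ C ≤ P (vtx t ℓ i a) ⊔ C := sup_le_sup_right inf_le_left _
        exact add_mem (Submodule.mem_sup_left hq') (this h5)
    · exact ⟨⊥, fun h => absurd h (by omega), fun h => absurd h hn⟩
  choose f hf0 hf hf' using key
  let Q : Vtx t ℓ → Submodule k M := fam ⊥ C₀ fun i j => f i (ℓ i - j)
  have hQ : ∀ i a, 0 < a → a ≤ ℓ i → Q (vtx t ℓ i a) = f i (ℓ i - a) := fun i a h0 ha => by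
    refine (fam_vtx _ _ _ i a).trans ?_
    rw [if_neg (by omega)]
    split_ifs with h
    · rfl
    · rw [show ℓ i - a = 0 by omega, hf0]
  have hall : ∀ v, Disjoint (P v) (Q v) ∧ P v ⊔ Q v = D.at' M v := by
    refine vtx_forall ?_ ⟨h2, h3⟩ fun i a h0 ha => ?_
    · rw [hsrc]; exact ⟨disjoint_bot_right, sup_bot_eq _⟩
    · rw [hQ i a h0 ha.le]
      have := hf i (ℓ i - a) (by omega)
      rw [Nat.sub_sub_self ha.le] at this
      exact this.2
  rcases D.indec_split hM P Q hP (fun i a ha m hm => by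
      rcases Nat.eq_zero_or_pos a with rfl | h0
      · rw [vtx_zero] at hm
        rw [(Submodule.mem_bot k).1 hm, smul_zero]
        exact zero_mem _
      · rw [hQ i a h0 ha.le] at hm
        rw [hQ i (a + 1) (by omega) ha]
        have := hf' i (ℓ i - (a + 1)) (by omega)
        rw [show ℓ i - (a + 1) + 1 = ℓ i - a by omega, Nat.sub_sub_self ha.le,
          Nat.sub_sub_self (by omega)] at this
        exact this hm) (fun v => (hall v).1) (fun v => (hall v).2) with h | h
  · exact .inl h
  · exact .inr fun v => by rw [← (hall v).2, h, sup_bot_eq]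

end Split

section Classes

variable (M : ModuleCat.{u} R)

/-- Modules whose arrows are injective. -/
abbrev MonoArrows : Prop :=
  ∀ i a, a < ℓ i → ∀ m : M, D.e (vtx t ℓ i a) • m = m → D.p i a (a + 1) • m = 0 → m = 0

/-- Modules vanishing at the source whose arrows are injective. -/
def MonoRep : Prop := (∀ m : M, D.e .src • m = m → m = 0) ∧ D.MonoArrows M

/-- Modules vanishing at the sink which are generated at the source. -/
def EpiRep : Prop := (∀ m : M, D.e .snk • m = m → m = 0) ∧
  ∀ i a, a < ℓ i → ∀ m : M, D.e (vtx t ℓ i a) • m = m → ∃ n : M, D.p i 0 a • n = m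

/-- Modules vanishing at the source and at the sink. -/
def MidRep : Prop := (∀ m : M, D.e .src • m = m → m = 0) ∧ ∀ m : M, D.e .snk • m = m → m = 0

variable {M}

lemma indec_trichotomy (hM : Indec R M) (hw : ∀ i (m : M), D.p i 0 (ℓ i) • m = 0) :
    D.MonoRep M ∨ D.EpiRep M ∨ D.MidRep M := by
  let _ := kMod k R M
  have hbot : ∀ P : Submodule k M, P = ⊥ → ∀ m ∈ P, m = 0 := fun P h m hm => by
    rw [h] at hm; exact (Submodule.mem_bot k).1 hm
  let K : Vtx t ℓ → Submodule k M := fam (D.at' M .src) ⊥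
    fun i a => LinearMap.ker (act M (D.p i a (ℓ i))) ⊓ D.at' M (vtx t ℓ i a)
  have hK : ∀ i a, a < ℓ i → ∀ m, m ∈ K (vtx t ℓ i a) ↔
      D.p i a (ℓ i) • m = 0 ∧ m ∈ D.at' M (vtx t ℓ i a) := fun i a ha m => by
    have : K (vtx t ℓ i a) = _ := fam_vtx _ _ _ i a
    rw [this]
    split_ifs with h0
    · subst h0
      rw [vtx_zero]
      exact ⟨fun h => ⟨hw i m, h⟩, fun h => h.2⟩
    · rfl
  rcases D.indec_of_reflect hM K (vtx_forall le_rfl bot_le fun i a h0 ha m hm =>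
      ((hK i a ha m).1 hm).2) (fun i a ha m hm => by
        obtain ⟨h1, h2⟩ := (hK i a ha m).1 hm
        by_cases ha' : a + 1 < ℓ i
        · rw [hK i _ ha', D.p_p_smul (by omega) (by omega) le_rfl]
          exact ⟨h1, D.p_mem (by omega) ha m⟩
        · obtain ha' : a + 1 = ℓ i := by omega
          rw [ha', h1]; exact zero_mem _) (fun i a ha m hm hm' => by
        rw [hK i a ha]
        refine ⟨?_, hm⟩
        rw [← D.p_p_smul (Nat.le_succ a) ha le_rfl]
        by_cases ha' : a + 1 < ℓ i
        · exact ((hK i _ ha' _).1 hm').1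
        · obtain ha' : a + 1 = ℓ i := by omega
          rw [ha', D.vtx_ℓ] at hm'
          rw [Nat.succ_eq_add_one, ha', (Submodule.mem_bot k).1 hm', smul_zero]) rfl with h | h
  · refine .inl ⟨hbot _ (h .src), fun i a ha m hm hm' => hbot _ (h _) m ((hK i a ha m).2 ⟨?_, hm⟩)⟩
    rw [← D.p_p_smul (Nat.le_succ a) ha le_rfl, hm', smul_zero]
  have hz : ∀ m : M, D.e .snk • m = m → m = 0 := hbot (D.at' M .snk) (h .snk).symm
  let P : Vtx t ℓ → Submodule k M := fam (D.at' M .src) ⊥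
    fun i a => LinearMap.range (act M (D.p i 0 a))
  have hP : ∀ i a, a < ℓ i → ∀ m, m ∈ P (vtx t ℓ i a) ↔ ∃ n : M, D.p i 0 a • n = m :=
      fun i a ha m => by
    have : P (vtx t ℓ i a) = _ := fam_vtx _ _ _ i a
    rw [this]
    split_ifs with h0
    · subst h0
      rw [← vtx_zero i, D.p_self i 0 (by omega)]
      exact ⟨fun h => ⟨m, h⟩, fun ⟨n, hn⟩ => hn ▸ D.e_mem _ n⟩
    · rfl
  have hPl : ∀ i, P (vtx t ℓ i (ℓ i)) = ⊥ := fun i => by rw [D.vtx_ℓ]; rfl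
  rcases D.indec_of_surj hM P (vtx_forall le_rfl bot_le fun i a h0 ha m hm => by
      obtain ⟨n, rfl⟩ := (hP i a ha m).1 hm
      exact D.p_mem (by omega) ha.le n) (fun i a ha m hm => by
        obtain ⟨n, rfl⟩ := (hP i a ha m).1 hm
        rw [D.p_p_smul (Nat.zero_le a) (Nat.le_succ a) ha, Nat.succ_eq_add_one]
        by_cases ha' : a + 1 < ℓ i
        · exact (hP i _ ha' _).2 ⟨n, rfl⟩
        · obtain ha' : a + 1 = ℓ i := by omega
          rw [ha', hw]; exact zero_mem _) (fun i a _ ha m hm => by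
        by_cases ha' : a + 1 < ℓ i
        · obtain ⟨n, rfl⟩ := (hP i _ ha' m).1 hm
          exact ⟨D.p i 0 a • n, (hP i a ha _).2 ⟨n, rfl⟩, D.p_p_smul (by omega) (by omega) ha n⟩
        · obtain ha' : a + 1 = ℓ i := by omega
          rw [ha', hPl] at hm
          exact ⟨0, zero_mem _, by rw [smul_zero, (Submodule.mem_bot k).1 hm]⟩) rfl with h' | h'
  · exact .inr (.inr ⟨hbot _ (h' .src), hz⟩)
  · exact .inr (.inl ⟨hz, fun i a ha m hm => (hP i a ha m).1 (h' (vtx t ℓ i a) ▸ hm)⟩)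

end Classes

end TD

/-- An algebra is laura if the indecomposables outside the left and right parts are distributed
over finitely many types, each of which contains at most one module up to isomorphism. -/
lemma laura_of_types {R : Type u} [Ring R] {τ : Type*} (s : Set τ) (hs : s.Finite)
    (P : τ → ModuleCat.{u} R → Prop)
    (hiso : ∀ x M N, P x M → P x N → Nonempty (M ≃ₗ[R] N))
    (hcov : ∀ M, Indec R M → FdMod R M → InLeftPart R M ∨ InRightPart R M ∨ ∃ x ∈ s, P x M) :
    Laura R := by
  let F : τ → ModuleCat.{u} R := fun x => if h : ∃ M, P x M then h.choose else ModuleCat.of R PUnit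
  refine ⟨F '' s, hs.image F, fun M hi hf hL hR => ?_⟩
  rcases hcov M hi hf with h | h | ⟨x, hx, h⟩
  · exact absurd h hL
  · exact absurd h hR
  · refine ⟨F x, ⟨x, hx, rfl⟩, hiso x M _ h ?_⟩
    have h' : ∃ M, P x M := ⟨M, h⟩
    simp only [F, dif_pos h']
    exact h'.choose_spec

namespace TD

variable (D : TD k R t ℓ)

section Interval

/-- Modules supported on the interval from `a` to `b` of branch `i`, with one-dimensional spaces. -/
def IsInt (i : Fin t) (a b : ℕ) (M : ModuleCat.{u} R) : Prop :=
  0 < a ∧ a ≤ b ∧ b < ℓ i ∧ ∃ x : M, D.e (vtx t ℓ i a) • x = x ∧ D.p i a b • x ≠ 0 ∧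
    D.p i a (b + 1) • x = 0 ∧ ∀ m : M, ∃ r : R, m = r • x

lemma smul_interior {M : Type u} [AddCommGroup M] [Module R M] [Module k M] [IsScalarTower k R M]
    {i : Fin t} {a : ℕ} (h0 : 0 < a) (ha : a < ℓ i) {x : M} (hx : D.e (vtx t ℓ i a) • x = x)
    (r : R) : ∃ c : ℕ → k, r • x = ∑ j ∈ Finset.Icc a (ℓ i), c j • D.p i a j • x := by
  have hone : ∀ j, a ≤ j → j ≤ ℓ i → ∃ c : ℕ → k, D.p i a j • x =
      ∑ j ∈ Finset.Icc a (ℓ i), c j • D.p i a j • x := fun j h1 h2 => by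
    refine ⟨Pi.single j 1, ?_⟩
    rw [Finset.sum_eq_single j]
    · simp
    · intro b _ hb; simp [hb]
    · intro h; exact absurd (Finset.mem_Icc.2 ⟨h1, h2⟩) h
  induction D.mem_span r using Submodule.span_induction with
  | zero => exact ⟨0, by simp⟩
  | add r s _ _ hr hs =>
    obtain ⟨c, hc⟩ := hr
    obtain ⟨d, hd⟩ := hs
    exact ⟨c + d, by simp [add_smul, hc, hd, Finset.sum_add_distrib]⟩
  | smul c r _ hr =>
    obtain ⟨d, hd⟩ := hr
    exact ⟨c • d, by simp [hd, Finset.smul_sum, mul_smul]⟩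
  | mem r hr =>
    rcases hr with ⟨v, rfl⟩ | ⟨i', a', b, hab, hb, rfl⟩
    · by_cases hv : v = vtx t ℓ i a
      · subst hv
        obtain ⟨c, hc⟩ := hone a le_rfl ha.le
        exact ⟨c, by rw [← hc, D.p_self i a ha.le]⟩
      · exact ⟨0, by rw [← hx, D.e_e, if_neg hv]; simp⟩
    · by_cases hv : vtx t ℓ i' a' = vtx t ℓ i a
      · obtain ⟨rfl, rfl⟩ := vtx_inj h0 ha hv.symm
        exact hone b hab.le hb
      · exact ⟨0, by rw [D.p_smul_of_ne hab.le hb hv hx]; simp⟩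

variable {M N : ModuleCat.{u} R}

lemma exists_hom_mid {i : Fin t} {a b : ℕ} (h0 : 0 < a) (hab : a ≤ b)
    (hb : b < ℓ i) {x : M} (hx : D.e (vtx t ℓ i a) • x = x) (hx' : D.p i a b • x ≠ 0)
    (hlow : ∀ m : M, D.e (vtx t ℓ i (a - 1)) • m = m → m = 0) {y : N}
    (hy : D.e (vtx t ℓ i a) • y = y) (hy' : D.p i a (b + 1) • y = 0) :
    ∃ f : M →ₗ[R] N, f x = y ∧ ∀ m, ∃ r : R, f m = r • y := by
  let _ := kMod k R M
  let _ := kMod k R N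
  obtain ⟨ζ, hζ⟩ := Module.Projective.exists_dual_eq_one k hx'
  let G : Fin t → ℕ → M →ₗ[k] N := fun i' j => if i' = i ∧ a ≤ j ∧ j ≤ b then
    (ζ ∘ₗ act M (D.p i j b)).smulRight (D.p i a j • y) else 0
  have hG1 : ∀ j, a ≤ j → j ≤ b → ∀ m, G i j m = ζ (D.p i j b • m) • D.p i a j • y :=
    fun j h1 h2 m => by simp [G, h1, h2]
  have hG0 : ∀ i' j, ¬ (i' = i ∧ a ≤ j ∧ j ≤ b) → ∀ m, G i' j m = 0 :=
    fun i' j h m => by simp only [G]; rw [if_neg h]; rfl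
  obtain ⟨f, hf0, hfz, hf⟩ := D.exists_hom (M := M) (N := N) 0 0 G (fun m _ => zero_mem _)
    (fun m _ => zero_mem _) (fun i' m _ => hG0 _ _ (by omega) m)
    (fun i' m _ => hG0 _ _ (by rintro ⟨rfl, h⟩; omega) m) (fun i' j h1 h2 m _ => by
      by_cases h : i' = i ∧ a ≤ j ∧ j ≤ b
      · obtain ⟨rfl, h3, h4⟩ := h
        rw [hG1 j h3 h4]
        exact Submodule.smul_mem _ _ (D.p_mem h3 h2.le y)
      · rw [hG0 _ _ h]; exact zero_mem _) (fun i' j hj m hm => by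
      by_cases h : i' = i
      · subst h
        by_cases h1 : a ≤ j
        · by_cases h2 : j ≤ b
          · rw [hG1 j h1 h2, smul_comm, D.p_p_smul h1 (Nat.le_succ j) hj]
            by_cases h3 : j + 1 ≤ b
            · rw [hG1 _ (by omega) h3, D.p_p_smul (Nat.le_succ j) h3 hb.le]
            · obtain rfl : j = b := by omega
              rw [Nat.succ_eq_add_one, hy', smul_zero, hG0 _ _ (by omega)]
          · rw [hG0 _ _ (by omega), hG0 _ _ (by omega), smul_zero]
        · rw [hG0 _ _ (by omega), smul_zero]
          by_cases h2 : a ≤ j + 1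
          · have : m = 0 := hlow m (by rw [show a - 1 = j by omega]; exact hm)
            rw [this, smul_zero, map_zero]
          · rw [hG0 _ _ (by omega)]
      · rw [hG0 _ _ (by tauto), hG0 _ _ (by tauto), smul_zero])
  refine ⟨f, ?_, fun m => ?_⟩
  · rw [hf i a (by omega) x hx, hG1 a le_rfl hab, hζ, one_smul, D.p_self_smul (by omega), hy]
  · have key : ∀ v, ∃ r : R, f (D.e v • m) = r • y := by
      refine vtx_forall ⟨0, ?_⟩ ⟨0, ?_⟩ fun i' j _ hj => ?_
      · rw [hf0 _ (D.e_mem _ m)]; simp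
      · rw [hfz _ (D.e_mem _ m)]; simp
      · rw [hf i' j hj.le _ (D.e_mem _ m)]
        by_cases h : i' = i ∧ a ≤ j ∧ j ≤ b
        · obtain ⟨rfl, h3, h4⟩ := h
          exact ⟨_, (hG1 j h3 h4 _).trans (smul_assoc _ _ _).symm⟩
        · exact ⟨0, by rw [hG0 _ _ h, zero_smul]⟩
    choose r hr using key
    refine ⟨∑ v, r v, ?_⟩
    conv_lhs => rw [← D.sum_e m]
    rw [map_sum, Finset.sum_smul]
    exact Finset.sum_congr rfl fun v _ => hr v

/-- An endomorphism fixing a nonzero element which generates its image is the identity of an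
indecomposable module. -/
lemma generates_of_endo {R : Type u} [Ring R] {M : ModuleCat.{u} R} (hM : Indec R M) {x : M}
    (hx : x ≠ 0) (f : M →ₗ[R] M) (hfx : f x = x) (hf : ∀ m, ∃ r : R, f m = r • x) (m : M) :
    ∃ r : R, m = r • x := by
  rcases hM.2 f (by
    ext m
    obtain ⟨r, hr⟩ := hf m
    rw [LinearMap.comp_apply, hr, map_smul, hfx]) with h | h
  · exact absurd (by rw [← hfx, h]; rfl) hx
  · obtain ⟨r, hr⟩ := hf m
    exact ⟨r, by rw [← hr, h]; rfl⟩

lemma MidRep.isInt (hM : D.MidRep M) (hi : Indec R M) : ∃ i a b, D.IsInt i a b M := by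
  have hv : ∃ v, ∃ m : M, D.e v • m = m ∧ m ≠ 0 := by
    have := hi.1
    obtain ⟨m, hm⟩ := exists_ne (0 : M)
    by_contra! h
    refine hm (D.ext_e fun v => ?_)
    rw [smul_zero, h v _ (D.e_e_self v m)]
  have hia : ∃ (a : ℕ) (i : Fin t), 0 < a ∧ a < ℓ i ∧ ∃ m : M, D.e (vtx t ℓ i a) • m = m ∧ m ≠ 0 := by
    obtain ⟨v, hv⟩ := hv
    revert hv
    revert v
    refine vtx_forall (fun ⟨m, h1, h2⟩ => absurd (hM.1 m h1) h2)
      (fun ⟨m, h1, h2⟩ => absurd (hM.2 m h1) h2) fun i a h0 ha h => ⟨a, i, h0, ha, h⟩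
  obtain ⟨i, h0, ha, y, hy, hy'⟩ := Nat.find_spec hia
  have hmin := fun j => Nat.find_min hia (m := j)
  obtain ⟨a, haa⟩ : ∃ a, Nat.find hia = a := ⟨_, rfl⟩
  rw [haa] at h0 ha hy hmin
  have hb : ∃ b, a ≤ b ∧ b < ℓ i ∧ ∃ x : M, D.e (vtx t ℓ i a) • x = x ∧ x ≠ 0 ∧
      D.p i a (b + 1) • x = 0 := by
    refine ⟨ℓ i - 1, by omega, by omega, y, hy, hy', hM.2 _ ?_⟩
    rw [← D.vtx_ℓ i, show ℓ i - 1 + 1 = ℓ i by omega]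
    exact D.e_p_smul ha.le le_rfl y
  obtain ⟨hab, hbl, x, hx, hx0, hxb⟩ := Nat.find_spec hb
  have hminb := fun j => Nat.find_min hb (m := j)
  obtain ⟨b, hbb⟩ : ∃ b, Nat.find hb = b := ⟨_, rfl⟩
  rw [hbb] at hab hbl hxb hminb
  have hxab : D.p i a b • x ≠ 0 := fun h => by
    rcases hab.eq_or_lt with rfl | h'
    · rw [D.p_self_smul ha.le, hx] at h; exact hx0 h
    · exact hminb (b - 1) (by omega) ⟨by omega, by omega, x, hx, hx0, by
        rwa [show b - 1 + 1 = b by omega]⟩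
  have hlow : ∀ m : M, D.e (vtx t ℓ i (a - 1)) • m = m → m = 0 := fun m hm => by
    by_cases h : a - 1 = 0
    · rw [h, vtx_zero] at hm; exact hM.1 m hm
    · by_contra hm0
      exact hmin (a - 1) (by omega) ⟨i, by omega, by omega, m, hm, hm0⟩
  obtain ⟨f, hf1, hf2⟩ := D.exists_hom_mid h0 hab hbl hx hxab hlow hx hxb
  exact ⟨i, a, b, h0, hab, hbl, x, hx, hxab, hxb, generates_of_endo hi hx0 f hf1 hf2⟩

variable {D}

lemma IsInt.eq_smul [Module k M] [IsScalarTower k R M] {i : Fin t} {a b : ℕ} (h0 : 0 < a) (hab : a ≤ b) (hb : b < ℓ i) {x : M}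
    (hx : D.e (vtx t ℓ i a) • x = x) (hxb : D.p i a (b + 1) • x = 0) (hg : ∀ m : M, ∃ r : R, m = r • x)
    {v} {m : M} (hm : D.e v • m = m) (hm0 : m ≠ 0) :
    ∃ j, a ≤ j ∧ j ≤ b ∧ v = vtx t ℓ i j ∧ ∃ c : k, m = c • D.p i a j • x := by
  obtain ⟨r, rfl⟩ := hg m
  obtain ⟨c, hc⟩ := D.smul_interior h0 (by omega) hx r
  have hz : ∀ j, j ∈ Finset.Icc a (ℓ i) → ¬ (j ≤ b ∧ v = vtx t ℓ i j) →
      D.e v • (c j • D.p i a j • x) = 0 := fun j hj h => by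
    obtain ⟨h1, h2⟩ := Finset.mem_Icc.1 hj
    rw [smul_comm]
    by_cases h3 : j ≤ b
    · rw [D.at_ne (by tauto) (D.p_mem h1 h2 x), smul_zero]
    · rw [← D.p_p_smul (b := b + 1) (by omega) (by omega) h2, hxb]; simp
  have hsum : r • x = ∑ j ∈ Finset.Icc a (ℓ i), D.e v • (c j • D.p i a j • x) := by
    rw [← Finset.smul_sum, ← hc, hm]
  by_cases h : ∃ j ∈ Finset.Icc a (ℓ i), j ≤ b ∧ v = vtx t ℓ i j
  · obtain ⟨j, hj, hjb, rfl⟩ := h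
    obtain ⟨h1, h2⟩ := Finset.mem_Icc.1 hj
    refine ⟨j, h1, hjb, rfl, c j, ?_⟩
    rw [hsum, Finset.sum_eq_single_of_mem j hj]
    · rw [smul_comm, D.e_p_smul h1 h2]
    · intro j' hj' hne
      refine hz j' hj' fun ⟨_, h⟩ => hne ?_
      exact (vtx_inj (by omega) (by omega) h).2.symm
  · exact absurd (hsum.trans (Finset.sum_eq_zero fun j hj => hz j hj fun h' => h ⟨j, hj, h'⟩)) hm0

lemma IsInt.midRep {i a b} (h : D.IsInt i a b M) : D.MidRep M := by
  let _ := kMod k R M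
  obtain ⟨h0, hab, hb, x, hx, hxb, hxb', hg⟩ := h
  constructor <;> intro m hm <;> by_contra hm0 <;>
    obtain ⟨j, h1, h2, h3, -⟩ := IsInt.eq_smul h0 hab hb hx hxb' hg hm hm0
  · have := vtx_inj (ℓ := ℓ) (i := i) (a := j) (j := i) (b := 0) (by omega) (by omega) (by rw [← h3, vtx_zero])
    omega
  · have := vtx_inj (ℓ := ℓ) (i := i) (a := j) (j := i) (b := ℓ i) (by omega) (by omega) (by rw [← h3, D.vtx_ℓ])
    omega

lemma IsInt.of_hom {i a b i' a' b'} (hM : D.IsInt i a b M) (hN : D.IsInt i' a' b' N)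
    (f : M →ₗ[R] N) (hf : f ≠ 0) : i = i' ∧ a' ≤ a ∧ b' ≤ b ∧
      (a = a' → b = b' → Function.Bijective f) := by
  let _ := kMod k R M
  let _ := kMod k R N
  obtain ⟨h0, hab, hb, x, hx, hxb, hxb', hg⟩ := hM
  obtain ⟨h0', hab', hb', y, hy, hyb, hyb', hg'⟩ := hN
  have hfx : f x ≠ 0 := fun h => hf (by
    ext m
    obtain ⟨r, rfl⟩ := hg m
    simp [h])
  obtain ⟨j, h1, h2, h3, c, hc⟩ := IsInt.eq_smul h0' hab' hb' hy hyb' hg' (D.map_at f hx) hfx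
  obtain ⟨rfl, rfl⟩ := vtx_inj h0 (by omega) h3
  have hc0 : c ≠ 0 := by rintro rfl; simp [hc] at hfx
  refine ⟨rfl, h1, ?_, ?_⟩
  · by_contra hlt
    apply hyb
    have : D.p i a (b + 1) • f x = 0 := by rw [← map_smul, hxb', map_zero]
    rw [hc, smul_comm, smul_eq_zero_iff_right hc0, D.p_p_smul h1 (by omega) (by omega)] at this
    rw [← D.p_p_smul (b := b + 1) (by omega) (by omega) (by omega), this, smul_zero]
  · rintro rfl rfl
    rw [D.p_self_smul (by omega), hy] at hc
    constructor
    · rw [← LinearMap.ker_eq_bot, LinearMap.ker_eq_bot']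
      intro m hm
      refine D.ext_e fun v => ?_
      rw [smul_zero]
      by_contra hm0
      obtain ⟨j, h1, h2, -, d, hd⟩ := IsInt.eq_smul h0 hab hb hx hxb' hg (D.e_e_self v m) hm0
      have h4 : f (D.e v • m) = 0 := by rw [map_smul, hm, smul_zero]
      rw [hd, hom_smul, map_smul, hc, smul_comm (D.p i a j) c, smul_eq_zero_iff_right, smul_eq_zero_iff_right hc0] at h4
      · exact hyb (by rw [← D.p_p_smul h1 h2 (by omega), h4, smul_zero])
      · rintro rfl; simp [hd] at hm0
    · intro n
      obtain ⟨r, rfl⟩ := hg' n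
      refine ⟨r • (c⁻¹ • x), ?_⟩
      rw [map_smul, hom_smul, hc, smul_smul, inv_mul_cancel₀ hc0, one_smul]

lemma IsInt.nonempty_equiv {i a b} (hM : D.IsInt i a b M) (hN : D.IsInt i a b N) :
    Nonempty (M ≃ₗ[R] N) := by
  have hMid := hM.midRep
  obtain ⟨h0, hab, hb, x, hx, hxb, hxb', hg⟩ := id hM
  obtain ⟨-, -, -, y, hy, hyb, hyb', -⟩ := id hN
  obtain ⟨f, hf, -⟩ := D.exists_hom_mid h0 hab hb hx hxb (fun m hm => by
    let _ := kMod k R M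
    by_contra hm0
    obtain ⟨j, h1, h2, h3, -⟩ := IsInt.eq_smul h0 hab hb hx hxb' hg hm hm0
    have := vtx_inj (by omega) (by omega) h3.symm
    omega) hy hyb'
  have hf0 : f ≠ 0 := by
    rintro rfl
    exact hyb (by rw [← hf]; simp)
  exact ⟨LinearEquiv.ofBijective f ((hM.of_hom hN f hf0).2.2.2 rfl rfl)⟩

end Interval


lemma finite_ring (D : TD k R t ℓ) : Module.Finite k R := by
  refine ⟨Submodule.fg_def.2 ⟨_, ?_, D.span_top⟩⟩
  refine (Set.finite_range D.e).union (Set.Finite.subset (s := ⋃ i : Fin t, ⋃ a ∈ Set.Iic (ℓ i),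
    (fun b => D.p i a b) '' Set.Iic (ℓ i)) ?_ ?_)
  · exact Set.finite_iUnion fun i => (Set.finite_Iic _).biUnion fun a _ => (Set.finite_Iic _).image _
  · rintro _ ⟨i, a, b, hab, hb, rfl⟩
    exact Set.mem_iUnion.2 ⟨i, Set.mem_biUnion (hab.le.trans hb) ⟨b, hb, rfl⟩⟩

lemma finite_of_fd (D : TD k R t ℓ) {M : ModuleCat.{u} R} [Module k M] [IsScalarTower k R M] (h : FdMod R M) :
    Module.Finite k M := by
  have := D.finite_ring
  have : Module.Finite R M := h
  exact Module.Finite.trans R M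

section Classes

variable {M N : ModuleCat.{u} R}

lemma p_smul_eq_zero_of_mono
    (hN : D.MonoArrows N)
    {i : Fin t} {a b : ℕ} (hab : a ≤ b) (hb : b ≤ ℓ i) {m : N} (hm : D.e (vtx t ℓ i a) • m = m)
    (h : D.p i a b • m = 0) : m = 0 := by
  induction b, hab using Nat.le_induction with
  | base => rwa [D.p_self_smul hb, hm] at h
  | succ b hab ih =>
    refine ih (by omega) (hN i b hb _ (D.e_p_smul hab (by omega) m) ?_)
    rw [← D.p_succ_smul hab hb, h]

lemma hom_eq_zero_of_map_snk {f : M →ₗ[R] N} (hf : ∀ m : M, D.e .snk • m = m → f m = 0)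
    (hN : D.MonoArrows N)
    (ht : 0 < t) : f = 0 := by
  let _ := kMod k R M
  let _ := kMod k R N
  have key : ∀ i a, a ≤ ℓ i → ∀ m : M, D.e (vtx t ℓ i a) • m = m → f m = 0 := fun i a ha m hm => by
    refine D.p_smul_eq_zero_of_mono hN ha le_rfl (D.map_at f hm) ?_
    rw [← map_smul, hf (D.p i a (ℓ i) • m)]
    rw [← D.vtx_ℓ i, D.e_p_smul ha le_rfl]
  refine D.hom_ext_at (vtx_forall (fun m hm => ?_) (fun m hm => ?_) fun i a h0 ha m hm => ?_)
  · exact key ⟨0, ht⟩ 0 (by omega) m (by rw [vtx_zero]; exact hm)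
  · exact key ⟨0, ht⟩ _ le_rfl m (by rw [D.vtx_ℓ]; exact hm)
  · exact key i a ha.le m hm

lemma hom_eq_zero_of_snk (hM : ∀ m : M, D.e .snk • m = m → m = 0)
    (hN : D.MonoArrows N)
    (ht : 0 < t) (f : M →ₗ[R] N) : f = 0 :=
  D.hom_eq_zero_of_map_snk (fun m hm => by rw [hM m hm, map_zero]) hN ht

lemma EpiRep.hom_eq_zero (hM : D.EpiRep M) (hN : ∀ m : N, D.e .src • m = m → m = 0)
    (f : M →ₗ[R] N) : f = 0 := by
  let _ := kMod k R M
  let _ := kMod k R N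
  refine D.hom_ext_at (vtx_forall (fun m hm => ?_) (fun m hm => ?_) fun i a h0 ha m hm => ?_)
  · exact hN _ (D.map_at f hm)
  · rw [hM.1 m hm]; simp
  · obtain ⟨n, rfl⟩ := hM.2 i a ha m hm
    rw [← D.p_e_smul (Nat.zero_le a) ha.le n, map_smul, vtx_zero,
      hN (f (D.e .src • n)) (D.map_at f (D.e_e_self _ n)), smul_zero, LinearMap.zero_apply]

lemma EpiRep.src_ne_zero (hM : D.EpiRep M) (hi : Indec R M) :
    ¬ ∀ m : M, D.e .src • m = m → m = 0 := fun h => by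
  have := EpiRep.hom_eq_zero D hM h LinearMap.id
  have hnt := hi.1
  obtain ⟨m, hm⟩ := exists_ne (0 : M)
  exact hm (LinearMap.congr_fun this m)

lemma MonoRep.pdLeOne (ht : 0 < t) (hM : D.MonoRep M) : PdLeOne R M := by
  let _ := kMod k R M
  refine D.pd_le_one ht M (fun i a b hab hb h m hm => ?_) fun v hv _ _ i => hM.1 _ (hv i)
  exact D.p_smul_eq_zero_of_mono hM.2 hab.le hb hm (by rw [h, zero_smul])

lemma functional_eq_zero {V : Type u} [AddCommGroup V] [Module R V] [Module k V]
    (hV : ∀ m : V, D.e .snk • m = m → m = 0) {ξ : V →ₗ[k] k} (hξ : ∀ m, ξ (D.e .snk • m) = ξ m) :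
    ξ = 0 := by
  ext m
  rw [← hξ, hV _ (D.e_e_self _ m), map_zero, LinearMap.zero_apply]

lemma EpiRep.idLeOne (ht : 0 < t) (hf : FdMod R M) (hM : D.EpiRep M) : IdLeOne R M := by
  let _ := kMod k R M
  have := D.finite_of_fd hf
  refine D.id_le_one ht M (fun i a b hab hb h m hm => ?_)
    fun ξ hξ _ _ i => D.functional_eq_zero hM.1 (hξ i)
  rcases hb.eq_or_lt with rfl | hb'
  · exact hM.1 m (by rw [← D.vtx_ℓ i]; exact hm)
  · obtain ⟨n, rfl⟩ := hM.2 i b hb' m hm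
    rw [← D.p_p_smul (Nat.zero_le a) hab.le hb, h, zero_smul]

end Classes

variable {D}

/-- Every algebra of this kind is weakly shod if all branches vanish. -/
theorem weaklyShod_of_w_eq_zero (ht : 0 < t) (hw : ∀ i, D.w i = 0) : WeaklyShod R := by
  have tri : ∀ M : ModuleCat.{u} R, Indec R M → D.MonoRep M ∨ D.EpiRep M ∨ D.MidRep M :=
    fun M hM => D.indec_trichotomy hM fun i m => by
      have := hw i
      rw [w] at this
      rw [this, zero_smul]
  have hsnk : ∀ M : ModuleCat.{u} R, D.EpiRep M ∨ D.MidRep M → ∀ m : M, D.e .snk • m = m → m = 0 :=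
    fun M hM => hM.elim (fun h => h.1) fun h => h.2
  intro M hi hf hL hR hcyc
  have hmid : D.MidRep M := by
    rcases tri M hi with h | h | h
    · refine absurd (inLeftPart_of (P := fun X => Indec R X → D.MonoRep X) ?_
        (fun X hX _ h => MonoRep.pdLeOne D ht (h hX)) hi hf fun _ => h) hL
      rintro X Y ⟨hX, -, hY, -, f, hf0, -⟩ hYm -
      exact (tri X hX).resolve_right fun h =>
        hf0 (D.hom_eq_zero_of_snk (hsnk X h) (hYm hY).2 ht f)
    · refine absurd (inRightPart_of (P := fun X => Indec R X → D.EpiRep X) ?_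
        (fun X hX hX' h => EpiRep.idLeOne D ht hX' (h hX)) hi hf fun _ => h) hR
      rintro X Y ⟨hX, -, hY, -, f, hf0, -⟩ hXe -
      have h0 := fun h => hf0 (EpiRep.hom_eq_zero D (hXe hX) h f)
      exact ((tri Y hY).resolve_left (h0 ·.1)).resolve_right (h0 ·.1)
    · exact h
  obtain ⟨i, a, b, hM⟩ := MidRep.isInt D hmid hi
  let Inv : ModuleCat.{u} R → Prop := fun X =>
    D.EpiRep X ∨ ∃ i' a' b', D.IsInt i' a' b' X ∧ a' + b' < a + b
  have step : ∀ X Y, Step R X Y → Inv X ∨ D.IsInt i a b X → Inv Y := by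
    rintro X Y ⟨hX, -, hY, -, f, hf0, hfb⟩ hXI
    have hX' : D.EpiRep X ∨ ∃ i' a' b', D.IsInt i' a' b' X ∧ a' + b' ≤ a + b := by
      rcases hXI with (h | ⟨i', a', b', h, h'⟩) | h
      · exact .inl h
      · exact .inr ⟨_, _, _, h, h'.le⟩
      · exact .inr ⟨_, _, _, h, le_rfl⟩
    rcases tri Y hY with h | h | h
    · refine absurd (D.hom_eq_zero_of_snk (hsnk X ?_) h.2 ht f) hf0
      exact hX'.imp_right fun ⟨_, _, _, h, _⟩ => h.midRep
    · exact .inl h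
    · rcases hX' with h' | ⟨i', a', b', h', hle⟩
      · exact absurd (EpiRep.hom_eq_zero D h' h.1 f) hf0
      · obtain ⟨i'', a'', b'', h''⟩ := MidRep.isInt D h hY
        obtain ⟨-, h1, h2, h3⟩ := h'.of_hom h'' f hf0
        refine .inr ⟨_, _, _, h'', ?_⟩
        by_contra hlt
        exact hfb (h3 (by omega) (by omega))
  have hInv : Inv M := by
    have : ∀ X, Relation.TransGen (Step R) M X → Inv X := fun X hX => by
      induction hX with
      | single h => exact step _ _ h (.inr hM)
      | tail _ h ih => exact step _ _ h (.inl ih)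
    exact this M hcyc
  rcases hInv with h | ⟨i', a', b', h, hlt⟩
  · exact EpiRep.src_ne_zero D h hi hmid.1
  · have hid : (LinearMap.id : M →ₗ[R] M) ≠ 0 := fun h0 => by
      have hnt := hi.1
      obtain ⟨m, hm⟩ := exists_ne (0 : M)
      exact hm (LinearMap.congr_fun h0 m)
    have h1 := h.of_hom hM LinearMap.id hid
    omega

lemma w_ne_zero_of_Rel (h : D.Rel = ⊥) (i : Fin t) : D.w i ≠ 0 := fun h0 => by
  have : Pi.single i 1 ∈ D.Rel := by
    rw [D.mem_Rel, Finset.sum_eq_single i]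
    · simp [h0]
    · intro j _ hj; simp [hj]
    · simp
  rw [h, Submodule.mem_bot] at this
  simpa using congrFun this i

/-- The algebra is weakly shod if there are no linear relations between the branches. -/
theorem weaklyShod_of_Rel_eq_bot (ht : 0 < t) (h : D.Rel = ⊥) : WeaklyShod R := by
  intro M hi hf hL _
  refine absurd ⟨hi, hf, fun X _ _ _ => ?_⟩ hL
  let _ := kMod k R X
  refine D.pd_le_one ht X (fun i a b hab hb h0 => absurd h0
    (D.p_ne_zero_of_w (w_ne_zero_of_Rel h i) hab.le hb)) fun v _ hv _ i => ?_
  have := hv (Pi.single i 1) fun r hr => by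
    rw [h, Submodule.mem_bot] at hr
    simp [hr]
  rw [Finset.sum_eq_single i] at this
  · simpa using this
  · intro j _ hj; simp [hj]
  · simp

lemma exists_coeff (h : D.m = 1) :
    ∃ (b : R) (c : Fin t → k), b ≠ 0 ∧ (∀ i, D.w i = c i • b) ∧ c ∈ D.Lam := by
  obtain ⟨⟨b, hb⟩, hb0, hs⟩ := finrank_eq_one_iff'.1 h
  choose c hc using fun i => hs ⟨D.w i, Submodule.subset_span ⟨i, rfl⟩⟩
  have hb0' : b ≠ 0 := fun h => hb0 (Subtype.ext h)
  have hc' : ∀ i, D.w i = c i • b := fun i => (congrArg Subtype.val (hc i)).symm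
  refine ⟨b, c, hb0', hc', D.mem_Lam_of hb0' hc'⟩

/-- The algebra is weakly shod if the branches are nonzero multiples of each other. -/
theorem weaklyShod_of_m_eq_one (ht : 0 < t) (h : D.m = 1) (hw : ∀ i, D.w i ≠ 0) :
    WeaklyShod R := by
  obtain ⟨b, c, hb, hc, hcL⟩ := exists_coeff h
  have hc0 : ∀ i, c i ≠ 0 := fun i h0 => hw i (by rw [hc, h0, zero_smul])
  refine weaklyShod_of_split (fun M => ∀ m : M, D.e .snk • m = m → m = 0)
    (fun N => D.MonoArrows N)
    (fun M hi _ => ?_) (fun M N _ _ _ _ hM hN f => D.hom_eq_zero_of_snk hM hN ht f)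
    (fun M _ _ hM => ?_) fun M _ hf hM => ?_
  · let _ := kMod k R M
    let K : Vtx t ℓ → Submodule k M := fam (LinearMap.ker (act M b) ⊓ D.at' M .src) ⊥
      fun i a => LinearMap.ker (act M (D.p i a (ℓ i))) ⊓ D.at' M (vtx t ℓ i a)
    have hK : ∀ i a, a ≤ ℓ i → ∀ m, m ∈ K (vtx t ℓ i a) ↔
        D.p i a (ℓ i) • m = 0 ∧ m ∈ D.at' M (vtx t ℓ i a) := fun i a ha m => by
      have : K (vtx t ℓ i a) = _ := fam_vtx _ _ _ i a
      rw [this]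
      split_ifs with h0 h1
      · subst h0
        rw [vtx_zero, show D.p i 0 (ℓ i) = c i • b from hc i, smul_assoc, smul_eq_zero_iff_right (hc0 i)]
        rfl
      · rfl
      · obtain rfl : a = ℓ i := by omega
        rw [D.p_self_smul le_rfl, Submodule.mem_bot]
        exact ⟨fun h => by simp [h], fun ⟨h1, h2⟩ => by rw [← h1]; exact (D.mem_at.1 h2).symm⟩
    rcases D.indec_of_reflect hi K (vtx_forall inf_le_right bot_le fun i a _ ha m hm =>
        ((hK i a ha.le m).1 hm).2) (fun i a ha m hm => by
          rw [hK i _ ha, D.p_p_smul (Nat.le_succ a) ha le_rfl]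
          exact ⟨((hK i a ha.le m).1 hm).1, D.p_mem (Nat.le_succ a) ha m⟩) (fun i a ha m hm h => by
          rw [hK i _ ha, D.p_p_smul (Nat.le_succ a) ha le_rfl] at h
          exact (hK i a ha.le m).2 ⟨h.1, hm⟩) rfl with h | h
    · refine .inr fun i a ha m hm h0 => ?_
      have : m ∈ K (vtx t ℓ i a) := (hK i a ha.le m).2 ⟨by
        rw [← D.p_p_smul (Nat.le_succ a) ha le_rfl, h0, smul_zero], hm⟩
      rw [h] at this
      exact (Submodule.mem_bot k).1 this
    · refine .inl fun m hm => ?_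
      have : m ∈ K .snk := by rw [h]; exact hm
      exact (Submodule.mem_bot k).1 this
  · let _ := kMod k R M
    refine D.pd_le_one ht M (fun i a b hab hb h0 => absurd h0
      (D.p_ne_zero_of_w (hw i) hab.le hb)) fun v hv _ hv' i => ?_
    exact D.p_smul_eq_zero_of_mono hM (Nat.zero_le (ℓ i - 1)) (by omega)
      (by rw [vtx_zero]; exact hv i) (hv' i)
  · let _ := kMod k R M
    have := D.finite_of_fd hf
    exact D.id_le_one ht M (fun i a b hab hb h0 => absurd h0
      (D.p_ne_zero_of_w (hw i) hab.le hb)) fun ξ hξ _ _ i => D.functional_eq_zero hM (hξ i)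

variable (D)

/-- Modules generated by an element `g` at the source and an element `h` at the `y`-th vertex of
the branch `i₀`, with the same nonzero image in the sink. -/
structure TypeGen (i₀ : Fin t) (b : R) (x y : ℕ) (M : ModuleCat.{u} R) (g h : M) : Prop where
  hx : x < ℓ i₀
  hy : 0 < y
  hyl : y ≤ ℓ i₀
  hg : D.e .src • g = g
  hh : D.e (vtx t ℓ i₀ y) • h = h
  hgx : D.p i₀ 0 (x + 1) • g = 0
  hgh : D.p i₀ y (ℓ i₀) • h = b • g

/-- Indecomposable modules on which not all branches vanish. -/
structure TypeMod (i₀ : Fin t) (b : R) (x y : ℕ) (M : ModuleCat.{u} R) (g h : M) : Prop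
    extends TypeGen D i₀ b x y M g h where
  ne : b • g ≠ 0
  ker_le : ∀ m : M, D.e .src • m = m → D.p i₀ 0 x • m = 0 → b • m = 0
  notMem : ∀ n : M, D.p i₀ (y - 1) (ℓ i₀) • n ≠ b • g

lemma exists_functional {V W : Type*} [AddCommGroup V] [Module k V] [AddCommGroup W] [Module k W]
    (α : V →ₗ[k] W) (β : V →ₗ[k] k) (n : W) (h : ∀ m, ∀ r : k, α m = r • n → β m = 0) :
    ∃ ζ : W →ₗ[k] k, (∀ m, ζ (α m) = β m) ∧ ζ n = 0 := by
  have h1 : β ∈ (LinearMap.ker ((k ∙ n).mkQ ∘ₗ α)).dualAnnihilator := by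
    rw [Submodule.mem_dualAnnihilator]
    intro m hm
    rw [LinearMap.mem_ker, LinearMap.comp_apply, Submodule.mkQ_apply,
      Submodule.Quotient.mk_eq_zero] at hm
    obtain ⟨r, hr⟩ := Submodule.mem_span_singleton.1 hm
    exact h m r hr.symm
  rw [← LinearMap.range_dualMap_eq_dualAnnihilator_ker] at h1
  obtain ⟨ζ, rfl⟩ := h1
  refine ⟨ζ ∘ₗ (k ∙ n).mkQ, fun m => rfl, ?_⟩
  rw [LinearMap.comp_apply, Submodule.mkQ_apply, (Submodule.Quotient.mk_eq_zero _).2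
    (Submodule.mem_span_singleton_self n), map_zero]

section

variable {i₀ : Fin t} {b : R} {c : Fin t → k}

lemma e_mul_of_coeff (hb : ∀ i, D.w i = c i • b) (hc : ∃ i, c i ≠ 0) :
    D.e .snk * b = b ∧ b * D.e .src = b := by
  obtain ⟨i, hi⟩ := hc
  have : b = (c i)⁻¹ • D.p i 0 (ℓ i) := by
    rw [show D.p i 0 (ℓ i) = c i • b from hb i, smul_smul, inv_mul_cancel₀ hi, one_smul]
  rw [this, mul_smul_comm, smul_mul_assoc]
  refine ⟨?_, ?_⟩
  · congr 1
    have := D.e_p i 0 (ℓ i) (Nat.zero_le _) le_rfl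
    rwa [D.vtx_ℓ] at this
  · congr 1
    have := D.p_e i 0 (ℓ i) (Nat.zero_le _) le_rfl
    rwa [vtx_zero] at this

variable {x y : ℕ} {M N : ModuleCat.{u} R} {g h : M} {g' h' : N}

variable {D}

lemma TypeMod.exists_hom (hb : ∀ i, D.w i = c i • b) (hc0 : c i₀ = 0) (hc : ∀ i, i ≠ i₀ → c i ≠ 0)
    (ht : ∃ i, i ≠ i₀) (hM : TypeMod D i₀ b x y M g h) (hN : TypeGen D i₀ b x y N g' h') :
    ∃ f : M →ₗ[R] N, f g = g' ∧ f h = h' ∧ (∀ m, ∃ r s : R, f m = r • g' + s • h') ∧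
      ∀ m, D.e .src • m = m → ∃ r : k, f m = algebraMap k R r • g' := by
  let _ := kMod k R M
  let _ := kMod k R N
  obtain ⟨hbe, hbe'⟩ := D.e_mul_of_coeff hb (ht.imp hc)
  have hw0 : ∀ m : M, D.p i₀ 0 (ℓ i₀) • m = 0 := fun m => by
    rw [show D.p i₀ 0 (ℓ i₀) = c i₀ • b from hb i₀, hc0, zero_smul, zero_smul]
  have hp0 : ∀ (V : Type u) [AddCommGroup V] [Module R V] [Module k V] [IsScalarTower k R V] i
      (m : V), D.p i 0 (ℓ i) • m = c i • b • m := fun V _ _ _ _ i m => by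
    rw [show D.p i 0 (ℓ i) = c i • b from hb i, smul_assoc]
  obtain ⟨η, hη, hη'⟩ : ∃ η : M →ₗ[k] k, η (b • g) = 1 ∧ ∀ n, η (D.p i₀ (y - 1) (ℓ i₀) • n) = 0 := by
    obtain ⟨f, hf, hf'⟩ := Submodule.exists_le_ker_of_notMem
      (v := b • g) (p := LinearMap.range (act (k := k) M (D.p i₀ (y - 1) (ℓ i₀))))
      (fun ⟨n, hn⟩ => hM.notMem n hn)
    refine ⟨(f (b • g))⁻¹ • f, by simp [hf], fun n => ?_⟩
    have : f (D.p i₀ (y - 1) (ℓ i₀) • n) = 0 := hf' ⟨n, rfl⟩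
    simp [this]
  obtain ⟨ζ, hζ, hζ'⟩ : ∃ ζ : M →ₗ[k] k, (∀ m, ζ (D.p i₀ 0 x • m) = η (b • m)) ∧
      (y ≤ x → ζ (D.p i₀ y x • h) = 0) := by
    have key : ∀ m : M, D.p i₀ 0 x • m = 0 → b • m = 0 := fun m hm => by
      rw [← hbe', mul_smul]
      refine hM.ker_le _ (D.e_e_self _ _) ?_
      rw [← vtx_zero i₀, D.p_e_smul (Nat.zero_le x) hM.hx.le, hm]
    obtain ⟨ζ, h1, h2⟩ := exists_functional (act (k := k) M (D.p i₀ 0 x)) (η ∘ₗ act M b)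
      (if y ≤ x then D.p i₀ y x • h else 0) (fun m r hr => by
        rw [act_apply] at hr
        rw [LinearMap.comp_apply, act_apply, key, map_zero]
        split_ifs at hr with hyx
        · have := congrArg (D.p i₀ x (ℓ i₀) • ·) hr
          rw [D.p_p_smul (Nat.zero_le x) hM.hx.le le_rfl, hw0, smul_comm,
            D.p_p_smul hyx hM.hx.le le_rfl, hM.hgh, eq_comm, smul_eq_zero, or_iff_left hM.ne] at this
          rw [hr, this, zero_smul]
        · rw [hr, smul_zero])
    exact ⟨ζ, h1, fun hyx => by rwa [if_pos hyx] at h2⟩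
  let G : Fin t → ℕ → M →ₗ[k] N := fun i j => if i = i₀ then
      (if j ≤ x then (ζ ∘ₗ act M (D.p i₀ j x)).smulRight (D.p i₀ 0 j • g') else 0) +
        (if y ≤ j then (η ∘ₗ act M (D.p i₀ j (ℓ i₀))).smulRight (D.p i₀ y j • h') else 0)
    else (c i)⁻¹ • (η ∘ₗ act M (D.p i j (ℓ i))).smulRight (D.p i 0 j • g')
  have hG0 : ∀ j m, G i₀ j m = (if j ≤ x then ζ (D.p i₀ j x • m) • D.p i₀ 0 j • g' else 0) +
      if y ≤ j then η (D.p i₀ j (ℓ i₀) • m) • D.p i₀ y j • h' else 0 := fun j m => by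
    simp only [G, if_true]; split_ifs <;> simp
  have hG1 : ∀ i, i ≠ i₀ → ∀ j m, G i j m = (c i)⁻¹ • η (D.p i j (ℓ i) • m) • D.p i 0 j • g' :=
    fun i hi j m => by simp [G, hi]
  have hvl := D.vtx_ℓ
  obtain ⟨f, hfs, hfz, hf⟩ := D.exists_hom (M := M) (N := N) ((η ∘ₗ act M b).smulRight g')
    (η.smulRight (b • g')) G (fun m _ => Submodule.smul_mem _ _ hN.hg)
    (fun m _ => Submodule.smul_mem _ _ (by rw [D.mem_at, ← mul_smul, hbe]))
    (fun i m _ => by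
      by_cases hi : i = i₀
      · subst hi
        rw [hG0, if_pos (Nat.zero_le x), if_neg (by have := hN.hy; omega), hζ, add_zero,
          D.p_self_smul (Nat.zero_le _), vtx_zero, hN.hg]; rfl
      · rw [hG1 i hi, hp0, map_smul, smul_eq_mul, ← mul_smul, inv_mul_cancel_left₀ (hc i hi),
          D.p_self_smul (Nat.zero_le _), vtx_zero, hN.hg]; rfl)
    (fun i m hm => by
      by_cases hi : i = i₀
      · subst hi
        rw [hG0, if_neg (by have := hN.hx; omega), if_pos hN.hyl, D.p_self_smul le_rfl, hvl,
          D.mem_at.1 hm, hN.hgh, zero_add]; rfl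
      · rw [hG1 i hi, hp0, D.p_self_smul le_rfl, hvl, D.mem_at.1 hm, smul_comm (η m),
          inv_smul_smul₀ (hc i hi)]; rfl)
    (fun i j h0 hj m _ => by
      by_cases hi : i = i₀
      · subst hi
        rw [hG0]
        refine add_mem ?_ ?_ <;> split_ifs with h1
        · exact Submodule.smul_mem _ _ (D.p_mem (Nat.zero_le _) hj.le _)
        · exact zero_mem _
        · exact Submodule.smul_mem _ _ (D.p_mem h1 hj.le _)
        · exact zero_mem _
      · rw [hG1 i hi]
        exact Submodule.smul_mem _ _ (Submodule.smul_mem _ _ (D.p_mem (Nat.zero_le _) hj.le _)))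
    (fun i j hj m _ => by
      by_cases hi : i = i₀
      · subst hi
        rw [hG0, hG0, smul_add]
        congr 1
        · by_cases h1 : j ≤ x
          · rw [if_pos h1, smul_comm, D.p_p_smul (Nat.zero_le j) (Nat.le_succ j) hj]
            by_cases h2 : j + 1 ≤ x
            · rw [if_pos h2, D.p_p_smul (Nat.le_succ j) h2 hN.hx.le]
            · obtain rfl : j = x := by omega
              rw [Nat.succ_eq_add_one, hN.hgx, smul_zero, if_neg h2]
          · rw [if_neg h1, if_neg (by omega), smul_zero]
        · by_cases h1 : y ≤ j
          · rw [if_pos h1, smul_comm, D.p_p_smul h1 (Nat.le_succ j) hj, if_pos (by omega),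
              D.p_p_smul (Nat.le_succ j) hj le_rfl]
          · rw [if_neg h1, smul_zero]
            split_ifs with h2
            · obtain rfl : y = j + 1 := by omega
              have := hη' m
              rw [Nat.add_sub_cancel] at this
              rw [D.p_p_smul (Nat.le_succ j) hj le_rfl, this, zero_smul]
            · rfl
      · rw [hG1 i hi, hG1 i hi, D.p_p_smul (Nat.le_succ j) hj le_rfl, smul_comm (D.p i j (j + 1)),
          smul_comm (D.p i j (j + 1)), D.p_p_smul (Nat.zero_le j) (Nat.le_succ j) hj])
  have hfs' : ∀ m, D.e .src • m = m → f m = η (b • m) • g' := fun m hm => hfs m hm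
  refine ⟨f, ?_, ?_, fun m => ?_, fun m hm => ⟨η (b • m), ?_⟩⟩
  · rw [hfs' g hM.hg, hη, one_smul]
  · rw [hf i₀ y hM.hyl h hM.hh, hG0, if_pos le_rfl, hM.hgh, hη, one_smul, D.p_self_smul hM.hyl, hN.hh]
    split_ifs with h1
    · rw [hζ' h1, zero_smul, zero_add]
    · rw [zero_add]
  · have key : ∀ v, ∃ r s : R, f (D.e v • m) = r • g' + s • h' := by
      refine vtx_forall ⟨algebraMap k R (η (b • D.e .src • m)), 0, ?_⟩
        ⟨η (D.e .snk • m) • b, 0, ?_⟩ fun i j _ hj => ?_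
      · rw [hfs' _ (D.e_mem _ m), zero_smul, add_zero, algebraMap_smul]
      · rw [hfz _ (D.e_mem _ m), zero_smul, add_zero, smul_assoc]; rfl
      · rw [hf i j hj.le _ (D.e_mem _ m)]
        by_cases hi : i = i₀
        · subst hi
          rw [hG0]
          refine ⟨if j ≤ x then ζ (D.p i j x • D.e (vtx t ℓ i j) • m) • D.p i 0 j else 0,
            if y ≤ j then η (D.p i j (ℓ i) • D.e (vtx t ℓ i j) • m) • D.p i y j else 0, ?_⟩
          congr 1 <;> split_ifs <;> simp
        · rw [hG1 i hi]
          exact ⟨(c i)⁻¹ • η (D.p i j (ℓ i) • D.e (vtx t ℓ i j) • m) • D.p i 0 j, 0, by simp⟩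
    choose r s hrs using key
    refine ⟨∑ v, r v, ∑ v, s v, ?_⟩
    rw [Finset.sum_smul, Finset.sum_smul, ← Finset.sum_add_distrib]
    conv_lhs => rw [← D.sum_e m, map_sum]
    exact Finset.sum_congr rfl fun v _ => hrs v
  · rw [hfs' m hm, algebraMap_smul]

end

end TD

namespace TD

variable {D : TD k R t ℓ}
  {i₀ : Fin t} {b : R} {c : Fin t → k} {x y : ℕ} {M N : ModuleCat.{u} R} {g h : M}

lemma TypeMod.generates (hb : ∀ i, D.w i = c i • b) (hc0 : c i₀ = 0)
    (hc : ∀ i, i ≠ i₀ → c i ≠ 0) (ht : ∃ i, i ≠ i₀) (hM : TypeMod D i₀ b x y M g h)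
    (hi : Indec R M) : (∀ m : M, ∃ r s : R, m = r • g + s • h) ∧
      ∀ m : M, D.e .src • m = m → ∃ r : k, m = algebraMap k R r • g := by
  obtain ⟨f, hg, hh, h1, h2⟩ := hM.exists_hom hb hc0 hc ht hM.toTypeGen
  have : f = LinearMap.id := by
    refine (hi.2 f (LinearMap.ext fun m => ?_)).resolve_left fun h0 => hM.ne ?_
    · obtain ⟨r, s, hm⟩ := h1 m
      rw [LinearMap.comp_apply, hm, map_add, map_smul, map_smul, hg, hh]
    · rw [← hg, h0, LinearMap.zero_apply, smul_zero]
  subst this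
  exact ⟨h1, h2⟩

lemma TypeMod.nonempty_equiv (hb : ∀ i, D.w i = c i • b) (hc0 : c i₀ = 0)
    (hc : ∀ i, i ≠ i₀ → c i ≠ 0) (ht : ∃ i, i ≠ i₀) (hM : TypeMod D i₀ b x y M g h)
    (hi : Indec R M) {g' h' : N} (hN : TypeMod D i₀ b x y N g' h') (hi' : Indec R N) :
    Nonempty (M ≃ₗ[R] N) := by
  obtain ⟨f, hg, hh, -⟩ := hM.exists_hom hb hc0 hc ht hN.toTypeGen
  obtain ⟨f', hg', hh', -⟩ := hN.exists_hom hb hc0 hc ht hM.toTypeGen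
  refine ⟨LinearEquiv.ofLinearMap f f' (LinearMap.ext fun n => ?_) (LinearMap.ext fun m => ?_)⟩
  · obtain ⟨r, s, hn⟩ := (hN.generates hb hc0 hc ht hi').1 n
    simp [hn, hg, hg', hh, hh']
  · obtain ⟨r, s, hn⟩ := (hM.generates hb hc0 hc ht hi).1 m
    simp [hn, hg, hg', hh, hh']

lemma TypeMod.hom_eq_zero_of_monoRep (hb : ∀ i, D.w i = c i • b) (hc0 : c i₀ = 0)
    (hc : ∀ i, i ≠ i₀ → c i ≠ 0) (ht : ∃ i, i ≠ i₀) (hM : TypeMod D i₀ b x y M g h)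
    (hi : Indec R M) (hN : D.MonoRep N) (f : M →ₗ[R] N) : f = 0 := by
  let _ := kMod k R N
  have hg : f g = 0 := hN.1 _ (D.map_at f hM.hg)
  have hh : f h = 0 := D.p_smul_eq_zero_of_mono hN.2 hM.hyl le_rfl (D.map_at f hM.hh) (by
    rw [← map_smul, hM.hgh, map_smul, hg, smul_zero])
  ext m
  obtain ⟨r, s, hm⟩ := (hM.generates hb hc0 hc ht hi).1 m
  simp [hm, hg, hh]

lemma TypeMod.hom_eq_zero_of_epiRep (hb : ∀ i, D.w i = c i • b) (hc0 : c i₀ = 0)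
    (hc : ∀ i, i ≠ i₀ → c i ≠ 0) (ht : ∃ i, i ≠ i₀) (hM : TypeMod D i₀ b x y M g h)
    (hi : Indec R M) (hN : D.EpiRep N) (f : N →ₗ[R] M) : f = 0 := by
  let _ := kMod k R M
  let _ := kMod k R N
  obtain ⟨hbe, hbe'⟩ := D.e_mul_of_coeff hb (ht.imp hc)
  have h0 : ∀ n : N, f (D.e .src • n) = 0 := fun n => by
    obtain ⟨r, hr⟩ := (hM.generates hb hc0 hc ht hi).2 _ (D.map_at f (D.e_e_self .src n))
    have hbn : b • D.e .src • n = 0 := hN.1 _ (by rw [← mul_smul, hbe])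
    have := congrArg f hbn
    rw [map_smul, hr, algebraMap_smul, map_zero, smul_comm, smul_eq_zero, or_iff_left hM.ne] at this
    rw [hr, this, map_zero, zero_smul]
  refine D.hom_ext_at (vtx_forall (fun m hm => ?_) (fun m hm => ?_) fun i a _ ha m hm => ?_)
  · rw [← D.mem_at.1 hm, h0, LinearMap.zero_apply]
  · rw [hN.1 m hm, map_zero, map_zero]
  · obtain ⟨n, rfl⟩ := hN.2 i a ha m hm
    rw [← D.p_e_smul (Nat.zero_le a) ha.le n, vtx_zero, map_smul, h0, smul_zero,
      LinearMap.zero_apply]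

lemma exists_typeMod (D : TD k R t ℓ) (hb : ∀ i, D.w i = c i • b) (hc0 : c i₀ = 0)
    (hc : ∀ i, i ≠ i₀ → c i ≠ 0) (ht : ∃ i, i ≠ i₀) {n : M} (hn : b • n ≠ 0) :
    ∃ x y, ∃ g h : M, TypeMod D i₀ b x y M g h := by
  obtain ⟨hbe, hbe'⟩ := D.e_mul_of_coeff hb (ht.imp hc)
  have hw0 : ∀ m : M, D.p i₀ 0 (ℓ i₀) • m = 0 := fun m => by
    rw [show D.p i₀ 0 (ℓ i₀) = c i₀ • b from hb i₀, hc0, zero_smul, zero_smul]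
  have hl := D.hℓ i₀
  have hx : ∃ x, x < ℓ i₀ ∧ ∃ m : M, D.e .src • m = m ∧ D.p i₀ 0 (x + 1) • m = 0 ∧ b • m ≠ 0 :=
    ⟨ℓ i₀ - 1, by omega, D.e .src • n, D.e_e_self _ _, by
      rw [show ℓ i₀ - 1 + 1 = ℓ i₀ by omega, hw0], by rwa [← mul_smul, hbe']⟩
  obtain ⟨hxl, m, hm, hxm, hbm⟩ := Nat.find_spec hx
  set x := Nat.find hx with hx_def
  have hy : ∃ y, y ≤ ℓ i₀ ∧ ∃ m h : M, D.e .src • m = m ∧ D.p i₀ 0 (x + 1) • m = 0 ∧ b • m ≠ 0 ∧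
      D.p i₀ y (ℓ i₀) • h = b • m :=
    ⟨ℓ i₀, le_rfl, m, b • m, hm, hxm, hbm, by
      rw [D.p_self_smul le_rfl, D.vtx_ℓ, ← mul_smul, hbe]⟩
  obtain ⟨hyl, g, h, hg, hxg, hbg, hgh⟩ := Nat.find_spec hy
  set y := Nat.find hy with hy_def
  have hy0 : 0 < y := by
    rcases Nat.eq_zero_or_pos y with h0 | h0
    · rw [h0, hw0] at hgh
      exact absurd hgh.symm hbg
    · exact h0
  refine ⟨x, y, g, D.e (vtx t ℓ i₀ y) • h, ⟨hxl, hy0, hyl, hg, D.e_e_self _ _, hxg, ?_⟩, hbg,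
    fun m' hm' h0 => ?_, fun n hn => ?_⟩
  · rw [D.p_e_smul hyl le_rfl, hgh]
  · by_contra hbm'
    rcases Nat.eq_zero_or_pos x with hx0 | hx0
    · rw [hx0, D.p_self_smul (Nat.zero_le _), vtx_zero, hm'] at h0
      rw [h0, smul_zero] at hbm'
      exact hbm' rfl
    · refine Nat.find_min hx (m := x - 1) (by omega) ⟨by omega, m', hm', ?_, hbm'⟩
      rwa [Nat.sub_add_cancel hx0]
  · exact Nat.find_min hy (m := y - 1) (by omega) ⟨by omega, g, n, hg, hxg, hbg, hn⟩

theorem laura_of_one_zero (D : TD k R t ℓ) (hb : ∀ i, D.w i = c i • b) (hc0 : c i₀ = 0)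
    (hc : ∀ i, i ≠ i₀ → c i ≠ 0) (ht : ∃ i, i ≠ i₀) : Laura R := by
  have ht0 : 0 < t := i₀.pos
  have tri : ∀ M : ModuleCat.{u} R, Indec R M → D.MonoRep M ∨ D.EpiRep M ∨
      (D.MidRep M ∨ ∃ x y, ∃ g h : M, TypeMod D i₀ b x y M g h) := fun M hM => by
    by_cases h : ∀ n : M, b • n = 0
    · have := D.indec_trichotomy hM fun i m => by
        rw [show D.p i 0 (ℓ i) = c i • b from hb i, ← algebraMap_smul R (c i) b, smul_eq_mul,
          mul_smul, h, smul_zero]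
      tauto
    · push Not at h
      obtain ⟨n, hn⟩ := h
      exact .inr (.inr (.inr (D.exists_typeMod hb hc0 hc ht hn)))
  let P : (Fin t × ℕ × ℕ) ⊕ (ℕ × ℕ) → ModuleCat.{u} R → Prop := fun x M => Sum.elim
    (fun x => D.IsInt x.1 x.2.1 x.2.2 M)
    (fun x => Indec R M ∧ ∃ g h : M, TypeMod D i₀ b x.1 x.2 M g h) x
  let L := ∑ i, ℓ i
  have hL : ∀ i, ℓ i ≤ L := fun i => Finset.single_le_sum (fun _ _ => Nat.zero_le _) (Finset.mem_univ i)
  refine laura_of_types ({x | ∃ i a b, a ≤ L ∧ b ≤ L ∧ x = Sum.inl (i, a, b)} ∪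
    {x | ∃ a b, a ≤ L ∧ b ≤ L ∧ x = Sum.inr (a, b)}) ?_ P ?_ fun M hi hf => ?_
  · refine Set.Finite.union ?_ ?_
    · refine (Set.toFinite (Set.range fun z : Fin t × Fin (L + 1) × Fin (L + 1) =>
        (Sum.inl (z.1, (z.2.1 : ℕ), (z.2.2 : ℕ)) : (Fin t × ℕ × ℕ) ⊕ (ℕ × ℕ)))).subset ?_
      rintro _ ⟨i, a, b, ha, hb, rfl⟩
      exact ⟨(i, ⟨a, by omega⟩, ⟨b, by omega⟩), rfl⟩
    · refine (Set.toFinite (Set.range fun z : Fin (L + 1) × Fin (L + 1) =>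
        (Sum.inr ((z.1 : ℕ), (z.2 : ℕ)) : (Fin t × ℕ × ℕ) ⊕ (ℕ × ℕ)))).subset ?_
      rintro _ ⟨a, b, ha, hb, rfl⟩
      exact ⟨(⟨a, by omega⟩, ⟨b, by omega⟩), rfl⟩
  · rintro (⟨i, a, b⟩ | ⟨a, b⟩) M N h1 h2
    · exact h1.nonempty_equiv h2
    · obtain ⟨hi, g, h, h1⟩ := h1
      obtain ⟨hi', g', h', h2⟩ := h2
      exact h1.nonempty_equiv hb hc0 hc ht hi h2 hi'
  rcases tri M hi with h | h | h | ⟨x, y, g, h, hT⟩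
  · refine .inl (inLeftPart_of (P := fun X => Indec R X → D.MonoRep X) ?_
      (fun X hX _ h => MonoRep.pdLeOne D ht0 (h hX)) hi hf fun _ => h)
    rintro X Y ⟨hX, -, hY, -, f, hf0, -⟩ hYm -
    rcases tri X hX with h | h | h | ⟨x, y, g, h, hT⟩
    · exact h
    · exact absurd (D.hom_eq_zero_of_snk h.1 (hYm hY).2 ht0 f) hf0
    · exact absurd (D.hom_eq_zero_of_snk h.2 (hYm hY).2 ht0 f) hf0
    · exact absurd (hT.hom_eq_zero_of_monoRep hb hc0 hc ht hX (hYm hY) f) hf0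
  · refine .inr (.inl (inRightPart_of (P := fun X => Indec R X → D.EpiRep X) ?_
      (fun X hX hX' h => EpiRep.idLeOne D ht0 hX' (h hX)) hi hf fun _ => h))
    rintro X Y ⟨hX, -, hY, -, f, hf0, -⟩ hXe -
    rcases tri Y hY with h | h | h | ⟨x, y, g, h, hT⟩
    · exact absurd (EpiRep.hom_eq_zero D (hXe hX) h.1 f) hf0
    · exact h
    · exact absurd (EpiRep.hom_eq_zero D (hXe hX) h.1 f) hf0
    · exact absurd (hT.hom_eq_zero_of_epiRep hb hc0 hc ht hY (hXe hX) f) hf0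
  · obtain ⟨i, a, b, h⟩ := MidRep.isInt D h hi
    exact .inr (.inr ⟨_, .inl ⟨i, a, b, by have := h.2; have := hL i; omega,
      by have := h.2; have := hL i; omega, rfl⟩, h⟩)
  · exact .inr (.inr ⟨_, .inr ⟨x, y, hT.hx.le.trans (hL _), hT.hyl.trans (hL _), rfl⟩, hi, g, h, hT⟩)

end TD

/-- The composite of the maps `F a, …, F (b - 1)`. -/
def chain {k Z : Type*} [Semiring k] [AddCommMonoid Z] [Module k Z] (F : ℕ → Z →ₗ[k] Z) (a : ℕ) :
    ℕ → Z →ₗ[k] Z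
  | 0 => LinearMap.id
  | b + 1 => if a ≤ b then F b ∘ₗ chain F a b else LinearMap.id

section chain

variable {k Z : Type*} [Semiring k] [AddCommMonoid Z] [Module k Z] (F : ℕ → Z →ₗ[k] Z)

lemma chain_of_le {a b : ℕ} (h : b ≤ a) : chain F a b = LinearMap.id := by
  cases b with
  | zero => rfl
  | succ b => rw [chain, if_neg (by omega)]

lemma chain_succ {a b : ℕ} (h : a ≤ b) (z : Z) : chain F a (b + 1) z = F b (chain F a b z) := by
  rw [chain, if_pos h]; rfl

lemma chain_chain {a b c : ℕ} (hab : a ≤ b) (hbc : b ≤ c) (z : Z) :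
    chain F b c (chain F a b z) = chain F a c z := by
  induction c, hbc using Nat.le_induction with
  | base => rw [chain_of_le F le_rfl]; rfl
  | succ c hc ih => rw [chain_succ F hc, ih, chain_succ F (hab.trans hc)]

end chain

/-- A representation of a bound toupie quiver by subspaces of a vector space. -/
structure Rep {k R : Type u} [Field k] [Ring R] [Algebra k R] {t : ℕ} {ℓ : Fin t → ℕ}
    (D : TD k R t ℓ) (Z : Type u) [AddCommGroup Z] [Module k Z] where
  S : Vtx t ℓ → Submodule k Z
  F : Fin t → ℕ → Z →ₗ[k] Z
  hF : ∀ i a, a < ℓ i → ∀ z ∈ S (vtx t ℓ i a), F i a z ∈ S (vtx t ℓ i (a + 1))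
  hz : ∀ i a b, a < b → b ≤ ℓ i → (a, b) ≠ (0, ℓ i) → D.p i a b = 0 →
    ∀ z ∈ S (vtx t ℓ i a), chain (F i) a b z = 0
  hr : ∀ r ∈ D.Rel, ∀ z ∈ S .src, ∑ i, r i • chain (F i) 0 (ℓ i) z = 0

namespace Rep

variable {D : TD k R t ℓ}
  {Z : Type u} [AddCommGroup Z] [Module k Z] (X : Rep D Z)

lemma chain_mem {i : Fin t} {a b : ℕ} (hab : a ≤ b) (hb : b ≤ ℓ i) {z : Z}
    (hz : z ∈ X.S (vtx t ℓ i a)) : chain (X.F i) a b z ∈ X.S (vtx t ℓ i b) := by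
  induction b, hab using Nat.le_induction with
  | base => rwa [chain_of_le _ le_rfl]
  | succ c hc ih =>
    rw [chain_succ _ hc]
    exact X.hF i c hb _ (ih (by omega))

/-- The total space of a representation. -/
def tot : Submodule k (Vtx t ℓ → Z) := Submodule.pi Set.univ X.S

lemma mem_tot {x : Vtx t ℓ → Z} : x ∈ X.tot ↔ ∀ v, x v ∈ X.S v := by
  simp [tot, Submodule.mem_pi]

/-- The operators on the total space of a representation attached to the paths. -/
def sys : PathSys k (Module.End k X.tot) t ℓ where
  e v := (LinearMap.single k (fun _ => Z) v ∘ₗ LinearMap.proj v).restrict (p := X.tot) (q := X.tot)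
    fun x hx => X.mem_tot.2 fun w => by
      by_cases h : w = v
      · subst h; simpa using X.mem_tot.1 hx w
      · simp [Pi.single_eq_of_ne h]
  p i a b := if h : a ≤ b ∧ b ≤ ℓ i then
    (LinearMap.single k (fun _ => Z) (vtx t ℓ i b) ∘ₗ chain (X.F i) a b ∘ₗ
      LinearMap.proj (vtx t ℓ i a)).restrict (p := X.tot) (q := X.tot)
    fun x hx => X.mem_tot.2 fun w => by
      by_cases hw : w = vtx t ℓ i b
      · subst hw; simpa using X.chain_mem h.1 h.2 (X.mem_tot.1 hx _)
      · simp [Pi.single_eq_of_ne hw] else 0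
  e_mul v w := by
    ext x u
    split_ifs with h
    · subst h; simp
    · simp [LinearMap.restrict_apply, Pi.single_eq_of_ne h]
  e_sum := by
    ext x u
    simp [LinearMap.sum_apply, LinearMap.restrict_apply, Finset.sum_apply, Pi.single_apply]
  p_self i a ha := by
    rw [dif_pos ⟨le_rfl, ha⟩]
    ext x u
    simp [LinearMap.restrict_apply, chain_of_le]
  p_comp i a b c hab hbc hc := by
    rw [dif_pos ⟨hbc, hc⟩, dif_pos ⟨hab, hbc.trans hc⟩, dif_pos ⟨hab.trans hbc, hc⟩]
    ext x u
    simp [LinearMap.restrict_apply, chain_chain _ hab hbc]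

lemma sys_e (v w : Vtx t ℓ) (x : X.tot) :
    (X.sys.e v x).1 w = if w = v then x.1 w else 0 := by
  simp only [sys, LinearMap.restrict_apply, LinearMap.comp_apply, LinearMap.proj_apply,
    LinearMap.single_apply, Pi.single_apply]
  split_ifs with h
  · rw [h]
  · rfl

lemma sys_p {i : Fin t} {a b : ℕ} (hab : a ≤ b) (hb : b ≤ ℓ i) (w : Vtx t ℓ) (x : X.tot) :
    (X.sys.p i a b x).1 w = if w = vtx t ℓ i b then chain (X.F i) a b (x.1 (vtx t ℓ i a)) else 0 := by
  simp only [sys, dif_pos (And.intro hab hb), LinearMap.restrict_apply, LinearMap.comp_apply,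
    LinearMap.proj_apply, LinearMap.single_apply, Pi.single_apply]

lemma exists_hom : ∃ Ψ : R →ₐ[k] Module.End k X.tot, (∀ v, Ψ (D.e v) = X.sys.e v) ∧
    ∀ i a b, a ≤ b → b ≤ ℓ i → Ψ (D.p i a b) = X.sys.p i a b := by
  refine D.up X.sys (fun i a b hab hb hne h => ?_) fun r hr => ?_
  · refine LinearMap.ext fun x => Subtype.ext (funext fun w => ?_)
    rw [sys_p _ hab.le hb, X.hz i a b hab hb hne h _ (X.mem_tot.1 x.2 _)]
    simp
  · refine LinearMap.ext fun x => Subtype.ext (funext fun w => ?_)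
    have : ∀ i, (X.sys.p i 0 (ℓ i) x).1 w = if w = .snk then chain (X.F i) 0 (ℓ i) (x.1 .src) else 0 :=
      fun i => by rw [X.sys_p (Nat.zero_le _) le_rfl, D.vtx_ℓ, vtx_zero]
    simp only [LinearMap.sum_apply, LinearMap.smul_apply, Submodule.coe_sum, Submodule.coe_smul,
      Finset.sum_apply, Pi.smul_apply, this]
    by_cases hw : w = .snk
    · simpa [hw] using X.hr r hr _ (X.mem_tot.1 x.2 _)
    · simp [hw]

instance : Module R X.tot := Module.compHom X.tot X.exists_hom.choose.toRingHom

lemma smul_def (r : R) (x : X.tot) : r • x = X.exists_hom.choose r x := rfl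

instance : IsScalarTower k R X.tot :=
  IsScalarTower.of_algebraMap_smul fun c x => by
    rw [smul_def, AlgHom.commutes, Module.algebraMap_end_apply]

/-- The module given by a representation. -/
abbrev mod : ModuleCat.{u} R := ModuleCat.of R X.tot

lemma e_apply (v w : Vtx t ℓ) (x : X.tot) : (D.e v • x).1 w = if w = v then x.1 w else 0 := by
  rw [smul_def, X.exists_hom.choose_spec.1, sys_e]

lemma p_apply {i : Fin t} {a b : ℕ} (hab : a ≤ b) (hb : b ≤ ℓ i) (w : Vtx t ℓ) (x : X.tot) :
    (D.p i a b • x).1 w = if w = vtx t ℓ i b then chain (X.F i) a b (x.1 (vtx t ℓ i a)) else 0 := by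
  rw [smul_def, X.exists_hom.choose_spec.2 i a b hab hb, X.sys_p hab hb]

/-- The inclusion of the space at a vertex into the total space. -/
def inj (v : Vtx t ℓ) : X.S v →ₗ[k] X.tot :=
  (LinearMap.single k (fun _ => Z) v ∘ₗ (X.S v).subtype).codRestrict X.tot fun z =>
    X.mem_tot.2 fun w => by
      by_cases h : w = v
      · subst h; simp
      · simp [Pi.single_eq_of_ne h]

lemma inj_apply (v w : Vtx t ℓ) (z : X.S v) : (X.inj v z).1 w = if w = v then z.1 else 0 := by
  simp [inj, Pi.single_apply]

lemma inj_self (v : Vtx t ℓ) (z : X.S v) : (X.inj v z).1 v = z.1 := by simp [inj_apply]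

lemma inj_mem (v : Vtx t ℓ) (z : X.S v) : X.inj v z ∈ D.at' X.tot v := by
  refine Subtype.ext (funext fun w => ?_)
  rw [e_apply, inj_apply]
  split_ifs <;> rfl

lemma inj_injective (v : Vtx t ℓ) : Function.Injective (X.inj v) := fun z z' h => by
  have := congrFun (congrArg Subtype.val h) v
  rwa [inj_self, inj_self, Subtype.coe_inj] at this

lemma eq_inj {v : Vtx t ℓ} {x : X.tot} (hx : D.e v • x = x) :
    x = X.inj v ⟨x.1 v, X.mem_tot.1 x.2 v⟩ := by
  refine Subtype.ext (funext fun w => ?_)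
  rw [inj_apply, ← hx, e_apply]
  split_ifs with h
  · rw [h]; simp [e_apply]
  · rfl

lemma eq_of_at {v : Vtx t ℓ} {x y : X.tot} (hx : D.e v • x = x) (hy : D.e v • y = y)
    (h : x.1 v = y.1 v) : x = y := by
  rw [X.eq_inj hx, X.eq_inj hy]; congr

lemma p_inj {i : Fin t} {a b : ℕ} (hab : a ≤ b) (hb : b ≤ ℓ i) (z : X.S (vtx t ℓ i a)) :
    D.p i a b • X.inj _ z = X.inj _ ⟨_, X.chain_mem hab hb z.2⟩ := by
  refine Subtype.ext (funext fun w => ?_)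
  rw [X.p_apply hab hb, inj_self, inj_apply]

lemma p_apply_self {i : Fin t} {a b : ℕ} (hab : a ≤ b) (hb : b ≤ ℓ i) (x : X.tot) :
    (D.p i a b • x).1 (vtx t ℓ i b) = chain (X.F i) a b (x.1 (vtx t ℓ i a)) := by
  rw [X.p_apply hab hb, if_pos rfl]

lemma fdMod [Module.Finite k Z] : FdMod R X.mod :=
  Module.Finite.of_restrictScalars_finite k R X.tot

/-- Homomorphisms between modules given by representations. -/
lemma exists_map {Z' : Type u} [AddCommGroup Z'] [Module k Z'] (X' : Rep D Z')
    (h : Vtx t ℓ → Z →ₗ[k] Z') (hS : ∀ v, ∀ z ∈ X.S v, h v z ∈ X'.S v)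
    (hh : ∀ i a, a < ℓ i → ∀ z ∈ X.S (vtx t ℓ i a),
      h (vtx t ℓ i (a + 1)) (X.F i a z) = X'.F i a (h (vtx t ℓ i a) z)) :
    ∃ f : X.tot →ₗ[R] X'.tot, ∀ x v, (f x).1 v = h v (x.1 v) := by
  let f : X.tot →ₗ[k] X'.tot := (LinearMap.pi fun v => h v ∘ₗ LinearMap.proj v).restrict
    fun x hx => X'.mem_tot.2 fun v => hS v _ (X.mem_tot.1 hx v)
  have hf : ∀ x v, (f x).1 v = h v (x.1 v) := fun x v => rfl
  refine ⟨⟨⟨f, map_add f⟩, D.lin_of f (fun v x => ?_) fun i a ha x => ?_⟩, hf⟩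
  · refine Subtype.ext (funext fun w => ?_)
    rw [hf, e_apply, e_apply, hf]
    split_ifs <;> simp
  · refine Subtype.ext (funext fun w => ?_)
    rw [hf, X.p_apply (Nat.le_succ a) ha, X'.p_apply (Nat.le_succ a) ha, hf]
    split_ifs with hw
    · subst hw
      rw [chain_succ _ le_rfl, chain_succ _ le_rfl, chain_of_le _ le_rfl, chain_of_le _ le_rfl]
      exact hh i a ha _ (X.mem_tot.1 x.2 _)
    · simp

end Rep

/-- The data of a representation which, along each branch, is either constant in the interior or
zero except at the first and last interior vertices. -/
structure Core {k R : Type u} [Field k] [Ring R] [Algebra k R] {t : ℕ} {ℓ : Fin t → ℕ}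
    (D : TD k R t ℓ) (V W : Type u) [AddCommGroup V] [Module k V] [AddCommGroup W]
    [Module k W] where
  J : Fin t → Prop
  φ : Fin t → V →ₗ[k] W
  ξ : Fin t → V →ₗ[k] V
  U : Fin t → Submodule k W
  hJ : ∀ i, J i → 2 ≤ ℓ i
  hφ : ∀ i, J i → φ i = 0
  hξ : ∀ i, ¬ J i → ξ i = 0
  hU : ∀ i, ¬ J i → ∀ v, φ i v ∈ U i
  hw : ∀ i, ¬ J i → D.w i ≠ 0
  hr : ∀ r ∈ D.Rel, ∀ v, ∑ i, r i • φ i v = 0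

namespace Core

variable {D : TD k R t ℓ}
  {V W : Type u} [AddCommGroup V] [Module k V] [AddCommGroup W] [Module k W] (X : Core D V W)

/-- The maps of the representation attached to core data. -/
def F (i : Fin t) (a : ℕ) : V × W →ₗ[k] V × W :=
  if a = 0 then ((X.ξ i).prod (X.φ i)) ∘ₗ LinearMap.fst k V W
  else LinearMap.inr k V W ∘ₗ LinearMap.snd k V W

lemma F_zero (i : Fin t) (z : V × W) : X.F i 0 z = (X.ξ i z.1, X.φ i z.1) := rfl

lemma F_pos (i : Fin t) {a : ℕ} (ha : 0 < a) (z : V × W) : X.F i a z = (0, z.2) := by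
  rw [F, if_neg ha.ne']; rfl

lemma chain_pos (i : Fin t) {a b : ℕ} (ha : 0 < a) (hab : a < b) (z : V × W) :
    chain (X.F i) a b z = (0, z.2) := by
  induction b, hab using Nat.le_induction with
  | base => rw [chain_succ _ le_rfl, chain_of_le _ le_rfl, F_pos X i ha]; rfl
  | succ b hb ih => rw [chain_succ _ (by omega), ih, F_pos X i (by omega)]

lemma chain_zero_one (i : Fin t) (z : V × W) : chain (X.F i) 0 1 z = (X.ξ i z.1, X.φ i z.1) := by
  rw [chain_succ _ le_rfl, chain_of_le _ le_rfl]; rfl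

lemma chain_zero (i : Fin t) {b : ℕ} (hb : 1 < b) (z : V × W) :
    chain (X.F i) 0 b z = (0, X.φ i z.1) := by
  rw [← chain_chain _ zero_le_one hb.le, chain_zero_one, chain_pos X i one_pos hb]

lemma chain_zero_ℓ (i : Fin t) (z : V × W) :
    chain (X.F i) 0 (ℓ i) z = (0, X.φ i z.1) := by
  rcases (D.hℓ i).lt_or_eq with h | h
  · exact X.chain_zero i h z
  · rw [← h, chain_zero_one, X.hξ i fun hJ => by have := X.hJ i hJ; omega]; rfl

/-- The spaces of the representation attached to core data. -/
def S : Vtx t ℓ → Submodule k (V × W) :=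
  fam ((⊤ : Submodule k V).prod ⊥) ((⊥ : Submodule k V).prod ⊤) fun i a =>
    (if a = 1 then LinearMap.range (X.ξ i) else ⊥).prod (if X.J i ∧ a + 1 ≠ ℓ i then ⊥ else X.U i)

lemma mem_S_src {z : V × W} : z ∈ X.S .src ↔ z.2 = 0 := by
  simp [S, Submodule.mem_prod]

lemma mem_S_snk {z : V × W} : z ∈ X.S .snk ↔ z.1 = 0 := by
  simp [S, Submodule.mem_prod]

lemma mem_S {i : Fin t} {a : ℕ} (h0 : 0 < a) (ha : a < ℓ i) {z : V × W} :
    z ∈ X.S (vtx t ℓ i a) ↔ (if a = 1 then ∃ v, X.ξ i v = z.1 else z.1 = 0) ∧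
      (if X.J i ∧ a + 1 ≠ ℓ i then z.2 = 0 else z.2 ∈ X.U i) := by
  rw [S, fam_vtx, if_neg h0.ne', if_pos ha, Submodule.mem_prod]
  split_ifs <;> simp

lemma snd_eq_zero {i : Fin t} (hi : X.J i) {a : ℕ} (ha : a + 1 < ℓ i) {z : V × W}
    (hz : z ∈ X.S (vtx t ℓ i a)) : z.2 = 0 := by
  rcases Nat.eq_zero_or_pos a with rfl | h0
  · rw [vtx_zero] at hz; exact X.mem_S_src.1 hz
  · have := ((X.mem_S h0 (by omega)).1 hz).2
    rwa [if_pos ⟨hi, by omega⟩] at this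

/-- The representation attached to core data. -/
def rep : Rep D (V × W) where
  S := X.S
  F := X.F
  hF i a ha z hz := by
    rcases Nat.eq_zero_or_pos a with rfl | h0
    · rw [F_zero]
      rcases (D.hℓ i).lt_or_eq with h | h
      · refine (X.mem_S one_pos h).2 ⟨by simp, ?_⟩
        split_ifs with hc
        · simp [X.hφ i hc.1]
        · by_cases hJ : X.J i
          · simp [X.hφ i hJ]
          · exact X.hU i hJ _
      · rw [vtx_snk i (0 + 1) one_pos h.ge, mem_S_snk,
          X.hξ i fun hJ => by have := X.hJ i hJ; omega]
        rfl
    · rw [X.F_pos i h0]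
      rcases (show a + 1 ≤ ℓ i from ha).lt_or_eq with h | h
      · refine (X.mem_S (by omega) h).2 ⟨?_, ?_⟩
        · rw [if_neg (by omega)]
        · have := ((X.mem_S h0 ha).1 hz).2
          change if X.J i ∧ a + 1 + 1 ≠ ℓ i then z.2 = 0 else z.2 ∈ X.U i
          split_ifs with hc
          · exact X.snd_eq_zero hc.1 h hz
          · by_cases hJ : X.J i
            · exact X.snd_eq_zero hJ h hz ▸ zero_mem _
            · rwa [if_neg (by tauto)] at this
      · rw [vtx_snk i _ (by omega) h.ge, mem_S_snk]
  hz i a b hab hb hne hp z hz := by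
    by_cases hJ : X.J i
    · have h2 : a + 1 < b := by
        by_contra hc
        obtain rfl : b = a + 1 := by omega
        exact D.arrow_ne i a hb hp
      have hz2 := X.snd_eq_zero hJ (by omega) hz
      rcases Nat.eq_zero_or_pos a with rfl | h0
      · rw [X.chain_zero i (by omega), X.hφ i hJ]; rfl
      · rw [X.chain_pos i h0 hab, hz2]; rfl
    · exact absurd hp (D.p_ne_zero_of_w (X.hw i hJ) hab.le hb)
  hr r hr z hz := by
    simp only [X.chain_zero_ℓ]
    refine Prod.ext ?_ ?_
    · simp [Prod.fst_sum]
    · simpa [Prod.snd_sum] using X.hr r hr z.1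

/-- The module attached to core data. -/
abbrev mod : ModuleCat.{u} R := X.rep.mod

/-- The inclusion of the space at the source. -/
def src : V →ₗ[k] X.rep.tot :=
  X.rep.inj .src ∘ₗ (LinearMap.inl k V W).codRestrict (X.rep.S .src) fun _ => X.mem_S_src.2 rfl

/-- The inclusion of the space at the sink. -/
def snk : W →ₗ[k] X.rep.tot :=
  X.rep.inj .snk ∘ₗ (LinearMap.inr k V W).codRestrict (X.rep.S .snk) fun _ => X.mem_S_snk.2 rfl

/-- The projection to the space at the source. -/
def prS : X.rep.tot →ₗ[k] V := LinearMap.fst k V W ∘ₗ LinearMap.proj .src ∘ₗ X.rep.tot.subtype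

/-- The projection to the space at the sink. -/
def prK : X.rep.tot →ₗ[k] W := LinearMap.snd k V W ∘ₗ LinearMap.proj .snk ∘ₗ X.rep.tot.subtype

lemma prS_apply (x : X.rep.tot) : X.prS x = (x.1 .src).1 := rfl

lemma prK_apply (x : X.rep.tot) : X.prK x = (x.1 .snk).2 := rfl

lemma src_mem (v : V) : D.e .src • X.src v = X.src v := X.rep.inj_mem _ _

lemma snk_mem (w : W) : D.e .snk • X.snk w = X.snk w := X.rep.inj_mem _ _

lemma src_val (v : V) : (X.src v).1 .src = (v, 0) := X.rep.inj_self _ _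

lemma snk_val (w : W) : (X.snk w).1 .snk = (0, w) := X.rep.inj_self _ _

lemma prS_src (v : V) : X.prS (X.src v) = v := by
  rw [prS_apply, src_val]

lemma prK_snk (w : W) : X.prK (X.snk w) = w := by
  rw [prK_apply, snk_val]

lemma src_prS {x : X.rep.tot} (hx : D.e .src • x = x) : X.src (X.prS x) = x := by
  refine X.rep.eq_of_at (X.src_mem _) hx ?_
  rw [src_val]
  exact Prod.ext rfl (X.mem_S_src.1 (X.rep.mem_tot.1 x.2 .src)).symm

lemma snk_prK {x : X.rep.tot} (hx : D.e .snk • x = x) : X.snk (X.prK x) = x := by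
  refine X.rep.eq_of_at (X.snk_mem _) hx ?_
  rw [snk_val]
  exact Prod.ext (X.mem_S_snk.1 (X.rep.mem_tot.1 x.2 .snk)).symm rfl

lemma w_src (i : Fin t) (v : V) : D.p i 0 (ℓ i) • X.src v = X.snk (X.φ i v) := by
  refine X.rep.eq_of_at (v := vtx t ℓ i (ℓ i)) (D.e_p_smul (Nat.zero_le _) le_rfl _) ?_ ?_
  · rw [D.vtx_ℓ]; exact X.snk_mem _
  · rw [X.rep.p_apply_self (Nat.zero_le _) le_rfl, vtx_zero, D.vtx_ℓ]
    change chain (X.F i) 0 (ℓ i) _ = _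
    rw [X.chain_zero_ℓ, src_val, snk_val]

lemma p_one_src {i : Fin t} (hi : 1 < ℓ i) {v : V} :
    D.p i 0 1 • X.src v = 0 ↔ X.ξ i v = 0 ∧ X.φ i v = 0 := by
  have h : (D.p i 0 1 • X.src v).1 (vtx t ℓ i 1) = (X.ξ i v, X.φ i v) := by
    rw [X.rep.p_apply_self zero_le_one hi.le, vtx_zero]
    change chain (X.F i) 0 1 _ = _
    rw [chain_zero_one, src_val]
  constructor
  · intro h0
    rw [h0] at h
    exact ⟨(congrArg Prod.fst h).symm, (congrArg Prod.snd h).symm⟩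
  · rintro ⟨h1, h2⟩
    rw [h1, h2] at h
    exact X.rep.eq_of_at (D.e_p_smul zero_le_one hi.le _) (smul_zero _) h

/-- The elements at an interior vertex which come from the space at the sink. -/
lemma exists_interior {i : Fin t} {a : ℕ} (h0 : 0 < a) (ha : a < ℓ i) (hJ : X.J i → a + 1 = ℓ i)
    {w : W} (hw : w ∈ X.U i) :
    ∃ x : X.rep.tot, D.e (vtx t ℓ i a) • x = x ∧ D.p i a (ℓ i) • x = X.snk w := by
  have hS : ((0, w) : V × W) ∈ X.S (vtx t ℓ i a) := by
    refine (X.mem_S h0 ha).2 ⟨?_, ?_⟩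
    · split_ifs
      · exact ⟨0, map_zero _⟩
      · rfl
    · rw [if_neg (by tauto)]; exact hw
  refine ⟨X.rep.inj _ ⟨_, hS⟩, X.rep.inj_mem _ _, ?_⟩
  refine X.rep.eq_of_at (v := vtx t ℓ i (ℓ i)) (D.e_p_smul ha.le le_rfl _) ?_ ?_
  · rw [D.vtx_ℓ]; exact X.snk_mem _
  · rw [X.rep.p_apply_self ha.le le_rfl, Rep.inj_self]
    change chain (X.F i) a (ℓ i) _ = _
    rw [X.chain_pos i h0 ha, D.vtx_ℓ, snk_val]

lemma prK_mem {i : Fin t} {a : ℕ} (h0 : 0 < a) (ha : a < ℓ i) (x : X.rep.tot) :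
    X.prK (D.p i a (ℓ i) • x) ∈ X.U i := by
  rw [prK_apply, ← D.vtx_ℓ i, X.rep.p_apply_self ha.le le_rfl]
  change (chain (X.F i) a (ℓ i) _).2 ∈ _
  rw [X.chain_pos i h0 ha]
  have := ((X.mem_S h0 ha).1 (X.rep.mem_tot.1 x.2 _)).2
  split_ifs at this
  · exact this ▸ zero_mem _
  · exact this

lemma exists_p_eq {i : Fin t} {a : ℕ} (h0 : 0 < a) (ha : a < ℓ i) {x : X.rep.tot}
    (hx : D.e (vtx t ℓ i a) • x = x) (h : D.p i a (ℓ i) • x = 0) :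
    ∃ v : V, x = D.p i 0 a • X.src v := by
  have hS := (X.mem_S h0 ha).1 (X.rep.mem_tot.1 x.2 _)
  have h2 : (x.1 (vtx t ℓ i a)).2 = 0 := by
    have := X.rep.p_apply_self ha.le le_rfl x
    rw [h] at this
    change _ = chain (X.F i) a (ℓ i) _ at this
    rw [X.chain_pos i h0 ha] at this
    exact (congrArg Prod.snd this).symm
  have key : ∃ v : V, x.1 (vtx t ℓ i a) = chain (X.F i) 0 a (v, 0) := by
    by_cases h1 : a = 1
    · subst h1
      obtain ⟨v, hv⟩ := hS.1
      by_cases hJ : X.J i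
      · exact ⟨v, by rw [chain_zero_one, X.hφ i hJ]; exact Prod.ext hv.symm h2⟩
      · refine ⟨0, Eq.trans (Prod.ext ?_ h2) (map_zero (chain (X.F i) 0 1)).symm⟩
        rw [← hv, X.hξ i hJ]; rfl
    · rw [if_neg h1] at hS
      exact ⟨0, Eq.trans (Prod.ext hS.1 h2) (map_zero (chain (X.F i) 0 a)).symm⟩
  obtain ⟨v, hv⟩ := key
  refine ⟨v, X.rep.eq_of_at hx (D.e_p_smul h0.le ha.le _) ?_⟩
  rw [X.rep.p_apply_self h0.le ha.le, hv, vtx_zero, src_val]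
  rfl

section Hom

variable {V' W' : Type u} [AddCommGroup V'] [Module k V'] [AddCommGroup W'] [Module k W']
  (X' : Core D V' W')

/-- Homomorphisms between modules attached to core data. -/
lemma exists_map (f : V →ₗ[k] V') (h : W →ₗ[k] W') (g : Fin t → V →ₗ[k] V')
    (hφ : ∀ i v, X'.φ i (f v) = h (X.φ i v)) (hg : ∀ i v, g i (X.ξ i v) = X'.ξ i (f v))
    (hU : ∀ i, ∀ w ∈ X.U i, h w ∈ X'.U i) (hJ : ∀ i, ¬ X.J i → X'.J i → ∀ w ∈ X.U i, h w = 0) :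
    ∃ F : X.rep.tot →ₗ[R] X'.rep.tot, (∀ v, F (X.src v) = X'.src (f v)) ∧
      ∀ w, F (X.snk w) = X'.snk (h w) := by
  have key : ∃ F : X.rep.tot →ₗ[R] X'.rep.tot, ∀ x v, (F x).1 v =
      fam (f.prodMap h) (f.prodMap h) (fun i _ => (g i).prodMap h) v (x.1 v) := by
    refine X.rep.exists_map X'.rep
      (fam (f.prodMap h) (f.prodMap h) fun i _ => (g i).prodMap h) (vtx_forall
        (fun z hz => X'.mem_S_src.2 ?_) (fun z hz => X'.mem_S_snk.2 ?_) fun i a h0 ha z hz => ?_)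
      fun i a ha z hz => ?_
    · have := X.mem_S_src.1 hz
      change h z.2 = 0
      rw [this, map_zero]
    · have := X.mem_S_snk.1 hz
      change f z.1 = 0
      rw [this, map_zero]
    · have hz' := (X.mem_S h0 ha).1 hz
      rw [fam_vtx, if_neg h0.ne', if_pos ha]
      refine (X'.mem_S h0 ha).2 ⟨?_, ?_⟩
      · change if a = 1 then ∃ v, X'.ξ i v = g i z.1 else g i z.1 = 0
        have := hz'.1
        split_ifs at this ⊢
        · obtain ⟨v, hv⟩ := this
          exact ⟨f v, by rw [← hv, hg]⟩
        · rw [this, map_zero]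
      · change if X'.J i ∧ a + 1 ≠ ℓ i then h z.2 = 0 else h z.2 ∈ X'.U i
        have := hz'.2
        by_cases hc : X.J i ∧ a + 1 ≠ ℓ i
        · rw [if_pos hc] at this
          rw [this, map_zero]
          split_ifs
          · rfl
          · exact zero_mem _
        · rw [if_neg hc] at this
          split_ifs with hc'
          · exact hJ i (by tauto) hc'.1 _ this
          · exact hU i _ this
    · rw [fam_vtx, fam_vtx, if_neg (Nat.succ_ne_zero a), if_pos ha]
      change (if a + 1 < ℓ i then (g i).prodMap h else f.prodMap h) (X.F i a z) =
        X'.F i a ((if a = 0 then f.prodMap h else (g i).prodMap h) z)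
      rcases Nat.eq_zero_or_pos a with rfl | h0
      · rw [if_pos rfl, F_zero, F_zero]
        split_ifs with h1
        · exact Prod.ext (hg i _) (hφ i _).symm
        · refine Prod.ext ?_ (hφ i _).symm
          have e1 : ¬ X.J i := fun hJ => by have := X.hJ i hJ; omega
          have e2 : ¬ X'.J i := fun hJ => by have := X'.hJ i hJ; omega
          change f (X.ξ i z.1) = X'.ξ i (f z.1)
          rw [X.hξ i e1, X'.hξ i e2]
          exact map_zero f
      · rw [if_neg h0.ne', F_pos X i h0, F_pos X' i h0]
        split_ifs
        · exact Prod.ext (map_zero (g i)) rfl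
        · exact Prod.ext (map_zero f) rfl
  obtain ⟨F, hF⟩ := key
  refine ⟨F, fun v => ?_, fun w => ?_⟩
  · refine X'.rep.eq_of_at (v := .src) (D.map_at F (X.src_mem v)) (X'.src_mem _) ?_
    rw [hF, src_val, src_val]
    exact Prod.ext rfl (map_zero h)
  · refine X'.rep.eq_of_at (v := .snk) (D.map_at F (X.snk_mem w)) (X'.snk_mem _) ?_
    rw [hF, snk_val, snk_val]
    exact Prod.ext (map_zero f) rfl

/-- A homomorphism between modules attached to core data is determined at the source and at the
sink by compatible linear maps. -/
lemma exists_restrict (G : X.rep.tot →ₗ[R] X'.rep.tot) :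
    ∃ (f : V →ₗ[k] V') (h : W →ₗ[k] W'), (∀ v, G (X.src v) = X'.src (f v)) ∧
      (∀ w, G (X.snk w) = X'.snk (h w)) ∧ (∀ i v, X'.φ i (f v) = h (X.φ i v)) ∧
      (∀ i, 1 < ℓ i → ∀ v, X.ξ i v = 0 → X.φ i v = 0 → X'.ξ i (f v) = 0) ∧
      ∀ i, 1 < ℓ i → ∀ w ∈ X.U i, h w ∈ X'.U i := by
  have h1 : ∀ v, G (X.src v) = X'.src (X'.prS (TD.toK (k := k) G (X.src v))) := fun v =>
    (X'.src_prS (D.map_at G (X.src_mem v))).symm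
  have h2 : ∀ w, G (X.snk w) = X'.snk (X'.prK (TD.toK (k := k) G (X.snk w))) := fun w =>
    (X'.snk_prK (D.map_at G (X.snk_mem w))).symm
  refine ⟨X'.prS ∘ₗ TD.toK G ∘ₗ X.src, X'.prK ∘ₗ TD.toK G ∘ₗ X.snk, h1, h2, fun i v => ?_,
    fun i hi v hξ hφ => ?_, fun i hi w hw => ?_⟩
  · have := congrArg X'.prK (X'.w_src i (X'.prS (TD.toK (k := k) G (X.src v))))
    rw [X'.prK_snk, ← h1, ← map_smul, X.w_src] at this
    exact this.symm
  · have h3 := (X.p_one_src hi).2 ⟨hξ, hφ⟩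
    have h4 := congrArg G h3
    rw [map_smul, map_zero, h1] at h4
    exact ((X'.p_one_src hi).1 h4).1
  · obtain ⟨x, -, hx⟩ := X.exists_interior (i := i) (a := ℓ i - 1) (by omega) (by omega)
      (fun _ => by omega) hw
    have := X'.prK_mem (i := i) (a := ℓ i - 1) (by omega) (by omega) (G x)
    rwa [← map_smul, hx] at this

end Hom

lemma indec (hne : Nontrivial V ∨ Nontrivial W)
    (H : ∀ (f : V →ₗ[k] V) (h : W →ₗ[k] W), (∀ v, f (f v) = f v) → (∀ w, h (h w) = h w) →
      (∀ i v, X.φ i (f v) = h (X.φ i v)) → (∀ i, X.J i → ∀ v, X.ξ i v = 0 → X.ξ i (f v) = 0) →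
      (∀ i, 1 < ℓ i → ∀ w ∈ X.U i, h w ∈ X.U i) →
      ((∀ v, f v = 0) ∧ ∀ w, h w = 0) ∨ ((∀ v, f v = v) ∧ ∀ w, h w = w)) : Indec R X.mod := by
  have key : ∀ G : X.rep.tot →ₗ[R] X.rep.tot, (∀ x, G (G x) = G x) → (∀ v, G (X.src v) = 0) →
      (∀ w, G (X.snk w) = 0) → ∀ x, G x = 0 := by
    intro G hG h0 h1 x
    refine D.ext_e (vtx_forall (P := fun v => D.e v • G x = D.e v • (0 : X.rep.tot)) ?_ ?_
      fun i a ha0 ha => ?_)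
    · rw [← map_smul, ← X.src_prS (D.e_e_self _ x), h0, smul_zero]
    · rw [← map_smul, ← X.snk_prK (D.e_e_self _ x), h1, smul_zero]
    · rw [← map_smul, smul_zero]
      have hz : D.p i a (ℓ i) • G (D.e (vtx t ℓ i a) • x) = 0 := by
        rw [← map_smul, ← X.snk_prK (x := D.p i a (ℓ i) • _)
          (by rw [← D.vtx_ℓ i]; exact D.e_p_smul ha.le le_rfl _), h1]
      obtain ⟨v, hv⟩ := X.exists_p_eq ha0 ha (D.map_at G (D.e_e_self _ x)) hz
      rw [← hG, hv, map_smul, h0, smul_zero]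
  refine ⟨?_, fun G hG => ?_⟩
  · rcases hne with h | h
    · obtain ⟨v, v', hv⟩ := exists_pair_ne V
      exact ⟨X.src v, X.src v', fun e => hv (by rw [← X.prS_src v, e, X.prS_src])⟩
    · obtain ⟨v, v', hv⟩ := exists_pair_ne W
      exact ⟨X.snk v, X.snk v', fun e => hv (by rw [← X.prK_snk v, e, X.prK_snk])⟩
  · have hG' : ∀ x, G (G x) = G x := fun x => LinearMap.congr_fun hG x
    obtain ⟨f, h, h1, h2, h3, h4, h5⟩ := X.exists_restrict X G
    rcases H f h
      (fun v => by rw [← X.prS_src (f (f v)), ← h1, ← h1, hG', h1, X.prS_src])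
      (fun w => by rw [← X.prK_snk (h (h w)), ← h2, ← h2, hG', h2, X.prK_snk]) h3
      (fun i hi v hv => h4 i (X.hJ i hi) v hv (by rw [X.hφ i hi]; rfl)) h5 with ⟨a, b⟩ | ⟨a, b⟩
    · left
      refine LinearMap.ext (key G hG' (fun v => ?_) fun w => ?_)
      · rw [h1, a, map_zero]
      · rw [h2, b, map_zero]
    · right
      refine LinearMap.ext fun x => (sub_eq_zero.1 ?_).symm
      refine key (LinearMap.id - G) (fun x => ?_) (fun v => ?_) (fun w => ?_) x
      · simp [hG']
      · simp [h1, a]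
      · simp [h2, b]

lemma fdMod [Module.Finite k V] [Module.Finite k W] : FdMod R X.mod := X.rep.fdMod

end Core

namespace TD

variable (D : TD k R t ℓ)

variable {D} in
lemma IsInt.indec {i : Fin t} {a b : ℕ} {M : ModuleCat.{u} R} (h : D.IsInt i a b M) :
    Indec R M := by
  let _ := kMod k R M
  obtain ⟨h0, hab, hb, x, hx, hxb, hxb', hg⟩ := h
  have hx0 : x ≠ 0 := fun h => hxb (by rw [h, smul_zero])
  refine ⟨⟨x, 0, hx0⟩, fun f hf => ?_⟩
  have key : ∃ c : k, f x = c • x := by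
    by_cases h : f x = 0
    · exact ⟨0, by rw [h, zero_smul]⟩
    · obtain ⟨j, h1, h2, h3, c, hc⟩ :=
        IsInt.eq_smul h0 hab hb hx hxb' hg (D.map_at f hx) h
      obtain rfl := vtx_inj_same (by omega) (by omega) h3
      exact ⟨c, by rw [hc, D.p_self_smul (by omega), hx]⟩
  obtain ⟨c, hc⟩ := key
  have hcc : (c * c) • x = c • x := by
    rw [mul_smul, ← hc, ← hom_smul f, ← hc]
    exact LinearMap.congr_fun hf x
  have hc' : c * c = c := by
    by_contra h
    exact hx0 ((smul_eq_zero.1 (by rw [sub_smul, hcc, sub_self] :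
      (c * c - c) • x = 0)).resolve_left (sub_ne_zero.2 h))
  rcases eq_or_ne c 0 with h | h
  · left
    refine LinearMap.ext fun m => ?_
    obtain ⟨r, rfl⟩ := hg m
    rw [map_smul, hc, h, zero_smul, smul_zero]; rfl
  · right
    obtain rfl : c = 1 := mul_left_cancel₀ h (hc'.trans (mul_one c).symm)
    refine LinearMap.ext fun m => ?_
    obtain ⟨r, rfl⟩ := hg m
    rw [map_smul, hc, one_smul]; rfl

/-- The representation which is one-dimensional on an interval of interior vertices of a branch. -/
def intRep (i : Fin t) (a b : ℕ) (hb : b < ℓ i) (hp : D.p i a b ≠ 0) : Rep D k where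
  S := fam ⊥ ⊥ fun j c => if j = i ∧ a ≤ c ∧ c ≤ b then ⊤ else ⊥
  F j c := if j = i ∧ a ≤ c ∧ c < b then LinearMap.id else 0
  hF j c hc z hz := by
    by_cases h : j = i ∧ a ≤ c ∧ c < b
    · obtain ⟨rfl, h1, h2⟩ := h
      rw [fam_vtx, if_neg (by omega), if_pos (by omega), if_pos ⟨rfl, by omega, by omega⟩]
      trivial
    · rw [if_neg h]; exact zero_mem _
  hz j c d hcd hd _ h z hz := by
    rw [fam_vtx] at hz
    by_cases hc : c ≠ 0 ∧ c < ℓ j ∧ j = i ∧ a ≤ c ∧ c ≤ b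
    · obtain ⟨hc0, hcl, rfl, h1, h2⟩ := hc
      by_cases hdb : d ≤ b
      · refine absurd ?_ hp
        rw [← D.p_comp j a d b (by omega) hdb hb.le, ← D.p_comp j a c d h1 hcd.le hd, h,
          zero_mul, mul_zero]
      · rw [← chain_chain _ (show c ≤ b + 1 by omega) (show b + 1 ≤ d by omega), chain_succ _ h2,
          if_neg (by omega)]
        exact map_zero _
    · have : z = 0 := by
        split_ifs at hz <;> first | exact hz | (exfalso; tauto)
      rw [this, map_zero]
  hr r hr z hz := by
    rw [show z = 0 from hz]; simp

lemma intRep_S (i : Fin t) (a b : ℕ) (hb : b < ℓ i) (hp : D.p i a b ≠ 0) :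
    (D.intRep i a b hb hp).S = fam ⊥ ⊥ fun j c => if j = i ∧ a ≤ c ∧ c ≤ b then ⊤ else ⊥ := rfl

lemma exists_isInt {i : Fin t} {a b : ℕ} (h0 : 0 < a) (hab : a ≤ b) (hb : b < ℓ i)
    (hp : D.p i a b ≠ 0) : ∃ M : ModuleCat.{u} R, FdMod R M ∧ D.IsInt i a b M := by
  let X := D.intRep i a b hb hp
  have hS : ∀ c, a ≤ c → c ≤ b → X.S (vtx t ℓ i c) = ⊤ := fun c h1 h2 => by
    rw [intRep_S, fam_vtx, if_neg (by omega), if_pos (by omega), if_pos ⟨rfl, h1, h2⟩]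
  have hF : ∀ c, a ≤ c → c < b → X.F i c = LinearMap.id := fun c h1 h2 => by
    change ite _ _ _ = _
    rw [if_pos ⟨rfl, h1, h2⟩]
  have hch : ∀ c, a ≤ c → c ≤ b → ∀ z, chain (X.F i) a c z = z := fun c h1 => by
    induction c, h1 using Nat.le_induction with
    | base => intro _ z; rw [chain_of_le _ le_rfl]; rfl
    | succ c hc ih => intro h2 z; rw [chain_succ _ hc, ih (by omega), hF c hc h2]; rfl
  let x := X.inj (vtx t ℓ i a) ⟨1, by rw [hS a le_rfl hab]; trivial⟩
  have hpx : ∀ c (h1 : a ≤ c) (h2 : c ≤ b) (z : k), X.inj (vtx t ℓ i c) ⟨z, by rw [hS c h1 h2]; trivial⟩ =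
      z • D.p i a c • x := fun c h1 h2 z => by
    rw [X.p_inj h1 (by omega), ← map_smul]
    congr 1
    refine Subtype.ext ?_
    change z = z • chain (X.F i) a c 1
    rw [hch c h1 h2, smul_eq_mul, mul_one]
  refine ⟨X.mod, X.fdMod, h0, hab, hb, x, X.inj_mem _ _, fun h => ?_, ?_, fun m => ?_⟩
  · have := hpx b hab le_rfl 1
    rw [h, smul_zero, ← LinearMap.map_zero (X.inj _)] at this
    exact one_ne_zero (congrArg Subtype.val (X.inj_injective _ this))
  · rw [X.p_inj (by omega) (by omega), ← LinearMap.map_zero (X.inj _)]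
    congr 1
    refine Subtype.ext ?_
    change chain (X.F i) a (b + 1) 1 = 0
    rw [chain_succ _ hab]
    change (ite _ _ _ : k →ₗ[k] k) _ = _
    rw [if_neg (by omega)]; rfl
  · suffices h : m ∈ Submodule.span R {x} by
      obtain ⟨r, hr⟩ := Submodule.mem_span_singleton.1 h
      exact ⟨r, hr.symm⟩
    have hz : ∀ v (m : X.tot), X.S v = ⊥ → D.e v • m = 0 := fun v m hv => by
      rw [X.eq_inj (D.e_e_self v m), ← LinearMap.map_zero (X.inj v)]
      congr 1
      have := X.mem_tot.1 (D.e v • m).2 v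
      rw [hv] at this
      exact Subtype.ext this
    rw [← D.sum_e m]
    refine sum_mem fun v _ => ?_
    clear * - v hz hpx
    revert v
    refine vtx_forall (by rw [hz _ m (by rw [intRep_S]; rfl)]; exact zero_mem _)
      (by rw [hz _ m (by rw [intRep_S]; rfl)]; exact zero_mem _) fun j c hc0 hc => ?_
    by_cases h : j = i ∧ a ≤ c ∧ c ≤ b
    · obtain ⟨rfl, h1, h2⟩ := h
      rw [X.eq_inj (D.e_e_self _ m), hpx c h1 h2, ← algebraMap_smul R, ← mul_smul]
      exact Submodule.smul_mem _ _ (Submodule.mem_span_singleton_self x)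
    · rw [hz _ m]
      · exact zero_mem _
      · rw [intRep_S, fam_vtx, if_neg hc0.ne', if_pos hc, if_neg h]

variable {D} in
lemma IsInt.at_eq_zero {i : Fin t} {a b : ℕ} {M : ModuleCat.{u} R} (h : D.IsInt i a b M) {j : ℕ}
    (hj : j < a) (m : M) (hm : D.e (vtx t ℓ i j) • m = m) : m = 0 := by
  let _ := kMod k R M
  by_contra hm0
  obtain ⟨h0, hab, hb, x, hx, hxb, hxb', hg⟩ := h
  obtain ⟨j', h1, h2, h3, -⟩ := IsInt.eq_smul h0 hab hb hx hxb' hg hm hm0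
  have := vtx_inj_same (by omega) (by omega) h3.symm
  omega

variable {D} in
lemma IsInt.step {i : Fin t} {a b a' b' : ℕ} {M N : ModuleCat.{u} R} (hM : D.IsInt i a b M)
    (hN : D.IsInt i a' b' N) (hfM : FdMod R M) (hfN : FdMod R N) (ha : a' ≤ a) (hb : b' ≤ b)
    (hab : a ≤ b') (hne : a' < a ∨ b' < b) : Step R M N := by
  have h1 := hM.at_eq_zero (j := a - 1) (by have := hM.1; omega)
  obtain ⟨h0, hab, hbl, x, hx, hxb, hxb', hg⟩ := id hM
  obtain ⟨h0', hab', hb', y, hy, hyb, hyb', hg'⟩ := id hN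
  obtain ⟨f, hf, -⟩ := D.exists_hom_mid h0 hab hbl hx hxb h1
    (y := D.p i a' a • y) (D.e_p_smul ha (by omega) y) (by
      rw [D.p_p_smul ha (by omega) (by omega), ← D.p_p_smul (show a' ≤ b' + 1 by omega)
        (show b' + 1 ≤ b + 1 by omega) (by omega), hyb', smul_zero])
  have hf0 : f ≠ 0 := fun h => hyb (by
    rw [← D.p_p_smul ha (by omega) (by omega), ← hf, h, LinearMap.zero_apply, smul_zero])
  refine ⟨hM.indec, hfM, hN.indec, hfN, f, hf0, fun hbij => ?_⟩
  have := (hN.of_hom hM (LinearEquiv.ofBijective f hbij).symm.toLinearMap fun h => ?_).2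
  · omega
  · have := hN.indec.1
    obtain ⟨n, hn⟩ := exists_ne (0 : N)
    exact hn ((LinearEquiv.ofBijective f hbij).symm.map_eq_zero_iff.1 (LinearMap.congr_fun h n))

/-- The simple module at an interior vertex. -/
def simp (i : Fin t) (a : ℕ) : ModuleCat.{u} R :=
  if h : ∃ M : ModuleCat.{u} R, FdMod R M ∧ D.IsInt i a a M then h.choose else ModuleCat.of R PUnit

lemma simp_spec {i : Fin t} {a : ℕ} (h0 : 0 < a) (ha : a < ℓ i) :
    FdMod R (D.simp i a) ∧ D.IsInt i a a (D.simp i a) := by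
  have h := D.exists_isInt h0 le_rfl ha (by rw [D.p_self i a ha.le]; exact D.e_ne _)
  rw [simp, dif_pos h]
  exact h.choose_spec

lemma indPath_simp {i : Fin t} {a b : ℕ} (h0 : 0 < a) (hab : a ≤ b) (hb : b < ℓ i) :
    IndPath R (D.simp i b) (D.simp i a) := by
  induction b, hab using Nat.le_induction with
  | base => exact .refl
  | succ b hab ih =>
    obtain ⟨N, hN, hN'⟩ := D.exists_isInt (show 0 < b by omega) (Nat.le_succ b) hb
      (D.arrow_ne i b (by omega))
    obtain ⟨h1, h2⟩ := D.simp_spec (i := i) (a := b + 1) (by omega) hb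
    obtain ⟨h3, h4⟩ := D.simp_spec (i := i) (a := b) (by omega) (by omega)
    exact .head (h2.step hN' h1 hN (by omega) le_rfl le_rfl (by omega))
      (.head (hN'.step h4 hN h3 le_rfl (by omega) le_rfl (by omega)) (ih (by omega)))

lemma one_lt_of_w_eq_zero {i : Fin t} (hi : D.w i = 0) : 1 < ℓ i := by
  have h1 := D.hℓ i
  by_contra h
  have : ℓ i = 1 := by omega
  exact D.arrow_ne i 0 h1 (by rw [zero_add, ← this]; exact hi)

variable {M : ModuleCat.{u} R}

lemma not_inLeftPart_of_zero {i : Fin t} (hi : D.w i = 0) (hM : Indec R M) (hf : FdMod R M) (s : M)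
    (hs0 : s ≠ 0) (hs : D.e .src • s = s) (hs' : D.p i 0 1 • s = 0)
    (hp : IndPath R (D.simp i 1) M) : ¬ InLeftPart R M := by
  intro hL
  have hl := D.one_lt_of_w_eq_zero hi
  have hne : D.p i (ℓ i) (ℓ i) ≠ 0 := by rw [D.p_self i _ le_rfl]; exact D.e_ne _
  have hex : ∃ a, D.p i (a + 1) (ℓ i) ≠ 0 := ⟨ℓ i - 1, by rwa [Nat.sub_add_cancel hl.le]⟩
  set a := Nat.find hex with ha
  have h1 : D.p i (a + 1) (ℓ i) ≠ 0 := Nat.find_spec hex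
  have hal : a + 1 < ℓ i := by
    have h2 := D.arrow_ne i (ℓ i - 1) (by omega)
    rw [Nat.sub_add_cancel hl.le] at h2
    have : a ≤ ℓ i - 2 := Nat.find_min' hex
      (by rwa [show ℓ i - 2 + 1 = ℓ i - 1 by omega])
    omega
  have h0 : D.p i a (ℓ i) = 0 := by
    rcases Nat.eq_zero_or_pos a with h | h
    · rw [h]; exact hi
    · by_contra hc
      have := Nat.find_min' hex (m := a - 1) (by rwa [Nat.sub_add_cancel h])
      omega
  rcases Nat.eq_zero_or_pos a with h | h
  · rw [h] at h0 h1 hal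
    obtain ⟨m, hm⟩ := D.pd_obstruction_zero i (by omega) h0 h1 (hL.2.2 M hM hf .refl) s
      (by rw [vtx_zero]; exact hs) hs'
    rw [if_pos rfl, zero_smul] at hm
    exact hs0 hm
  · obtain ⟨hS, hS'⟩ := D.simp_spec (i := i) h (by omega)
    obtain ⟨-, -, -, x, hx, hx0, hx', -⟩ := id hS'
    obtain ⟨m, hm⟩ := D.pd_obstruction_zero i (by omega) h0 h1 (hL.2.2 _ hS'.indec hS
      ((D.indPath_simp one_pos h (by omega)).trans hp)) x hx hx'
    rw [if_neg h.ne', ← D.p_e_smul (by omega) (by omega),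
      hS'.at_eq_zero (by omega) _ (D.e_e_self _ m), smul_zero] at hm
    exact hx0 (by rw [hm, smul_zero])

lemma not_inRightPart_of_zero {i : Fin t} (hi : D.w i = 0) (hM : Indec R M) (hf : FdMod R M) (s : M)
    (hs0 : ∀ m, s ≠ D.p i (ℓ i - 1) (ℓ i) • m) (hs : D.e .snk • s = s)
    (hp : IndPath R M (D.simp i (ℓ i - 1))) : ¬ InRightPart R M := by
  intro hL
  have hl := D.one_lt_of_w_eq_zero hi
  have hex : ∃ b, D.p i 0 b = 0 := ⟨ℓ i, hi⟩
  set b := Nat.find hex with hb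
  have h0 : D.p i 0 b = 0 := Nat.find_spec hex
  have hbl : b ≤ ℓ i := Nat.find_min' hex hi
  have hb1 : 1 < b := by
    by_contra hc
    interval_cases h : b
    · rw [D.p_self i 0 (Nat.zero_le _)] at h0
      exact D.e_ne _ h0
    · exact D.arrow_ne i 0 (by omega) h0
  have h1 : D.p i 0 (b - 1) ≠ 0 := Nat.find_min hex (by omega)
  rcases hbl.eq_or_lt with h | h
  · obtain ⟨m, hm⟩ := D.id_obstruction_zero i (by omega) hbl h0 h1 (hL.2.2 M hM hf .refl) s
      (by rw [h, D.vtx_ℓ]; exact hs) (fun h' => absurd h' (by omega))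
    rw [h] at hm
    exact hs0 m hm
  · obtain ⟨hS, hS'⟩ := D.simp_spec (i := i) (by omega : 0 < b) h
    obtain ⟨-, -, -, x, hx, hx0, hx', -⟩ := id hS'
    obtain ⟨m, hm⟩ := D.id_obstruction_zero i (by omega) hbl h0 h1 (hL.2.2 _ hS'.indec hS
      (hp.trans (D.indPath_simp (by omega) (by omega) (by omega)))) x hx fun _ => hx'
    rw [← D.p_e_smul (by omega) (by omega),
      hS'.at_eq_zero (by omega) _ (D.e_e_self _ m), smul_zero] at hm
    exact hx0 (by rw [hm, smul_zero])

lemma step_simp {i : Fin t} (hi : 1 < ℓ i) (hM : Indec R M) (hf : FdMod R M) {y s : M} (hy0 : y ≠ 0)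
    (hy : D.e (vtx t ℓ i 1) • y = y) (hy' : D.p i 1 2 • y = 0) (hs0 : s ≠ 0)
    (hs : D.e .src • s = s) : Step R (D.simp i 1) M := by
  obtain ⟨hS, hS'⟩ := D.simp_spec one_pos hi
  obtain ⟨-, -, -, x, hx, hx0, hx', -⟩ := id hS'
  obtain ⟨f, hfx, -⟩ := D.exists_hom_mid one_pos le_rfl hi hx hx0
    (hS'.at_eq_zero one_pos) hy hy'
  refine ⟨hS'.indec, hS, hM, hf, f, fun h => hy0 (by rw [← hfx, h]; rfl), fun hb => ?_⟩
  obtain ⟨n, rfl⟩ := hb.2 s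
  apply hs0
  rw [← hs, ← map_smul, hS'.midRep.1 _ (D.e_e_self _ n), map_zero]

lemma step_to_simp {i : Fin t} (hi : 1 < ℓ i) (hM : Indec R M) (hf : FdMod R M) [Module k M]
    [IsScalarTower k R M] (η : M →ₗ[k] k) {y s : M} (hy : D.e (vtx t ℓ i (ℓ i - 1)) • y = y)
    (hy0 : η y ≠ 0) (hη : ∀ m, η (D.p i (ℓ i - 2) (ℓ i - 1) • m) = 0) (hs0 : s ≠ 0)
    (hs : D.e .snk • s = s) : Step R M (D.simp i (ℓ i - 1)) := by
  let _ := kMod k R (D.simp i (ℓ i - 1))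
  obtain ⟨hS, hS'⟩ := D.simp_spec (i := i) (a := ℓ i - 1) (by omega) (by omega)
  obtain ⟨-, -, -, x, hx, hx0, hx', -⟩ := id hS'
  rw [D.p_self_smul (by omega), hx] at hx0
  have key : ∃ f : M →ₗ[R] D.simp i (ℓ i - 1), f y = η y • x := by
    obtain ⟨f, -, -, hf⟩ := D.exists_hom (0 : M →ₗ[k] D.simp i (ℓ i - 1)) 0
      (fun j c => if j = i ∧ c = ℓ i - 1 then η.smulRight x else 0)
      (fun m _ => zero_mem _) (fun m _ => zero_mem _) (fun j m _ => by rw [if_neg (by omega)])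
      (fun j m _ => by rw [if_neg (by rintro ⟨rfl, h⟩; omega)])
      (fun j c h0 hc m hm => by
        by_cases h : j = i ∧ c = ℓ i - 1
        · rw [if_pos h, h.1, h.2]; exact (D.at' _ _).smul_mem _ hx
        · rw [if_neg h]; exact zero_mem _)
      (fun j c hc m hm => by
        by_cases h : j = i ∧ c = ℓ i - 1
        · obtain ⟨rfl, rfl⟩ := h
          rw [if_pos ⟨rfl, rfl⟩, if_neg (by omega), LinearMap.smulRight_apply, smul_comm, hx',
            smul_zero]
          rfl
        · rw [if_neg h]
          by_cases h' : j = i ∧ c + 1 = ℓ i - 1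
          · obtain ⟨rfl, h'⟩ := h'
            obtain rfl : c = ℓ j - 2 := by omega
            rw [if_pos ⟨rfl, h'⟩, LinearMap.smulRight_apply, h', hη, zero_smul]
            simp
          · rw [if_neg h']
            simp)
    exact ⟨f, by rw [hf i _ (by omega) y hy, if_pos ⟨rfl, rfl⟩]; rfl⟩
  obtain ⟨f, hfy⟩ := key
  refine ⟨hM, hf, hS'.indec, hS, f, fun h => ?_, fun hb => ?_⟩
  · rw [h, LinearMap.zero_apply, eq_comm, smul_eq_zero] at hfy
    exact hfy.elim hy0 hx0
  · exact hs0 (hb.1 (by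
      rw [← hs, map_smul, hS'.midRep.2 _ (D.e_e_self _ _), map_zero]))

end TD

/-- Infinitely many pairwise nonisomorphic indecomposable modules outside of the left and the right
part. -/
lemma not_laura_of_seq {R : Type u} [Ring R] (M : ℕ → ModuleCat.{u} R) (hi : ∀ n, Indec R (M n))
    (hf : ∀ n, FdMod R (M n)) (hL : ∀ n, ¬ InLeftPart R (M n)) (hR : ∀ n, ¬ InRightPart R (M n))
    (hM : ∀ n n', Nonempty (M n ≃ₗ[R] M n') → n = n') : ¬ Laura R := by
  rintro ⟨S, hS, h⟩
  choose N hN e using fun n => h (M n) (hi n) (hf n) (hL n) (hR n)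
  have : Function.Injective fun n => (⟨N n, hN n⟩ : S) := fun n n' hn => by
    have hn' : N n = N n' := congrArg Subtype.val hn
    have h1 := e n
    rw [hn'] at h1
    exact hM n n' ⟨h1.some.trans (e n').some.symm⟩
  have := hS.to_subtype
  exact not_injective_infinite_finite _ ‹Function.Injective _›

/-- An idempotent commuting with a nilpotent map with one-dimensional kernel is trivial. -/
lemma idem_eq_of_commute {k V : Type*} [Field k] [AddCommGroup V] [Module k V] (N f : V →ₗ[k] V)
    {z : V} (hz : N z = 0) (hN : ∀ v, N v = 0 → ∃ c : k, v = c • z) {n : ℕ}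
    (hn : ∀ v, (N ^ n) v = 0) (hf : ∀ v, f (f v) = f v) (hc : ∀ v, N (f v) = f (N v)) :
    (∀ v, f v = 0) ∨ ∀ v, f v = v := by
  have key : ∀ g : V →ₗ[k] V, (∀ v, g (g v) = g v) → (∀ v, N (g v) = g (N v)) → g z = 0 →
      ∀ v, g v = 0 := by
    intro g hg hgc hgz v
    by_contra hv
    have hex : ∃ j, (N ^ j) (g v) = 0 := ⟨n, hn _⟩
    obtain ⟨j, hj⟩ : ∃ j, Nat.find hex = j + 1 := by
      refine Nat.exists_eq_succ_of_ne_zero fun h => hv ?_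
      have := Nat.find_spec hex
      rw [h] at this
      simpa using this
    have h1 : (N ^ (j + 1)) (g v) = 0 := hj ▸ Nat.find_spec hex
    have h2 : (N ^ j) (g v) ≠ 0 := Nat.find_min hex (by omega)
    have h3 : ∀ j, (N ^ j) (g v) = g ((N ^ j) v) := fun j => by
      induction j with
      | zero => rfl
      | succ j ih => rw [pow_succ', Module.End.mul_apply, ih, hgc]; rfl
    obtain ⟨c, hc⟩ := hN ((N ^ j) (g v)) (by rw [← h1, pow_succ']; rfl)
    apply h2
    rw [h3, ← hg, ← h3, hc, map_smul, hgz, smul_zero]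
  obtain ⟨c, hc'⟩ := hN (f z) (by rw [hc, hz, map_zero])
  by_cases h : f z = 0
  · exact .inl (key f hf hc h)
  · right
    have h1 : f z = z := by
      have : c • f z = c • z := by rw [← map_smul, ← hc', hf]
      have hc0 : c ≠ 0 := by rintro rfl; exact h (by rw [hc', zero_smul])
      exact smul_right_injective V hc0 this
    intro v
    refine (sub_eq_zero.1 (key (LinearMap.id - f) (fun v => ?_) (fun v => ?_) ?_ v)).symm
    · simp [hf]
    · simp [hc]
    · simp [h1]

namespace Core

variable {D : TD k R t ℓ}
  {V W : Type u} [AddCommGroup V] [Module k V] [AddCommGroup W] [Module k W] (X : Core D V W)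

lemma src_ne_zero {v : V} (hv : v ≠ 0) : X.src v ≠ 0 := fun h => hv (by
  rw [← X.prS_src v, h, map_zero])

lemma snk_ne_zero {w : W} (hw : w ≠ 0) : X.snk w ≠ 0 := fun h => hw (by
  rw [← X.prK_snk w, h, map_zero])

lemma p_two_src {i : Fin t} (hi : X.J i) (v : V) : D.p i 0 2 • X.src v = 0 := by
  have h2 := X.hJ i hi
  refine Subtype.ext (funext fun u => ?_)
  rw [X.rep.p_apply (Nat.zero_le 2) h2, vtx_zero, src_val]
  change ite _ (chain (X.F i) 0 2 _) _ = _
  rw [X.chain_zero i one_lt_two, X.hφ i hi]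
  exact ite_self _

lemma prK_p_eq_zero {i : Fin t} (hi : X.J i) {a : ℕ} (ha : a + 1 < ℓ i) (x : X.rep.tot) :
    X.prK (D.p i a (ℓ i) • x) = 0 := by
  rw [prK_apply, X.rep.p_apply (by omega) le_rfl, D.vtx_ℓ, if_pos rfl]
  have h := X.snd_eq_zero hi ha (X.rep.mem_tot.1 x.2 (vtx t ℓ i a))
  change (chain (X.F i) a (ℓ i) _).2 = 0
  rcases Nat.eq_zero_or_pos a with rfl | h0
  · rw [X.chain_zero_ℓ, X.hφ i hi]; rfl
  · rw [X.chain_pos i h0 (by omega), h]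

lemma step_simp {i : Fin t} (hi : X.J i) (hM : Indec R X.mod) (hf : FdMod R X.mod) {v : V}
    (hv : X.ξ i v ≠ 0) : Step R (D.simp i 1) X.mod := by
  have hl := X.hJ i hi
  refine D.step_simp hl hM hf (y := D.p i 0 1 • X.src v) (s := X.src v) (fun h => ?_)
    (D.e_p_smul zero_le_one (by omega) _) ?_ (X.src_ne_zero fun h => hv (by rw [h, map_zero]))
    (X.src_mem v)
  · exact hv ((X.p_one_src hl).1 h).1
  · rw [D.p_p_smul zero_le_one one_le_two hl, X.p_two_src hi]

lemma step_to_simp {i : Fin t} (hi : X.J i) (hM : Indec R X.mod) (hf : FdMod R X.mod) {u : W}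
    (hu : u ∈ X.U i) (hu0 : u ≠ 0) : Step R X.mod (D.simp i (ℓ i - 1)) := by
  have hl := X.hJ i hi
  obtain ⟨y, hy, hyu⟩ := X.exists_interior (i := i) (a := ℓ i - 1) (by omega) (by omega)
    (fun _ => by omega) hu
  obtain ⟨ζ, hζ⟩ := Module.Projective.exists_dual_eq_one k hu0
  refine D.step_to_simp hl hM hf (ζ ∘ₗ X.prK ∘ₗ TD.act X.rep.tot (D.p i (ℓ i - 1) (ℓ i))) hy ?_
    (fun m => ?_) (X.snk_ne_zero hu0) (X.snk_mem u)
  · simp [TD.act_apply, hyu, X.prK_snk, hζ]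
  · rw [LinearMap.comp_apply, LinearMap.comp_apply, TD.act_apply,
      D.p_p_smul (by omega) (by omega) le_rfl, X.prK_p_eq_zero hi (by omega), map_zero]

lemma p_one_eq_zero {i : Fin t} (hi : X.J i) {v : V} (hv : X.ξ i v = 0) :
    D.p i 0 1 • X.src v = 0 :=
  (X.p_one_src (X.hJ i hi)).2 ⟨hv, by rw [X.hφ i hi]; rfl⟩

lemma snk_ne {i : Fin t} (hi : X.J i) {w : W} (hw : w ∉ X.U i) (m : X.rep.tot) :
    X.snk w ≠ D.p i (ℓ i - 1) (ℓ i) • m := fun h => hw (by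
  have hl := X.hJ i hi
  rw [← X.prK_snk w, h]
  exact X.prK_mem (by omega) (by omega) m)

lemma not_inLeftPart {i : Fin t} (hi : X.J i) (hw : D.w i = 0) (hM : Indec R X.mod)
    (hf : FdMod R X.mod) {v v' : V} (hv : v ≠ 0) (hξ : X.ξ i v = 0) (hξ' : X.ξ i v' ≠ 0) :
    ¬ InLeftPart R X.mod :=
  D.not_inLeftPart_of_zero hw hM hf _ (X.src_ne_zero hv) (X.src_mem v) (X.p_one_eq_zero hi hξ)
    (.single (X.step_simp hi hM hf hξ'))

lemma not_inRightPart {i : Fin t} (hi : X.J i) (hw : D.w i = 0) (hM : Indec R X.mod)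
    (hf : FdMod R X.mod) {w u : W} (hwU : w ∉ X.U i) (hu : u ∈ X.U i) (hu0 : u ≠ 0) :
    ¬ InRightPart R X.mod :=
  D.not_inRightPart_of_zero hw hM hf _ (X.snk_ne hi hwU) (X.snk_mem w)
    (.single (X.step_to_simp hi hM hf hu hu0))

variable {V' W' : Type u} [AddCommGroup V'] [Module k V'] [AddCommGroup W'] [Module k W']
  (X' : Core D V' W')

lemma finrank_eq [Module.Finite k V] [Module.Finite k V'] (e : X.mod ≃ₗ[R] X'.mod) :
    Module.finrank k V = Module.finrank k V' := by
  obtain ⟨f, -, hf, -⟩ := X.exists_restrict X' e.toLinearMap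
  obtain ⟨g, -, hg, -⟩ := X'.exists_restrict X e.symm.toLinearMap
  have h1 : ∀ v, g (f v) = v := fun v => by
    rw [← X.prS_src (g (f v)), ← hg, ← hf]
    change X.prS (e.symm (e _)) = v
    rw [e.symm_apply_apply, X.prS_src]
  have h2 : ∀ v, f (g v) = v := fun v => by
    rw [← X'.prS_src (f (g v)), ← hf, ← hg]
    change X'.prS (e (e.symm _)) = v
    rw [e.apply_symm_apply, X'.prS_src]
  exact LinearEquiv.finrank_eq (LinearEquiv.ofLinearMap f g (LinearMap.ext h2) (LinearMap.ext h1))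

/-- A sequence of core modules of growing dimension outside of the left and the right part. -/
lemma not_laura {V W : ℕ → Type u} [∀ n, AddCommGroup (V n)] [∀ n, Module k (V n)]
    [∀ n, AddCommGroup (W n)] [∀ n, Module k (W n)] [∀ n, Module.Finite k (V n)]
    [∀ n, Module.Finite k (W n)] (X : ∀ n, Core D (V n) (W n)) (hi : ∀ n, Indec R (X n).mod)
    (hL : ∀ n, ¬ InLeftPart R (X n).mod) (hR : ∀ n, ¬ InRightPart R (X n).mod)
    (hV : ∀ n n', Module.finrank k (V n) = Module.finrank k (V n') → n = n') : ¬ Laura R :=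
  not_laura_of_seq (fun n => (X n).mod) hi (fun n => (X n).fdMod) hL hR fun n n' ⟨e⟩ =>
    hV n n' ((X n).finrank_eq (X n') e)

end Core

namespace TD

variable (D : TD k R t ℓ)

/-- The one-dimensional core data on a branch system with exactly one zero branch. -/
def oneCore {b : R} {c : Fin t → k} {i₀ : Fin t} (hb0 : b ≠ 0) (hb : ∀ i, D.w i = c i • b)
    (hc0 : c i₀ = 0) (hc : ∀ i, i ≠ i₀ → c i ≠ 0) (x : k) (U : Submodule k k) : Core D k k where
  J i := i = i₀
  φ i := c i • LinearMap.id
  ξ i := if i = i₀ then x • LinearMap.id else 0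
  U i := if i = i₀ then U else ⊤
  hJ := by
    rintro i rfl
    exact D.one_lt_of_w_eq_zero (by rw [hb, hc0, zero_smul])
  hφ := by rintro i rfl; rw [hc0, zero_smul]
  hξ i hi := if_neg hi
  hU i hi v := by rw [if_neg hi]; trivial
  hw i hi h := (smul_ne_zero (hc i hi) hb0) (by rw [← hb, h])
  hr r hr v := by
    simp only [LinearMap.smul_apply, LinearMap.id_apply, ← mul_smul, ← Finset.sum_smul,
      D.mem_Lam_of hb0 hb r hr, zero_smul]

theorem not_weaklyShod_of_one_zero {b : R} {c : Fin t → k} {i₀ : Fin t} (hb0 : b ≠ 0)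
    (hb : ∀ i, D.w i = c i • b) (hc0 : c i₀ = 0) (hc : ∀ i, i ≠ i₀ → c i ≠ 0)
    (ht : ∃ i, i ≠ i₀) : ¬ WeaklyShod R := by
  intro hWS
  have hw : D.w i₀ = 0 := by rw [hb, hc0, zero_smul]
  have hl := D.one_lt_of_w_eq_zero hw
  let X (x : k) (U : Submodule k k) : Core D k k := D.oneCore hb0 hb hc0 hc x U
  have hξ : ∀ x U v, (X x U).ξ i₀ v = x • v := fun x U v => by
    change (ite _ _ _ : k →ₗ[k] k) v = _
    rw [if_pos rfl]; rfl
  have hU : ∀ x U, (X x U).U i₀ = U := fun x U => if_pos rfl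
  have hind : ∀ x U, Indec R (X x U).mod := fun x U => by
    refine (X x U).indec (.inl inferInstance) fun f h hf hh hφ _ _ => ?_
    obtain ⟨i, hi⟩ := ht
    have hfh : ∀ v, f v = h v := fun v => by
      have := hφ i v
      change c i • f v = h (c i • v) at this
      rw [map_smul] at this
      exact smul_right_injective k (hc i hi) this
    have hf1 : ∀ v, f v = f 1 * v := fun v => by
      rw [← smul_eq_mul, smul_eq_mul, mul_comm, ← smul_eq_mul, ← map_smul, smul_eq_mul, mul_one]
    have h1 := hf 1
    rw [hf1 (f 1)] at h1
    rcases eq_or_ne (f 1) 0 with h0 | h0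
    · have : ∀ v, f v = 0 := fun v => by rw [hf1, h0, zero_mul]
      exact .inl ⟨this, fun v => by rw [← hfh, this]⟩
    · have h2 : f 1 = 1 := mul_left_cancel₀ h0 (h1.trans (mul_one _).symm)
      have : ∀ v, f v = v := fun v => by rw [hf1, h2, one_mul]
      exact .inr ⟨this, fun v => by rw [← hfh, this]⟩
  have hmap : ∀ x U x' U', x' = 0 → U ≤ U' → ∃ F : (X x U).rep.tot →ₗ[R] (X x' U').rep.tot,
      (∀ v, F ((X x U).src v) = (X x' U').src v) ∧ ∀ w, F ((X x U).snk w) = (X x' U').snk w := by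
    intro x U x' U' hx' hU'
    refine (X x U).exists_map (X x' U') LinearMap.id LinearMap.id 0 (fun i v => rfl)
      (fun i v => ?_) (fun i w hw => ?_) fun i h1 h2 => absurd h2 h1
    · by_cases hi : i = i₀
      · subst hi
        rw [hξ, hx', hξ, zero_smul]; rfl
      · rw [(X x' U').hξ i hi]; rfl
    · by_cases hi : i = i₀
      · subst hi
        rw [hU] at hw ⊢
        exact hU' hw
      · change w ∈ ite _ _ _
        rw [if_neg hi]; trivial
  have h10 : (1 : k) ∉ (⊥ : Submodule k k) := fun h => one_ne_zero ((Submodule.mem_bot k).1 h)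
  have hne : ∀ x U x' U' (F : (X x U).rep.tot →ₗ[R] (X x' U').rep.tot),
      (∀ v, F ((X x U).src v) = (X x' U').src v) → F ≠ 0 := fun x U x' U' F hF h =>
    (X x' U').src_ne_zero (one_ne_zero (α := k)) (by rw [← hF, h]; rfl)
  have s1 : Step R (X 1 ⊥).mod (X 0 ⊥).mod := by
    obtain ⟨F, hF, -⟩ := hmap 1 ⊥ 0 ⊥ rfl le_rfl
    refine ⟨hind _ _, (X _ _).fdMod, hind _ _, (X _ _).fdMod, F, hne _ _ _ _ F hF, fun hb => ?_⟩
    have h1 : D.p i₀ 0 1 • (X 1 ⊥).src 1 = 0 := hb.1 (by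
      rw [map_smul, hF, (X 0 ⊥).p_one_eq_zero rfl (by rw [hξ, zero_smul]), map_zero])
    have := (((X 1 ⊥).p_one_src hl).1 h1).1
    rw [hξ, one_smul] at this
    exact one_ne_zero this
  have s2 : Step R (X 0 ⊥).mod (X 0 ⊤).mod := by
    obtain ⟨F, hF, hF'⟩ := hmap 0 ⊥ 0 ⊤ rfl bot_le
    refine ⟨hind _ _, (X _ _).fdMod, hind _ _, (X _ _).fdMod, F, hne _ _ _ _ F hF, fun hb => ?_⟩
    obtain ⟨y, hy, hyu⟩ := (X 0 ⊤).exists_interior (i := i₀) (a := ℓ i₀ - 1) (w := 1) (by omega)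
      (by omega) (fun _ => by omega) (by rw [hU]; trivial)
    obtain ⟨m, rfl⟩ := hb.2 y
    refine (X 0 ⊥).snk_ne (i := i₀) rfl (w := 1) (by rw [hU]; exact h10) m (hb.1 ?_)
    rw [map_smul, hyu, hF']
  have s3 := (X 0 ⊤).step_to_simp (i := i₀) rfl (hind _ _) (X _ _).fdMod (u := 1)
    (by rw [hU]; trivial) one_ne_zero
  have s4 := (X 1 ⊥).step_simp (i := i₀) rfl (hind _ _) (X _ _).fdMod (v := 1)
    (by rw [hξ, one_smul]; exact one_ne_zero)
  refine hWS (X 0 ⊥).mod (hind _ _) (X _ _).fdMod ?_ ?_ ?_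
  · exact D.not_inLeftPart_of_zero hw (hind _ _) (X _ _).fdMod _
      ((X 0 ⊥).src_ne_zero (one_ne_zero (α := k))) ((X 0 ⊥).src_mem 1)
      ((X 0 ⊥).p_one_eq_zero rfl (by rw [hξ, zero_smul])) (.head s4 (.single s1))
  · exact D.not_inRightPart_of_zero hw (hind _ _) (X _ _).fdMod _
      ((X 0 ⊥).snk_ne (i := i₀) rfl (w := 1) (by rw [hU]; exact h10)) ((X 0 ⊥).snk_mem 1)
      (.head s2 (.single s3))
  · refine .head' s2 (.head s3 ?_)
    exact (D.indPath_simp one_pos (by omega) (by omega)).trans (.head s4 (.single s1))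

end TD

/-- The nilpotent shift. -/
def shift (k : Type u) [Field k] (n : ℕ) : (Fin (n + 2) → k) →ₗ[k] (Fin (n + 2) → k) :=
  LinearMap.pi fun i => if h : i.1 + 1 < n + 2 then LinearMap.proj ⟨i.1 + 1, h⟩ else 0

section shift

variable (k : Type u) [Field k] (n : ℕ)

lemma shift_apply (v : Fin (n + 2) → k) (i : Fin (n + 2)) :
    shift k n v i = if h : i.1 + 1 < n + 2 then v ⟨i.1 + 1, h⟩ else 0 := by
  simp only [shift, LinearMap.pi_apply]
  split_ifs <;> rfl

lemma shift_pow_apply (j : ℕ) (v : Fin (n + 2) → k) (i : Fin (n + 2)) :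
    (shift k n ^ j) v i = if h : i.1 + j < n + 2 then v ⟨i.1 + j, h⟩ else 0 := by
  induction j generalizing i with
  | zero => simp
  | succ j ih =>
    rw [pow_succ', Module.End.mul_apply, shift_apply]
    split_ifs with h1 h2 h2
    · rw [ih, dif_pos (by simpa using by omega)]
      congr 2
      simp; omega
    · rw [ih, dif_neg (by simp; omega)]
    · omega
    · rfl

lemma shift_pow_eq_zero (v : Fin (n + 2) → k) : (shift k n ^ (n + 2)) v = 0 := by
  funext i
  rw [shift_pow_apply, dif_neg (by omega)]; rfl

lemma shift_zero : shift k n (Pi.single 0 1) = 0 := by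
  funext i
  rw [shift_apply]
  split_ifs with h
  · exact Pi.single_eq_of_ne (fun e => by simpa using congrArg Fin.val e) _
  · rfl

lemma shift_one : shift k n (Pi.single 1 1) = Pi.single 0 1 := by
  funext i
  rw [shift_apply]
  split_ifs with h
  · simp only [Pi.single_apply, Fin.ext_iff]
    congr 1
    simp
  · have hi : i ≠ 0 := by
      rintro rfl
      exact h (by simp)
    rw [Pi.single_eq_of_ne hi]

lemma shift_ker (v : Fin (n + 2) → k) (h : shift k n v = 0) :
    ∃ c : k, v = c • (Pi.single 0 1 : Fin (n + 2) → k) := by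
  refine ⟨v 0, funext fun i => ?_⟩
  rcases Fin.eq_zero_or_eq_succ i with rfl | ⟨j, rfl⟩
  · simp
  · have := congrFun h j.castSucc
    rw [shift_apply, dif_pos (show j.castSucc.1 + 1 < n + 2 from Nat.succ_lt_succ j.2)] at this
    rw [Pi.smul_apply, Pi.single_eq_of_ne (Fin.succ_ne_zero j), smul_zero]
    exact this

lemma shift_last (v : Fin (n + 2) → k) : shift k n v (Fin.last _) = 0 := by
  rw [shift_apply, dif_neg (by simp)]

lemma single_zero_ne : (Pi.single 0 1 : Fin (n + 2) → k) ≠ 0 := fun h => by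
  simpa using congrFun h 0

lemma last_notMem_range : (Pi.single (Fin.last _) 1 : Fin (n + 2) → k) ∉
    LinearMap.range (shift k n) := by
  rintro ⟨v, hv⟩
  have := congrFun hv (Fin.last _)
  rw [shift_last, Pi.single_eq_same] at this
  exact zero_ne_one this

lemma shift_idem (f : (Fin (n + 2) → k) →ₗ[k] (Fin (n + 2) → k)) (hf : ∀ v, f (f v) = f v)
    (hc : ∀ v, shift k n (f v) = f (shift k n v)) : (∀ v, f v = 0) ∨ ∀ v, f v = v :=
  idem_eq_of_commute _ f (shift_zero k n) (shift_ker k n) (shift_pow_eq_zero k n) hf hc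

end shift

/-- Vectors annihilated by two independent families of scalars vanish. -/
lemma eq_zero_of_pencil {ι k V : Type*} [Field k] [AddCommGroup V] [Module k V] {lam mu : ι → k}
    (h : ∀ x y : k, (∀ i, x * lam i + y * mu i = 0) → x = 0 ∧ y = 0) {a b : V}
    (hab : ∀ i, lam i • a + mu i • b = 0) : a = 0 ∧ b = 0 := by
  have key : ∀ ζ : Module.Dual k V, ζ a = 0 ∧ ζ b = 0 := fun ζ => h _ _ fun i => by
    simpa [mul_comm] using congrArg ζ (hab i)
  exact ⟨(Module.forall_dual_apply_eq_zero_iff k a).1 fun ζ => (key ζ).1,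
    (Module.forall_dual_apply_eq_zero_iff k b).1 fun ζ => (key ζ).2⟩

namespace TD

variable (D : TD k R t ℓ)

lemma exists_coeffs : ∃ c : Fin D.m → Fin t → k, (∀ j, c j ∈ D.Lam) ∧
    ∀ x : Fin D.m → k, (∀ i, ∑ j, x j * c j i = 0) → x = 0 := by
  have : Module.Finite k (Submodule.span k (Set.range D.w)) :=
    Module.Finite.span_of_finite k (Set.finite_range _)
  let B : Module.Basis (Fin D.m) k (Submodule.span k (Set.range D.w)) := Module.finBasis k _
  let w' : Fin t → Submodule.span k (Set.range D.w) := fun i =>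
    ⟨D.w i, Submodule.subset_span ⟨i, rfl⟩⟩
  refine ⟨fun j i => B.coord j (w' i), fun j => D.mem_Lam.2 fun r hr => ?_, fun x hx => ?_⟩
  · have h : ∑ i, r i • w' i = 0 := Subtype.ext (by
      simpa [w', Submodule.coe_sum] using D.mem_Rel.1 hr)
    simpa [map_sum] using congrArg (B.coord j) h
  · have hz : ∑ j, x j • B.coord j = 0 := by
      refine LinearMap.ext fun ⟨s, hs⟩ => ?_
      induction hs using Submodule.span_induction with
      | mem s hs =>
        obtain ⟨i, rfl⟩ := hs
        simpa [LinearMap.sum_apply] using hx i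
      | zero => exact map_zero _
      | add s s' hs hs' h1 h2 =>
        have := map_add (∑ j, x j • B.coord j) ⟨s, hs⟩ ⟨s', hs'⟩
        rw [h1, h2] at this
        exact this.trans (add_zero _)
      | smul c s hs h =>
        have := map_smul (∑ j, x j • B.coord j) c ⟨s, hs⟩
        rw [h] at this
        exact this.trans (smul_zero _)
    funext j
    have := LinearMap.congr_fun hz (B j)
    rw [LinearMap.sum_apply, Finset.sum_eq_single j (fun i _ hi => ?_) (by simp)] at this
    · simpa using this
    · simp [hi.symm]

lemma exists_pencil (h : 2 ≤ D.m) : ∃ lam ∈ D.Lam, ∃ mu ∈ D.Lam,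
    ∀ x y : k, (∀ i, x * lam i + y * mu i = 0) → x = 0 ∧ y = 0 := by
  obtain ⟨c, hc, hx⟩ := D.exists_coeffs
  have h01 : (⟨0, by omega⟩ : Fin D.m) ≠ ⟨1, by omega⟩ := fun h => by simp at h
  refine ⟨c ⟨0, by omega⟩, hc _, c ⟨1, by omega⟩, hc _, fun x y hxy => ?_⟩
  have h := hx (fun j => if j = ⟨0, by omega⟩ then x else if j = ⟨1, by omega⟩ then y else 0)
    fun i => by
      rw [Finset.sum_eq_add_of_mem _ _ (Finset.mem_univ _) (Finset.mem_univ _) h01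
        (fun j _ hj => by rw [if_neg hj.1, if_neg hj.2, zero_mul]), if_pos rfl,
        if_neg h01.symm, if_pos rfl, hxy i]
  constructor
  · have := congrFun h ⟨0, by omega⟩
    rwa [if_pos rfl] at this
  · have := congrFun h ⟨1, by omega⟩
    rwa [if_neg h01.symm, if_pos rfl] at this

lemma Lam_eq_zero {θ : Fin t → k} (hθ : θ ∈ D.Lam) {i : Fin t} (hi : D.w i = 0) : θ i = 0 := by
  have := D.mem_Lam.1 hθ (Pi.single i 1) (D.mem_Rel.2 (by
    rw [Finset.sum_eq_single i (fun j _ hj => by rw [Pi.single_eq_of_ne hj, zero_smul])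
      (by simp), hi, smul_zero]))
  simpa [Pi.single_apply] using this

/-- Core data attached to a pencil `lam + mu N`. -/
def pencil {V : Type u} [AddCommGroup V] [Module k V] {lam mu : Fin t → k} (hlam : lam ∈ D.Lam)
    (hmu : mu ∈ D.Lam) (N : V →ₗ[k] V) (J : Fin t → Prop) (ξ : Fin t → V →ₗ[k] V)
    (U : Fin t → Submodule k V) (hJ : ∀ i, J i → 2 ≤ ℓ i) (h0 : ∀ i, J i → lam i = 0 ∧ mu i = 0)
    (hξ : ∀ i, ¬ J i → ξ i = 0) (hU : ∀ i, ¬ J i → ∀ v, lam i • v + mu i • N v ∈ U i)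
    (hw : ∀ i, ¬ J i → D.w i ≠ 0) : Core D V V where
  J := J
  φ i := lam i • LinearMap.id + mu i • N
  ξ := ξ
  U := U
  hJ := hJ
  hφ i hi := by rw [(h0 i hi).1, (h0 i hi).2, zero_smul, zero_smul, add_zero]
  hξ := hξ
  hU := hU
  hw := hw
  hr r hr v := by
    have h1 := D.mem_Lam.1 hlam r hr
    have h2 := D.mem_Lam.1 hmu r hr
    simp only [LinearMap.add_apply, LinearMap.smul_apply, LinearMap.id_apply, smul_add, ← mul_smul,
      Finset.sum_add_distrib, ← Finset.sum_smul, h1, h2, zero_smul, add_zero]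

lemma pencil_indec {lam mu : Fin t → k} (hlam : lam ∈ D.Lam) (hmu : mu ∈ D.Lam) (n : ℕ)
    (J : Fin t → Prop) (ξ : Fin t → (Fin (n + 2) → k) →ₗ[k] (Fin (n + 2) → k))
    (U : Fin t → Submodule k (Fin (n + 2) → k)) (hJ h0 hξ hU hw)
    (h : ∀ x y : k, (∀ i, x * lam i + y * mu i = 0) → x = 0 ∧ y = 0) :
    Indec R (D.pencil hlam hmu (shift k n) J ξ U hJ h0 hξ hU hw).mod := by
  refine Core.indec _ (.inl inferInstance) fun f g hf hg hφ _ _ => ?_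
  have key : ∀ v, f v - g v = 0 ∧ shift k n (f v) - g (shift k n v) = 0 := fun v =>
    eq_zero_of_pencil h fun i => by
      have := hφ i v
      change lam i • f v + mu i • shift k n (f v) = g (lam i • v + mu i • shift k n v) at this
      rw [map_add, map_smul, map_smul, ← sub_eq_zero] at this
      rw [← this]
      module
  have hfg : ∀ v, f v = g v := fun v => sub_eq_zero.1 (key v).1
  rcases shift_idem k n f hf fun v => by rw [hfg (shift k n v)]; exact sub_eq_zero.1 (key v).2
    with h | h
  · exact .inl ⟨h, fun v => by rw [← hfg, h]⟩
  · exact .inr ⟨h, fun v => by rw [← hfg, h]⟩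

theorem not_laura_of_two_le_of_zero (hm : 2 ≤ D.m) {i₀ : Fin t} (hi : D.w i₀ = 0) : ¬ Laura R := by
  obtain ⟨lam, hlam, mu, hmu, h⟩ := D.exists_pencil hm
  let X (n : ℕ) : Core D (Fin (n + 2) → k) (Fin (n + 2) → k) :=
    D.pencil hlam hmu (shift k n) (fun i => D.w i = 0) (fun i => if i = i₀ then shift k n else 0)
      (fun i => if i = i₀ then LinearMap.range (shift k n) else ⊤)
      (fun i hi => D.one_lt_of_w_eq_zero hi)
      (fun i hi => ⟨D.Lam_eq_zero hlam hi, D.Lam_eq_zero hmu hi⟩)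
      (fun i h => if_neg (by rintro rfl; exact h hi))
      (fun i h v => by rw [if_neg (by rintro rfl; exact h hi)]; trivial) (fun i h => h)
  have hX : ∀ n, Indec R (X n).mod := fun n => D.pencil_indec hlam hmu n _ _ _ _ _ _ _ _ h
  have hξ : ∀ n, (X n).ξ i₀ = shift k n := fun n => if_pos rfl
  have hU : ∀ n, (X n).U i₀ = LinearMap.range (shift k n) := fun n => if_pos rfl
  refine Core.not_laura X hX (fun n => ?_) (fun n => ?_) fun n n' h => by simpa using h
  · refine (X n).not_inLeftPart (i := i₀) hi hi (hX n) (X n).fdMod (single_zero_ne k n)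
      (by rw [hξ, shift_zero]) (v' := Pi.single 1 1) (by rw [hξ, shift_one]; exact single_zero_ne k n)
  · exact (X n).not_inRightPart (i := i₀) hi hi (hX n) (X n).fdMod
      (by rw [hU]; exact last_notMem_range k n)
      (by rw [hU]; exact ⟨_, shift_one k n⟩) (single_zero_ne k n)

/-- Core data with four subspaces of the plane over a nilpotent shift. -/
def twoZeroCore {b : R} {c : Fin t → k} (hb0 : b ≠ 0) (hb : ∀ i, D.w i = c i • b) {i₀ i₁ : Fin t}
    (h₀ : c i₀ = 0) (h₁ : c i₁ = 0) (n : ℕ) :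
    Core D ((Fin (n + 2) → k) × (Fin (n + 2) → k)) ((Fin (n + 2) → k) × (Fin (n + 2) → k)) where
  J i := c i = 0
  φ i := c i • LinearMap.id
  ξ i := if i = i₀ then LinearMap.inr k _ _ ∘ₗ LinearMap.snd k _ _ else
    if i = i₁ then LinearMap.inl k _ _ ∘ₗ LinearMap.fst k _ _ else 0
  U i := if i = i₀ then LinearMap.graph LinearMap.id else
    if i = i₁ then LinearMap.graph (shift k n) else ⊤
  hJ i h := D.one_lt_of_w_eq_zero (by rw [hb, h, zero_smul])
  hφ i h := by rw [h, zero_smul]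
  hξ i h := by rw [if_neg (by rintro rfl; exact h h₀), if_neg (by rintro rfl; exact h h₁)]
  hU i h v := by
    rw [if_neg (by rintro rfl; exact h h₀), if_neg (by rintro rfl; exact h h₁)]; trivial
  hw i h h' := (smul_ne_zero h hb0) (by rw [← hb, h'])
  hr r hr v := by
    simp only [LinearMap.smul_apply, LinearMap.id_apply, ← mul_smul, ← Finset.sum_smul,
      D.mem_Lam_of hb0 hb r hr, zero_smul]

theorem not_laura_of_two_zero {b : R} {c : Fin t → k} (hb0 : b ≠ 0) (hb : ∀ i, D.w i = c i • b)
    {i₀ i₁ i₂ : Fin t} (hne : i₀ ≠ i₁) (h₀ : c i₀ = 0) (h₁ : c i₁ = 0) (h₂ : c i₂ ≠ 0) :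
    ¬ Laura R := by
  have hw₀ : D.w i₀ = 0 := by rw [hb, h₀, zero_smul]
  have hw₁ : D.w i₁ = 0 := by rw [hb, h₁, zero_smul]
  let X := D.twoZeroCore hb0 hb h₀ h₁
  have hξ₀ : ∀ n v, (X n).ξ i₀ v = (0, v.2) := fun n v => by
    change (ite _ _ _ : _ →ₗ[k] _) v = _
    rw [if_pos rfl]; rfl
  have hξ₁ : ∀ n v, (X n).ξ i₁ v = (v.1, 0) := fun n v => by
    change (ite _ _ _ : _ →ₗ[k] _) v = _
    rw [if_neg hne.symm, if_pos rfl]; rfl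
  have hU₀ : ∀ n v, v ∈ (X n).U i₀ ↔ v.2 = v.1 := fun n v => by
    change v ∈ ite _ _ _ ↔ _
    rw [if_pos rfl, LinearMap.mem_graph_iff]; rfl
  have hU₁ : ∀ n v, v ∈ (X n).U i₁ ↔ v.2 = shift k n v.1 := fun n v => by
    change v ∈ ite _ _ _ ↔ _
    rw [if_neg hne.symm, if_pos rfl, LinearMap.mem_graph_iff]
  have hX : ∀ n, Indec R (X n).mod := fun n => by
    refine (X n).indec (.inl inferInstance) fun f h hf hh hφ hξ hU => ?_
    have hfh : ∀ v, f v = h v := fun v => by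
      have := hφ i₂ v
      change c i₂ • f v = h (c i₂ • v) at this
      rw [map_smul] at this
      exact smul_right_injective _ h₂ this
    have e1 : ∀ v, (f (v, 0)).2 = 0 := fun v => by
      have := hξ i₀ h₀ (v, 0) (by rw [hξ₀]; rfl)
      rw [hξ₀] at this
      exact congrArg Prod.snd this
    have e2 : ∀ v, (f (0, v)).1 = 0 := fun v => by
      have := hξ i₁ h₁ (0, v) (by rw [hξ₁]; rfl)
      rw [hξ₁] at this
      exact congrArg Prod.fst this
    have hsp : ∀ v w, f (v, w) = ((f (v, 0)).1, (f (0, w)).2) := fun v w => by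
      have : ((v, w) : (Fin (n + 2) → k) × (Fin (n + 2) → k)) = (v, 0) + (0, w) := by simp
      rw [this, map_add]
      refine Prod.ext ?_ ?_
      · simp [e2]
      · simp [e1]
    have e3 : ∀ v, (f (0, v)).2 = (f (v, 0)).1 := fun v => by
      have := hU i₀ (D.one_lt_of_w_eq_zero hw₀) (v, v) ((hU₀ n _).2 rfl)
      rwa [← hfh, hU₀, hsp] at this
    have e4 : ∀ v, (f (shift k n v, 0)).1 = shift k n (f (v, 0)).1 := fun v => by
      have := hU i₁ (D.one_lt_of_w_eq_zero hw₁) (v, shift k n v) ((hU₁ n _).2 rfl)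
      rwa [← hfh, hU₁, hsp, e3] at this
    have e5 : (∀ v, (f (v, 0)).1 = 0) ∨ ∀ v, (f (v, 0)).1 = v :=
      shift_idem k n (LinearMap.fst k _ _ ∘ₗ f ∘ₗ LinearMap.inl k _ _)
        (fun v => by
          have := congrArg Prod.fst (hf (v, 0))
          rw [hsp v 0, hsp] at this
          exact this)
        fun v => (e4 v).symm
    rcases e5 with h | h
    · have : ∀ v, f v = 0 := fun v => by
        rw [← Prod.mk.eta (p := v), hsp, e3, h, h]; rfl
      exact .inl ⟨this, fun v => by rw [← hfh, this]⟩
    · have : ∀ v, f v = v := fun v => by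
        rw [← Prod.mk.eta (p := v), hsp, e3, h, h]
      exact .inr ⟨this, fun v => by rw [← hfh, this]⟩
  refine Core.not_laura X hX (fun n => ?_) (fun n => ?_) fun n n' h => ?_
  · refine (X n).not_inLeftPart (i := i₀) h₀ hw₀ (hX n) (X n).fdMod (v := (Pi.single 0 1, 0))
      (v' := (0, Pi.single 0 1)) (fun h => ?_) (by rw [hξ₀]; rfl) (fun h => ?_)
    · exact single_zero_ne k n (congrArg Prod.fst h)
    · rw [hξ₀] at h
      exact single_zero_ne k n (congrArg Prod.snd h)
  · refine (X n).not_inRightPart (i := i₀) h₀ hw₀ (hX n) (X n).fdMod (w := (Pi.single 0 1, 0))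
      (u := (Pi.single 0 1, Pi.single 0 1)) (fun h => ?_) ((hU₀ n _).2 rfl) (fun h => ?_)
    · exact single_zero_ne k n ((hU₀ n _).1 h).symm
    · exact single_zero_ne k n (congrArg Prod.fst h)
  · simp only [Module.finrank_prod, Module.finrank_fin_fun] at h
    omega

end TD

namespace Core

variable {D : TD k R t ℓ}
  {V W : Type u} [AddCommGroup V] [Module k V] [AddCommGroup W] [Module k W] (X : Core D V W)

lemma p_src_eq_zero {i : Fin t} {a : ℕ} (ha : 1 < a) (hl : a ≤ ℓ i) {v : V} (hv : X.φ i v = 0) :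
    D.p i 0 a • X.src v = 0 := by
  refine Subtype.ext (funext fun u => ?_)
  rw [X.rep.p_apply (Nat.zero_le a) hl, vtx_zero, src_val]
  change ite _ (chain (X.F i) 0 a _) _ = _
  rw [X.chain_zero i ha, hv]
  exact ite_self _

/-- Families of vectors at the source obstructing projective dimension at most one. -/
lemma eq_zero_of_pdLeOne (hw : ∀ i, D.w i ≠ 0) (h : PdLeOne R X.mod) (v : Fin t → V)
    (hℓ : ∀ i, v i ≠ 0 → 2 ≤ ℓ i) (hΛ : ∀ θ ∈ D.Lam, ∑ i, θ i • v i = 0)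
    (hφ : ∀ i, X.φ i (v i) = 0) (hξ : ∀ i, X.ξ i (v i) = 0 ∨ 3 ≤ ℓ i) (i : Fin t) : v i = 0 := by
  by_contra hv
  refine X.src_ne_zero hv (D.pd_obstruction hw h (fun i => X.src (v i)) (fun i => X.src_mem _)
    (fun θ hθ => ?_) (fun i => ?_) i)
  · have := congrArg X.src (hΛ θ hθ)
    rw [map_sum, map_zero] at this
    rw [← this]
    exact Finset.sum_congr rfl fun i _ => (map_smul _ _ _).symm
  · by_cases h0 : v i = 0
    · rw [h0, map_zero, smul_zero]
    have h2 := hℓ i h0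
    by_cases h3 : 3 ≤ ℓ i
    · exact X.p_src_eq_zero (by omega) (by omega) (hφ i)
    · have : ℓ i - 1 = 1 := by omega
      rw [this]
      exact (X.p_one_src h2).2 ⟨(hξ i).resolve_right h3, hφ i⟩

/-- Families of functionals at the sink obstructing injective dimension at most one. -/
lemma eq_zero_of_idLeOne (hw : ∀ i, D.w i ≠ 0) (h : IdLeOne R X.mod) (u : Fin t → W →ₗ[k] k)
    (hℓ : ∀ i, u i ≠ 0 → 2 ≤ ℓ i) (hΛ : ∀ θ ∈ D.Lam, ∑ i, θ i • u i = 0)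
    (hU : ∀ i, (∀ w ∈ X.U i, u i w = 0) ∨ X.J i ∧ 3 ≤ ℓ i) (i : Fin t) : u i = 0 := by
  refine LinearMap.ext fun w => ?_
  have := D.id_obstruction hw h (fun i => u i ∘ₗ X.prK) (fun θ hθ => ?_) (fun i m => ?_) i
    (X.snk w) (X.snk_mem w)
  · rw [← X.prK_snk w]; exact this
  · refine LinearMap.ext fun m => ?_
    have := LinearMap.congr_fun (hΛ θ hθ) (X.prK m)
    simp only [LinearMap.sum_apply, LinearMap.smul_apply, LinearMap.comp_apply] at this ⊢
    exact this
  · by_cases h0 : u i = 0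
    · change u i _ = 0
      rw [h0]; rfl
    have h2 := hℓ i h0
    change u i (X.prK _) = 0
    rcases hU i with h | ⟨hJ, h3⟩
    · exact h _ (X.prK_mem one_pos h2 m)
    · rw [X.prK_p_eq_zero hJ h3, map_zero]

lemma not_inLeftPart_of_family (hw : ∀ i, D.w i ≠ 0) (hX : Indec R X.mod) (fX : FdMod R X.mod)
    {M : ModuleCat.{u} R} (hM : IndPath R X.mod M) (v : Fin t → V)
    (hℓ : ∀ i, v i ≠ 0 → 2 ≤ ℓ i) (hΛ : ∀ θ ∈ D.Lam, ∑ i, θ i • v i = 0)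
    (hφ : ∀ i, X.φ i (v i) = 0) (hξ : ∀ i, X.ξ i (v i) = 0 ∨ 3 ≤ ℓ i) {i : Fin t} (hi : v i ≠ 0) :
    ¬ InLeftPart R M := fun h =>
  hi (X.eq_zero_of_pdLeOne hw (h.2.2 _ hX fX hM) v hℓ hΛ hφ hξ i)

lemma not_inRightPart_of_family (hw : ∀ i, D.w i ≠ 0) (hX : Indec R X.mod) (fX : FdMod R X.mod)
    {M : ModuleCat.{u} R} (hM : IndPath R M X.mod) (u : Fin t → W →ₗ[k] k)
    (hℓ : ∀ i, u i ≠ 0 → 2 ≤ ℓ i) (hΛ : ∀ θ ∈ D.Lam, ∑ i, θ i • u i = 0)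
    (hU : ∀ i, (∀ w ∈ X.U i, u i w = 0) ∨ X.J i ∧ 3 ≤ ℓ i) {i : Fin t} (hi : u i ≠ 0) :
    ¬ InRightPart R M := fun h =>
  hi (X.eq_zero_of_idLeOne hw (h.2.2 _ hX fX hM) u hℓ hΛ hU i)

variable {V' W' : Type u} [AddCommGroup V'] [Module k V'] [AddCommGroup W'] [Module k W']
  (X' : Core D V' W')

/-- A noninjective nonzero morphism of core data gives a step. -/
lemma step_of_map (hX : Indec R X.mod) (fX : FdMod R X.mod) (hX' : Indec R X'.mod)
    (fX' : FdMod R X'.mod) (f : V →ₗ[k] V') (h : W →ₗ[k] W')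
    (hφ : ∀ i v, X'.φ i (f v) = h (X.φ i v)) (hξ : ∀ i v, X'.ξ i (f v) = 0)
    (hU : ∀ i, ∀ w ∈ X.U i, h w ∈ X'.U i) (hJ : ∀ i, ¬ X.J i → X'.J i → ∀ w ∈ X.U i, h w = 0)
    {v v' : V} (hv : v ≠ 0) (hfv : f v = 0) (hv' : f v' ≠ 0) : Step R X.mod X'.mod := by
  obtain ⟨F, hF, -⟩ := X.exists_map X' f h 0 hφ (fun i v => (hξ i v).symm) hU hJ
  refine ⟨hX, fX, hX', fX', F, fun h0 => ?_, fun hb => ?_⟩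
  · refine X'.src_ne_zero hv' ?_
    rw [← hF, h0]; rfl
  · refine X.src_ne_zero hv (hb.1 ?_)
    rw [hF, hfv, map_zero, LinearMap.map_zero]

end Core

namespace TD

variable (D : TD k R t ℓ)

lemma exists_pencil_of (h : 2 ≤ D.m) {lam : Fin t → k} (h0 : lam ≠ 0) :
    ∃ mu ∈ D.Lam, ∀ x y : k, (∀ i, x * lam i + y * mu i = 0) → x = 0 ∧ y = 0 := by
  obtain ⟨l₁, hl₁, l₂, hl₂, hl⟩ := D.exists_pencil h
  have key : ∀ mu : Fin t → k, (¬ ∀ x y : k, (∀ i, x * lam i + y * mu i = 0) → x = 0 ∧ y = 0) →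
      ∃ s : k, ∀ i, mu i = s * lam i := fun mu hmu => by
    push Not at hmu
    obtain ⟨x, y, hxy, hne⟩ := hmu
    have hy : y ≠ 0 := fun hy => h0 (funext fun i => by
      have := hxy i
      rw [hy, zero_mul, add_zero] at this
      exact (mul_eq_zero.1 this).resolve_left fun hx => hne hx hy)
    refine ⟨-x / y, fun i => ?_⟩
    field_simp
    linear_combination hxy i
  by_contra! hc
  obtain ⟨s₁, h₁⟩ := key l₁ fun h => by
    obtain ⟨x, y, hxy, hne⟩ := hc l₁ hl₁
    exact hne (h x y hxy).1 (h x y hxy).2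
  obtain ⟨s₂, h₂⟩ := key l₂ fun h => by
    obtain ⟨x, y, hxy, hne⟩ := hc l₂ hl₂
    exact hne (h x y hxy).1 (h x y hxy).2
  have hs := hl s₂ (-s₁) fun i => by rw [h₁, h₂]; ring
  have := hl 1 0 fun i => by rw [h₁, neg_eq_zero.1 hs.2]; ring
  exact one_ne_zero this.1

/-- An algebra without zero branches is not laura if some nonzero linear relation between the
branches and some nonzero element of its annihilator have disjoint supports. -/
theorem not_laura_of_disjoint (hw : ∀ i, D.w i ≠ 0) (hm : 2 ≤ D.m) {r lam : Fin t → k}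
    (hr : r ∈ D.Rel) (hr0 : r ≠ 0) (hlam : lam ∈ D.Lam) (hlam0 : lam ≠ 0)
    (h : ∀ i, lam i * r i = 0) : ¬ Laura R := by
  obtain ⟨mu, hmu, hp⟩ := D.exists_pencil_of hm hlam0
  obtain ⟨i, hi⟩ := Function.ne_iff.1 hr0
  have hΛ : ∀ {V : Type u} [AddCommGroup V] [Module k V] (v : V), ∀ θ ∈ D.Lam,
      ∑ i, θ i • r i • v = 0 := fun v θ hθ => by
    simp only [← mul_smul, ← Finset.sum_smul]
    rw [Finset.sum_congr rfl fun i _ => mul_comm (θ i) (r i)]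
    rw [D.mem_Lam.1 hθ r hr, zero_smul]
  let X (n : ℕ) : Core D (Fin (n + 2) → k) (Fin (n + 2) → k) :=
    D.pencil hlam hmu (shift k n) (fun _ => False) 0
      (fun i => if r i = 0 then ⊤ else LinearMap.range (shift k n))
      (fun i h => h.elim) (fun i h => h.elim) (fun i _ => rfl)
      (fun j _ v => by
        split_ifs with h0
        · trivial
        · rw [(mul_eq_zero.1 (h j)).resolve_right h0, zero_smul, zero_add]
          exact Submodule.smul_mem _ _ ⟨v, rfl⟩)
      (fun i _ => hw i)
  have hX : ∀ n, Indec R (X n).mod := fun n => D.pencil_indec hlam hmu n _ _ _ _ _ _ _ _ hp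
  refine Core.not_laura X hX (fun n => ?_) (fun n => ?_) fun n n' h => by simpa using h
  · refine (X n).not_inLeftPart_of_family hw (hX n) (X n).fdMod .refl
      (fun i => r i • Pi.single 0 1) (fun i hv => D.adm r (D.mem_Rel.1 hr) i fun h0 => hv ?_)
      (hΛ _) (fun j => ?_) (fun j => .inl rfl) (smul_ne_zero hi (single_zero_ne k n))
    · rw [h0, zero_smul]
    · change lam j • r j • _ + mu j • shift k n (r j • _) = _
      rw [← mul_smul, h, map_smul, shift_zero, zero_smul, smul_zero, smul_zero, add_zero]
  · refine (X n).not_inRightPart_of_family hw (hX n) (X n).fdMod .refl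
      (fun i => r i • LinearMap.proj (Fin.last _))
      (fun i hv => D.adm r (D.mem_Rel.1 hr) i fun h0 => hv ?_)
      (hΛ _) (fun j => .inl fun w hv => ?_) (i := i) fun h0 => hi ?_
    · rw [h0, zero_smul]
    · change w ∈ ite _ _ _ at hv
      split_ifs at hv with h0
      · rw [h0, zero_smul]; rfl
      · obtain ⟨v, rfl⟩ := hv
        change r j • shift k n v (Fin.last _) = 0
        rw [shift_last, smul_zero]
    · simpa using LinearMap.congr_fun h0 (Pi.single (Fin.last _) 1)

/-- Some of the branches form a basis of the space they span; the coordinates belong to the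
annihilator of the linear relations. -/
lemma exists_basis : ∃ (a : Fin D.m → Fin t) (lam : Fin D.m → Fin t → k), (∀ c, lam c ∈ D.Lam) ∧
    (∀ c c', lam c (a c') = if c = c' then 1 else 0) ∧
    ∀ i, D.w i = ∑ c, lam c i • D.w (a c) := by
  obtain ⟨κ, a, ha, hs, hl⟩ := exists_linearIndependent' k D.w
  have : Finite κ := Finite.of_injective a ha
  have : Fintype κ := Fintype.ofFinite κ
  let B₀ := Module.Basis.span hl
  have hm : Fintype.card κ = D.m := by
    rw [← Module.finrank_eq_card_basis B₀, hs]; rfl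
  let e : κ ≃ Fin D.m := Fintype.equivFinOfCardEq hm
  let B := B₀.reindex e
  let w' (i : Fin t) : Submodule.span k (Set.range (D.w ∘ a)) :=
    ⟨D.w i, hs ▸ Submodule.subset_span ⟨i, rfl⟩⟩
  have hB : ∀ c, B c = w' (a (e.symm c)) := fun c => Subtype.ext (by
    simp [B, B₀, w', Module.Basis.span_apply])
  refine ⟨a ∘ e.symm, fun c i => B.coord c (w' i), fun c => D.mem_Lam.2 fun r hr => ?_,
    fun c c' => ?_, fun i => ?_⟩
  · have h : ∑ i, r i • w' i = 0 := Subtype.ext (by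
      simpa [w', Submodule.coe_sum] using D.mem_Rel.1 hr)
    simpa [map_sum] using congrArg (B.coord c) h
  · change B.coord c (w' (a (e.symm c'))) = _
    rw [← hB, Module.Basis.coord_apply, Module.Basis.repr_self, Finsupp.single_apply]
    exact if_congr eq_comm rfl rfl
  · have := congrArg Subtype.val (B.sum_repr (w' i))
    rw [Submodule.coe_sum] at this
    refine this.symm.trans (Finset.sum_congr rfl fun c _ => ?_)
    rw [Submodule.coe_smul, hB]
    rfl

/-- The linear relation expressing a branch through a basis of branches. -/
def basisRel {m : ℕ} (a : Fin m → Fin t) (lam : Fin m → Fin t → k) (j : Fin t) : Fin t → k :=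
  Pi.single j 1 - ∑ c, lam c j • Pi.single (a c) 1

section basis

variable {D} {m : ℕ} {a : Fin m → Fin t} {lam : Fin m → Fin t → k}

lemma basisRel_mem (hw : ∀ i, D.w i = ∑ c, lam c i • D.w (a c)) (j : Fin t) :
    basisRel a lam j ∈ D.Rel := by
  rw [D.mem_Rel]
  simp only [basisRel, Pi.sub_apply, Finset.sum_apply, Pi.smul_apply, sub_smul, Finset.sum_smul,
    Finset.sum_sub_distrib, smul_eq_mul, mul_smul]
  rw [Finset.sum_comm, Finset.sum_eq_single j (fun i _ hi => by simp [hi]) (by simp),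
    Pi.single_eq_same, one_smul, sub_eq_zero, hw j]
  refine Finset.sum_congr rfl fun c _ => ?_
  rw [Finset.sum_eq_single (a c) (fun i _ hi => by simp [hi]) (by simp), Pi.single_eq_same,
    one_smul]

lemma basisRel_self {j : Fin t} (hj : j ∉ Set.range a) : basisRel a lam j j = 1 := by
  simp only [basisRel, Pi.sub_apply, Pi.single_eq_same, Finset.sum_apply, Pi.smul_apply]
  rw [Finset.sum_eq_zero, sub_zero]
  intro c _
  rw [Pi.single_eq_of_ne (fun h => hj ⟨c, h.symm⟩), smul_zero]

lemma basisRel_of_notMem {i j : Fin t} (hi : i ∉ Set.range a) (hij : i ≠ j) :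
    basisRel a lam j i = 0 := by
  simp only [basisRel, Pi.sub_apply, Pi.single_eq_of_ne hij, Finset.sum_apply, Pi.smul_apply]
  rw [Finset.sum_eq_zero, sub_zero]
  intro c _
  rw [Pi.single_eq_of_ne (fun h => hi ⟨c, h.symm⟩), smul_zero]

lemma basis_injective (hδ : ∀ c c', lam c (a c') = if c = c' then 1 else 0) :
    Function.Injective a := fun c c' h => by
  by_contra hne
  have h1 := hδ c c
  have h2 := hδ c c'
  rw [if_pos rfl, h, h2, if_neg hne] at h1
  exact zero_ne_one h1

lemma basisRel_basis (hδ : ∀ c c', lam c (a c') = if c = c' then 1 else 0) {j : Fin t}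
    (hj : j ∉ Set.range a) (c : Fin m) : basisRel a lam j (a c) = - lam c j := by
  simp only [basisRel, Pi.sub_apply, Pi.single_eq_of_ne (fun h => hj ⟨c, h⟩), Finset.sum_apply,
    Pi.smul_apply]
  rw [Finset.sum_eq_single c (fun c' _ hc => ?_) (by simp), Pi.single_eq_same, smul_eq_mul,
    mul_one, zero_sub]
  rw [Pi.single_eq_of_ne (fun h => hc (basis_injective hδ h).symm), smul_zero]

/-- If no relation is disjoint from an element of the annihilator, the coordinates of a branch
outside of the basis do not vanish. -/
lemma basis_ne_zero (hlam : ∀ c, lam c ∈ D.Lam)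
    (hδ : ∀ c c', lam c (a c') = if c = c' then 1 else 0)
    (hw : ∀ i, D.w i = ∑ c, lam c i • D.w (a c))
    (hN : ∀ r ∈ D.Rel, ∀ θ ∈ D.Lam, (∀ i, θ i * r i = 0) → r = 0 ∨ θ = 0) {j : Fin t}
    (hj : j ∉ Set.range a) (c : Fin m) : lam c j ≠ 0 := fun h0 => by
  have key : ∀ i, lam c i * basisRel a lam j i = 0 := fun i => by
    by_cases hi : i ∈ Set.range a
    · obtain ⟨c', rfl⟩ := hi
      rw [basisRel_basis hδ hj, hδ]
      split_ifs with hc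
      · rw [← hc, h0, neg_zero, mul_zero]
      · rw [zero_mul]
    · by_cases hij : i = j
      · rw [hij, h0, zero_mul]
      · rw [basisRel_of_notMem hi hij, mul_zero]
  rcases hN _ (basisRel_mem hw j) _ (hlam c) key with h | h
  · have := congrFun h j
    rw [basisRel_self hj] at this
    exact one_ne_zero this
  · have := congrFun h (a c)
    rw [hδ, if_pos rfl] at this
    exact one_ne_zero this

end basis

end TD

/-- Vectors annihilated by three independent families of scalars vanish. -/
lemma eq_zero_of_triple {ι k V : Type*} [Field k] [AddCommGroup V] [Module k V]
    {l₁ l₂ l₃ : ι → k}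
    (h : ∀ x y z : k, (∀ i, x * l₁ i + y * l₂ i + z * l₃ i = 0) → x = 0 ∧ y = 0 ∧ z = 0)
    {a b c : V} (habc : ∀ i, l₁ i • a + l₂ i • b + l₃ i • c = 0) : a = 0 ∧ b = 0 ∧ c = 0 := by
  have key : ∀ ζ : Module.Dual k V, ζ a = 0 ∧ ζ b = 0 ∧ ζ c = 0 := fun ζ => h _ _ _ fun i => by
    simpa [mul_comm] using congrArg ζ (habc i)
  exact ⟨(Module.forall_dual_apply_eq_zero_iff k a).1 fun ζ => (key ζ).1,
    (Module.forall_dual_apply_eq_zero_iff k b).1 fun ζ => (key ζ).2.1,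
    (Module.forall_dual_apply_eq_zero_iff k c).1 fun ζ => (key ζ).2.2⟩

namespace TD

variable (D : TD k R t ℓ)

/-- Core data attached to three linear maps. -/
def triple {V W : Type u} [AddCommGroup V] [Module k V] [AddCommGroup W] [Module k W]
    (hw : ∀ i, D.w i ≠ 0) {l₁ l₂ l₃ : Fin t → k} (h₁ : l₁ ∈ D.Lam) (h₂ : l₂ ∈ D.Lam)
    (h₃ : l₃ ∈ D.Lam) (f₁ f₂ f₃ : V →ₗ[k] W) (U : Fin t → Submodule k W)
    (hU : ∀ i v, l₁ i • f₁ v + l₂ i • f₂ v + l₃ i • f₃ v ∈ U i) : Core D V W where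
  J _ := False
  φ i := l₁ i • f₁ + l₂ i • f₂ + l₃ i • f₃
  ξ _ := 0
  U := U
  hJ _ h := h.elim
  hφ _ h := h.elim
  hξ _ _ := rfl
  hU i _ v := hU i v
  hw i _ := hw i
  hr r hr v := by
    simp only [LinearMap.add_apply, LinearMap.smul_apply, smul_add, ← mul_smul,
      Finset.sum_add_distrib, ← Finset.sum_smul, D.mem_Lam.1 h₁ r hr, D.mem_Lam.1 h₂ r hr,
      D.mem_Lam.1 h₃ r hr, zero_smul, add_zero]

lemma triple_indec {V W : Type u} [AddCommGroup V] [Module k V] [AddCommGroup W] [Module k W]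
    [Nontrivial V] (hw : ∀ i, D.w i ≠ 0) {l₁ l₂ l₃ : Fin t → k} (h₁ : l₁ ∈ D.Lam)
    (h₂ : l₂ ∈ D.Lam) (h₃ : l₃ ∈ D.Lam)
    (hl : ∀ x y z : k, (∀ i, x * l₁ i + y * l₂ i + z * l₃ i = 0) → x = 0 ∧ y = 0 ∧ z = 0)
    (f₁ f₂ f₃ : V →ₗ[k] W) (U : Fin t → Submodule k W) (hU)
    (H : ∀ (f : V →ₗ[k] V) (h : W →ₗ[k] W), (∀ v, f (f v) = f v) → (∀ v, f₁ (f v) = h (f₁ v)) →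
      (∀ v, f₂ (f v) = h (f₂ v)) → (∀ v, f₃ (f v) = h (f₃ v)) →
      ((∀ v, f v = 0) ∧ ∀ w, h w = 0) ∨ ((∀ v, f v = v) ∧ ∀ w, h w = w)) :
    Indec R (D.triple hw h₁ h₂ h₃ f₁ f₂ f₃ U hU).mod := by
  refine Core.indec _ (.inl inferInstance) fun f h hf _ hφ _ _ => ?_
  have key : ∀ v, f₁ (f v) - h (f₁ v) = 0 ∧ f₂ (f v) - h (f₂ v) = 0 ∧ f₃ (f v) - h (f₃ v) = 0 :=
    fun v => eq_zero_of_triple hl fun i => by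
      have := hφ i v
      change l₁ i • f₁ (f v) + l₂ i • f₂ (f v) + l₃ i • f₃ (f v) =
        h (l₁ i • f₁ v + l₂ i • f₂ v + l₃ i • f₃ v) at this
      rw [map_add, map_add, map_smul, map_smul, map_smul, ← sub_eq_zero] at this
      rw [← this]
      module
  exact H f h hf (fun v => sub_eq_zero.1 (key v).1) (fun v => sub_eq_zero.1 (key v).2.1)
    fun v => sub_eq_zero.1 (key v).2.2

lemma smul_family {r : Fin t → k} (hr : r ∈ D.Rel) {V : Type*} [AddCommGroup V] [Module k V]
    (v : V) {θ : Fin t → k} (hθ : θ ∈ D.Lam) : ∑ i, θ i • r i • v = 0 := by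
  simp only [← mul_smul, ← Finset.sum_smul]
  rw [Finset.sum_congr rfl fun i _ => mul_comm (θ i) (r i), D.mem_Lam.1 hθ r hr, zero_smul]

theorem not_laura_of_triple (hw : ∀ i, D.w i ≠ 0) {l₁ l₂ l₃ P Q : Fin t → k} (h₁ : l₁ ∈ D.Lam)
    (h₂ : l₂ ∈ D.Lam) (h₃ : l₃ ∈ D.Lam)
    (hl : ∀ x y z : k, (∀ i, x * l₁ i + y * l₂ i + z * l₃ i = 0) → x = 0 ∧ y = 0 ∧ z = 0)
    (hP : P ∈ D.Rel) (hQ : Q ∈ D.Rel) (h : ∀ i, l₁ i * P i + l₂ i * Q i = 0) {i : Fin t}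
    (hi : P i ≠ 0 ∨ Q i ≠ 0) : ¬ Laura R := by
  have hℓ : ∀ j, (P j ≠ 0 ∨ Q j ≠ 0) → 2 ≤ ℓ j := fun j hj =>
    hj.elim (D.adm P (D.mem_Rel.1 hP) j) (D.adm Q (D.mem_Rel.1 hQ) j)
  let X := D.triple hw h₁ h₂ h₃ (V := k × k × k) (W := k × k)
    ((LinearMap.fst k k (k × k)).prod (LinearMap.snd k k k ∘ₗ LinearMap.snd k k (k × k)))
    (LinearMap.inl k k k ∘ₗ LinearMap.fst k k k ∘ₗ LinearMap.snd k k (k × k))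
    (LinearMap.inl k k k ∘ₗ LinearMap.snd k k k ∘ₗ LinearMap.snd k k (k × k)) (fun _ => ⊤)
    fun _ _ => trivial
  let B (n : ℕ) := D.triple hw h₁ h₂ h₃ LinearMap.id (shift k n) 0 (fun _ => ⊤) fun _ _ => trivial
  let η (j : Fin t) : k × k × k →ₗ[k] k := P j • LinearMap.fst k k (k × k) +
    Q j • LinearMap.fst k k k ∘ₗ LinearMap.snd k k (k × k)
  let Y := D.triple hw h₁ h₂ h₃ (V := k × k) (W := k × k × k)
    ((LinearMap.fst k k k).prod ((0 : k × k →ₗ[k] k).prod (LinearMap.snd k k k)))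
    (LinearMap.inr k k (k × k) ∘ₗ LinearMap.inl k k k ∘ₗ LinearMap.fst k k k)
    (LinearMap.inr k k (k × k) ∘ₗ LinearMap.inr k k k ∘ₗ LinearMap.fst k k k)
    (fun j => LinearMap.ker (η j)) fun j v => by
      simp only [LinearMap.mem_ker, η]
      simp
      linear_combination v.1 * h j
  have hX : Indec R X.mod := D.triple_indec hw h₁ h₂ h₃ hl _ _ _ _ _ fun f g hf e1 e2 e3 => by
    have a1 : ((f (1, 0, 0)).1, (f (1, 0, 0)).2.2) = g (1, 0) := e1 (1, 0, 0)
    have a2 : ((f (1, 0, 0)).2.1, (0 : k)) = g (0, 0) := e2 (1, 0, 0)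
    have a3 : ((f (1, 0, 0)).2.2, (0 : k)) = g (0, 0) := e3 (1, 0, 0)
    have b1 : ((f (0, 1, 0)).1, (f (0, 1, 0)).2.2) = g (0, 0) := e1 (0, 1, 0)
    have b2 : ((f (0, 1, 0)).2.1, (0 : k)) = g (1, 0) := e2 (0, 1, 0)
    have c1 : ((f (0, 0, 1)).1, (f (0, 0, 1)).2.2) = g (0, 1) := e1 (0, 0, 1)
    have c2 : ((f (0, 0, 1)).2.1, (0 : k)) = g (0, 0) := e2 (0, 0, 1)
    have c3 : ((f (0, 0, 1)).2.2, (0 : k)) = g (1, 0) := e3 (0, 0, 1)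
    have g0 : g (0, 0) = 0 := map_zero g
    rw [g0] at a2 a3 b1 c2
    rw [← c3] at a1 b2
    have fv : ∀ x y z, f (x, y, z) = x • f (1, 0, 0) + y • f (0, 1, 0) + z • f (0, 0, 1) :=
      fun x y z => by simp [← map_smul, ← map_add]
    have gv : ∀ x y, g (x, y) = x • g (1, 0) + y • g (0, 1) := fun x y => by
      simp [← map_smul, ← map_add]
    have i3 := hf (0, 0, 1)
    generalize f (1, 0, 0) = A at *
    generalize f (0, 1, 0) = B at *
    generalize f (0, 0, 1) = C at *
    obtain ⟨A1, A2, A3⟩ := A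
    obtain ⟨B1, B2, B3⟩ := B
    obtain ⟨d, C2, c⟩ := C
    simp only [Prod.mk.injEq, Prod.mk_eq_zero, and_true] at a1 a2 a3 b1 b2 c2
    obtain ⟨rfl, rfl⟩ := a1
    obtain ⟨rfl, rfl⟩ := b1
    subst a2 b2 c2
    rw [← c1, ← c3] at gv
    rw [fv] at i3
    simp only [Prod.smul_mk, Prod.mk_add_mk, Prod.mk.injEq, smul_eq_mul, mul_zero, zero_mul,
      add_zero, zero_add] at i3 fv gv
    obtain ⟨h3, -, h2⟩ := i3
    rcases (by simpa [mul_self_eq_zero, sub_eq_zero] using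
      show B2 * (B2 - 1) = 0 by linear_combination h2) with h0 | h0
    · subst h0
      have : d = 0 := by linear_combination -h3
      subst this
      exact .inl ⟨fun v => (fv _ _ _).trans (by simp), fun v => (gv _ _).trans (by simp)⟩
    · subst h0
      have : d = 0 := by linear_combination h3
      subst this
      exact .inr ⟨fun v => (fv _ _ _).trans (by simp), fun v => (gv _ _).trans (by simp)⟩
  have hB : ∀ n, Indec R (B n).mod := fun n =>
    D.triple_indec hw h₁ h₂ h₃ hl _ _ _ _ _ fun f g hf e1 e2 _ => by
      have hfg : ∀ v, f v = g v := e1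
      rcases shift_idem k n f hf fun v => (e2 v).trans (hfg _).symm with h | h
      · exact .inl ⟨h, fun v => by rw [← hfg, h]⟩
      · exact .inr ⟨h, fun v => by rw [← hfg, h]⟩
  have hY : Indec R Y.mod := D.triple_indec hw h₁ h₂ h₃ hl _ _ _ _ _ fun f g hf e1 e2 e3 => by
    have a1 : ((f (1, 0)).1, (0 : k), (f (1, 0)).2) = g (1, 0, 0) := e1 (1, 0)
    have a2 : ((0 : k), (f (1, 0)).1, (0 : k)) = g (0, 1, 0) := e2 (1, 0)
    have a3 : ((0 : k), (0 : k), (f (1, 0)).1) = g (0, 0, 1) := e3 (1, 0)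
    have b1 : ((f (0, 1)).1, (0 : k), (f (0, 1)).2) = g (0, 0, 1) := e1 (0, 1)
    have fv : ∀ x y, f (x, y) = x • f (1, 0) + y • f (0, 1) := fun x y => by
      simp [← map_smul, ← map_add]
    have gv : ∀ x y z, g (x, y, z) = x • g (1, 0, 0) + y • g (0, 1, 0) + z • g (0, 0, 1) :=
      fun x y z => by simp [← map_smul, ← map_add]
    rw [← a1, ← a2, ← a3] at gv
    rw [← a3] at b1
    have i1 := hf (1, 0)
    generalize f (1, 0) = A at *
    generalize f (0, 1) = B at *
    obtain ⟨a, b⟩ := A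
    obtain ⟨B1, B2⟩ := B
    simp only [Prod.mk.injEq, true_and] at b1
    obtain ⟨rfl, rfl⟩ := b1
    rw [fv] at i1
    simp only [Prod.smul_mk, Prod.mk_add_mk, Prod.mk.injEq, smul_eq_mul, mul_zero,
      add_zero, zero_add] at i1 fv gv
    obtain ⟨h2, h3⟩ := i1
    rcases (by simpa [mul_self_eq_zero, sub_eq_zero] using
      show B2 * (B2 - 1) = 0 by linear_combination h2) with h0 | h0
    · subst h0
      have : b = 0 := by linear_combination -h3
      subst this
      exact .inl ⟨fun v => (fv _ _).trans (by simp), fun v => (gv _ _ _).trans (by simp)⟩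
    · subst h0
      have : b = 0 := by linear_combination h3
      subst this
      exact .inr ⟨fun v => (fv _ _).trans (by simp), fun v => (gv _ _ _).trans (by simp)⟩
  have e0 : ∀ n, (Pi.single 0 1 : Fin (n + 2) → k) ≠ 0 := single_zero_ne k
  have hXB : ∀ n, Step R X.mod (B n).mod := fun n =>
    X.step_of_map (B n) hX X.fdMod (hB n) (B n).fdMod
      (LinearMap.toSpanSingleton k _ (Pi.single 0 1) ∘ₗ LinearMap.snd k k k ∘ₗ
        LinearMap.snd k k (k × k))
      (LinearMap.toSpanSingleton k _ (Pi.single 0 1) ∘ₗ LinearMap.snd k k k)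
      (fun j v => by
        change l₁ j • (v.2.2 • Pi.single 0 1) + l₂ j • shift k n (v.2.2 • Pi.single 0 1) +
          l₃ j • (0 : Fin (n + 2) → k) = (l₁ j • v.2.2 + l₂ j • 0 + l₃ j • 0 : k) • Pi.single 0 1
        rw [map_smul, shift_zero]
        simp [mul_smul])
      (fun _ _ => rfl) (fun _ _ _ => trivial) (fun _ _ h => h.elim)
      (v := (1, 0, 0)) (v' := (0, 0, 1)) (by simp) (by simp)
      (by change (1 : k) • (Pi.single 0 1 : Fin (n + 2) → k) ≠ 0; rw [one_smul]; exact e0 n)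
  have hBY : ∀ n, Step R (B n).mod Y.mod := fun n =>
    (B n).step_of_map Y (hB n) (B n).fdMod hY Y.fdMod
      (LinearMap.inr k k k ∘ₗ LinearMap.proj (Fin.last _))
      (LinearMap.inr k k (k × k) ∘ₗ LinearMap.inr k k k ∘ₗ LinearMap.proj (Fin.last _))
      (fun j v => by
        refine Prod.ext ?_ (Prod.ext ?_ ?_)
        · change l₁ j • (0 : k) + l₂ j • (0 : k) + l₃ j • (0 : k) = 0
          simp
        · change l₁ j • (0 : k) + l₂ j • (0 : k) + l₃ j • (0 : k) = 0
          simp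
        · change l₁ j • v (Fin.last _) + l₂ j • (0 : k) + l₃ j • (0 : k) =
            l₁ j • v (Fin.last _) + l₂ j • shift k n v (Fin.last _) + l₃ j • (0 : k)
          rw [shift_last])
      (fun _ _ => rfl)
      (fun j v _ => by
        change P j * (0 : k) + Q j * (0 : k) = 0
        simp)
      (fun _ _ h => h.elim) (v := Pi.single 0 1) (v' := Pi.single (Fin.last _) 1) (e0 n)
      (by simp [Fin.last_pos.ne'])
      (by simp)
  refine Core.not_laura B hB (fun n => ?_) (fun n => ?_) fun n n' h => by simpa using h
  · refine X.not_inLeftPart_of_family hw hX X.fdMod (.single (hXB n))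
      (fun j => P j • (1, 0, 0) + Q j • (0, 1, 0)) (fun j hv => hℓ j ?_) (fun θ hθ => ?_)
      (fun j => ?_) (fun j => .inl rfl) (i := i) (fun h0 => ?_)
    · by_contra! hc
      exact hv (by rw [hc.1, hc.2]; simp)
    · simp only [smul_add, Finset.sum_add_distrib, D.smul_family hP _ hθ, D.smul_family hQ _ hθ,
        add_zero]
    · refine Prod.ext ?_ ?_
      · change l₁ j • (P j • 1 + Q j • 0 : k) + l₂ j • (P j • 0 + Q j • 1 : k) +
          l₃ j • (P j • 0 + Q j • 0 : k) = 0
        simpa using h j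
      · change l₁ j • (P j • 0 + Q j • 0 : k) + l₂ j • (0 : k) + l₃ j • (0 : k) = 0
        simp
    · simp at h0
      exact hi.elim (fun h => h h0.1) fun h => h h0.2
  · refine Y.not_inRightPart_of_family hw hY Y.fdMod (.single (hBY n)) η (fun j hv => hℓ j ?_)
      (fun θ hθ => ?_) (fun j => .inl fun w hv => hv) (i := i) (fun h0 => ?_)
    · by_contra! hc
      exact hv (by simp only [η, hc.1, hc.2, zero_smul, add_zero])
    · simp only [η, smul_add, Finset.sum_add_distrib]
      exact (congrArg₂ (· + ·) (D.smul_family hP _ hθ) (D.smul_family hQ _ hθ)).trans (add_zero _)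
    · have h1 := LinearMap.congr_fun h0 (1, 0, 0)
      have h2 := LinearMap.congr_fun h0 (0, 1, 0)
      simp [η] at h1 h2
      exact hi.elim (fun h => h h1) fun h => h h2

end TD

namespace TD

variable (D : TD k R t ℓ)
  {a : Fin D.m → Fin t} {lam : Fin D.m → Fin t → k}

theorem not_laura_of_basis (hw : ∀ i, D.w i ≠ 0) (hlam : ∀ c, lam c ∈ D.Lam)
    (hδ : ∀ c c', lam c (a c') = if c = c' then 1 else 0)
    (hwa : ∀ i, D.w i = ∑ c, lam c i • D.w (a c))
    (hN : ∀ r ∈ D.Rel, ∀ θ ∈ D.Lam, (∀ i, θ i * r i = 0) → r = 0 ∨ θ = 0) (hm : 3 ≤ D.m)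
    {j j' : Fin t} (hj : j ∉ Set.range a) (hj' : j' ∉ Set.range a) (hne : j ≠ j') :
    ¬ Laura R := by
  have hnz := D.basis_ne_zero hlam hδ hwa hN hj
  have hnz' := D.basis_ne_zero hlam hδ hwa hN hj'
  have h01 : (⟨0, by omega⟩ : Fin D.m) ≠ ⟨1, by omega⟩ := by simp
  have h02 : (⟨0, by omega⟩ : Fin D.m) ≠ ⟨2, by omega⟩ := by simp
  have h12 : (⟨1, by omega⟩ : Fin D.m) ≠ ⟨2, by omega⟩ := by simp
  generalize (⟨0, by omega⟩ : Fin D.m) = c₀ at *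
  generalize (⟨1, by omega⟩ : Fin D.m) = c₁ at *
  generalize (⟨2, by omega⟩ : Fin D.m) = c₂ at *
  have hr := D.basisRel_mem hwa j
  have hr' := D.basisRel_mem hwa j'
  refine D.not_laura_of_triple hw (hlam c₀) (hlam c₁) (hlam c₂) (fun x y z h => ?_)
    (P := (lam c₁ j * lam c₀ j' * lam c₁ j') • basisRel a lam j -
      (lam c₀ j * lam c₁ j * lam c₁ j') • basisRel a lam j')
    (Q := (lam c₀ j * lam c₁ j * lam c₀ j') • basisRel a lam j' -
      (lam c₀ j * lam c₀ j' * lam c₁ j') • basisRel a lam j)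
    (sub_mem (D.Rel.smul_mem _ hr) (D.Rel.smul_mem _ hr'))
    (sub_mem (D.Rel.smul_mem _ hr') (D.Rel.smul_mem _ hr)) (fun i => ?_) (i := j) (.inl ?_)
  · have h0 := h (a c₀)
    have h1 := h (a c₁)
    have h2 := h (a c₂)
    simp only [hδ, if_true, if_neg h01, if_neg h02, if_neg h12, if_neg h01.symm, if_neg h02.symm,
      if_neg h12.symm] at h0 h1 h2
    exact ⟨by simpa using h0, by simpa using h1, by simpa using h2⟩
  · simp only [Pi.sub_apply, Pi.smul_apply, smul_eq_mul]
    by_cases hi : i ∈ Set.range a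
    · obtain ⟨c, rfl⟩ := hi
      rw [basisRel_basis hδ hj, basisRel_basis hδ hj', hδ, hδ]
      split_ifs with h1 h2 h2
      · exact absurd (h1.trans h2.symm) h01
      · subst h1; ring
      · subst h2; ring
      · ring
    · by_cases h1 : i = j
      · subst h1
        rw [basisRel_self hj, basisRel_of_notMem hi hne]
        ring
      · rw [basisRel_of_notMem hi h1]
        by_cases h2 : i = j'
        · subst h2
          rw [basisRel_self hj']
          ring
        · rw [basisRel_of_notMem hi h2]
          ring
  · simp only [Pi.sub_apply, Pi.smul_apply, smul_eq_mul]
    rw [basisRel_self hj, basisRel_of_notMem hj hne]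
    simp [hnz, hnz']

lemma exists_mem_Lam_eq_zero (hm : 3 ≤ D.m) (i₁ i₂ : Fin t) :
    ∃ lam ∈ D.Lam, lam ≠ 0 ∧ lam i₁ = 0 ∧ lam i₂ = 0 := by
  obtain ⟨c, hc, h⟩ := D.exists_coeffs
  let f : (Fin D.m → k) →ₗ[k] Fin t → k := Fintype.linearCombination k c
  have hf : ∀ x i, f x i = ∑ j, x j * c j i := fun x i => by
    simp [f, Fintype.linearCombination_apply]
  obtain ⟨x, hx, hx0⟩ := Submodule.exists_mem_ne_zero_of_ne_bot
    (LinearMap.ker_ne_bot_of_finrank_lt (f := (LinearMap.proj (R := k) i₁ ∘ₗ f).prod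
      (LinearMap.proj i₂ ∘ₗ f)) (by simp; omega))
  have h1 : f x i₁ = 0 ∧ f x i₂ = 0 := Prod.mk_eq_zero.1 hx
  refine ⟨f x, ?_, fun h0 => hx0 (h x fun i => ?_), h1.1, h1.2⟩
  · rw [Fintype.linearCombination_apply]
    exact D.Lam.sum_mem fun j _ => D.Lam.smul_mem _ (hc j)
  · rw [← hf, h0]; rfl

variable {D} {lam : Fin t → k} (hlam : lam ∈ D.Lam) {i₁ i₂ : Fin t} (h₁ : lam i₁ = 0)
  (h₂ : lam i₂ = 0) (hℓ₁ : 2 ≤ ℓ i₁) (hℓ₂ : 2 ≤ ℓ i₂) (hw : ∀ i, D.w i ≠ 0)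

lemma sum_smul_comp {V W : Type*} [AddCommGroup V] [Module k V] [AddCommGroup W] [Module k W]
    (hlam : lam ∈ D.Lam) {r : Fin t → k} (hr : r ∈ D.Rel) (f : V →ₗ[k] W) (v : V) :
    ∑ i, r i • (lam i • f) v = 0 := by
  simp only [LinearMap.smul_apply, ← mul_smul, ← Finset.sum_smul]
  rw [D.mem_Lam.1 hlam r hr, zero_smul]

/-- Core data with two long arms, mapping to a pencil. -/
def longSource : Core D (k × k) k where
  J i := i = i₁ ∨ i = i₂
  φ i := lam i • LinearMap.snd k k k
  ξ i := if i = i₁ then LinearMap.inl k k k ∘ₗ LinearMap.fst k k k else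
    if i = i₂ then LinearMap.inl k k k ∘ₗ (LinearMap.fst k k k - LinearMap.snd k k k) else 0
  U i := if i = i₁ ∨ i = i₂ then ⊥ else ⊤
  hJ i h := by rcases h with rfl | rfl <;> assumption
  hφ i h := by rcases h with rfl | rfl <;> simp only [h₁, h₂, zero_smul]
  hξ i h := by rw [if_neg fun h' => h (.inl h'), if_neg fun h' => h (.inr h')]
  hU i h v := by rw [if_neg h]; trivial
  hw i _ := hw i
  hr _ hr v := sum_smul_comp hlam hr _ v

/-- Core data with two long arms, receiving a map from a pencil. -/
def longTarget : Core D k (k × k) where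
  J i := i = i₁ ∨ i = i₂
  φ i := lam i • LinearMap.inl k k k
  ξ _ := 0
  U i := LinearMap.ker (if i = i₁ then LinearMap.fst k k k else
    if i = i₂ then LinearMap.fst k k k + LinearMap.snd k k k else LinearMap.snd k k k)
  hJ i h := by rcases h with rfl | rfl <;> assumption
  hφ i h := by rcases h with rfl | rfl <;> simp only [h₁, h₂, zero_smul]
  hξ _ _ := rfl
  hU i h v := by
    rw [if_neg fun h' => h (.inl h'), if_neg fun h' => h (.inr h')]
    exact mul_zero (lam i)
  hw i _ := hw i
  hr _ hr v := sum_smul_comp hlam hr _ v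

lemma longSource_indec (h0 : lam ≠ 0) (hne : i₁ ≠ i₂) :
    Indec R (longSource hlam h₁ h₂ hℓ₁ hℓ₂ hw).mod := by
  obtain ⟨j, hj⟩ := Function.ne_iff.1 h0
  refine Core.indec _ (.inl inferInstance) fun f g hf hg hφ hξ _ => ?_
  have e0 : ∀ v, (f v).2 = g v.2 := fun v => by
    have h : lam j • (f v).2 = g (lam j • v.2) := hφ j v
    rw [map_smul] at h
    exact smul_right_injective k hj h
  have e1 : (f (0, 1)).1 = 0 := by
    have h : (longSource hlam h₁ h₂ hℓ₁ hℓ₂ hw).ξ i₁ = LinearMap.inl k k k ∘ₗ LinearMap.fst k k k :=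
      if_pos rfl
    have := hξ i₁ (.inl rfl) (0, 1)
    rw [h] at this
    exact congrArg Prod.fst (this rfl)
  have e2 : (f (1, 1)).1 - (f (1, 1)).2 = 0 := by
    have h : (longSource hlam h₁ h₂ hℓ₁ hℓ₂ hw).ξ i₂ =
        LinearMap.inl k k k ∘ₗ (LinearMap.fst k k k - LinearMap.snd k k k) :=
      (if_neg hne.symm).trans (if_pos rfl)
    have := hξ i₂ (.inr rfl) (1, 1)
    rw [h] at this
    exact congrArg Prod.fst (this (Prod.ext (sub_self _) rfl))
  have f11 : f (1, 1) = f (1, 0) + f (0, 1) := by rw [← map_add]; simp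
  have fv : ∀ v, f v = v.1 • f (1, 0) + v.2 • f (0, 1) := fun v => by simp [← map_smul, ← map_add]
  have gv : ∀ x, g x = x * g 1 := fun x => by rw [← smul_eq_mul, ← map_smul]; simp
  have e3 := e0 (1, 0)
  have e4 := e0 (0, 1)
  have e5 := hg 1
  rw [gv (g 1)] at e5
  rw [map_zero] at e3
  rw [f11, Prod.fst_add, Prod.snd_add, e1, e3, e4, add_zero, zero_add] at e2
  have key : ∀ v, f v = g 1 • v := fun v => by
    refine Prod.ext ?_ ?_
    · rw [fv]; simp [e1, sub_eq_zero.1 e2, mul_comm]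
    · rw [fv]; simp [e3, e4, mul_comm]
  rcases mul_eq_zero.1 (show g 1 * (g 1 - 1) = 0 by linear_combination e5) with h | h
  · exact .inl ⟨fun v => by rw [key, h, zero_smul], fun x => by rw [gv, h, mul_zero]⟩
  · exact .inr ⟨fun v => by rw [key, sub_eq_zero.1 h, one_smul],
      fun x => by rw [gv, sub_eq_zero.1 h, mul_one]⟩

lemma longTarget_indec (h0 : lam ≠ 0) (hne : i₁ ≠ i₂) :
    Indec R (longTarget hlam h₁ h₂ hℓ₁ hℓ₂ hw).mod := by
  obtain ⟨j, hj⟩ := Function.ne_iff.1 h0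
  refine Core.indec _ (.inl inferInstance) fun f g hf _ hφ _ hU => ?_
  have e0 : (f 1, 0) = g (1, 0) := by
    have h : lam j • (f 1, (0 : k)) = g (lam j • (1, 0)) := hφ j 1
    rw [map_smul] at h
    exact smul_right_injective _ hj h
  have e1 : (g (0, 1)).1 = 0 := by
    have h := hU i₁ hℓ₁ (0, 1)
    simpa [longTarget] using h
  have e2 : (g (1, -1)).1 + (g (1, -1)).2 = 0 := by
    have h := hU i₂ hℓ₂ (1, -1)
    simpa [longTarget, hne.symm] using h
  have g11 : g (1, -1) = g (1, 0) - g (0, 1) := by rw [← map_sub]; simp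
  have gv : ∀ v, g v = v.1 • g (1, 0) + v.2 • g (0, 1) := fun v => by simp [← map_smul, ← map_add]
  have fv : ∀ x, f x = x * f 1 := fun x => by rw [← smul_eq_mul, ← map_smul]; simp
  have e5 := hf 1
  rw [fv (f 1)] at e5
  rw [g11, ← e0, Prod.fst_sub, Prod.snd_sub, e1] at e2
  have e6 : (g (0, 1)).2 = f 1 := by linear_combination -e2
  have key : ∀ v, g v = f 1 • v := fun v => by
    refine Prod.ext ?_ ?_
    · rw [gv]; simp [e1, ← e0, mul_comm]
    · rw [gv]; simp [e6, ← e0, mul_comm]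
  rcases mul_eq_zero.1 (show f 1 * (f 1 - 1) = 0 by linear_combination e5) with h | h
  · exact .inl ⟨fun x => by rw [fv, h, mul_zero], fun v => by rw [key, h, zero_smul]⟩
  · exact .inr ⟨fun x => by rw [fv, sub_eq_zero.1 h, mul_one],
      fun v => by rw [key, sub_eq_zero.1 h, one_smul]⟩

theorem not_laura_of_two_long (D : TD k R t ℓ) (hw : ∀ i, D.w i ≠ 0) (hm : 3 ≤ D.m)
    {r : Fin t → k} (hr : r ∈ D.Rel) (hr0 : r ≠ 0) {i₁ i₂ : Fin t} (hne : i₁ ≠ i₂)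
    (hℓ₁ : 3 ≤ ℓ i₁) (hℓ₂ : 3 ≤ ℓ i₂) : ¬ Laura R := by
  obtain ⟨lam, hlam, h0, h₁, h₂⟩ := D.exists_mem_Lam_eq_zero hm i₁ i₂
  obtain ⟨mu, hmu, hp⟩ := D.exists_pencil_of (by omega) h0
  obtain ⟨i, hi⟩ := Function.ne_iff.1 hr0
  have hℓ : ∀ {V : Type u} [AddCommGroup V] [Module k V] (v : V) (i), r i • v ≠ 0 → 2 ≤ ℓ i :=
    fun v i hv => D.adm r (D.mem_Rel.1 hr) i fun h => hv (by rw [h, zero_smul])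
  let X := longSource hlam h₁ h₂ (by omega) (by omega) hw
  let Y := longTarget hlam h₁ h₂ (by omega) (by omega) hw
  let B (n : ℕ) : Core D (Fin (n + 2) → k) (Fin (n + 2) → k) :=
    D.pencil hlam hmu (shift k n) (fun _ => False) 0
      (fun i => if i = i₁ ∨ i = i₂ then LinearMap.range (shift k n) else ⊤)
      (fun i h => h.elim) (fun i h => h.elim) (fun i _ => rfl)
      (fun j _ v => by
        split_ifs with h
        · have : lam j = 0 := by rcases h with rfl | rfl <;> assumption
          rw [this, zero_smul, zero_add]
          exact Submodule.smul_mem _ _ ⟨v, rfl⟩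
        · trivial)
      (fun i _ => hw i)
  have hX : Indec R X.mod := longSource_indec _ _ _ _ _ _ h0 hne
  have hY : Indec R Y.mod := longTarget_indec _ _ _ _ _ _ h0 hne
  have hB : ∀ n, Indec R (B n).mod := fun n => D.pencil_indec hlam hmu n _ _ _ _ _ _ _ _ hp
  have hXB : ∀ n, Step R X.mod (B n).mod := fun n =>
    X.step_of_map (B n) hX X.fdMod (hB n) (B n).fdMod
      (LinearMap.toSpanSingleton k _ (Pi.single 0 1) ∘ₗ LinearMap.snd k k k)
      (LinearMap.toSpanSingleton k _ (Pi.single 0 1))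
      (fun j v => by
        change lam j • (v.2 • Pi.single 0 1) + mu j • shift k n (v.2 • Pi.single 0 1) =
          (lam j • v.2 : k) • Pi.single 0 1
        rw [map_smul, shift_zero]
        simp [mul_smul])
      (fun _ _ => rfl)
      (fun j w hv => by
        change w ∈ ite _ _ _ at hv
        change _ ∈ ite _ _ _
        split_ifs at hv ⊢
        · rw [(Submodule.mem_bot k).1 hv, LinearMap.map_zero]; exact zero_mem _
        · trivial)
      (fun _ _ h => h.elim)
      (v := (1, 0)) (v' := (0, 1)) (by simp) (by simp)
      (by change (1 : k) • (Pi.single 0 1 : Fin (n + 2) → k) ≠ 0; rw [one_smul];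
          exact single_zero_ne k n)
  have hlast : ∀ n (w : Fin (n + 2) → k), w ∈ LinearMap.range (shift k n) → w (Fin.last _) = 0 := by
    rintro n _ ⟨v, rfl⟩
    exact shift_last k n v
  have hBY : ∀ n, Step R (B n).mod Y.mod := fun n =>
    (B n).step_of_map Y (hB n) (B n).fdMod hY Y.fdMod (LinearMap.proj (Fin.last _))
      (LinearMap.inl k k k ∘ₗ LinearMap.proj (Fin.last _))
      (fun j v => by
        refine Prod.ext ?_ ?_
        · change lam j • v (Fin.last _) =
            lam j • v (Fin.last _) + mu j • shift k n v (Fin.last _)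
          rw [shift_last, smul_zero, add_zero]
        · exact mul_zero (lam j))
      (fun _ _ => rfl)
      (fun j w hv => by
        change w ∈ ite _ _ _ at hv
        change _ ∈ LinearMap.ker (ite _ _ _)
        by_cases h1 : j = i₁
        · rw [if_pos (.inl h1)] at hv
          rw [if_pos h1]
          exact hlast n w hv
        rw [if_neg h1]
        by_cases h2 : j = i₂
        · rw [if_pos (.inr h2)] at hv
          rw [if_pos h2]
          exact (add_zero _).trans (hlast n w hv)
        · rw [if_neg h2]; rfl)
      (fun j _ hj w hv => by
        change w ∈ ite _ _ _ at hv
        rw [if_pos (show j = i₁ ∨ j = i₂ from hj)] at hv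
        change (w (Fin.last _), (0 : k)) = 0
        rw [hlast n w hv]; rfl)
      (v := Pi.single 0 1) (v' := Pi.single (Fin.last _) 1) (single_zero_ne k n)
      (by simp [Fin.last_pos.ne']) (by simp)
  refine Core.not_laura B hB (fun n => ?_) (fun n => ?_) fun n n' h => by simpa using h
  · refine X.not_inLeftPart_of_family hw hX X.fdMod (.single (hXB n)) (fun i => r i • (1, 0))
      (hℓ _) (fun θ hθ => D.smul_family hr _ hθ) (fun j => ?_) (fun j => ?_) (i := i)
      (smul_ne_zero hi (by simp))
    · change lam j • (r j • (0 : k)) = 0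
      simp
    · by_cases h1 : j = i₁
      · exact .inr (h1 ▸ hℓ₁)
      by_cases h2 : j = i₂
      · exact .inr (h2 ▸ hℓ₂)
      · refine .inl ?_
        rw [X.hξ j (by rintro (h | h) <;> contradiction)]
        rfl
  · refine Y.not_inRightPart_of_family hw hY Y.fdMod (.single (hBY n))
      (fun i => r i • LinearMap.snd k k k)
      (fun i hv => D.adm r (D.mem_Rel.1 hr) i fun h => hv (by rw [h, zero_smul])) (fun θ hθ => D.smul_family hr _ hθ) (fun j => ?_)
      (i := i) fun h => hi (by simpa using LinearMap.congr_fun h (0, 1))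
    by_cases h1 : j = i₁
    · exact .inr ⟨.inl h1, h1 ▸ hℓ₁⟩
    by_cases h2 : j = i₂
    · exact .inr ⟨.inr h2, h2 ▸ hℓ₂⟩
    · refine .inl fun w hv => ?_
      change w ∈ LinearMap.ker (ite _ _ _) at hv
      rw [if_neg h1, if_neg h2] at hv
      change r j • w.2 = 0
      rw [show w.2 = 0 from hv, smul_zero]

end TD

namespace TD

variable (D : TD k R t ℓ)

/-- Functionals at the sink vanishing on the image of the final part of every branch. -/
def SinkFunctional {M : Type u} [AddCommGroup M] [Module R M] [Module k M] (u : M →ₗ[k] k) : Prop :=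
  (∀ m, u (D.e .snk • m) = u m) ∧ ∀ i m, u (D.p i 1 (ℓ i) • m) = 0

variable {D}

lemma span_compl {V : Type*} [AddCommGroup V] [Module k V] {u : V →ₗ[k] k} {S : Submodule k V}
    {g : V} (hg : g ∈ S) (hu : u g = 1) : Disjoint (Submodule.span k {g}) (LinearMap.ker u ⊓ S) ∧
      Submodule.span k {g} ⊔ LinearMap.ker u ⊓ S = S := by
  constructor
  · rw [Submodule.disjoint_def]
    rintro v hv ⟨hv', -⟩
    obtain ⟨c, rfl⟩ := Submodule.mem_span_singleton.1 hv
    have : u (c • g) = 0 := hv'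
    rw [map_smul, hu, smul_eq_mul, mul_one] at this
    rw [this, zero_smul]
  · refine le_antisymm (sup_le ((Submodule.span_singleton_le_iff_mem _ _).2 hg) inf_le_right)
      fun v hv => Submodule.mem_sup.2 ⟨u v • g, Submodule.mem_span_singleton.2 ⟨_, rfl⟩,
        v - u v • g, ⟨?_, S.sub_mem hv (S.smul_mem _ hg)⟩, add_sub_cancel _ _⟩
    change u (v - u v • g) = 0
    rw [map_sub, map_smul, hu, smul_eq_mul, mul_one, sub_self]

/-- Indecomposable modules with a nonzero sink functional, if there is at most one long arm. -/
lemma SinkFunctional.monoRep {M : ModuleCat.{u} R} [Module k M] [IsScalarTower k R M]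
    (hM : Indec R M) (hℓ : ∀ i, 2 ≤ ℓ i) {i₁ : Fin t} (h₁ : ∀ i ≠ i₁, ℓ i = 2) {u : M →ₗ[k] k}
    (hu : D.SinkFunctional u) (h0 : u ≠ 0) :
    D.MonoRep M ∧ ∀ m : M, D.e .snk • m = m → u m = 0 → m = 0 := by
  have hex : ∃ j, j ≤ ℓ i₁ ∧ ∃ m, u (D.p i₁ j (ℓ i₁) • m) ≠ 0 := by
    obtain ⟨m, hm⟩ := DFunLike.ne_iff.1 h0
    exact ⟨ℓ i₁, le_rfl, m, by rwa [D.p_self_smul le_rfl, D.vtx_ℓ, hu.1]⟩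
  obtain ⟨j, ⟨hj, m, hm⟩, hmin⟩ : ∃ j, (j ≤ ℓ i₁ ∧ ∃ m, u (D.p i₁ j (ℓ i₁) • m) ≠ 0) ∧
      ∀ a < j, ∀ m, u (D.p i₁ a (ℓ i₁) • m) = 0 := by
    refine ⟨Nat.find hex, Nat.find_spec hex, fun a ha m => by_contra fun h => ?_⟩
    exact Nat.find_min hex ha ⟨ha.le.trans (Nat.find_spec hex).1, m, h⟩
  have h2 : 2 ≤ j := by
    by_contra hlt
    obtain rfl | rfl : j = 0 ∨ j = 1 := by omega
    · rw [← D.p_p_smul zero_le_one (by have := hℓ i₁; omega) le_rfl] at hm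
      exact hm (hu.2 _ _)
    · exact hm (hu.2 _ _)
  obtain ⟨x, hx, hx1⟩ : ∃ x, D.e (vtx t ℓ i₁ j) • x = x ∧ u (D.p i₁ j (ℓ i₁) • x) = 1 := by
    refine ⟨(u (D.p i₁ j (ℓ i₁) • m))⁻¹ • D.e (vtx t ℓ i₁ j) • m, ?_, ?_⟩
    · rw [smul_comm, D.e_e_self]
    · rw [smul_comm, D.p_e_smul hj le_rfl, map_smul, smul_eq_mul, inv_mul_cancel₀ hm]
  let P : Vtx t ℓ → Submodule k M := fam ⊥ (Submodule.span k {D.p i₁ j (ℓ i₁) • x})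
    fun i a => if i = i₁ ∧ j ≤ a then Submodule.span k {D.p i₁ j a • x} else ⊥
  let Q : Vtx t ℓ → Submodule k M := fam (D.at' M .src) (LinearMap.ker u ⊓ D.at' M .snk)
    fun i a => if i = i₁ ∧ j ≤ a then
      LinearMap.ker (u ∘ₗ act M (D.p i₁ a (ℓ i₁))) ⊓ D.at' M (vtx t ℓ i₁ a) else D.at' M (vtx t ℓ i a)
  have hP₁ : ∀ a, j ≤ a → a ≤ ℓ i₁ → P (vtx t ℓ i₁ a) = Submodule.span k {D.p i₁ j a • x} :=
    fun a ha hl => by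
      have : P (vtx t ℓ i₁ a) = _ := fam_vtx _ _ _ i₁ a
      rw [this, if_neg (by omega), if_pos (show i₁ = i₁ ∧ j ≤ a from ⟨rfl, ha⟩)]
      split_ifs with h
      · rfl
      · rw [show a = ℓ i₁ by omega]
  have hP₀ : ∀ i a, a < ℓ i → ¬ (i = i₁ ∧ j ≤ a) → P (vtx t ℓ i a) = ⊥ := fun i a ha h => by
    have : P (vtx t ℓ i a) = _ := fam_vtx _ _ _ i a
    rw [this, if_pos ha, if_neg h, ite_self]
  have hQ₁ : ∀ a, j ≤ a → a ≤ ℓ i₁ → ∀ m, m ∈ Q (vtx t ℓ i₁ a) ↔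
      u (D.p i₁ a (ℓ i₁) • m) = 0 ∧ D.e (vtx t ℓ i₁ a) • m = m := fun a ha hl m => by
    have : Q (vtx t ℓ i₁ a) = _ := fam_vtx _ _ _ i₁ a
    rw [this, if_neg (by omega), if_pos (show i₁ = i₁ ∧ j ≤ a from ⟨rfl, ha⟩)]
    split_ifs with h
    · rfl
    · rw [show a = ℓ i₁ by omega, D.p_self_smul le_rfl, D.vtx_ℓ, hu.1]
      rfl
  have hQ₀ : ∀ i a, a < ℓ i → ¬ (i = i₁ ∧ j ≤ a) → Q (vtx t ℓ i a) = D.at' M (vtx t ℓ i a) :=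
    fun i a ha h => by
      have : Q (vtx t ℓ i a) = _ := fam_vtx _ _ _ i a
      rw [this, if_pos ha, if_neg h]
      split_ifs with h0
      · rw [h0, vtx_zero]
      · rfl
  have hcompl : ∀ v, Disjoint (P v) (Q v) ∧ P v ⊔ Q v = D.at' M v := by
    refine vtx_forall ⟨disjoint_bot_left, bot_sup_eq _⟩ ?_ fun i a h0 ha => ?_
    · refine span_compl ?_ hx1
      rw [← D.vtx_ℓ i₁]
      exact D.p_mem hj le_rfl x
    · by_cases h : i = i₁ ∧ j ≤ a
      · obtain ⟨rfl, h⟩ := h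
        rw [hP₁ a h ha.le, show Q (vtx t ℓ i a) =
          LinearMap.ker (u ∘ₗ act M (D.p i a (ℓ i))) ⊓ D.at' M (vtx t ℓ i a) from
          Submodule.ext (hQ₁ a h ha.le)]
        refine span_compl (D.p_mem h ha.le x) ?_
        change u (D.p i a (ℓ i) • D.p i j a • x) = 1
        rw [D.p_p_smul h ha.le le_rfl, hx1]
      · rw [hP₀ i a ha h, hQ₀ i a ha h]
        exact ⟨disjoint_bot_left, bot_sup_eq _⟩
  have key : (∀ v, P v = ⊥) ∨ ∀ v, Q v = ⊥ := by
    refine D.indec_split hM P Q (fun i a ha m hm => ?_) (fun i a ha m hm => ?_)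
      (fun v => (hcompl v).1) fun v => (hcompl v).2
    · by_cases h : i = i₁ ∧ j ≤ a
      · obtain ⟨rfl, h⟩ := h
        rw [hP₁ a h ha.le] at hm
        obtain ⟨c, rfl⟩ := Submodule.mem_span_singleton.1 hm
        rw [hP₁ _ (by omega) ha, smul_comm, D.p_p_smul h (Nat.le_succ a) ha]
        exact Submodule.smul_mem _ _ (Submodule.mem_span_singleton_self _)
      · rw [hP₀ i a ha h] at hm
        rw [(Submodule.mem_bot k).1 hm, smul_zero]
        exact zero_mem _
    · have hmem : D.e (vtx t ℓ i (a + 1)) • D.p i a (a + 1) • m = D.p i a (a + 1) • m :=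
        D.e_p_smul (Nat.le_succ a) ha m
      by_cases h : i = i₁ ∧ j ≤ a + 1
      · obtain ⟨rfl, h⟩ := h
        rw [hQ₁ _ h ha, D.p_p_smul (Nat.le_succ a) ha le_rfl]
        refine ⟨?_, hmem⟩
        by_cases h' : j ≤ a
        · exact ((hQ₁ a h' ha.le m).1 hm).1
        · exact hmin a (by omega) m
      · by_cases hl : a + 1 < ℓ i
        · rw [hQ₀ i _ hl h]; exact hmem
        · have hl : a + 1 = ℓ i := by omega
          have hi : i ≠ i₁ := fun hi => h ⟨hi, by subst hi; omega⟩
          have ha1 : a = 1 := by have := h₁ i hi; omega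
          subst ha1
          rw [hl] at hmem ⊢
          rw [D.vtx_ℓ] at hmem ⊢
          exact ⟨hu.2 i m, hmem⟩
  rcases key with h | h
  · have h1 := hP₁ j le_rfl hj
    rw [h, D.p_self_smul hj, hx] at h1
    rw [Submodule.span_singleton_eq_bot.1 h1.symm, smul_zero, map_zero] at hx1
    exact absurd hx1 zero_ne_one
  · have hQ : ∀ v m, m ∈ Q v → m = 0 := fun v m hm => by
      rw [h] at hm; exact (Submodule.mem_bot k).1 hm
    refine ⟨⟨fun m hm => hQ .src m hm, fun i a ha n hn hn₀ => hQ (vtx t ℓ i a) n ?_⟩,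
      fun m hm hm' => hQ .snk m ⟨hm', hm⟩⟩
    by_cases ht : i = i₁ ∧ j ≤ a
    · obtain ⟨rfl, hja⟩ := ht
      rw [hQ₁ a hja ha.le, ← D.p_p_smul (Nat.le_succ a) ha le_rfl, hn₀, smul_zero, map_zero]
      exact ⟨rfl, hn⟩
    · rw [hQ₀ i a ha ht]; exact hn

/-- The algebra is weakly shod if all relations between the branches are multiples of one relation
of full support and at most one branch is long. -/
theorem weaklyShod_of_Rel_eq_span (D : TD k R t ℓ) (ht : 0 < t) (hw : ∀ i, D.w i ≠ 0)
    {r : Fin t → k} (hr : D.Rel = Submodule.span k {r}) (hr0 : ∀ i, r i ≠ 0) {i₁ : Fin t}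
    (h₁ : ∀ i ≠ i₁, ℓ i = 2) : WeaklyShod R := by
  have hrm : r ∈ D.Rel := by rw [hr]; exact Submodule.mem_span_singleton_self r
  have hℓ : ∀ i, 2 ≤ ℓ i := fun i => D.adm r (D.mem_Rel.1 hrm) i (hr0 i)
  let A (M : ModuleCat.{u} R) : Prop := letI := kMod k R M
    ∀ u : M →ₗ[k] k, D.SinkFunctional u → u = 0
  let B (M : ModuleCat.{u} R) : Prop := D.MonoRep M ∧ (letI := kMod k R M
    ∃ u : M →ₗ[k] k, D.SinkFunctional u ∧ ∀ m : M, D.e .snk • m = m → u m = 0 → m = 0)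
  refine weaklyShod_of_split A B (fun M hi _ => ?_) (fun M N _ _ _ _ hM hN f => ?_)
    (fun M _ _ hM => MonoRep.pdLeOne D ht hM.1) fun M _ hf hM => ?_
  · let _ := kMod k R M
    by_cases h : A M
    · exact .inl h
    · obtain ⟨u, hu⟩ := not_forall.1 h
      obtain ⟨hu, h0⟩ := Classical.not_imp.1 hu
      have := hu.monoRep hi hℓ h₁ h0
      exact .inr ⟨this.1, u, hu, this.2⟩
  · let _ := kMod k R M
    let _ := kMod k R N
    obtain ⟨hN, u, hu, hu'⟩ := hN
    have h0 := hM (u ∘ₗ TD.toK f) ⟨fun m => ?_, fun i m => ?_⟩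
    · exact D.hom_eq_zero_of_map_snk (fun m hm => hu' _ (D.map_at f hm) (LinearMap.congr_fun h0 m))
        hN.2 ht
    · change u (f _) = u (f m)
      rw [map_smul, hu.1]
    · change u (f _) = 0
      rw [map_smul, hu.2]
  · let _ := kMod k R M
    have := D.finite_of_fd hf
    refine D.id_le_one ht M (fun i a b hab hb h0 => absurd h0
      (D.p_ne_zero_of_w (hw i) hab.le hb)) fun ξ hξ hΛ hp i => hM _ ⟨hξ i, fun j m => ?_⟩
    have key : (fun i => ξ i (D.p j 1 (ℓ j) • m)) ∈ D.Rel := D.mem_Rel_of_Lam fun θ hθ => by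
      have := LinearMap.congr_fun (hΛ θ hθ) (D.p j 1 (ℓ j) • m)
      simpa [LinearMap.sum_apply, mul_comm] using this
    rw [hr] at key
    obtain ⟨c, hc⟩ := Submodule.mem_span_singleton.1 key
    have h1 := congrFun hc j
    have h2 := congrFun hc i
    simp only [Pi.smul_apply, hp, smul_eq_mul] at h1 h2
    rw [← h2, (mul_eq_zero.1 h1).resolve_right (hr0 j), zero_mul]

variable (D)

/-- Coordinates on the paths from the source to the sink with respect to two of the branches, such
that any two branches are linearly independent. -/
structure Coord where
  β₁ : R →ₗ[k] k
  β₂ : R →ₗ[k] k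
  i₁ : Fin t
  i₂ : Fin t
  w_eq : ∀ i, D.w i = β₁ (D.w i) • D.w i₁ + β₂ (D.w i) • D.w i₂
  β₁_w₁ : β₁ (D.w i₁) = 1
  β₁_w₂ : β₁ (D.w i₂) = 0
  β₂_w₁ : β₂ (D.w i₁) = 0
  β₂_w₂ : β₂ (D.w i₂) = 1
  β₁_e : ∀ r, β₁ (D.e .snk * r * D.e .src) = β₁ r
  β₂_e : ∀ r, β₂ (D.e .snk * r * D.e .src) = β₂ r
  w_ne : ∀ i, D.w i ≠ 0
  indep : ∀ i j, i ≠ j → β₁ (D.w i) * β₂ (D.w j) ≠ β₁ (D.w j) * β₂ (D.w i)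

namespace Coord

variable {D} (P : D.Coord) {K : Type u} [Field K] [Algebra k K] (x : K)

lemma mem_Lam (β : R →ₗ[k] k) : (fun i => β (D.w i)) ∈ D.Lam :=
  D.mem_Lam.2 fun r hr => by
    have := congrArg β (D.mem_Rel.1 hr)
    simpa [map_sum] using this

/-- The values of a generic functional on the branches. -/
def c (i : Fin t) : K := algebraMap k K (P.β₁ (D.w i)) + x * algebraMap k K (P.β₂ (D.w i))

lemma c_ne_zero {x : K} (hx : Transcendental k x) (i : Fin t) : P.c x i ≠ 0 := by
  intro h
  have h1 : (Polynomial.C (P.β₁ (D.w i)) + Polynomial.X * Polynomial.C (P.β₂ (D.w i)) :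
      Polynomial k) = 0 := by
    by_contra h0
    exact hx ⟨_, h0, by simpa [c, mul_comm x] using h⟩
  have h2 := congrArg (fun q => Polynomial.coeff q 0) h1
  have h3 := congrArg (fun q => Polynomial.coeff q 1) h1
  simp [Polynomial.coeff_C] at h2 h3
  apply P.w_ne i
  rw [P.w_eq i, h2, h3, zero_smul, zero_smul, add_zero]

/-- Partial fractions with distinct poles are linearly independent. -/
lemma partial_fractions {x : K} (hx : Transcendental k x) (s : Fin t → k)
    (hs : ∑ i, algebraMap k K (s i) * (algebraMap k K (P.β₂ (D.w i)) ^ 2 / P.c x i) = 0)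
    (i : Fin t) : P.β₂ (D.w i) = 0 ∨ s i = 0 := by
  let L (i : Fin t) : Polynomial k :=
    Polynomial.C (P.β₁ (D.w i)) + Polynomial.X * Polynomial.C (P.β₂ (D.w i))
  have hL : ∀ i, Polynomial.aeval x (L i) = P.c x i := fun i => by simp [L, c, mul_comm x]
  let q : Polynomial k := ∑ i, Polynomial.C (s i * P.β₂ (D.w i) ^ 2) *
    ∏ j ∈ Finset.univ.erase i, L j
  have hq : q = 0 := by
    by_contra h0
    refine hx ⟨q, h0, ?_⟩
    have h1 : Polynomial.aeval x q = (∏ j, P.c x j) *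
        ∑ i, algebraMap k K (s i) * (algebraMap k K (P.β₂ (D.w i)) ^ 2 / P.c x i) := by
      rw [map_sum, Finset.mul_sum]
      refine Finset.sum_congr rfl fun i _ => ?_
      rw [map_mul, map_prod, Polynomial.aeval_C, ← Finset.mul_prod_erase _ _ (Finset.mem_univ i)]
      simp only [hL, map_mul, map_pow]
      field_simp [P.c_ne_zero hx i]
    rw [h1, hs, mul_zero]
  refine or_iff_not_imp_left.2 fun hi => ?_
  have h1 := congrArg (Polynomial.eval (-P.β₁ (D.w i) / P.β₂ (D.w i))) hq
  have h2 : ∀ j, Polynomial.eval (-P.β₁ (D.w i) / P.β₂ (D.w i)) (L j) * P.β₂ (D.w i) =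
      P.β₁ (D.w j) * P.β₂ (D.w i) - P.β₁ (D.w i) * P.β₂ (D.w j) := fun j => by
    simp only [L, Polynomial.eval_add, Polynomial.eval_mul, Polynomial.eval_C, Polynomial.eval_X]
    field_simp
    ring
  rw [Polynomial.eval_finsetSum, Finset.sum_eq_single i _ (by simp)] at h1
  · rw [Polynomial.eval_mul, Polynomial.eval_C, Polynomial.eval_prod, Polynomial.eval_zero] at h1
    rcases mul_eq_zero.1 h1 with h | h
    · exact (mul_eq_zero.1 h).resolve_right (pow_ne_zero 2 hi)
    · obtain ⟨j, hj, h0⟩ := Finset.prod_eq_zero_iff.1 h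
      have := h2 j
      rw [h0, zero_mul] at this
      exact absurd (sub_eq_zero.1 this.symm) (P.indep j i (Finset.ne_of_mem_erase hj))
  · intro j _ hj
    have := h2 i
    rw [sub_self, mul_eq_zero] at this
    rw [Polynomial.eval_mul, Polynomial.eval_prod, Finset.prod_eq_zero
      (Finset.mem_erase.2 ⟨hj.symm, Finset.mem_univ i⟩) (this.resolve_right hi), mul_zero]

section Functional

variable {M : Type u} [AddCommGroup M] [Module R M] [Module k M] [IsScalarTower k R M]

/-- The functionals on `M` corresponding to the homomorphisms to the generic module. -/
structure GenFunctional (ψ : M →ₗ[k] K) : Prop where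
  snk : ∀ m, ψ (D.e .snk • m) = ψ m
  mul : ∀ m, ψ (D.w P.i₂ • m) = x * ψ (D.w P.i₁ • m)

variable (M) in
/-- A module is torsion if it has no nonzero generic functionals. -/
def Tors : Prop := ∀ ψ : M →ₗ[k] K, P.GenFunctional x ψ → ψ = 0

variable {P x}

lemma GenFunctional.map_w {ψ : M →ₗ[k] K} (hψ : P.GenFunctional x ψ) (i : Fin t) (m : M) :
    ψ (D.w i • m) = P.c x i * ψ (D.w P.i₁ • m) := by
  rw [P.w_eq i, add_smul, smul_assoc, smul_assoc, map_add, LinearMap.map_smul ψ,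
    LinearMap.map_smul ψ, hψ.mul, c,
    Algebra.smul_def, Algebra.smul_def]
  ring

lemma GenFunctional.comp {N : Type u} [AddCommGroup N] [Module R N] [Module k N]
    [IsScalarTower k R N] {ψ : M →ₗ[k] K} (hψ : P.GenFunctional x ψ) (f : N →ₗ[R] M) :
    P.GenFunctional x (ψ ∘ₗ toK f) where
  snk m := by
    change ψ (f _) = ψ (f _)
    rw [map_smul, hψ.snk]
  mul m := by
    change ψ (f _) = x * ψ (f _)
    rw [map_smul, hψ.mul, map_smul f]

lemma Tors.of_surjective {N : Type u} [AddCommGroup N] [Module R N] [Module k N]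
    [IsScalarTower k R N] (hM : P.Tors x M) (f : M →ₗ[R] N) (hf : Function.Surjective f) :
    P.Tors x N := fun ψ hψ => LinearMap.ext fun n => by
  obtain ⟨m, rfl⟩ := hf n
  exact LinearMap.congr_fun (hM _ (hψ.comp f)) m

/-- The functional on the algebra given by a functional on `M` and an element of `M`. -/
def orb (ψ : M →ₗ[k] K) (m : M) : R →ₗ[k] K where
  toFun r := ψ (r • m)
  map_add' r s := by rw [add_smul, map_add]
  map_smul' a r := by rw [smul_assoc, map_smul]; rfl

lemma GenFunctional.orb {ψ : M →ₗ[k] K} (hψ : P.GenFunctional x ψ) (m : M) :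
    P.GenFunctional (M := R) x (orb ψ m) where
  snk r := by
    change ψ ((D.e .snk * r) • m) = ψ (r • m)
    rw [mul_smul, hψ.snk]
  mul r := by
    change ψ ((D.w P.i₂ * r) • m) = x * ψ ((D.w P.i₁ * r) • m)
    rw [mul_smul, hψ.mul, mul_smul]

/-- The spaces of the generic module at the vertices are one-dimensional over `K`. -/
lemma GenFunctional.eq_zero (hx : Transcendental k x) {χ : R →ₗ[k] K}
    (hχ : P.GenFunctional (M := R) x χ) {i : Fin t} {a : ℕ} (ha : a ≤ ℓ i)
    (h : ∀ r, χ (r * D.e (vtx t ℓ i a)) = χ r) (h0 : χ (D.p i a (ℓ i)) = 0) : χ = 0 := by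
  have key : (⊤ : Submodule k R) ≤ LinearMap.ker χ := by
    rw [← D.span_top, Submodule.span_le]
    rintro _ (⟨v, rfl⟩ | ⟨j, b, c, hbc, hc, rfl⟩)
    · change χ _ = 0
      have h1 : χ (D.e .snk * D.e v) = χ (D.e v) := hχ.snk _
      rw [← h1, D.e_mul]
      split_ifs with hv
      · rw [← h, D.e_mul]
        split_ifs with hv'
        · obtain rfl : a = ℓ i := (vtx_inj_same ha le_rfl (hv'.symm.trans (D.vtx_ℓ i).symm))
          rw [D.p_self i _ le_rfl] at h0
          rwa [hv']
        · exact map_zero χ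
      · exact map_zero χ
    · change χ _ = 0
      have h1 : χ (D.e .snk * D.p j b c) = χ (D.p j b c) := hχ.snk _
      by_cases hc' : c = ℓ j
      · subst hc'
        rw [← h]
        by_cases hv : vtx t ℓ i a = vtx t ℓ j b
        · rw [hv, D.p_e j b _ hbc.le le_rfl]
          rcases Nat.eq_zero_or_pos b with rfl | hb
          · obtain rfl : a = 0 := vtx_inj_same ha (Nat.zero_le _) (by rw [hv, vtx_zero, vtx_zero])
            have hw : ∀ i, χ (D.w i) = P.c x i * χ (D.w P.i₁) := fun i => by
              simpa using hχ.map_w i (1 : R)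
            have h2 : P.c x i * χ (D.w P.i₁) = 0 := by rw [← hw]; exact h0
            exact (hw j).trans (by
              rw [(mul_eq_zero.1 h2).resolve_left (P.c_ne_zero hx i), mul_zero])
          · obtain ⟨rfl, rfl⟩ := vtx_inj hb hbc hv.symm
            exact h0
        · rw [D.p_e_of_ne j b _ hbc.le le_rfl _ (Ne.symm hv), map_zero]
      · rw [← h1, ← D.e_p j b c hbc.le hc, ← mul_assoc, D.e_mul, if_neg, zero_mul, map_zero]
        intro hv
        exact hc' (vtx_inj_same hc le_rfl (hv.symm.trans (D.vtx_ℓ j).symm))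
  exact LinearMap.ext fun r => key trivial

/-- A torsion module has injective dimension at most one. -/
lemma Tors.idLeOne (ht : 0 < t) (hx : Transcendental k x) (M : ModuleCat.{u} R) [Module k M]
    [IsScalarTower k R M] [Module.Finite k M] (hM : P.Tors x M) : IdLeOne R M := by
  refine D.id_le_one ht M (fun i a b hab hb h0 => absurd h0
    (D.p_ne_zero_of_w (P.w_ne i) hab.le hb)) fun ξ hξ hΛ hp => ?_
  have h1 : ∀ m, ∑ i, P.β₁ (D.w i) * ξ i m = 0 := fun m => by
    have := LinearMap.congr_fun (hΛ _ (mem_Lam P.β₁)) m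
    simpa [LinearMap.sum_apply] using this
  have h2 : ∀ m, ∑ i, P.β₂ (D.w i) * ξ i m = 0 := fun m => by
    have := LinearMap.congr_fun (hΛ _ (mem_Lam P.β₂)) m
    simpa [LinearMap.sum_apply] using this
  let ψ : M →ₗ[k] K := ∑ i, (ξ i).smulRight (algebraMap k K (P.β₂ (D.w i)) ^ 2 / P.c x i)
  have hψ : ∀ m, ψ m = ∑ i, algebraMap k K (ξ i m) *
      (algebraMap k K (P.β₂ (D.w i)) ^ 2 / P.c x i) := fun m => by
    simp [ψ, LinearMap.sum_apply, Algebra.smul_def]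
  have hgen : P.GenFunctional x ψ := ⟨fun m => by simp only [hψ, hξ], fun m => by
    have h3 : ∀ i, P.β₁ (D.w i) * ξ i (D.w P.i₁ • m) + P.β₂ (D.w i) * ξ i (D.w P.i₂ • m) = 0 :=
      fun i => by
        have := hp i (D.p i 0 1 • m)
        rw [D.p_p_smul (Nat.zero_le 1) (D.hℓ i) le_rfl] at this
        change ξ i (D.w i • m) = 0 at this
        rw [P.w_eq i, add_smul, smul_assoc, smul_assoc, map_add,
          LinearMap.map_smul (ξ i), LinearMap.map_smul (ξ i)] at this
        exact this
    have h4 := congrArg (algebraMap k K) (h2 (D.w P.i₁ • m))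
    rw [map_sum, map_zero] at h4
    rw [hψ, hψ, Finset.mul_sum, ← sub_eq_zero, ← Finset.sum_sub_distrib, ← neg_eq_zero, ← h4,
      ← Finset.sum_neg_distrib]
    refine Finset.sum_congr rfl fun i _ => ?_
    have h5 := congrArg (algebraMap k K) (h3 i)
    rw [map_add, map_mul, map_mul, map_zero] at h5
    have hc := P.c_ne_zero hx i
    rw [map_mul]
    field_simp
    simp only [c]
    linear_combination (-algebraMap k K (P.β₂ (D.w i))) * h5⟩
  have h6 : ∀ i m, P.β₂ (D.w i) = 0 ∨ ξ i m = 0 := fun i m =>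
    P.partial_fractions hx (fun i => ξ i m) (by rw [← hψ, hM ψ hgen]; rfl) i
  intro i
  ext m
  refine (h6 i m).elim (fun hi => ?_) id
  have h7 := h1 m
  rw [Finset.sum_eq_single i _ (by simp)] at h7
  · refine (mul_eq_zero.1 h7).resolve_left fun h => P.w_ne i ?_
    rw [P.w_eq i, h, hi, zero_smul, zero_smul, add_zero]
  · intro j _ hj
    rw [(h6 j m).resolve_left fun h => P.indep i j hj.symm (by rw [h, hi]; simp), mul_zero]

end Functional

end Coord

end TD

namespace TD.Coord

variable {D : TD k R t ℓ}
  (P : D.Coord) {K : Type u} [Field K] [Algebra k K] (x : K)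

/-- The generic module as a space of functionals on the algebra. -/
def genSub : Submodule k (R →ₗ[k] K) where
  carrier := {χ | P.GenFunctional (M := R) x χ}
  add_mem' := fun {χ χ'} h h' =>
    ⟨fun m => by rw [LinearMap.add_apply, h.snk, h'.snk, LinearMap.add_apply],
      fun m => by rw [LinearMap.add_apply, h.mul, h'.mul, LinearMap.add_apply, mul_add]⟩
  zero_mem' := ⟨fun _ => rfl, fun _ => by simp⟩
  smul_mem' a χ h := ⟨fun m => by rw [LinearMap.smul_apply, h.snk, LinearMap.smul_apply],
    fun m => by rw [LinearMap.smul_apply, h.mul, LinearMap.smul_apply, mul_smul_comm]⟩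

/-- The generic module. -/
def GenMod : Type u := P.genSub x

instance : AddCommGroup (P.GenMod x) := inferInstanceAs (AddCommGroup (P.genSub x))
instance : Module k (P.GenMod x) := inferInstanceAs (Module k (P.genSub x))

variable {P x}

/-- The underlying functional of an element of the generic module. -/
def GenMod.toFun (φ : P.GenMod x) : R →ₗ[k] K := φ.1

lemma GenMod.gen (φ : P.GenMod x) : P.GenFunctional (M := R) x φ.toFun := φ.2

lemma GenMod.ext {φ φ' : P.GenMod x} (h : ∀ r, φ.toFun r = φ'.toFun r) : φ = φ' :=
  Subtype.ext (LinearMap.ext h)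

/-- The element of the generic module given by a functional on `M` and an element of `M`. -/
def genOrb {M : Type u} [AddCommGroup M] [Module R M] [Module k M] [IsScalarTower k R M]
    {ψ : M →ₗ[k] K} (hψ : P.GenFunctional x ψ) (m : M) : P.GenMod x := ⟨orb ψ m, hψ.orb m⟩

instance : Module R (P.GenMod x) where
  smul r φ := genOrb φ.gen r
  one_smul φ := GenMod.ext fun s => congrArg φ.toFun (mul_one s)
  mul_smul r r' φ := GenMod.ext fun s => congrArg φ.toFun (mul_assoc s r r').symm
  smul_zero _ := rfl
  smul_add _ _ _ := rfl
  add_smul r r' φ := GenMod.ext fun s =>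
    (congrArg φ.toFun (mul_add s r r')).trans (map_add φ.toFun _ _)
  zero_smul φ := GenMod.ext fun s => (congrArg φ.toFun (mul_zero s)).trans (map_zero φ.toFun)

lemma GenMod.smul_toFun (r s : R) (φ : P.GenMod x) : (r • φ).toFun s = φ.toFun (s * r) := rfl
lemma GenMod.ksmul_toFun (a : k) (s : R) (φ : P.GenMod x) : (a • φ).toFun s = a • φ.toFun s := rfl
lemma GenMod.sub_toFun (s : R) (φ φ' : P.GenMod x) :
    (φ - φ').toFun s = φ.toFun s - φ'.toFun s := rfl

instance : IsScalarTower k R (P.GenMod x) where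
  smul_assoc a r φ := GenMod.ext fun s => by
    rw [GenMod.smul_toFun, GenMod.ksmul_toFun, GenMod.smul_toFun, mul_smul_comm,
      LinearMap.map_smul φ.toFun]

/-- The homomorphism to the generic module given by a functional. -/
def genHom {M : Type u} [AddCommGroup M] [Module R M] [Module k M] [IsScalarTower k R M]
    {ψ : M →ₗ[k] K} (hψ : P.GenFunctional x ψ) : M →ₗ[R] P.GenMod x where
  toFun := genOrb hψ
  map_add' m m' := GenMod.ext fun r => (congrArg ψ (smul_add r m m')).trans (map_add ψ _ _)
  map_smul' r m := GenMod.ext fun s => congrArg ψ (mul_smul s r m).symm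

variable (P x)

/-- The evaluation of a functional on the algebra at a point of the generic module. -/
def evalAt (y : K) : R →ₗ[k] K := P.β₁.smulRight y + P.β₂.smulRight (x * y)

variable {x} in
lemma evalAt_apply (y : K) (r : R) : P.evalAt x y r = P.β₁ r • y + P.β₂ r • (x * y) := rfl

lemma evalAt_conj (y : K) (r : R) :
    P.evalAt x y (D.e .snk * r * D.e .src) = P.evalAt x y r := by
  rw [evalAt_apply, evalAt_apply, P.β₁_e, P.β₂_e]

lemma evalAt_src (y : K) (r : R) : P.evalAt x y (r * D.e .src) = P.evalAt x y r := by
  rw [← P.evalAt_conj, mul_assoc, mul_assoc, D.e_idem, ← mul_assoc, P.evalAt_conj]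

lemma evalAt_w (y : K) (i : Fin t) : P.evalAt x y (D.w i) = P.c x i * y := by
  rw [evalAt_apply, c, Algebra.smul_def, Algebra.smul_def]
  ring

lemma evalAt_w₁ (y : K) : P.evalAt x y (D.w P.i₁) = y := by
  rw [evalAt_w, c, P.β₁_w₁, P.β₂_w₁]
  simp

lemma evalAt_w₂ (y : K) : P.evalAt x y (D.w P.i₂) = x * y := by
  rw [evalAt_w, c, P.β₁_w₂, P.β₂_w₂]
  simp

lemma evalAt_gen (y : K) : P.GenFunctional (M := R) x (P.evalAt x y) where
  snk r := by
    change P.evalAt x y (D.e .snk * r) = _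
    rw [← P.evalAt_conj, ← mul_assoc, D.e_idem, P.evalAt_conj]
  mul r := by
    change P.evalAt x y (D.w P.i₂ * r) = x * P.evalAt x y (D.w P.i₁ * r)
    have key : (⊤ : Submodule k R) ≤ LinearMap.ker
        (P.evalAt x y ∘ₗ LinearMap.mulLeft k (D.w P.i₂) -
          LinearMap.mulLeft k x ∘ₗ P.evalAt x y ∘ₗ LinearMap.mulLeft k (D.w P.i₁)) := by
      have hw : ∀ i v, v ≠ .src → D.w i * D.e v = 0 := fun i v hv =>
        D.p_e_of_ne i 0 _ (Nat.zero_le _) le_rfl _ (by rw [vtx_zero]; exact hv.symm)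
      have hw' : ∀ i, D.w i * D.e .src = D.w i := fun i => by
        have := D.p_e i 0 (ℓ i) (Nat.zero_le _) le_rfl
        rwa [vtx_zero] at this
      rw [← D.span_top, Submodule.span_le]
      rintro _ (⟨v, rfl⟩ | ⟨j, b, c, hbc, hc, rfl⟩)
      · change P.evalAt x y (D.w P.i₂ * D.e v) - x * P.evalAt x y (D.w P.i₁ * D.e v) = 0
        by_cases hv : v = .src
        · rw [hv, hw', hw', evalAt_w₁, evalAt_w₂, sub_self]
        · rw [hw _ _ hv, hw _ _ hv, map_zero, mul_zero, sub_self]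
      · change P.evalAt x y (D.w P.i₂ * D.p j b c) - x * P.evalAt x y (D.w P.i₁ * D.p j b c) = 0
        have hv : vtx t ℓ j c ≠ .src := fun h => by
          have := vtx_inj_same hc (Nat.zero_le _) (h.trans (vtx_zero j).symm)
          omega
        rw [← D.e_p j b c hbc.le hc, ← mul_assoc, ← mul_assoc, hw _ _ hv, hw _ _ hv, zero_mul,
          map_zero, mul_zero, sub_self]
    exact sub_eq_zero.1 (key (trivial : r ∈ (⊤ : Submodule k R)))

/-- The generators of the generic module. -/
def pt : K →ₗ[k] P.GenMod x where
  toFun y := ⟨P.evalAt x y, P.evalAt_gen x y⟩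
  map_add' y z := GenMod.ext fun r => by
    change P.evalAt x (y + z) r = P.evalAt x y r + P.evalAt x z r
    simp only [evalAt_apply, mul_add, smul_add]
    abel
  map_smul' a y := GenMod.ext fun r => by
    change P.evalAt x (a • y) r = a • P.evalAt x y r
    simp only [evalAt_apply, mul_smul_comm, smul_add, smul_comm a]

lemma pt_toFun (y : K) (r : R) : (P.pt x y).toFun r = P.evalAt x y r := rfl

lemma e_pt (y : K) : D.e .src • P.pt x y = P.pt x y :=
  GenMod.ext fun r => by rw [GenMod.smul_toFun, pt_toFun, evalAt_src, pt_toFun]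

variable {x}

lemma eq_smul_pt (hx : Transcendental k x) {i : Fin t} {a : ℕ} (ha : a ≤ ℓ i) {φ : P.GenMod x}
    (hφ : φ ∈ D.at' (k := k) (P.GenMod x) (vtx t ℓ i a)) :
    φ = D.p i 0 a • P.pt x ((P.c x i)⁻¹ * φ.toFun (D.p i a (ℓ i))) := by
  have h1 : ∀ r, φ.toFun (r * D.e (vtx t ℓ i a)) = φ.toFun r := fun r => by
    rw [← GenMod.smul_toFun, D.mem_at.1 hφ]
  refine sub_eq_zero.1 (GenMod.ext fun r => ?_)
  refine LinearMap.congr_fun (GenFunctional.eq_zero hx (GenMod.gen _) ha (fun r => ?_) ?_) r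
  · rw [GenMod.sub_toFun, GenMod.sub_toFun, h1, GenMod.smul_toFun, GenMod.smul_toFun, mul_assoc,
      D.e_p i 0 a (Nat.zero_le a) ha]
  · rw [GenMod.sub_toFun, GenMod.smul_toFun, D.p_comp i 0 a _ (Nat.zero_le a) ha le_rfl, pt_toFun]
    change _ - P.evalAt x _ (D.w i) = 0
    rw [evalAt_w, mul_inv_cancel_left₀ (P.c_ne_zero hx i), sub_self]

lemma w_pt (hx : Transcendental k x) (y : K) :
    D.w P.i₂ • P.pt x y = D.w P.i₁ • P.pt x (x * y) := by
  have hw : ∀ i, D.e .snk * D.w i = D.w i := fun i => by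
    have := D.e_p i 0 (ℓ i) (Nat.zero_le _) le_rfl
    rwa [D.vtx_ℓ] at this
  refine sub_eq_zero.1 (GenMod.ext fun r => ?_)
  refine LinearMap.congr_fun
    (GenFunctional.eq_zero hx (GenMod.gen _) (le_refl (ℓ P.i₁)) (fun r => ?_) ?_) r
  · simp only [GenMod.sub_toFun, GenMod.smul_toFun]
    rw [D.vtx_ℓ, mul_assoc, mul_assoc, hw, hw]
  · simp only [GenMod.sub_toFun, GenMod.smul_toFun, pt_toFun]
    rw [D.p_self _ _ le_rfl, D.vtx_ℓ, hw, hw, evalAt_w₁, evalAt_w₂, sub_self]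

variable {P}

/-- Homomorphisms from the generic module are determined by their values on the generators. -/
lemma hom_ext_pt (hx : Transcendental k x) (i₀ : Fin t) {N : Type u} [AddCommGroup N] [Module R N]
    [Module k N] [IsScalarTower k R N] {f g : P.GenMod x →ₗ[R] N}
    (h : ∀ y, f (P.pt x y) = g (P.pt x y)) : f = g := by
  refine D.hom_ext_at fun v φ hφ => ?_
  obtain ⟨i, a, ha, rfl⟩ := exists_vtx D.hℓ i₀ v
  rw [P.eq_smul_pt hx ha hφ, map_smul, map_smul, h]

/-- Homomorphisms from the generic module are given by their values on the generators. -/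
lemma exists_hom_pt (hx : Transcendental k x) {E : Type u} [AddCommGroup E] [Module R E]
    [Module k E] [IsScalarTower k R E] (s : K →ₗ[k] E) (hs : ∀ y, D.e .src • s y = s y)
    (hs' : ∀ y, D.w P.i₂ • s y = D.w P.i₁ • s (x * y)) :
    ∃ τ : P.GenMod x →ₗ[R] E, ∀ y, τ (P.pt x y) = s y := by
  let ev (r : R) : P.GenMod x →ₗ[k] K :=
    { toFun φ := φ.toFun r
      map_add' φ φ' := rfl
      map_smul' a φ := rfl }
  have hw : ∀ i y, D.w i • s y = D.w P.i₁ • s (P.c x i * y) := fun i y => by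
    have h1 : P.c x i * y = P.β₁ (D.w i) • y + P.β₂ (D.w i) • (x * y) := by
      rw [← P.evalAt_w, evalAt_apply]
    rw [h1, map_add, map_smul, map_smul, smul_add, smul_comm, smul_comm (D.w P.i₁), ← hs']
    conv_lhs => rw [P.w_eq i, add_smul, smul_assoc, smul_assoc]
  obtain ⟨τ, hτ, -, -⟩ := D.exists_hom (k := k) (M := P.GenMod x) (N := E) (s ∘ₗ ev (D.w P.i₁))
    (act E (D.w P.i₁) ∘ₗ s ∘ₗ ev 1)
    (fun i a => act E (D.p i 0 a) ∘ₗ s ∘ₗ LinearMap.mulLeft k (P.c x i)⁻¹ ∘ₗ ev (D.p i a (ℓ i)))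
    (fun φ _ => hs _)
    (fun φ _ => by
      have := D.p_mem (k := k) (Nat.zero_le (ℓ P.i₁)) le_rfl (s (φ.toFun 1))
      rwa [D.vtx_ℓ] at this)
    (fun i φ hφ => by
      have h1 : φ.toFun (D.w i) = P.c x i * φ.toFun (D.w P.i₁) := by
        simpa using φ.gen.map_w i (1 : R)
      change D.p i 0 0 • s ((P.c x i)⁻¹ * φ.toFun (D.w i)) = s (φ.toFun (D.w P.i₁))
      rw [D.p_self_smul (Nat.zero_le _), vtx_zero, hs, h1, inv_mul_cancel_left₀ (P.c_ne_zero hx i)])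
    (fun i φ hφ => by
      change D.w i • s ((P.c x i)⁻¹ * φ.toFun (D.p i (ℓ i) (ℓ i))) = D.w P.i₁ • s (φ.toFun 1)
      rw [hw, mul_inv_cancel_left₀ (P.c_ne_zero hx i), D.p_self i _ le_rfl, D.vtx_ℓ]
      have := φ.gen.snk (1 : R)
      rw [smul_eq_mul, mul_one] at this
      rw [this])
    (fun i a _ ha φ _ => D.p_mem (Nat.zero_le a) ha.le _)
    (fun i a ha φ _ => by
      change D.p i a (a + 1) • D.p i 0 a • s ((P.c x i)⁻¹ * φ.toFun (D.p i a (ℓ i))) =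
        D.p i 0 (a + 1) • s ((P.c x i)⁻¹ * φ.toFun (D.p i (a + 1) (ℓ i) * D.p i a (a + 1)))
      rw [D.p_comp i a (a + 1) _ (Nat.le_succ a) ha le_rfl,
        D.p_p_smul (Nat.zero_le a) (Nat.le_succ a) ha])
  refine ⟨τ, fun y => ?_⟩
  rw [hτ _ (P.e_pt x y)]
  change s (P.evalAt x y (D.w P.i₁)) = s y
  rw [evalAt_w₁]

section Lift

open TensorProduct

variable {T : Type u} [AddCommGroup T] [Module R T] [Module k T] [IsScalarTower k R T]

/-- The difference of the multiplications by the two branches over the extension field. -/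
def pencil (P : D.Coord) (x : K) (T : Type u) [AddCommGroup T] [Module R T] [Module k T]
    [IsScalarTower k R T] : K ⊗[k] T →ₗ[K] K ⊗[k] T :=
  (act T (D.w P.i₂)).baseChange K - x • (act T (D.w P.i₁)).baseChange K

lemma pencil_tmul (z : K) (m : T) :
    pencil P x T (z ⊗ₜ m) = z ⊗ₜ[k] (D.w P.i₂ • m) - (x * z) ⊗ₜ[k] (D.w P.i₁ • m) := by
  simp [pencil, TensorProduct.smul_tmul']

lemma Tors.mem_range (hT : P.Tors x T) (m : T) :
    (1 : K) ⊗ₜ[k] (D.e .snk • m) ∈ LinearMap.range (pencil P x T) := by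
  by_contra h
  obtain ⟨F, hF, hF'⟩ := Submodule.exists_le_ker_of_notMem h
  let ψ : T →ₗ[k] K := F.restrictScalars k ∘ₗ TensorProduct.mk k K T 1 ∘ₗ act T (D.e .snk)
  have hψ : ∀ m, ψ m = F (1 ⊗ₜ (D.e .snk • m)) := fun m => rfl
  have hw : ∀ i (m : T), D.e .snk • D.w i • m = D.w i • m := fun i m => by
    have := D.e_p_smul (Nat.zero_le (ℓ i)) le_rfl m
    rwa [D.vtx_ℓ] at this
  have := hT ψ ⟨fun m => by rw [hψ, hψ, D.e_e_self], fun m => by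
    have h1 : F (pencil P x T (1 ⊗ₜ m)) = 0 := hF' ⟨_, rfl⟩
    rw [pencil_tmul, map_sub, sub_eq_zero, ← smul_eq_mul, ← TensorProduct.smul_tmul', map_smul,
      smul_eq_mul] at h1
    rw [hψ, hψ, hw, hw, h1]⟩
  exact hF (LinearMap.congr_fun this m)

/-- The linear map `y ↦ η (z * y) • m` associated with `z ⊗ m`. -/
def twist (η : K →ₗ[k] k) (T : Type u) [AddCommGroup T] [Module k T] :
    K ⊗[k] T →ₗ[k] K →ₗ[k] T :=
  TensorProduct.lift (LinearMap.mk₂ k (fun z m => (η ∘ₗ LinearMap.mulLeft k z).smulRight m)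
    (fun z z' m => by ext y; simp [add_mul, add_smul])
    (fun a z m => by ext y; simp [mul_smul])
    (fun z m m' => by ext y; simp)
    (fun a z m => by ext y; simp [smul_comm a]))

lemma twist_tmul (η : K →ₗ[k] k) (z : K) (m : T) (y : K) :
    twist η T (z ⊗ₜ m) y = η (z * y) • m := rfl

lemma twist_pencil (η : K →ₗ[k] k) (Z : K ⊗[k] T) (y : K) :
    twist η T (pencil P x T Z) y =
      D.w P.i₂ • twist η T Z y - D.w P.i₁ • twist η T Z (x * y) := by
  induction Z using TensorProduct.induction_on with
  | zero => simp
  | tmul z m =>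
    rw [pencil_tmul, map_sub, LinearMap.sub_apply]
    simp only [twist_tmul]
    rw [smul_comm (D.w P.i₂), smul_comm (D.w P.i₁), mul_assoc, mul_left_comm]
  | add Z Z' h h' =>
    simp only [map_add, LinearMap.add_apply, h, h', smul_add]
    abel

lemma Tors.exists_solution [Module.Finite k T] (hT : P.Tors x T) (d : K →ₗ[k] T)
    (hd : ∀ y, D.e .snk • d y = d y) :
    ∃ h : K →ₗ[k] T, ∀ y, D.w P.i₂ • h y - D.w P.i₁ • h (x * y) = d y := by
  let b := Module.finBasis k T
  choose Z hZ using fun j => hT.mem_range (b j)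
  refine ⟨∑ j, twist (b.coord j ∘ₗ d) T (Z j), fun y => ?_⟩
  rw [LinearMap.sum_apply, LinearMap.sum_apply, Finset.smul_sum, Finset.smul_sum,
    ← Finset.sum_sub_distrib]
  simp only [← twist_pencil, hZ, twist_tmul, one_mul]
  have := b.sum_repr (d y)
  conv_rhs => rw [← hd, ← this, Finset.smul_sum]
  refine Finset.sum_congr rfl fun j _ => ?_
  rw [smul_comm]
  rfl

/-- Homomorphisms from the generic module lift along quotients by finite-dimensional torsion
submodules. -/
lemma Tors.exists_lift (hx : Transcendental k x) {E : Type u} [AddCommGroup E] [Module R E]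
    [Module k E] [IsScalarTower k R E] (S : Submodule R E) [Module.Finite k S]
    (hS : P.Tors x S) (γ : P.GenMod x →ₗ[R] E ⧸ S) :
    ∃ τ : P.GenMod x →ₗ[R] E, S.mkQ ∘ₗ τ = γ := by
  obtain ⟨σ, hσ⟩ := (toK (k := k) S.mkQ).exists_rightInverse_of_surjective
    (LinearMap.range_eq_top.2 S.mkQ_surjective)
  have hσ : ∀ q, S.mkQ (σ q) = q := fun q => LinearMap.congr_fun hσ q
  let s : K →ₗ[k] E := act E (D.e .src) ∘ₗ σ ∘ₗ toK γ ∘ₗ P.pt x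
  have hs : ∀ y, S.mkQ (s y) = γ (P.pt x y) := fun y => by
    change S.mkQ (D.e .src • σ (γ (P.pt x y))) = _
    rw [map_smul, hσ, ← map_smul, P.e_pt]
  have hs' : ∀ y, D.e .src • s y = s y := fun y => D.e_e_self _ _
  have hw : ∀ i (m : E), D.e .snk • D.w i • m = D.w i • m := fun i m => by
    have := D.e_p_smul (Nat.zero_le (ℓ i)) le_rfl m
    rwa [D.vtx_ℓ] at this
  have hw' : ∀ i (m : E), D.w i • D.e .src • m = D.w i • m := fun i m => by
    have := D.p_e_smul (Nat.zero_le (ℓ i)) le_rfl m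
    rwa [vtx_zero] at this
  let d : K →ₗ[k] S := LinearMap.codRestrict (S.restrictScalars k)
    (act E (D.w P.i₂) ∘ₗ s - act E (D.w P.i₁) ∘ₗ s ∘ₗ LinearMap.mulLeft k x) fun y => by
      change D.w P.i₂ • s y - D.w P.i₁ • s (x * y) ∈ S
      rw [← S.ker_mkQ, LinearMap.mem_ker, map_sub, map_smul, map_smul, hs, hs, ← map_smul γ,
        ← map_smul γ, P.w_pt hx, sub_self]
  have hd : ∀ y, (d y : E) = D.w P.i₂ • s y - D.w P.i₁ • s (x * y) := fun y => rfl
  obtain ⟨h, hh⟩ := hS.exists_solution d fun y => Subtype.ext (by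
    rw [Submodule.coe_smul, hd, smul_sub, hw, hw])
  have hh' : ∀ y, D.w P.i₂ • (h y : E) - D.w P.i₁ • (h (x * y) : E) = d y := fun y =>
    congrArg Subtype.val (hh y)
  obtain ⟨τ, hτ⟩ := exists_hom_pt (P := P) hx
    (s - act E (D.e .src) ∘ₗ (S.restrictScalars k).subtype ∘ₗ h) (fun y => by
      change D.e .src • (s y - D.e .src • (h y : E)) = s y - D.e .src • (h y : E)
      rw [smul_sub, hs', D.e_e_self]) fun y => by
      change D.w P.i₂ • (s y - D.e .src • (h y : E)) =
        D.w P.i₁ • (s (x * y) - D.e .src • (h (x * y) : E))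
      have h1 := hh' y
      rw [hd] at h1
      rw [smul_sub, smul_sub, hw', hw', sub_eq_sub_iff_sub_eq_sub, h1]
  refine ⟨τ, hom_ext_pt hx P.i₁ fun y => ?_⟩
  have h1 : S.mkQ (D.e .src • (h y : E)) = 0 := by
    rw [← LinearMap.mem_ker, S.ker_mkQ]
    exact S.smul_mem _ (h y).2
  rw [LinearMap.comp_apply, hτ, ← hs]
  change S.mkQ (s y - D.e .src • (h y : E)) = _
  rw [map_sub, h1, sub_zero]

end Lift

end TD.Coord

namespace TD.Coord

variable {D : TD k R t ℓ}
  {P : D.Coord} {K : Type u} [Field K] [Algebra k K] {x : K}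

section

variable {M : Type u} [AddCommGroup M] [Module R M] [Module k M] [IsScalarTower k R M]

/-- A maximal torsion submodule is a direct summand. -/
lemma Tors.exists_retraction [Module.Finite k M] (ht : 0 < t) (hx : Transcendental k x) {T : Submodule R M}
    (hT : P.Tors x T) (hmax : ∀ N : Submodule R M, T < N → ¬ P.Tors x N) :
    ∃ ρ : (⊤ : Submodule R M) →ₗ[R] T, ∀ n (hn : n ∈ T), ρ ⟨n, trivial⟩ = ⟨n, hn⟩ := by
  have : Module.Finite R M := Module.Finite.of_restrictScalars_finite k R M
  have hart : IsArtinian R M := isArtinian_of_tower k inferInstance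
  have : Module.Finite k T :=
    inferInstanceAs (Module.Finite k (T.restrictScalars k))
  obtain ⟨E, f, hf, hE, hQ⟩ := Tors.idLeOne ht hx (ModuleCat.of R T) hT
  change T →ₗ[R] E at f
  change Module.Injective R (E ⧸ LinearMap.range f) at hQ
  let _ := kMod k R E
  have hS : P.Tors x (LinearMap.range f) := hT.of_surjective f.rangeRestrict f.surjective_rangeRestrict
  have : Module.Finite k (LinearMap.range f) := Module.Finite.of_surjective
    (toK (k := k) f.rangeRestrict) f.surjective_rangeRestrict
  have key : ∀ N : Submodule R M, ∀ hN : T ≤ N,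
      ∃ ρ : N →ₗ[R] T, ∀ n (hn : n ∈ T), ρ ⟨n, hN hn⟩ = ⟨n, hn⟩ := by
    refine fun N => wellFounded_lt.induction (C := fun N : Submodule R M => ∀ hN : T ≤ N,
      ∃ ρ : N →ₗ[R] T, ∀ n (hn : n ∈ T), ρ ⟨n, hN hn⟩ = ⟨n, hn⟩) N fun N ih hN => ?_
    rcases hN.eq_or_lt with rfl | hlt
    · exact ⟨LinearMap.id, fun _ _ => rfl⟩
    · obtain ⟨ψ, hψ⟩ := not_forall.1 (hmax N hlt)
      obtain ⟨hψ, hψ0⟩ := Classical.not_imp.1 hψ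
      let g := genHom hψ
      have hgT : ∀ n (hn : n ∈ T), g ⟨n, hN hn⟩ = 0 := fun n hn => GenMod.ext fun r => by
        have := LinearMap.congr_fun (hT _ (hψ.comp (Submodule.inclusion hN))) (r • ⟨n, hn⟩)
        exact this
      let N' : Submodule R M := (LinearMap.ker g).map N.subtype
      have hTN' : T ≤ N' := fun n hn => ⟨⟨n, hN hn⟩, hgT n hn, rfl⟩
      have hN'N : N' < N := by
        refine lt_of_le_of_ne (Submodule.map_subtype_le _ _) fun h => hψ0 (LinearMap.ext fun n => ?_)
        have h1 : (n : M) ∈ N' := by rw [h]; exact n.2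
        obtain ⟨n', hn', h2⟩ := h1
        obtain rfl : n' = n := Subtype.ext h2
        have h3 := congrArg (fun φ => GenMod.toFun φ 1) (LinearMap.mem_ker.1 hn')
        change ψ ((1 : R) • n') = 0 at h3
        rwa [one_smul] at h3
      obtain ⟨ρ, hρ⟩ := ih N' hN'N hTN'
      obtain ⟨σ, hσ⟩ := hE.out (Submodule.inclusion hN'N.le) (Submodule.inclusion_injective _)
        (f ∘ₗ ρ)
      have hker : LinearMap.ker g ≤ LinearMap.ker ((LinearMap.range f).mkQ ∘ₗ σ) := fun n hn => by
        rw [LinearMap.mem_ker, LinearMap.comp_apply, ← LinearMap.mem_ker, Submodule.ker_mkQ]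
        have := hσ ⟨n, n, hn, rfl⟩
        exact ⟨_, this.symm⟩
      obtain ⟨γ, hγ⟩ := hQ.out ((LinearMap.ker g).liftQ g le_rfl)
        (LinearMap.ker_eq_bot.1 (Submodule.ker_liftQ_eq_bot _ _ _ le_rfl))
        ((LinearMap.ker g).liftQ _ hker)
      have hγ : ∀ n, γ (g n) = (LinearMap.range f).mkQ (σ n) := fun n =>
        hγ ((LinearMap.ker g).mkQ n)
      obtain ⟨τ, hτ⟩ := Tors.exists_lift hx (LinearMap.range f) hS γ
      have hr : ∀ n, (σ - τ ∘ₗ g) n ∈ LinearMap.range f := fun n => by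
        rw [← Submodule.ker_mkQ (LinearMap.range f), LinearMap.mem_ker, LinearMap.sub_apply,
          map_sub, ← hγ, ← hτ]
        exact sub_self _
      refine ⟨(LinearEquiv.ofInjective f hf).symm.toLinearMap ∘ₗ (σ - τ ∘ₗ g).codRestrict _ hr,
        fun n hn => ?_⟩
      have h1 : σ ⟨n, hN hn⟩ = f ⟨n, hn⟩ :=
        (hσ ⟨n, hTN' hn⟩).trans (congrArg f (hρ n hn))
      refine (LinearEquiv.symm_apply_eq _).2 (Subtype.ext ?_)
      change σ ⟨n, hN hn⟩ - τ (g ⟨n, hN hn⟩) = f ⟨n, hn⟩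
      rw [hgT n hn, map_zero, sub_zero, h1]
  exact key ⊤ le_top

/-- The arrows act injectively on a torsion-free module. -/
lemma p_injective (hx : Transcendental k x)
    (hM : ∀ N : Submodule R M, P.Tors x N → N = ⊥) {i : Fin t} {a : ℕ} (ha : a < ℓ i) {m : M}
    (hm : D.e (vtx t ℓ i a) • m = m) (h : D.p i a (a + 1) • m = 0) : m = 0 := by
  have h1 : P.Tors x (Submodule.span R {m}) := fun ψ hψ => LinearMap.ext fun n => by
    obtain ⟨n, hn⟩ := n
    obtain ⟨r, rfl⟩ := Submodule.mem_span_singleton.1 hn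
    let m' : Submodule.span R {m} := ⟨m, Submodule.mem_span_singleton_self m⟩
    have h2 := GenFunctional.eq_zero hx (hψ.orb m') ha.le (fun r => by
      change ψ ((r * _) • m') = ψ (r • m')
      rw [mul_smul]
      exact congrArg (fun y => ψ (r • y)) (Subtype.ext hm)) (by
      change ψ (D.p i a (ℓ i) • m') = 0
      rw [← D.p_p_smul (Nat.le_succ a) ha le_rfl]
      have : D.p i a (a + 1) • m' = 0 := Subtype.ext h
      rw [this, smul_zero, map_zero])
    exact LinearMap.congr_fun h2 r
  exact Submodule.span_singleton_eq_bot.1 (hM _ h1)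

end

/-- The algebra is weakly shod if the paths between the source and the sink span a plane in which
any two branches are linearly independent. -/
theorem weaklyShod (P : D.Coord) (ht : 0 < t) : WeaklyShod R := by
  let K := RatFunc k
  let x : K := RatFunc.X
  have hx : Transcendental k x := RatFunc.transcendental_X
  let A (M : ModuleCat.{u} R) : Prop := letI := kMod k R M
    P.Tors x M
  let B (M : ModuleCat.{u} R) : Prop := letI := kMod k R M
    ∀ N : Submodule R M, P.Tors x N → N = ⊥
  refine weaklyShod_of_split A B (fun M hi hf => ?_) (fun M N _ _ _ _ hM hN f => ?_)
    (fun M _ hf hM => ?_) fun M _ hf hM => ?_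
  · let _ := kMod k R M
    have := D.finite_of_fd hf
    have : IsNoetherian R M := isNoetherian_of_tower k inferInstance
    have h0 : P.Tors x (⊥ : Submodule R M) := fun ψ _ => LinearMap.ext fun n => by
      rw [Subsingleton.elim n 0, map_zero, map_zero]
    obtain ⟨T, hT, hmax⟩ := WellFounded.has_min (wellFounded_gt (α := Submodule R M))
      {T | P.Tors x T} ⟨⊥, h0⟩
    obtain ⟨ρ, hρ⟩ := Tors.exists_retraction ht hx hT fun N hN hN' => hmax N hN' hN
    let π : M →ₗ[R] M := T.subtype ∘ₗ ρ ∘ₗ (Submodule.topEquiv (R := R) (M := M)).symm.toLinearMap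
    have hπ : ∀ n ∈ T, π n = n := fun n hn => congrArg Subtype.val (hρ n hn)
    have hπT : ∀ n, π n ∈ T := fun n => (ρ _).2
    rcases hi.2 π (LinearMap.ext fun n => hπ _ (hπT n)) with h | h
    · have hT0 : T = ⊥ := by
        rw [eq_bot_iff]
        intro n hn
        rw [Submodule.mem_bot, ← hπ n hn, h, LinearMap.zero_apply]
      exact .inr fun N hN => by
        by_contra hne
        exact hmax N hN (by rw [hT0]; exact bot_lt_iff_ne_bot.2 hne)
    · refine .inl (hT.of_surjective T.subtype fun n => ⟨⟨n, ?_⟩, rfl⟩)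
      have := hπT n
      rwa [h] at this
  · let _ := kMod k R M
    let _ := kMod k R N
    exact LinearMap.range_eq_bot.1 (hN _ (Tors.of_surjective hM f.rangeRestrict
      f.surjective_rangeRestrict))
  · let _ := kMod k R M
    have := D.finite_of_fd hf
    exact D.pd_le_one ht M (fun i a b hab hb h0 => absurd h0
      (D.p_ne_zero_of_w (P.w_ne i) hab.le hb)) fun v hv _ hv' i =>
        D.p_smul_eq_zero_of_mono (fun i a ha m hm h => p_injective hx hM ha hm h)
          (Nat.zero_le (ℓ i - 1)) (by omega) (by rw [vtx_zero]; exact hv i) (hv' i)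
  · let _ := kMod k R M
    have := D.finite_of_fd hf
    exact Tors.idLeOne ht hx M hM

end TD.Coord

namespace TD

variable (D : TD k R t ℓ)

lemma exists_coord_functional {θ : Fin t → k} (hθ : θ ∈ D.Lam) :
    ∃ β : R →ₗ[k] k, (∀ i, β (D.w i) = θ i) ∧ ∀ r, β (D.e .snk * r * D.e .src) = β r := by
  let f : (Fin t → k) →ₗ[k] R := Fintype.linearCombination k D.w
  let g : (Fin t → k) →ₗ[k] k := Fintype.linearCombination k θ
  have hg : g ∈ (LinearMap.ker f).dualAnnihilator := by
    rw [Submodule.mem_dualAnnihilator]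
    intro r hr
    have := D.mem_Lam.1 hθ r (D.mem_Rel.2 (by simpa [f, Fintype.linearCombination_apply] using hr))
    simpa [g, Fintype.linearCombination_apply] using this
  rw [← LinearMap.range_dualMap_eq_dualAnnihilator_ker] at hg
  obtain ⟨β, hβ⟩ := hg
  have hw : ∀ i, D.e .snk * D.w i * D.e .src = D.w i := fun i => by
    have h1 := D.e_p i 0 (ℓ i) (Nat.zero_le _) le_rfl
    have h2 := D.p_e i 0 (ℓ i) (Nat.zero_le _) le_rfl
    rw [D.vtx_ℓ] at h1
    rw [vtx_zero] at h2
    rw [w, h1, h2]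
  refine ⟨β ∘ₗ LinearMap.mulRight k (D.e .src) ∘ₗ LinearMap.mulLeft k (D.e .snk), fun i => ?_,
    fun r => ?_⟩
  · change β (D.e .snk * D.w i * D.e .src) = θ i
    rw [hw]
    have := LinearMap.congr_fun hβ (Pi.single i 1)
    simpa [f, g, Fintype.linearCombination_apply, Pi.single_apply] using this
  · change β (D.e .snk * (D.e .snk * r * D.e .src) * D.e .src) = β (D.e .snk * r * D.e .src)
    rw [mul_assoc, mul_assoc, mul_assoc, D.e_idem, ← mul_assoc, ← mul_assoc, D.e_idem]

/-- The case in which the paths from the source to the sink span a plane. -/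
theorem weaklyShod_of_m_eq_two (D : TD k R t ℓ) (ht : 0 < t) (hw : ∀ i, D.w i ≠ 0) (hm : D.m = 2)
    (hN : ∀ r ∈ D.Rel, ∀ θ ∈ D.Lam, (∀ i, θ i * r i = 0) → r = 0 ∨ θ = 0) : WeaklyShod R := by
  obtain ⟨a, lam, hlam, hδ, hwa⟩ := D.exists_basis
  obtain ⟨c₁, c₂, hc, huniv⟩ : ∃ c₁ c₂ : Fin D.m, c₁ ≠ c₂ ∧ ∀ f : Fin D.m → R,
      ∑ c, f c = f c₁ + f c₂ := by
    rw [hm]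
    exact ⟨0, 1, zero_ne_one, fun f => Fin.sum_univ_two f⟩
  obtain ⟨β₁, h₁, h₁'⟩ := D.exists_coord_functional (hlam c₁)
  obtain ⟨β₂, h₂, h₂'⟩ := D.exists_coord_functional (hlam c₂)
  have hw_eq : ∀ i, D.w i = lam c₁ i • D.w (a c₁) + lam c₂ i • D.w (a c₂) := fun i => by
    rw [hwa i, huniv]
  refine (Coord.mk β₁ β₂ (a c₁) (a c₂) (fun i => by rw [h₁, h₂]; exact hw_eq i)
    (by rw [h₁, hδ, if_pos rfl]) (by rw [h₁, hδ, if_neg hc]) (by rw [h₂, hδ, if_neg hc.symm])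
    (by rw [h₂, hδ, if_pos rfl]) h₁' h₂' hw ?_).weaklyShod ht
  intro i j hij h
  rw [h₁, h₁, h₂, h₂] at h
  have main : ∀ d : Fin D.m, (d = c₁ ∨ d = c₂) → lam d i ≠ 0 → False := fun d hd hdi => by
    have hr : (Pi.single j (lam d i) - Pi.single i (lam d j) : Fin t → k) ∈ D.Rel := by
      rw [D.mem_Rel]
      simp only [Pi.sub_apply, sub_smul, Finset.sum_sub_distrib, Pi.single_apply, ite_smul,
        zero_smul, Finset.sum_ite_eq', Finset.mem_univ, if_true]
      rw [hw_eq i, hw_eq j, smul_add, smul_add, smul_smul, smul_smul, smul_smul, smul_smul,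
        sub_eq_zero]
      rcases hd with rfl | rfl
      · rw [mul_comm (lam d i) (lam d j), h, mul_comm (lam d j) (lam c₂ i)]
      · rw [mul_comm (lam d j) (lam d i), mul_comm (lam d i) (lam c₁ j), ← h,
          mul_comm (lam c₁ i)]
    have hθ : lam c₂ i • lam c₁ - lam c₁ i • lam c₂ ∈ D.Lam :=
      sub_mem (Submodule.smul_mem _ _ (hlam _)) (Submodule.smul_mem _ _ (hlam _))
    rcases hN _ hr _ hθ (fun s => by
      simp only [Pi.sub_apply, Pi.smul_apply, smul_eq_mul, Pi.single_apply]
      by_cases hs : s = j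
      · subst hs
        rw [show lam c₂ i * lam c₁ s - lam c₁ i * lam c₂ s = 0 by rw [h]; ring, zero_mul]
      · by_cases hs' : s = i
        · subst hs'
          rw [mul_comm, show lam c₂ s * lam c₁ s - lam c₁ s * lam c₂ s = 0 by ring, mul_zero]
        · rw [if_neg hs, if_neg hs', sub_self, mul_zero]) with h0 | h0
    · have := congrFun h0 j
      simp [hij.symm] at this
      exact hdi this
    · have h3 := congrFun h0 (a c₁)
      have h4 := congrFun h0 (a c₂)
      simp [hδ, hc, hc.symm] at h3 h4
      rcases hd with rfl | rfl
      · exact hdi h4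
      · exact hdi h3
  apply hw i
  rw [hw_eq i, not_not.1 (main c₁ (.inl rfl)), not_not.1 (main c₂ (.inr rfl)), zero_smul, zero_smul,
    add_zero]

section

variable {D} {m : ℕ} {a : Fin m → Fin t} {lam : Fin m → Fin t → k}

/-- A relation is determined by its coefficients outside a basis of branches. -/
lemma eq_zero_of_mem_Rel (hlam : ∀ c, lam c ∈ D.Lam)
    (hδ : ∀ c c', lam c (a c') = if c = c' then 1 else 0) {r : Fin t → k} (hr : r ∈ D.Rel)
    (h : ∀ j ∉ Set.range a, r j = 0) : r = 0 := by
  funext j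
  by_cases hj : j ∈ Set.range a
  · obtain ⟨c, rfl⟩ := hj
    have h1 := D.mem_Lam.1 (hlam c) r hr
    rwa [Finset.sum_eq_single (a c) (fun i _ hi => ?_) (by simp), hδ, if_pos rfl, mul_one] at h1
    by_cases hi' : i ∈ Set.range a
    · obtain ⟨c', rfl⟩ := hi'
      rw [hδ, if_neg (fun hc => hi (by rw [hc])), mul_zero]
    · rw [h i hi', zero_mul]
  · exact h j hj

end

theorem weaklyShod_of_laura (D : TD k R t ℓ) (ht : 0 < t) (hw : ∀ i, D.w i ≠ 0) (hm : 2 ≤ D.m)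
    (hL : Laura R) : WeaklyShod R := by
  by_cases hR : D.Rel = ⊥
  · exact D.weaklyShod_of_Rel_eq_bot ht hR
  have hN : ∀ r ∈ D.Rel, ∀ θ ∈ D.Lam, (∀ i, θ i * r i = 0) → r = 0 ∨ θ = 0 := by
    intro r hr θ hθ h
    by_contra! hne
    exact D.not_laura_of_disjoint hw hm hr hne.1 hθ hne.2 h hL
  rcases hm.eq_or_lt with h2 | h3
  · exact D.weaklyShod_of_m_eq_two ht hw h2.symm hN
  obtain ⟨a, lam, hlam, hδ, hwa⟩ := D.exists_basis
  obtain ⟨j, hj⟩ : ∃ j, j ∉ Set.range a := by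
    by_contra! h
    refine hR (eq_bot_iff.2 fun r hr => ?_)
    exact eq_zero_of_mem_Rel hlam hδ hr fun j hj => absurd (h j) hj
  have huniq : ∀ j', j' ∉ Set.range a → j' = j := fun j' hj' => by
    by_contra hne
    exact D.not_laura_of_basis hw hlam hδ hwa hN h3 hj' hj hne hL
  have hr := basisRel_mem hwa j
  have hr0 : ∀ i, basisRel a lam j i ≠ 0 := fun i => by
    by_cases hi : i ∈ Set.range a
    · obtain ⟨c, rfl⟩ := hi
      rw [basisRel_basis hδ hj]
      exact neg_ne_zero.2 (basis_ne_zero hlam hδ hwa hN hj c)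
    · rw [huniq i hi, basisRel_self hj]
      exact one_ne_zero
  have hspan : D.Rel = Submodule.span k {basisRel a lam j} := by
    refine le_antisymm (fun s hs => ?_) ((Submodule.span_singleton_le_iff_mem _ _).2 hr)
    refine Submodule.mem_span_singleton.2 ⟨s j, (sub_eq_zero.1 ?_).symm⟩
    refine eq_zero_of_mem_Rel hlam hδ (sub_mem hs (Submodule.smul_mem _ _ hr)) fun j' hj' => ?_
    rw [huniq j' hj', Pi.sub_apply, Pi.smul_apply, basisRel_self hj, smul_eq_mul, mul_one, sub_self]
  have hℓ : ∀ i, 2 ≤ ℓ i := fun i => D.adm _ (D.mem_Rel.1 hr) i (hr0 i)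
  have hone : ∃ i₁, ∀ i ≠ i₁, ℓ i = 2 := by
    by_cases h : ∃ i₁, 3 ≤ ℓ i₁
    · obtain ⟨i₁, h₁⟩ := h
      refine ⟨i₁, fun i hi => ?_⟩
      by_contra hi2
      exact D.not_laura_of_two_long hw h3 hr (fun h0 => hr0 i (congrFun h0 i)) hi
        (by have := hℓ i; omega) h₁ hL
    · push Not at h
      exact ⟨j, fun i _ => le_antisymm (Nat.lt_succ_iff.1 (h i)) (hℓ i)⟩
  obtain ⟨i₁, h₁⟩ := hone
  exact D.weaklyShod_of_Rel_eq_span ht hw hspan hr0 h₁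

theorem laura_and_not_weaklyShod_iff (D : TD k R t ℓ) (ht : 2 ≤ t) :
    (Laura R ∧ ¬ WeaklyShod R) ↔ (D.m = 1 ∧ ∃! i, D.w i = 0) := by
  have ht0 : 0 < t := by omega
  constructor
  · rintro ⟨hL, hS⟩
    have hm : D.m = 1 := by
      by_contra hm
      have h2 : D.m = 0 ∨ 2 ≤ D.m := by omega
      rcases h2 with h0 | h2
      · have hfin : Module.Finite k (Submodule.span k (Set.range D.w)) :=
          Module.Finite.span_of_finite k (Set.finite_range _)
        have hbot := Submodule.finrank_eq_zero.1 h0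
        exact hS (D.weaklyShod_of_w_eq_zero ht0 fun i =>
          (Submodule.mem_bot k).1 (hbot ▸ Submodule.subset_span ⟨i, rfl⟩))
      · by_cases hw : ∃ i, D.w i = 0
        · obtain ⟨i, hi⟩ := hw
          exact D.not_laura_of_two_le_of_zero h2 hi hL
        · exact hS (D.weaklyShod_of_laura ht0 (not_exists.1 hw) h2 hL)
    refine ⟨hm, ?_⟩
    obtain ⟨b, c, hb0, hb, -⟩ := exists_coeff hm
    have hw : ∃ i, D.w i = 0 := by
      by_contra hw
      exact hS (D.weaklyShod_of_m_eq_one ht0 hm (not_exists.1 hw))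
    obtain ⟨i₀, h₀⟩ := hw
    refine ⟨i₀, h₀, fun i₁ h₁ => ?_⟩
    by_contra hne
    have hc : ∀ i, D.w i = 0 → c i = 0 := fun i hi =>
      (smul_eq_zero.1 ((hb i).symm.trans hi)).resolve_right hb0
    obtain ⟨i₂, h₂⟩ : ∃ i, c i ≠ 0 := by
      by_contra! h
      have : Set.range D.w ⊆ {0} := by
        rintro _ ⟨i, rfl⟩
        rw [hb, h, zero_smul]
        rfl
      have hspan : Submodule.span k (Set.range D.w) = ⊥ :=
        eq_bot_iff.2 (Submodule.span_le.2 this)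
      rw [m, hspan, finrank_bot] at hm
      exact zero_ne_one hm
    exact D.not_laura_of_two_zero hb0 hb hne (hc _ h₁) (hc _ h₀) h₂ hL
  · rintro ⟨hm, i₀, h₀, hi₀⟩
    obtain ⟨b, c, hb0, hb, -⟩ := exists_coeff hm
    have hc0 : c i₀ = 0 := (smul_eq_zero.1 ((hb i₀).symm.trans h₀)).resolve_right hb0
    have hc : ∀ i, i ≠ i₀ → c i ≠ 0 := fun i hi h0 =>
      hi (hi₀ i (by change D.w i = 0; rw [hb, h0, zero_smul]))
    have : Nontrivial (Fin t) := Fin.nontrivial_iff_two_le.2 ht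
    have hex : ∃ i, i ≠ i₀ := exists_ne i₀
    exact ⟨D.laura_of_one_zero hb hc0 hc hex, D.not_weaklyShod_of_one_zero hb0 hb hc0 hc hex⟩

end TD

end Toupie

namespace Toupie

/-- A toupie algebra `A = kQ/I` (with `t ≥ 2` branches and
`m = dim_k e₀ A e∞`) is laura and not weakly shod if and only if `m = 1` and exactly one
of the branches lies in the ideal `I`. -/
theorem laura_not_weaklyShod_iff {k : Type u} [Field k] (T : ToupieAlg k) :
    (Laura (Alg T)ᵐᵒᵖ ∧ ¬ WeaklyShod (Alg T)ᵐᵒᵖ) ↔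
      (mDim T = 1 ∧ ∃! i : Fin T.t, branchInI T i) := by
  rw [(toTD T).laura_and_not_weaklyShod_iff T.ht, mDim_eq]
  simp only [branchInI_iff]

end Toupie
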